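/- Let D be a bounded planar domain whose boundary consists of m ≥ 2 pairwise disjoint simple closed curves. A continuous function Φ on bD extends holomorphically through D if and only if for every g ∈ A(bD) the conjugate of the harmonic extension of Re(gΦ) to D is single-valued. -/

import Mathlib

open Complex Set

/-- `u` is harmonic on `s`: locally the real part of a holomorphic function. -/
def HarmonicOnD (u : ℂ → ℝ) (s : Set ℂ) : Prop :=
  ∀ z ∈ s, ∃ ε > 0, ∃ F : ℂ → ℂ, DifferentiableOn ℂ F (Metric.ball z ε) ∧
    ∀ w ∈ Metric.ball z ε, u w = (F w).re

/-- `Φ` (defined on `bD = frontier D`) extends holomorphically through `D`. -/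
def ExtendsHolo (D : Set ℂ) (Φ : ℂ → ℂ) : Prop :=
  ∃ F : ℂ → ℂ, ContinuousOn F (closure D) ∧ DifferentiableOn ℂ F D ∧
    Set.EqOn F Φ (frontier D)

/-- The conjugate of `u` is single valued on `D`: `u` is the real part of a
single-valued holomorphic function on `D`. -/
def HasSingleValuedConjugate (u : ℂ → ℝ) (D : Set ℂ) : Prop :=
  ∃ F : ℂ → ℂ, DifferentiableOn ℂ F D ∧ ∀ z ∈ D, u z = (F z).re

/-- A simple closed curve: continuous, 1-periodic, injective on a period. -/
def IsSimpleClosedCurve (γ : ℝ → ℂ) : Prop :=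
  Continuous γ ∧ (∀ t, γ (t + 1) = γ t) ∧ Set.InjOn γ (Set.Ico 0 1)

namespace HX
open Metric Filter Topology InnerProductSpace Real

/-- local sub-mean value property -/
def SubM (v : ℂ → ℝ) (D : Set ℂ) : Prop :=
  ∀ z ∈ D, ∃ ε > 0, ∀ r, 0 < r → r < ε → v z ≤ circleAverage v z r

theorem circleAverage_lt_of {f : ℂ → ℝ} {c : ℂ} {r a : ℝ} (hr : 0 < r)
    (hf : ContinuousOn f (sphere c r)) (hle : ∀ x ∈ sphere c r, f x ≤ a)
    (hlt : f (c + r) < a) : circleAverage f c r < a := by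
  have hm : ∀ θ, circleMap c r θ ∈ sphere c r := fun θ => circleMap_mem_sphere c hr.le θ
  have hc : Continuous fun θ => f (circleMap c r θ) := by
    refine hf.comp_continuous (continuous_circleMap c r) hm
  have h1 : ∫ θ in (0:ℝ)..2 * π, f (circleMap c r θ) < ∫ θ in (0:ℝ)..2 * π, a := by
    apply intervalIntegral.integral_lt_integral_of_continuousOn_of_le_of_exists_lt two_pi_pos
      hc.continuousOn continuousOn_const
    · intro x _; exact hle _ (hm x)
    · exact ⟨0, by simp [two_pi_pos.le], by simpa [circleMap] using hlt⟩
  rw [circleAverage_def, smul_eq_mul]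
  rw [intervalIntegral.integral_const, smul_eq_mul, sub_zero] at h1
  have := mul_lt_mul_of_pos_left h1 (inv_pos.2 two_pi_pos)
  rwa [inv_mul_cancel_left₀ two_pi_pos.ne'] at this

/-- maximum principle, boundary behaviour given off compact sets -/
theorem maxB {D : Set ℂ} (hDo : IsOpen D) {v : ℂ → ℝ} {M : ℝ}
    (hv : ContinuousOn v D) (hs : SubM v D)
    (hb : ∀ ε > 0, ∃ K, IsCompact K ∧ K ⊆ D ∧ ∀ z ∈ D \ K, v z ≤ M + ε) :
    ∀ z ∈ D, v z ≤ M := by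
  intro z0 hz0
  by_contra! hlt
  obtain ⟨K, hK, hKD, hKb⟩ := hb ((v z0 - M) / 2) (by linarith)
  set K' := insert z0 K
  have hK' : IsCompact K' := hK.insert z0
  have hK'D : K' ⊆ D := insert_subset hz0 hKD
  obtain ⟨z1, hz1, hmax⟩ := hK'.exists_isMaxOn ⟨z0, mem_insert _ _⟩ (hv.mono hK'D)
  have h01 : v z0 ≤ v z1 := hmax (mem_insert _ _)
  have hall : ∀ z ∈ D, v z ≤ v z1 := by
    intro z hz
    by_cases hzK : z ∈ K
    · exact hmax (mem_insert_of_mem _ hzK)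
    · have := hKb z ⟨hz, hzK⟩; linarith
  set Mx := K' ∩ {z | v z = v z1}
  have hMx : IsCompact Mx := by
    have : Mx = K' ∩ v ⁻¹' {v z1} := rfl
    rw [this]
    exact hK'.of_isClosed_subset
      ((hv.mono hK'D).preimage_isClosed_of_isClosed hK'.isClosed isClosed_singleton)
      inter_subset_left
  obtain ⟨z2, hz2, hright⟩ := hMx.exists_isMaxOn ⟨z1, hz1, rfl⟩ (f := Complex.re) (by fun_prop)
  have hz2D : z2 ∈ D := hK'D hz2.1
  obtain ⟨ε, hε, hsub⟩ := hs z2 hz2D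
  obtain ⟨ρ, hρ, hball⟩ := Metric.isOpen_iff.1 hDo z2 hz2D
  set r := min ε ρ / 2
  have hr : 0 < r := by positivity
  have hrε : r < ε := by have := min_le_left ε ρ; have : 0 < min ε ρ := by positivity
                         simp only [r]; linarith
  have hrρ : r < ρ := by have := min_le_right ε ρ; have : 0 < min ε ρ := by positivity
                         simp only [r]; linarith
  have hsp : sphere z2 r ⊆ D := fun x hx => hball (by
    rw [mem_ball]; rw [mem_sphere] at hx; linarith)
  have key : circleAverage v z2 r < v z1 := by
    apply circleAverage_lt_of hr (hv.mono hsp) (fun x hx => hall x (hsp hx))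
    have hmem : z2 + (r:ℂ) ∈ D := hsp (by simp [hr.le])
    refine lt_of_le_of_ne (hall _ hmem) ?_
    intro he
    have hK2 : z2 + (r:ℂ) ∈ K' := by
      by_contra hno
      have := hKb _ ⟨hmem, fun h => hno (mem_insert_of_mem _ h)⟩
      linarith
    have := hright (a := z2 + r) ⟨hK2, he⟩
    simp at this
    linarith
  have := hsub r hr hrε
  rw [hz2.2] at this
  linarith

theorem compact_of_frontier {D : Set ℂ} (hDb : Bornology.IsBounded D) (hDo : IsOpen D)
    {v : ℂ → ℝ} {a : ℝ} (hv : ContinuousOn v (closure D)) (hb : ∀ z ∈ frontier D, v z < a) :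
    IsCompact (closure D ∩ {z | a ≤ v z}) ∧ closure D ∩ {z | a ≤ v z} ⊆ D := by
  constructor
  · have hc : IsCompact (closure D) := hDb.isCompact_closure
    exact hc.of_isClosed_subset
      (hv.preimage_isClosed_of_isClosed isClosed_closure isClosed_Ici) inter_subset_left
  · rintro z ⟨hz, hza⟩
    by_contra hzD
    have : z ∈ frontier D := by rw [hDo.frontier_eq]; exact ⟨hz, hzD⟩
    exact absurd (hb z this) (not_lt.2 hza)

theorem maxA {D : Set ℂ} (hDb : Bornology.IsBounded D) (hDo : IsOpen D) {v : ℂ → ℝ} {M : ℝ}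
    (hv : ContinuousOn v (closure D)) (hs : SubM v D) (hb : ∀ z ∈ frontier D, v z ≤ M) :
    ∀ z ∈ closure D, v z ≤ M := by
  have h := maxB hDo (M := M) (hv.mono subset_closure) hs (fun ε hε => by
    obtain ⟨h1, h2⟩ := compact_of_frontier hDb hDo hv (a := M + ε)
      (fun z hz => by linarith [hb z hz])
    refine ⟨_, h1, h2, fun z hz => ?_⟩
    by_contra! hlt
    exact hz.2 ⟨subset_closure hz.1, hlt.le⟩)
  intro z hz
  by_cases hzD : z ∈ D
  · exact h z hzD
  · exact hb z (by rw [hDo.frontier_eq]; exact ⟨hz, hzD⟩)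

/-- harmonic functions: bridge -/
theorem harm_iff {u : ℂ → ℝ} {D : Set ℂ} : HarmonicOnD u D ↔ HarmonicOnNhd u D := by
  constructor
  · intro h z hz
    obtain ⟨ε, hε, F, hF, hu⟩ := h z hz
    have hA : AnalyticAt ℂ F z := hF.analyticAt (ball_mem_nhds z hε)
    have := hA.harmonicAt_re
    refine (harmonicAt_congr_nhds ?_).1 this
    filter_upwards [ball_mem_nhds z hε] with w hw
    rw [hu w hw]
  · intro h z hz
    obtain ⟨ε, hε, hb⟩ := Metric.isOpen_iff.1 (isOpen_setOfPred_harmonicAt u) z (h z hz)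
    obtain ⟨F, hF, hu⟩ := HarmonicOnNhd.exists_analyticOnNhd_ball_re_eq (f := u) (z := z) (R := ε)
      (fun y hy => hb hy)
    exact ⟨ε, hε, F, hF.differentiableOn, fun w hw => (hu hw).symm⟩

theorem harm_re {F : ℂ → ℂ} {D : Set ℂ} (hDo : IsOpen D) (hF : DifferentiableOn ℂ F D) :
    HarmonicOnNhd (fun z => (F z).re) D := fun z hz =>
  (hF.analyticAt (hDo.mem_nhds hz)).harmonicAt_re

theorem harm_im {F : ℂ → ℂ} {D : Set ℂ} (hDo : IsOpen D) (hF : DifferentiableOn ℂ F D) :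
    HarmonicOnNhd (fun z => (F z).im) D := fun z hz =>
  (hF.analyticAt (hDo.mem_nhds hz)).harmonicAt_im

theorem harm_mean {u : ℂ → ℝ} {D : Set ℂ} (hu : HarmonicOnNhd u D) {c : ℂ} {r : ℝ}
    (hr : 0 ≤ r) (h : closedBall c r ⊆ D) : circleAverage u c r = u c :=
  HarmonicOnNhd.circleAverage_eq (by rw [abs_of_nonneg hr]; exact hu.mono h)

theorem exists_rad {D : Set ℂ} (hDo : IsOpen D) {z : ℂ} (hz : z ∈ D) :
    ∃ ε > 0, ∀ r, r < ε → closedBall z r ⊆ D := by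
  obtain ⟨ρ, hρ, hball⟩ := Metric.isOpen_iff.1 hDo z hz
  exact ⟨ρ, hρ, fun r hr => (closedBall_subset_ball hr).trans hball⟩

theorem SubM.of_harm {u : ℂ → ℝ} {D : Set ℂ} (hDo : IsOpen D) (hu : HarmonicOnNhd u D) :
    SubM u D := fun z hz => by
  obtain ⟨ε, hε, h⟩ := exists_rad hDo hz
  exact ⟨ε, hε, fun r h0 h1 => (harm_mean hu h0.le (h r h1)).ge⟩

theorem circleInt {v : ℂ → ℝ} {s : Set ℂ} {c : ℂ} {r : ℝ} (hv : ContinuousOn v s)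
    (hr : 0 ≤ r) (h : closedBall c r ⊆ s) : CircleIntegrable v c r :=
  (hv.mono (sphere_subset_closedBall.trans h)).circleIntegrable hr

theorem SubM.add {u v : ℂ → ℝ} {D : Set ℂ} (hDo : IsOpen D) (huc : ContinuousOn u D)
    (hvc : ContinuousOn v D) (hu : SubM u D)
    (hv : SubM v D) : SubM (u + v) D := fun z hz => by
  obtain ⟨ε, hε, h⟩ := exists_rad hDo hz
  obtain ⟨ε1, hε1, h1⟩ := hu z hz
  obtain ⟨ε2, hε2, h2⟩ := hv z hz
  refine ⟨min ε (min ε1 ε2), by positivity, fun r h0 hr => ?_⟩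
  simp only [lt_min_iff] at hr
  have hs := h r hr.1
  rw [circleAverage_add (circleInt huc h0.le hs) (circleInt hvc h0.le hs)]
  exact add_le_add (h1 r h0 hr.2.1) (h2 r h0 hr.2.2)

theorem SubM.norm {F : ℂ → ℂ} {D : Set ℂ} (hDo : IsOpen D) (hF : DifferentiableOn ℂ F D) :
    SubM (fun z => ‖F z‖) D := fun z hz => by
  obtain ⟨ε, hε, h⟩ := exists_rad hDo hz
  refine ⟨ε, hε, fun r h0 hr => ?_⟩
  have hc : closedBall z r ⊆ D := h r hr
  have hd : DiffContOnCl ℂ F (ball z r) := by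
    refine ⟨hF.mono (ball_subset_closedBall.trans hc), ?_⟩
    rw [closure_ball z h0.ne']
    exact hF.continuousOn.mono hc
  have := DiffContOnCl.circleAverage (f := F) (c := z) (R := r) (by rwa [abs_of_pos h0])
  show ‖F z‖ ≤ _
  rw [← this, circleAverage_def, circleAverage_def, norm_smul, smul_eq_mul, Real.norm_eq_abs,
    abs_of_pos (inv_pos.2 two_pi_pos)]
  refine mul_le_mul_of_nonneg_left ?_ (inv_pos.2 two_pi_pos).le
  exact intervalIntegral.norm_integral_le_integral_norm two_pi_pos.le

/-- uniqueness for harmonic functions with zero boundary behaviour -/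
theorem harm_zero {D : Set ℂ} (hDo : IsOpen D) {u : ℂ → ℝ} (hu : HarmonicOnNhd u D)
    (hb : ∀ ε > 0, ∃ K, IsCompact K ∧ K ⊆ D ∧ ∀ z ∈ D \ K, |u z| ≤ ε) :
    ∀ z ∈ D, u z = 0 := by
  intro z hz
  apply le_antisymm
  · refine maxB hDo hu.continuousOn (SubM.of_harm hDo hu) (fun ε hε => ?_) z hz
    obtain ⟨K, h1, h2, h3⟩ := hb ε hε
    exact ⟨K, h1, h2, fun z hz => by linarith [le_abs_self (u z), h3 z hz]⟩
  · have := maxB hDo (M := 0) hu.neg.continuousOn (SubM.of_harm hDo hu.neg) (fun ε hε => by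
      obtain ⟨K, h1, h2, h3⟩ := hb ε hε
      refine ⟨K, h1, h2, fun z hz => ?_⟩
      have := h3 z hz
      have := neg_abs_le (u z)
      simp only [Pi.neg_apply]; linarith) z hz
    simpa using this

/-- Solution of the Dirichlet problem -/
structure Sol (D : Set ℂ) (φ u : ℂ → ℝ) : Prop where
  cont : ContinuousOn u (closure D)
  harm : HarmonicOnNhd u D
  bd : ∀ z ∈ frontier D, u z = φ z

theorem Sol.le {D : Set ℂ} (hDb : Bornology.IsBounded D) (hDo : IsOpen D) {φ ψ u v : ℂ → ℝ}
    (h1 : Sol D φ u) (h2 : Sol D ψ v) (h : ∀ z ∈ frontier D, φ z ≤ ψ z) :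
    ∀ z ∈ closure D, u z ≤ v z := by
  intro z hz
  have := maxA hDb hDo (h1.cont.sub h2.cont) (SubM.of_harm hDo (h1.harm.sub h2.harm)) (M := 0)
    (fun z hz => by simp [h1.bd z hz, h2.bd z hz, h z hz]) z hz
  simpa using this

theorem Sol.unique {D : Set ℂ} (hDb : Bornology.IsBounded D) (hDo : IsOpen D) {φ u v : ℂ → ℝ}
    (h1 : Sol D φ u) (h2 : Sol D φ v) : ∀ z ∈ closure D, u z = v z := fun z hz =>
  le_antisymm (Sol.le hDb hDo h1 h2 (fun _ _ => le_rfl) z hz)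
    (Sol.le hDb hDo h2 h1 (fun _ _ => le_rfl) z hz)

theorem Sol.const {D : Set ℂ} (a : ℝ) : Sol D (fun _ => a) (fun _ => a) :=
  ⟨continuousOn_const, harmonicOnNhd_const a, fun _ _ => rfl⟩

theorem Sol.add {D : Set ℂ} {φ ψ u v : ℂ → ℝ} (h1 : Sol D φ u) (h2 : Sol D ψ v) :
    Sol D (fun z => φ z + ψ z) (fun z => u z + v z) :=
  ⟨h1.cont.add h2.cont, h1.harm.add h2.harm, fun z hz => by simp [h1.bd z hz, h2.bd z hz]⟩

theorem Sol.smul {D : Set ℂ} {φ u : ℂ → ℝ} (a : ℝ) (h1 : Sol D φ u) :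
    Sol D (fun z => a * φ z) (fun z => a * u z) :=
  ⟨h1.cont.const_smul a, h1.harm.const_smul (c := a), fun z hz => by simp [h1.bd z hz]⟩

theorem Sol.sub {D : Set ℂ} {φ ψ u v : ℂ → ℝ} (h1 : Sol D φ u) (h2 : Sol D ψ v) :
    Sol D (fun z => φ z - ψ z) (fun z => u z - v z) :=
  ⟨h1.cont.sub h2.cont, h1.harm.sub h2.harm, fun z hz => by simp [h1.bd z hz, h2.bd z hz]⟩

end HX

namespace HX
open Metric Filter Topology InnerProductSpace Real

/-- bounded pointwise limits of harmonic functions on a disc -/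
theorem harm_lim {c : ℂ} {R : ℝ} {v : ℕ → ℂ → ℝ} {u : ℂ → ℝ} {B : ℝ}
    (hvc : ∀ n, ContinuousOn (v n) (closedBall c R)) (hvh : ∀ n, HarmonicOnNhd (v n) (ball c R))
    (hb : ∀ n, ∀ z ∈ closedBall c R, |v n z| ≤ B)
    (hl : ∀ z ∈ closedBall c R, Tendsto (fun n => v n z) atTop (𝓝 (u z))) :
    HarmonicOnNhd u (ball c R) := by
  rcases le_or_gt R 0 with hR | hR
  · intro z hz; simp [ball_eq_empty.2 hR] at hz
  have hm : ∀ θ, circleMap c R θ ∈ sphere c R := fun θ => circleMap_mem_sphere c hR.le θ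
  have hm' : ∀ θ, circleMap c R θ ∈ closedBall c R := fun θ => sphere_subset_closedBall (hm θ)
  have hcont : ∀ n, Continuous fun θ => v n (circleMap c R θ) := fun n =>
    (hvc n).comp_continuous (continuous_circleMap c R) hm'
  have hlim : ∀ θ, Tendsto (fun n => v n (circleMap c R θ)) atTop (𝓝 (u (circleMap c R θ))) :=
    fun θ => hl _ (hm' θ)
  have hub : ∀ z ∈ closedBall c R, |u z| ≤ B := fun z hz =>
    le_of_tendsto (hl z hz).abs (Eventually.of_forall fun n => hb n z hz)
  have humeas : Measurable fun θ => u (circleMap c R θ) :=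
    measurable_of_tendsto_metrizable (fun n => (hcont n).measurable) (tendsto_pi_nhds.2 hlim)
  have hui : CircleIntegrable u c R := by
    rw [CircleIntegrable, intervalIntegrable_iff]
    refine MeasureTheory.Measure.integrableOn_of_bounded (M := B) (by simp [ENNReal.mul_eq_top])
      humeas.aestronglyMeasurable ?_
    exact Eventually.of_forall fun θ => hub _ (hm' θ)
  have hrep : ∀ w ∈ ball c R, u w = circleAverage ((re ∘ herglotzRieszKernel c w) • u) c R := by
    intro w hw
    have h1 : ∀ n, circleAverage ((re ∘ herglotzRieszKernel c w) • v n) c R = v n w := fun n =>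
      HarmonicContOnCl.circleAverage_re_herglotzRieszKernel_smul
        ⟨hvh n, by rw [closure_ball c hR.ne']; exact hvc n⟩ hw
    have hk : Continuous fun θ => (herglotzRieszKernel c w (circleMap c R θ)).re := by
      refine Complex.continuous_re.comp ?_
      exact (continuousOn_herglotzRieszKernel_sphere hw).comp_continuous (continuous_circleMap c R)
        (fun θ => by rw [abs_of_pos hR]; exact hm θ)
    have h2 : Tendsto (fun n => circleAverage ((re ∘ herglotzRieszKernel c w) • v n) c R) atTop
        (𝓝 (circleAverage ((re ∘ herglotzRieszKernel c w) • u) c R)) := by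
      simp only [circleAverage_def]
      refine Tendsto.const_smul ?_ _
      refine intervalIntegral.tendsto_integral_filter_of_dominated_convergence
        (fun θ => |(herglotzRieszKernel c w (circleMap c R θ)).re| * B) ?_ ?_ ?_ ?_
      · refine Eventually.of_forall fun n => Continuous.aestronglyMeasurable ?_
        exact hk.mul (hcont n)
      · refine Eventually.of_forall fun n => Eventually.of_forall fun θ _ => ?_
        simp only [Pi.smul_apply', smul_eq_mul, Function.comp_apply, norm_mul, Real.norm_eq_abs]
        exact mul_le_mul_of_nonneg_left (hb n _ (hm' θ)) (abs_nonneg _)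
      · exact (hk.abs.mul continuous_const).intervalIntegrable _ _
      · exact Eventually.of_forall fun θ _ => (hlim θ).const_mul _
    simp only [h1] at h2
    exact tendsto_nhds_unique (hl w (ball_subset_closedBall hw)) h2
  -- shift to centre zero
  set g : ℂ → ℝ := fun z => u (z + c)
  have hgi : CircleIntegrable g 0 R := by
    have : (fun θ => u (circleMap c R θ)) = fun θ => g (circleMap 0 R θ) := by
      ext θ; simp [g, circleMap, add_comm]
    rw [CircleIntegrable] at hui ⊢
    rwa [this] at hui
  have hgi' : CircleIntegrable (fun z => (g z : ℂ)) 0 R := by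
    simp only [CircleIntegrable, intervalIntegrable_iff] at hgi ⊢
    exact Complex.ofRealCLM.integrable_comp hgi
  have hF := differentiableOn_circleAverage_herglotzRieszKernel_smul hgi'
  set F := fun w => circleAverage (fun ζ => herglotzRieszKernel 0 w ζ • (g ζ : ℂ)) 0 R
  have hFu : ∀ w ∈ ball c R, (F (w - c)).re = u w := by
    intro w hw
    have hw0 : w - c ∈ ball (0:ℂ) R := by simpa [dist_eq_norm] using hw
    rw [re_circleAverage_herglotzRieszKernel_smul hgi hw0, hrep w hw,
      ← circleAverage_map_add_const (c := c)]
    congr 1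
    ext z
    simp [g, herglotzRieszKernel_def]
  have hF2 : DifferentiableOn ℂ (fun w => F (w - c)) (ball c R) := by
    refine hF.comp (by fun_prop) ?_
    intro w hw; simpa [dist_eq_norm] using hw
  intro z hz
  refine (harmonicAt_congr_nhds ?_).1 (harm_re isOpen_ball hF2 z hz)
  filter_upwards [isOpen_ball.mem_nhds hz] with w hw using hFu w hw

/-- uniform approximation of boundary data suffices -/
theorem sol_of_approx {D : Set ℂ} (hDb : Bornology.IsBounded D) (hDo : IsOpen D) {φ : ℂ → ℝ}
    (h : ∀ ε > 0, ∃ ψ u, Sol D ψ u ∧ ∀ z ∈ frontier D, |φ z - ψ z| ≤ ε) : ∃ u, Sol D φ u := by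
  have h' : ∀ n : ℕ, ∃ ψ u, Sol D ψ u ∧ ∀ z ∈ frontier D, |φ z - ψ z| ≤ 1 / ((n:ℝ) + 1) :=
    fun n => h _ (by positivity)
  choose ψ v hs hφ using h'
  have hdiff : ∀ n m, ∀ z ∈ closure D, |v n z - v m z| ≤ 1 / ((n:ℝ) + 1) + 1 / ((m:ℝ) + 1) := by
    have hh : ∀ n m, ∀ z ∈ closure D, v n z - v m z ≤ 1 / ((n:ℝ) + 1) + 1 / ((m:ℝ) + 1) := by
      intro n m z hz
      refine Sol.le hDb hDo ((hs n).sub (hs m)) (Sol.const _) (fun w hw => ?_) z hz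
      have h1 := abs_le.1 (hφ n w hw)
      have h2 := abs_le.1 (hφ m w hw)
      linarith
    intro n m z hz
    rw [abs_le]
    constructor <;> linarith [hh n m z hz, hh m n z hz]
  have ht0 : Tendsto (fun n : ℕ => 1 / ((n:ℝ) + 1)) atTop (𝓝 0) := tendsto_one_div_add_atTop_nhds_zero_nat
  have hcau : ∀ z ∈ closure D, ∃ l, Tendsto (fun n => v n z) atTop (𝓝 l) := by
    intro z hz
    apply cauchySeq_tendsto_of_complete
    rw [Metric.cauchySeq_iff']
    intro ε hε
    obtain ⟨N, hN⟩ := (ht0.eventually (gt_mem_nhds (half_pos hε))).exists_forall_of_atTop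
    refine ⟨N, fun n hn => ?_⟩
    rw [Real.dist_eq]
    have := hdiff n N z hz
    have := hN n hn
    have := hN N le_rfl
    linarith
  choose! u hu using hcau
  have hun : ∀ n, ∀ z ∈ closure D, |v n z - u z| ≤ 1 / ((n:ℝ) + 1) := by
    intro n z hz
    have h1 : Tendsto (fun m => |v n z - v m z|) atTop (𝓝 |v n z - u z|) :=
      (tendsto_const_nhds.sub (hu z hz)).abs
    have h2 : Tendsto (fun m : ℕ => 1 / ((n:ℝ) + 1) + 1 / ((m:ℝ) + 1)) atTop
        (𝓝 (1 / ((n:ℝ) + 1) + 0)) := tendsto_const_nhds.add ht0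
    simpa using le_of_tendsto_of_tendsto' h1 h2 (fun m => hdiff n m z hz)
  have hunif : TendstoUniformlyOn v u atTop (closure D) := by
    rw [Metric.tendstoUniformlyOn_iff]
    intro ε hε
    filter_upwards [ht0.eventually (gt_mem_nhds hε)] with n hn z hz
    rw [dist_comm, Real.dist_eq]
    exact (hun n z hz).trans_lt hn
  have huc : ContinuousOn u (closure D) :=
    hunif.continuousOn (Eventually.frequently (Eventually.of_forall fun n => (hs n).cont))
  refine ⟨u, huc, ?_, ?_⟩
  · intro z hz
    obtain ⟨ε, hε, hball⟩ := exists_rad hDo hz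
    have hcb := hball (ε / 2) (by linarith)
    obtain ⟨B, hB⟩ := (isCompact_closedBall z (ε/2)).exists_bound_of_continuousOn
      (huc.mono (hcb.trans subset_closure))
    have := harm_lim (c := z) (R := ε / 2) (v := v) (u := u) (B := B + 1)
      (fun n => (hs n).cont.mono (hcb.trans subset_closure))
      (fun n => (hs n).harm.mono (ball_subset_closedBall.trans hcb)) (fun n w hw => by
        have h1 := hun n w (subset_closure (hcb hw))
        have h2 := hB w hw
        rw [Real.norm_eq_abs] at h2
        have h3 : 1 / ((n:ℝ) + 1) ≤ 1 := by
          rw [div_le_one (by positivity)]; linarith [n.cast_nonneg (α := ℝ)]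
        have h4 : |v n w| ≤ |v n w - u w| + |u w| := by
          simpa using abs_add_le (v n w - u w) (u w)
        linarith) (fun w hw => hu w (subset_closure (hcb hw)))
    exact this z (mem_ball_self (by linarith))
  · intro z hz
    have hzc := frontier_subset_closure hz
    have h1 : Tendsto (fun n => v n z) atTop (𝓝 (φ z)) := by
      rw [tendsto_iff_dist_tendsto_zero]
      refine squeeze_zero (fun _ => dist_nonneg) (fun n => ?_) ht0
      rw [dist_comm, Real.dist_eq, (hs n).bd z hz]
      exact hφ n z hz
    exact tendsto_nhds_unique (hu z hzc) h1

/-- Dirichlet problem on a disc -/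
theorem sol_ball {c : ℂ} {R : ℝ} (hR : 0 < R) {φ : ℂ → ℝ} (hφ : ContinuousOn φ (sphere c R)) :
    ∃ u, Sol (ball c R) φ u := by
  have : Fact ((0:ℝ) < 1) := ⟨one_pos⟩
  refine sol_of_approx isBounded_ball isOpen_ball (fun ε hε => ?_)
  rw [frontier_ball c hR.ne']
  have hmem : ∀ x : AddCircle (1:ℝ), c + R * (x.toCircle : ℂ) ∈ sphere c R := by
    intro x; simp [abs_of_pos hR, Circle.norm_coe]
  let f : C(AddCircle (1:ℝ), ℂ) := ⟨fun x => (φ (c + R * (x.toCircle : ℂ)) : ℂ), by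
    refine Complex.continuous_ofReal.comp (hφ.comp_continuous ?_ hmem)
    exact continuous_const.add (continuous_const.mul
      (continuous_subtype_val.comp AddCircle.continuous_toCircle))⟩
  have hfcl : f ∈ (Submodule.span ℂ (range (fourier (T := 1)))).topologicalClosure := by
    rw [span_fourier_closure_eq_top]; trivial
  obtain ⟨p, hp, hpf⟩ := Metric.mem_closure_iff.1 hfcl ε hε
  have key : ∀ p ∈ Submodule.span ℂ (range (fourier (T := 1))), ∃ F G : ℂ → ℂ,
      Differentiable ℂ F ∧ Differentiable ℂ G ∧
      ∀ x : AddCircle (1:ℝ), p x = F (x.toCircle : ℂ) + (starRingEnd ℂ) (G (x.toCircle : ℂ)) := by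
    intro p hp
    induction hp using Submodule.span_induction with
    | mem p hp =>
      obtain ⟨n, rfl⟩ := hp
      rcases Int.eq_nat_or_neg n with ⟨k, rfl | rfl⟩
      · refine ⟨fun z => z ^ k, 0, by fun_prop, by fun_prop, fun x => ?_⟩
        simp [AddCircle.toCircle_nsmul, fourier_apply]
      · refine ⟨0, fun z => z ^ k, by fun_prop, by fun_prop, fun x => ?_⟩
        simp only [fourier_apply, AddCircle.toCircle_zsmul, Pi.zero_apply, zero_add, map_pow,
          zpow_neg, zpow_natCast]
        rw [Circle.coe_inv_eq_conj]
        simp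
    | zero => exact ⟨0, 0, by fun_prop, by fun_prop, by simp⟩
    | add p q _ _ hp hq =>
      obtain ⟨F, G, h1, h2, h3⟩ := hp
      obtain ⟨F', G', h1', h2', h3'⟩ := hq
      refine ⟨F + F', G + G', h1.add h1', h2.add h2', fun x => ?_⟩
      simp [h3, h3']; ring
    | smul a p _ hp =>
      obtain ⟨F, G, h1, h2, h3⟩ := hp
      refine ⟨fun z => a * F z, fun z => (starRingEnd ℂ) a * G z, by fun_prop, by fun_prop,
        fun x => ?_⟩
      simp [h3]; ring
  obtain ⟨F, G, hF, hG, hFG⟩ := key p hp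
  set H : ℂ → ℂ := fun z => F ((z - c) / R) + G ((z - c) / R)
  have hH : Differentiable ℂ H := by fun_prop
  refine ⟨fun z => (H z).re, fun z => (H z).re, ⟨(Complex.continuous_re.comp hH.continuous).continuousOn,
    harm_re isOpen_ball hH.differentiableOn, fun _ _ => rfl⟩, fun z hz => ?_⟩
  obtain ⟨x, hx⟩ : ∃ x : AddCircle (1:ℝ), (x.toCircle : ℂ) = (z - c) / R := by
    have hn : ‖(z - c) / R‖ = 1 := by
      rw [norm_div, Complex.norm_real, Real.norm_eq_abs, abs_of_pos hR, mem_sphere_iff_norm.1 hz,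
        div_self hR.ne']
    obtain ⟨x, hx⟩ := (AddCircle.homeomorphCircle (T := 1) one_ne_zero).surjective
      ⟨(z - c) / R, by simpa [Submonoid.unitSphere] using hn⟩
    refine ⟨x, ?_⟩
    rw [AddCircle.homeomorphCircle_apply] at hx
    rw [hx]
  have hz' : c + R * (x.toCircle : ℂ) = z := by
    rw [hx]; field_simp [Complex.ofReal_ne_zero.2 hR.ne']; ring
  have h1 : dist (f x) (p x) ≤ dist f p := ContinuousMap.dist_apply_le_dist x
  have h2 : f x = (φ z : ℂ) := by simp [f, hz']
  have h3 : (p x).re = (H z).re := by rw [hFG, hx]; simp [H]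
  rw [dist_eq_norm, h2] at h1
  have h4 := Complex.abs_re_le_norm ((φ z : ℂ) - p x)
  rw [sub_re, ofReal_re, h3] at h4
  linarith

/-- Harnack on a disc -/
theorem harnack_ball {c w : ℂ} {R : ℝ} {u : ℂ → ℝ} (hR : 0 < R)
    (hu : HarmonicOnNhd u (closedBall c R)) (h0 : ∀ z ∈ closedBall c R, 0 ≤ u z)
    (hw : w ∈ closedBall c (R / 2)) : u w ≤ 3 * u c ∧ u c ≤ 3 * u w := by
  have hwb : w ∈ ball c R := closedBall_subset_ball (by linarith) hw
  have hn : ‖w - c‖ ≤ R / 2 := by simpa [dist_eq_norm] using hw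
  have hn0 := norm_nonneg (w - c)
  have hcl : HarmonicContOnCl u (ball c R) :=
    ⟨hu.mono ball_subset_closedBall, by rw [closure_ball c hR.ne']; exact hu.continuousOn⟩
  have h1 := HarmonicContOnCl.circleAverage_re_herglotzRieszKernel_smul hcl hwb
  have h2 : circleAverage u c R = u c := harm_mean hu hR.le subset_rfl
  have hci : CircleIntegrable u c R :=
    (hu.continuousOn.mono sphere_subset_closedBall).circleIntegrable hR.le
  have hck : CircleIntegrable ((re ∘ herglotzRieszKernel c w) • u) c R := by
    refine ContinuousOn.circleIntegrable hR.le ?_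
    refine ContinuousOn.smul (Complex.continuous_re.comp_continuousOn ?_)
      (hu.continuousOn.mono sphere_subset_closedBall)
    have := continuousOn_herglotzRieszKernel_sphere hwb
    rwa [abs_of_pos hR] at this
  have h3 : ∀ a : ℝ, circleAverage (fun z => a * u z) c R = a * u c := by
    intro a
    have := circleAverage_fun_smul (a := a) (f := u) (c := c) (R := R)
    simpa [h2] using this
  constructor
  · rw [← h1, ← h3]
    apply circleAverage_mono hck (hci.const_smul (a := 3))
    intro x hx
    rw [abs_of_pos hR] at hx
    have hk := re_herglotzRieszKernel_le hx hwb
    have : (R + ‖w - c‖) / (R - ‖w - c‖) ≤ 3 := by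
      rw [div_le_iff₀ (by linarith)]; linarith
    simp only [Pi.smul_apply', Function.comp_apply, smul_eq_mul, herglotzRieszKernel_def]
    exact mul_le_mul_of_nonneg_right (hk.trans this) (h0 x (sphere_subset_closedBall hx))
  · have : (1/3) * u c ≤ u w := by
      rw [← h1, ← h3]
      apply circleAverage_mono (hci.const_smul (a := 1/3)) hck
      intro x hx
      rw [abs_of_pos hR] at hx
      have hk := le_re_herglotzRieszKernel hx hwb
      have : 1/3 ≤ (R - ‖w - c‖) / (R + ‖w - c‖) := by
        rw [le_div_iff₀ (by linarith)]; linarith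
      simp only [Pi.smul_apply', Function.comp_apply, smul_eq_mul, herglotzRieszKernel_def]
      exact mul_le_mul_of_nonneg_right (this.trans hk) (h0 x (sphere_subset_closedBall hx))
    linarith

/-- Harnack between points (as a relation) -/
def Hk (D : Set ℂ) (C : ℝ) (c z : ℂ) : Prop :=
  ∀ u : ℂ → ℝ, HarmonicOnNhd u D → (∀ w ∈ D, 0 ≤ u w) → u z ≤ C * u c ∧ u c ≤ C * u z

theorem harnack_point {D : Set ℂ} (hDo : IsOpen D) (hDc : IsPreconnected D) {c : ℂ} (hc : c ∈ D) :
    ∀ z ∈ D, ∃ C > 0, Hk D C c z := by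
  have hloc : ∀ z ∈ D, ∃ ε > 0, ∀ w ∈ ball z ε, w ∈ D ∧ Hk D 3 z w := by
    intro z hz
    obtain ⟨ε, hε, hball⟩ := exists_rad hDo hz
    have hcb := hball (ε / 2) (by linarith)
    refine ⟨ε / 4, by linarith, fun w hw => ⟨hcb (closedBall_subset_closedBall (by linarith)
      (ball_subset_closedBall hw)), fun u hu h0 => ?_⟩⟩
    exact harnack_ball (R := ε / 2) (by linarith) (hu.mono hcb) (fun x hx => h0 x (hcb hx))
      (by have := ball_subset_closedBall hw; rwa [show ε / 2 / 2 = ε / 4 by ring])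
  have htr : ∀ {C C' : ℝ} {a b d : ℂ}, 0 < C → 0 < C' → Hk D C a b → Hk D C' b d →
      Hk D (C * C') a d := by
    intro C C' a b d hC hC' h1 h2 u hu h0
    obtain ⟨x1, x2⟩ := h1 u hu h0
    obtain ⟨y1, y2⟩ := h2 u hu h0
    constructor
    · calc u d ≤ C' * u b := y1
        _ ≤ C' * (C * u a) := by gcongr
        _ = C * C' * u a := by ring
    · calc u a ≤ C * u b := x2
        _ ≤ C * (C' * u d) := by gcongr
        _ = C * C' * u d := by ring
  have hsym : ∀ {C : ℝ} {a b : ℂ}, Hk D C a b → Hk D C b a := fun h u hu h0 =>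
    ⟨(h u hu h0).2, (h u hu h0).1⟩
  set W := {z | z ∈ D ∧ ∃ C > 0, Hk D C c z}
  set W' := {z | z ∈ D ∧ ¬ ∃ C > 0, Hk D C c z}
  have hW : IsOpen W := by
    rw [Metric.isOpen_iff]
    rintro z ⟨hz, C, hC, h⟩
    obtain ⟨ε, hε, hl⟩ := hloc z hz
    exact ⟨ε, hε, fun w hw => ⟨(hl w hw).1, C * 3, by positivity, htr hC (by norm_num) h (hl w hw).2⟩⟩
  have hW' : IsOpen W' := by
    rw [Metric.isOpen_iff]
    rintro z ⟨hz, hno⟩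
    obtain ⟨ε, hε, hl⟩ := hloc z hz
    refine ⟨ε, hε, fun w hw => ⟨(hl w hw).1, ?_⟩⟩
    rintro ⟨C, hC, h⟩
    exact hno ⟨C * 3, by positivity, htr hC (by norm_num) h (hsym (hl w hw).2)⟩
  intro z hz
  by_contra hno
  have hcW : c ∈ W := ⟨hc, 1, one_pos, fun u _ _ => by simp⟩
  obtain ⟨x, _, h1, h2⟩ := hDc W W' hW hW' (fun x hx => by
    by_cases h : ∃ C > 0, Hk D C c x
    · exact Or.inl ⟨hx, h⟩
    · exact Or.inr ⟨hx, h⟩) ⟨c, hc, hcW⟩ ⟨z, hz, hz, hno⟩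
  exact h2.2 h1.2

theorem harnack {D : Set ℂ} (hDo : IsOpen D) (hDc : IsPreconnected D) {c : ℂ} (hc : c ∈ D)
    {K : Set ℂ} (hK : IsCompact K) (hKD : K ⊆ D) : ∃ C > 0, ∀ z ∈ K, Hk D C c z := by
  have hmono : ∀ {C C' : ℝ} {z : ℂ}, z ∈ D → C ≤ C' → Hk D C c z → Hk D C' c z :=
    fun hz hCC h u hu h0 => ⟨(h u hu h0).1.trans (mul_le_mul_of_nonneg_right hCC (h0 _ hc)),
      (h u hu h0).2.trans (mul_le_mul_of_nonneg_right hCC (h0 _ hz))⟩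
  have := hK.induction_on (p := fun S => ∃ C > 0, ∀ z ∈ S ∩ D, Hk D C c z) ⟨1, one_pos, by simp⟩
    (fun s t hst ⟨C, hC, h⟩ => ⟨C, hC, fun z hz => h z ⟨hst hz.1, hz.2⟩⟩)
    (fun s t ⟨C, hC, h⟩ ⟨C', hC', h'⟩ => ⟨max C C', by positivity, fun z hz => by
      rcases hz with ⟨hz | hz, hzD⟩
      · exact hmono hzD (le_max_left _ _) (h z ⟨hz, hzD⟩)
      · exact hmono hzD (le_max_right _ _) (h' z ⟨hz, hzD⟩)⟩)
    (fun z hz => by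
      obtain ⟨C, hC, h⟩ := harnack_point hDo hDc hc z (hKD hz)
      obtain ⟨ε, hε, hball⟩ := exists_rad hDo (hKD hz)
      have hcb := hball (ε / 2) (by linarith)
      refine ⟨ball z (ε / 4), mem_nhdsWithin_of_mem_nhds (ball_mem_nhds _ (by linarith)), C * 3,
        by positivity, fun w hw u hu h0 => ?_⟩
      obtain ⟨x1, x2⟩ := h u hu h0
      obtain ⟨y1, y2⟩ := harnack_ball (R := ε / 2) (w := w) (by linarith) (hu.mono hcb)
        (fun x hx => h0 x (hcb hx))
        (by have := ball_subset_closedBall hw.1; rwa [show ε / 2 / 2 = ε / 4 by ring])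
      constructor
      · nlinarith
      · calc u c ≤ C * u z := x2
          _ ≤ C * (3 * u w) := by gcongr
          _ = _ := by ring)
  obtain ⟨C, hC, h⟩ := this
  exact ⟨C, hC, fun z hz => h z ⟨hz, hKD hz⟩⟩

end HX

namespace HX
open Metric Filter Topology InnerProductSpace Real

/-- barriers -/
def Bar (D : Set ℂ) (p : ℂ) : Prop :=
  ∀ ε > 0, ∀ η > 0, ∃ b : ℂ → ℝ, ContinuousOn b (closure D) ∧ HarmonicOnNhd b D ∧
    (∀ z ∈ closure D, 0 ≤ b z) ∧ b p < η ∧ ∀ z ∈ closure D, ε ≤ dist z p → 1 ≤ b z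

/-- continuous subharmonic functions -/
structure CS (D : Set ℂ) (v : ℂ → ℝ) : Prop where
  cont : ContinuousOn v (closure D)
  sub : SubM v D

theorem SubM.mono {v : ℂ → ℝ} {D D' : Set ℂ} (h : SubM v D) (hD : D' ⊆ D) : SubM v D' :=
  fun z hz => h z (hD hz)

theorem CS.le_harm {D : Set ℂ} (hDb : Bornology.IsBounded D) (hDo : IsOpen D) {v h : ℂ → ℝ}
    (hv : CS D v) (hc : ContinuousOn h (closure D)) (hh : HarmonicOnNhd h D)
    (hle : ∀ z ∈ frontier D, v z ≤ h z) : ∀ z ∈ closure D, v z ≤ h z := by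
  intro z hz
  have := maxA hDb hDo (v := v + (-h)) (M := 0) (hv.cont.add hc.neg)
    (SubM.add hDo (hv.cont.mono subset_closure) hh.neg.continuousOn hv.sub
      (SubM.of_harm hDo hh.neg)) (fun z hz => by simp [hle z hz]) z hz
  simp at this
  linarith

/-- Poisson modification -/
theorem modif {D : Set ℂ} (hDo : IsOpen D) {v : ℂ → ℝ}
    (hv : CS D v) (q : ℂ × ℝ) : ∃ v', CS D v' ∧ (∀ z ∈ closure D, v z ≤ v' z) ∧
    (∀ z ∈ frontier D, v' z = v z) ∧
    (0 < q.2 → closedBall q.1 q.2 ⊆ D → HarmonicOnNhd v' (ball q.1 q.2)) := by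
  obtain ⟨a, r⟩ := q
  by_cases hq : 0 < r ∧ closedBall a r ⊆ D
  swap
  · exact ⟨v, hv, fun _ _ => le_rfl, fun _ _ => rfl, fun h1 h2 => absurd ⟨h1, h2⟩ hq⟩
  obtain ⟨hr, hB⟩ := hq
  have hvcl := hv.cont.mono (hB.trans subset_closure)
  obtain ⟨P, hP⟩ := sol_ball hr (hvcl.mono sphere_subset_closedBall)
  have hPc : ContinuousOn P (closedBall a r) := by
    have := hP.cont; rwa [closure_ball a hr.ne'] at this
  have hPs : ∀ z ∈ sphere a r, P z = v z := fun z hz =>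
    hP.bd z (by rwa [frontier_ball a hr.ne'])
  have hle : ∀ z ∈ closedBall a r, v z ≤ P z := by
    have := CS.le_harm isBounded_ball isOpen_ball (v := v) (h := P) (D := ball a r)
      ⟨by rwa [closure_ball a hr.ne'], hv.sub.mono (ball_subset_closedBall.trans hB)⟩ hP.cont hP.harm
      (fun z hz => (hP.bd z hz).ge)
    rwa [closure_ball a hr.ne'] at this
  classical
  set v' : ℂ → ℝ := fun z => if z ∈ closedBall a r then P z else v z
  have hvv : ∀ z, v z ≤ v' z := by
    intro z
    by_cases hz : z ∈ closedBall a r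
    · simp only [v', hz, if_true]; exact hle z hz
    · simp only [v', hz, if_false]; exact le_rfl
  have hout : ∀ z ∉ ball a r, v' z = v z := by
    intro z hz
    by_cases hz' : z ∈ closedBall a r
    · have hs : z ∈ sphere a r := by
        rw [mem_sphere]; rw [mem_closedBall] at hz'; rw [mem_ball, not_lt] at hz
        exact le_antisymm hz' hz
      simp only [v', hz', if_true]; exact hPs z hs
    · simp only [v', hz', if_false]
  have hcont : ContinuousOn v' (closure D) := by
    have h1 : ContinuousOn v' (closedBall a r) := hPc.congr (fun z hz => by simp only [v', hz, if_true])
    have h2 : ContinuousOn v' (closure D \ ball a r) :=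
      (hv.cont.mono diff_subset).congr (fun z hz => hout z hz.2)
    have h3 := h1.union_of_isClosed h2 isClosed_closedBall (isClosed_closure.sdiff isOpen_ball)
    refine h3.mono fun z hz => ?_
    by_cases hzb : z ∈ ball a r
    · exact Or.inl (ball_subset_closedBall hzb)
    · exact Or.inr ⟨hz, hzb⟩
  have hharm : HarmonicOnNhd v' (ball a r) := by
    intro z hz
    refine (harmonicAt_congr_nhds ?_).1 (hP.harm z hz)
    filter_upwards [isOpen_ball.mem_nhds hz] with w hw
    simp only [v', ball_subset_closedBall hw, if_true]
  refine ⟨v', ⟨hcont, fun z hz => ?_⟩, fun z _ => hvv z, fun z hz => hout z (fun hzb => ?_),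
    fun _ _ => hharm⟩
  · by_cases hzb : z ∈ ball a r
    · exact SubM.of_harm isOpen_ball hharm z hzb
    · obtain ⟨ε, hε, h⟩ := exists_rad hDo hz
      obtain ⟨ε1, hε1, h1⟩ := hv.sub z hz
      refine ⟨min ε ε1, by positivity, fun s hs0 hs => ?_⟩
      rw [lt_min_iff] at hs
      rw [hout z hzb]
      refine (h1 s hs0 hs.2).trans ?_
      have hcb := (h s hs.1).trans subset_closure
      exact circleAverage_mono (circleInt hv.cont hs0.le hcb) (circleInt hcont hs0.le hcb)
        (fun x _ => hvv x)
  · rw [hDo.frontier_eq] at hz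
    exact hz.2 (hB (ball_subset_closedBall hzb))

theorem perron {D : Set ℂ} (hDb : Bornology.IsBounded D) (hDo : IsOpen D)
    (hbar : ∀ p ∈ frontier D, Bar D p) {ψ : ℂ → ℝ} (hψ : CS D ψ) : ∃ u, Sol D ψ u := by
  have hcomp : IsCompact (closure D) := hDb.isCompact_closure
  obtain ⟨A, hA⟩ := hcomp.exists_bound_of_continuousOn hψ.cont
  have hA0 : 0 ≤ |A| := abs_nonneg A
  have hψA : ∀ z ∈ closure D, |ψ z| ≤ |A| := fun z hz => (hA z hz).trans (le_abs_self A)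
  let Step (n : ℕ) (v : {v // CS D v}) : {v // CS D v} :=
    ⟨Classical.choose (modif hDo v.2 (TopologicalSpace.denseSeq (ℂ × ℝ) n.unpair.1)),
      (Classical.choose_spec (modif hDo v.2 (TopologicalSpace.denseSeq (ℂ × ℝ) n.unpair.1))).1⟩
  have hStep : ∀ n v, (∀ z ∈ closure D, v.1 z ≤ (Step n v).1 z) ∧
    (∀ z ∈ frontier D, (Step n v).1 z = v.1 z) ∧
    (0 < (TopologicalSpace.denseSeq (ℂ × ℝ) n.unpair.1).2 →
      closedBall (TopologicalSpace.denseSeq (ℂ × ℝ) n.unpair.1).1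
        (TopologicalSpace.denseSeq (ℂ × ℝ) n.unpair.1).2 ⊆ D →
      HarmonicOnNhd (Step n v).1 (ball (TopologicalSpace.denseSeq (ℂ × ℝ) n.unpair.1).1
        (TopologicalSpace.denseSeq (ℂ × ℝ) n.unpair.1).2)) := fun n v =>
    (Classical.choose_spec (modif hDo v.2 (TopologicalSpace.denseSeq (ℂ × ℝ) n.unpair.1))).2
  let V : ℕ → {v // CS D v} := fun n => Nat.rec ⟨ψ, hψ⟩ (fun n v => Step n v) n
  have hVs : ∀ n, V (n + 1) = Step n (V n) := fun n => rfl
  set v : ℕ → ℂ → ℝ := fun n => (V n).1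
  have hmono : ∀ z ∈ closure D, Monotone fun n => v n z := fun z hz =>
    monotone_nat_of_le_succ fun n => by
      simp only [v, hVs]; exact (hStep n (V n)).1 z hz
  have hbd : ∀ n, ∀ z ∈ frontier D, v n z = ψ z := by
    intro n z hz
    induction n with
    | zero => rfl
    | succ n ih => rw [← ih]; exact (hStep n (V n)).2.1 z hz
  have hvψ : ∀ n, ∀ z ∈ closure D, ψ z ≤ v n z := fun n z hz => hmono z hz (Nat.zero_le n)
  have hvA : ∀ n, ∀ z ∈ closure D, v n z ≤ |A| := fun n =>
    CS.le_harm hDb hDo (V n).2 continuousOn_const (harmonicOnNhd_const _) (fun z hz => by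
      show v n z ≤ |A|
      rw [hbd n z hz]
      exact (le_abs_self _).trans (hψA z (frontier_subset_closure hz)))
  have hvab : ∀ n, ∀ z ∈ closure D, |v n z| ≤ |A| := fun n z hz => abs_le.2
    ⟨by linarith [hvψ n z hz, (abs_le.1 (hψA z hz)).1], hvA n z hz⟩
  have hlim : ∀ z ∈ closure D, ∃ l, Tendsto (fun n => v n z) atTop (𝓝 l) := fun z hz =>
    ⟨_, tendsto_atTop_ciSup (hmono z hz) ⟨|A|, by rintro _ ⟨n, rfl⟩; exact hvA n z hz⟩⟩
  choose! u hu using hlim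
  have hharm : HarmonicOnNhd u D := by
    intro z hz
    obtain ⟨ρ, hρ, hball⟩ := Metric.isOpen_iff.1 hDo z hz
    let O : Set (ℂ × ℝ) := {q | dist z q.1 < q.2 ∧ q.2 < ρ / 2}
    have hO : IsOpen O :=
      (isOpen_lt (continuous_const.dist continuous_fst) continuous_snd).inter
        (isOpen_lt continuous_snd continuous_const)
    obtain ⟨k, hk⟩ := (TopologicalSpace.denseRange_denseSeq (ℂ × ℝ)).exists_mem_open hO
      ⟨(z, ρ / 4), by simp only [O, mem_setOf_eq, dist_self]; constructor <;> linarith⟩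
    set q := TopologicalSpace.denseSeq (ℂ × ℝ) k with hq
    obtain ⟨hk1, hk2⟩ := hk
    have hq0 : 0 < q.2 := dist_nonneg.trans_lt hk1
    have hqD : closedBall q.1 q.2 ⊆ D := by
      refine Subset.trans (fun w hw => ?_) hball
      rw [mem_closedBall] at hw
      rw [mem_ball]
      have := dist_triangle w q.1 z
      rw [dist_comm q.1 z] at this
      linarith
    refine harm_lim (c := q.1) (R := q.2) (v := fun j => v (Nat.pair k j + 1)) (B := |A|)
      (fun j => (V (Nat.pair k j + 1)).2.cont.mono (hqD.trans subset_closure)) (fun j => ?_)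
      (fun j z hz => hvab (Nat.pair k j + 1) z (subset_closure (hqD hz))) (fun z hz => ?_) z hk1
    · have := (hStep (Nat.pair k j) (V (Nat.pair k j))).2.2
      simp only [Nat.unpair_pair] at this
      exact this hq0 hqD
    · refine (hu z (subset_closure (hqD hz))).comp (f := fun j => Nat.pair k j + 1) ?_
      refine tendsto_atTop_mono (fun j => ?_) tendsto_id
      exact (Nat.right_le_pair k j).trans (Nat.le_succ _)
  have huψ : ∀ z ∈ closure D, ψ z ≤ u z := fun z hz =>
    ge_of_tendsto' (hu z hz) (fun n => hvψ n z hz)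
  have hubd : ∀ z ∈ frontier D, u z = ψ z := fun z hz =>
    tendsto_nhds_unique (hu z (frontier_subset_closure hz))
      (tendsto_const_nhds.congr (fun n => (hbd n z hz).symm))
  refine ⟨u, fun p hp => ?_, hharm, hubd⟩
  by_cases hpD : p ∈ D
  · exact (hharm.continuousOn.continuousAt (hDo.mem_nhds hpD)).continuousWithinAt
  have hpf : p ∈ frontier D := by rw [hDo.frontier_eq]; exact ⟨hp, hpD⟩
  rw [Metric.continuousWithinAt_iff]
  intro ε hε
  set η := ε / (2 * |A| + 3) with hη
  have hη0 : 0 < η := by positivity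
  have hηε : η * (2 * |A| + 3) = ε := by rw [hη]; field_simp
  obtain ⟨δ, hδ, hd⟩ := Metric.continuousWithinAt_iff.1 (hψ.cont p hp) η hη0
  obtain ⟨b, hbc, hbh, hb0, hbp, hb1⟩ := hbar p hpf δ hδ η hη0
  have key : ∀ n, ∀ z ∈ closure D, v n z ≤ ψ p + η + 2 * |A| * b z := fun n =>
    CS.le_harm hDb hDo (V n).2 (h := fun z => ψ p + η + 2 * |A| * b z)
      (continuousOn_const.add (continuousOn_const.mul hbc))
      ((harmonicOnNhd_const _).add (hbh.const_smul (c := 2 * |A|))) (fun z hz => by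
        show v n z ≤ _
        rw [hbd n z hz]
        have hzc := frontier_subset_closure hz
        by_cases hzd : dist z p < δ
        · have := hd hzc hzd
          rw [Real.dist_eq, abs_lt] at this
          have := mul_nonneg (mul_nonneg zero_le_two hA0) (hb0 z hzc)
          linarith
        · have h1 := hb1 z hzc (not_lt.1 hzd)
          have h2 := abs_le.1 (hψA z hzc)
          have h3 := abs_le.1 (hψA p hp)
          have : 2 * |A| * 1 ≤ 2 * |A| * b z := mul_le_mul_of_nonneg_left h1 (by positivity)
          linarith)
  have key' : ∀ z ∈ closure D, u z ≤ ψ p + η + 2 * |A| * b z := fun z hz =>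
    le_of_tendsto' (hu z hz) (fun n => key n z hz)
  obtain ⟨δ', hδ', hd'⟩ := Metric.continuousWithinAt_iff.1 (hbc p hp) (η - b p) (by linarith)
  refine ⟨min δ δ', by positivity, fun z hz hzd => ?_⟩
  rw [lt_min_iff] at hzd
  have h1 := hd hz hzd.1
  have h2 := hd' hz hzd.2
  have h3 := key' z hz
  have h4 := huψ z hz
  rw [hubd p hpf]
  rw [Real.dist_eq, abs_lt] at h1 h2 ⊢
  have h5 : 2 * |A| * b z ≤ 2 * |A| * η := mul_le_mul_of_nonneg_left (by linarith) (by positivity)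
  constructor
  · nlinarith
  · nlinarith

/-- exponential test function on the boundary -/
noncomputable def eA (D : Set ℂ) (a : ℂ) : C(frontier D, ℝ) :=
  ⟨fun x => ‖Complex.exp (a * x)‖, by fun_prop⟩

theorem dirichlet {D : Set ℂ} (hDb : Bornology.IsBounded D) (hDo : IsOpen D)
    (hbar : ∀ p ∈ frontier D, Bar D p) {φ : ℂ → ℝ} (hφ : ContinuousOn φ (frontier D)) :
    ∃ u, Sol D φ u := by
  have hcomp : IsCompact (frontier D) :=
    hDb.isCompact_closure.of_isClosed_subset isClosed_frontier frontier_subset_closure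
  have : CompactSpace (frontier D) := isCompact_iff_compactSpace.1 hcomp
  let S : Subalgebra ℝ C(frontier D, ℝ) := Algebra.adjoin ℝ (range (eA D))
  have hcl : ∀ f ∈ Submonoid.closure (range (eA D)), ∃ a, f = eA D a := by
    intro f hf
    induction hf using Submonoid.closure_induction with
    | mem x hx => obtain ⟨a, rfl⟩ := hx; exact ⟨a, rfl⟩
    | one => exact ⟨0, by ext x; simp [eA]⟩
    | mul x y _ _ hx hy =>
      obtain ⟨a, rfl⟩ := hx
      obtain ⟨b, rfl⟩ := hy
      exact ⟨a + b, by ext x; simp [eA, add_mul, Complex.exp_add]⟩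
  have hS : ∀ f ∈ S, ∃ ψ u, Sol D ψ u ∧ ∀ x : frontier D, ψ x = f x := by
    intro f hf
    have hf' : f ∈ Submodule.span ℝ (Submonoid.closure (range (eA D)) : Set C(frontier D, ℝ)) := by
      rw [← Algebra.adjoin_eq_span]; exact hf
    clear hf
    induction hf' using Submodule.span_induction with
    | mem x hx =>
      obtain ⟨a, rfl⟩ := hcl x hx
      have hd : Differentiable ℂ fun z : ℂ => Complex.exp (a * z) := by fun_prop
      obtain ⟨u, hu⟩ := perron hDb hDo hbar (ψ := fun z => ‖Complex.exp (a * z)‖)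
        ⟨by fun_prop, SubM.norm hDo hd.differentiableOn⟩
      exact ⟨_, u, hu, fun x => rfl⟩
    | zero => exact ⟨_, _, Sol.const 0, fun x => rfl⟩
    | add x y _ _ hx hy =>
      obtain ⟨ψ, u, h, h'⟩ := hx
      obtain ⟨ψ2, u2, h2, h2'⟩ := hy
      exact ⟨_, _, h.add h2, fun x => by simp [h' x, h2' x]⟩
    | smul a x _ hx =>
      obtain ⟨ψ, u, h, h'⟩ := hx
      exact ⟨_, _, h.smul a, fun x => by simp [h' x]⟩
  have hsep : S.SeparatesPoints := by
    intro x y hxy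
    by_contra! hall
    have h1 : ∀ a : ℂ, (a * x).re = (a * y).re := by
      intro a
      have := hall _ ⟨eA D a, Algebra.subset_adjoin ⟨a, rfl⟩, rfl⟩
      simpa [eA, Complex.norm_exp] using this
    apply hxy
    apply Subtype.ext
    have h2 := h1 1
    have h3 := h1 I
    apply Complex.ext
    · simpa using h2
    · simpa using h3
  refine sol_of_approx hDb hDo (fun ε hε => ?_)
  let f : C(frontier D, ℝ) := ⟨fun x => φ x, hφ.restrict⟩
  obtain ⟨g, hg⟩ := ContinuousMap.exists_mem_subalgebra_near_continuousMap_of_separatesPoints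
    S hsep f ε hε
  obtain ⟨ψ, u, hu, hψ⟩ := hS g.1 g.2
  refine ⟨ψ, u, hu, fun z hz => ?_⟩
  have h1 := (ContinuousMap.norm_coe_le_norm (g.1 - f) ⟨z, hz⟩).trans hg.le
  have h2 := hψ ⟨z, hz⟩
  simp only at h2
  rw [h2, abs_sub_comm]
  exact h1

end HX

namespace HX
open Metric Filter Topology InnerProductSpace Real MeasureTheory

/-- negative part of the logarithm, truncated -/
noncomputable def fN (N t : ℝ) : ℝ := max (-N - Real.log t) 0

theorem fN_nonneg (N t : ℝ) : 0 ≤ fN N t := le_max_right _ _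

theorem fN_meas (N : ℝ) : Measurable (fN N) := by
  unfold fN; fun_prop

theorem fN_mono {N : ℝ} (hN : 0 ≤ N) (t : ℝ) : fN N t ≤ fN 0 t := by
  unfold fN
  exact max_le_max (by linarith) le_rfl

theorem fN_int0 : Integrable (fN 0) := by
  have h : fN 0 = (Icc (-1:ℝ) 1).indicator (fun t => - Real.log t) := by
    ext t
    by_cases ht : t ∈ Icc (-1:ℝ) 1
    · rw [indicator_of_mem ht]
      have : Real.log t ≤ 0 := by
        rw [← Real.log_abs]
        exact Real.log_nonpos (abs_nonneg t) (abs_le.2 ht)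
      simp [fN, this]
    · rw [indicator_of_notMem ht]
      have : 0 ≤ Real.log t := by
        rw [← Real.log_abs]
        refine Real.log_nonneg ?_
        by_contra hh
        exact ht (abs_le.1 (not_le.1 hh).le)
      simp [fN, this]
  rw [h, integrable_indicator_iff measurableSet_Icc, integrableOn_Icc_iff_integrableOn_Ioc,
    ← intervalIntegrable_iff_integrableOn_Ioc_of_le (by norm_num)]
  exact intervalIntegral.intervalIntegrable_log'.neg

theorem fN_int {N : ℝ} (hN : 0 ≤ N) : Integrable (fN N) :=
  fN_int0.mono' (fN_meas N).aestronglyMeasurable (ae_of_all _ fun t => by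
    rw [Real.norm_of_nonneg (fN_nonneg N t)]; exact fN_mono hN t)

theorem fN_tendsto : Tendsto (fun n : ℕ => ∫ t, fN n t) atTop (𝓝 0) := by
  have := tendsto_integral_of_dominated_convergence (F := fun (n : ℕ) t => fN n t)
    (f := fun _ => (0:ℝ)) (μ := volume) (fN 0) (fun n => (fN_meas n).aestronglyMeasurable) fN_int0
    (fun n => ae_of_all _ fun t => by
      rw [Real.norm_of_nonneg (fN_nonneg _ t)]; exact fN_mono (Nat.cast_nonneg n) t)
    (ae_of_all _ fun t => by
      refine tendsto_const_nhds.congr' ?_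
      filter_upwards [eventually_ge_atTop ⌈-Real.log t⌉₊] with n hn
      have := Nat.le_of_ceil_le hn
      simp only [fN]
      rw [max_eq_right (by linarith)])
  simpa using this

/-- accessibility data: a point of `V` at each small distance from `c` -/
structure Acc (V : Set ℂ) (c : ℂ) (d : ℝ) (x : ℝ → ℂ) : Prop where
  pos : 0 < d
  meas : Measurable x
  mem : ∀ r, 0 < r → r < d → x r ∈ V
  dst : ∀ r, 0 < r → r < d → ‖x r - c‖ = r

theorem acc_exists {V : Set ℂ} (hVo : IsOpen V) (hVc : IsPreconnected V) {c : ℂ}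
    (hc : c ∈ closure V) (hcV : c ∉ V) : ∃ d x, Acc V c d x := by
  classical
  obtain ⟨v0, hv0⟩ : V.Nonempty := closure_nonempty_iff.1 ⟨c, hc⟩
  have hne : v0 ≠ c := fun h => hcV (h ▸ hv0)
  have hd : 0 < dist v0 c := dist_pos.2 hne
  have hpt : ∀ r, 0 < r → r < dist v0 c → ∃ y ∈ V, dist y c = r := by
    intro r h0 h1
    obtain ⟨y, hy, hyr⟩ := Metric.mem_closure_iff.1 hc r h0
    have hp : IsPreconnected ((fun y => dist y c) '' V) := hVc.image _ (by fun_prop)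
    have := hp.Icc_subset (mem_image_of_mem _ hy) (mem_image_of_mem _ hv0)
      (⟨by rw [dist_comm]; exact hyr.le, h1.le⟩ : r ∈ Icc (dist y c) (dist v0 c))
    obtain ⟨y, hy, h⟩ := this
    exact ⟨y, hy, h⟩
  let q := TopologicalSpace.denseSeq (ℂ × ℝ)
  let p : ℕ → ℝ → Prop := fun n r => (r ≤ 0 ∨ dist v0 c ≤ r) ∨
    (ball (q n).1 (q n).2 ⊆ V ∧ |r - dist (q n).1 c| < (q n).2)
  have hpm : ∀ n, MeasurableSet {r | p n r} := by
    intro n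
    refine MeasurableSet.union (measurableSet_Iic.union measurableSet_Ici) ?_
    by_cases h : ball (q n).1 (q n).2 ⊆ V
    · simp only [h, true_and]
      exact (isOpen_lt (by fun_prop) continuous_const).measurableSet
    · simp only [h, false_and]; exact MeasurableSet.empty
  have hpe : ∀ r, ∃ n, p n r := by
    intro r
    by_cases hr : r ≤ 0 ∨ dist v0 c ≤ r
    · exact ⟨0, Or.inl hr⟩
    push Not at hr
    obtain ⟨y, hy, hyr⟩ := hpt r hr.1 hr.2
    obtain ⟨ρ, hρ, hball⟩ := Metric.isOpen_iff.1 hVo y hy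
    have hO : IsOpen {q : ℂ × ℝ | dist y q.1 < q.2 ∧ q.2 < ρ / 2} :=
      (isOpen_lt (continuous_const.dist continuous_fst) continuous_snd).inter
        (isOpen_lt continuous_snd continuous_const)
    obtain ⟨k, hk1, hk2⟩ := (TopologicalSpace.denseRange_denseSeq (ℂ × ℝ)).exists_mem_open hO
      ⟨(y, ρ / 4), by simp only [mem_setOf_eq, dist_self]; constructor <;> linarith⟩
    refine ⟨k, Or.inr ⟨Subset.trans (fun w hw => ?_) hball, ?_⟩⟩
    · rw [mem_ball] at hw ⊢
      have := dist_triangle w (q k).1 y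
      rw [dist_comm (q k).1 y] at this
      linarith
    · rw [← hyr]
      exact (abs_dist_sub_le y (q k).1 c).trans_lt hk1
  let g : ℕ → ℝ → ℂ := fun n r => c + r * (((q n).1 - c) / (dist (q n).1 c : ℂ))
  refine ⟨dist v0 c, fun r => g (Nat.find (hpe r)) r, hd, ?_, ?_, ?_⟩
  · exact Measurable.find (fun n => by fun_prop) hpm hpe
  all_goals
    intro r h0 h1
    have hs := Nat.find_spec (hpe r)
    set n := Nat.find (hpe r)
    rcases hs with hs | ⟨hb, hr⟩
    · rcases hs with hs | hs <;> linarith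
    have hq2 : 0 < (q n).2 := (abs_nonneg _).trans_lt hr
    have hqc : (q n).1 ≠ c := fun h => hcV (h ▸ hb (mem_ball_self hq2))
    have hdp : 0 < dist (q n).1 c := dist_pos.2 hqc
  · apply hb
    rw [mem_ball, dist_eq_norm]
    have : g n r - (q n).1 = ((r - dist (q n).1 c : ℝ) : ℂ) * (((q n).1 - c) / (dist (q n).1 c : ℂ)) := by
      have : (dist (q n).1 c : ℂ) ≠ 0 := by exact_mod_cast hdp.ne'
      simp only [g]; push_cast; field_simp; ring
    rw [this, norm_mul, norm_div, Complex.norm_real, Complex.norm_real, ← dist_eq_norm (q n).1 c,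
      Real.norm_of_nonneg hdp.le, div_self hdp.ne', mul_one]
    exact hr
  · simp only [g]
    rw [add_sub_cancel_left, norm_mul, norm_div, Complex.norm_real, Complex.norm_real, ← dist_eq_norm,
      Real.norm_of_nonneg hdp.le, div_self hdp.ne', mul_one, Real.norm_of_nonneg h0.le]

theorem Acc.mono {V : Set ℂ} {c : ℂ} {d δ : ℝ} {x : ℝ → ℂ} (h : Acc V c d x) (h0 : 0 < δ)
    (h1 : δ ≤ d) : Acc V c δ x :=
  ⟨h0, h.meas, fun r a b => h.mem r a (b.trans_le h1), fun r a b => h.dst r a (b.trans_le h1)⟩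

/-- the averaged logarithmic potential -/
noncomputable def Up (x : ℝ → ℂ) (δ : ℝ) (z : ℂ) : ℝ :=
  δ⁻¹ * ∫ r in Ioo 0 δ, Real.log ‖z - x r‖

theorem Acc.low {V : Set ℂ} {c : ℂ} {d : ℝ} {x : ℝ → ℂ} (h : Acc V c d x) (z : ℂ) {r : ℝ}
    (h0 : 0 < r) (h1 : r < d) : |‖z - c‖ - r| ≤ ‖z - x r‖ ∧ ‖z - x r‖ ≤ ‖z - c‖ + r := by
  have := h.dst r h0 h1
  constructor
  · have h2 := abs_norm_sub_norm_le (z - c) (x r - c)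
    rwa [this, sub_sub_sub_cancel_right] at h2
  · have h2 := norm_sub_le (z - c) (x r - c)
    rwa [this, sub_sub_sub_cancel_right] at h2

theorem ae_ne_vol (s : ℝ) (T : Set ℝ) : ∀ᵐ r ∂(volume.restrict T), r ≠ s :=
  ae_restrict_of_ae (compl_mem_ae_iff.2 (measure_singleton s))

theorem Acc.nlog {V : Set ℂ} {c : ℂ} {d : ℝ} {x : ℝ → ℂ} (h : Acc V c d x) (z : ℂ) :
    ∀ᵐ r ∂(volume.restrict (Ioo 0 d)), Real.log |‖z - c‖ - r| ≤ Real.log ‖z - x r‖ := by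
  filter_upwards [ae_ne_vol ‖z - c‖ _, ae_restrict_mem measurableSet_Ioo] with r hr hm
  have hp : 0 < |‖z - c‖ - r| := abs_pos.2 (sub_ne_zero.2 hr.symm)
  exact Real.log_le_log hp (h.low z hm.1 hm.2).1

theorem fN_int_shift {N : ℝ} (hN : 0 ≤ N) (s : ℝ) : Integrable (fun r => fN N (s - r)) :=
  (fN_int hN).comp_sub_left s

theorem Acc.integrable {V : Set ℂ} {c : ℂ} {d : ℝ} {x : ℝ → ℂ} (h : Acc V c d x) (z : ℂ) :
    IntegrableOn (fun r => Real.log ‖z - x r‖) (Ioo 0 d) := by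
  have hg : IntegrableOn (fun r => fN 0 (‖z - c‖ - r) + (‖z - c‖ + d)) (Ioo 0 d) :=
    (fN_int_shift le_rfl _).integrableOn.add (integrableOn_const (by simp))
  refine hg.mono' ?_ ?_
  · have := h.meas
    exact Measurable.aestronglyMeasurable (by fun_prop)
  · filter_upwards [h.nlog z, ae_restrict_mem measurableSet_Ioo] with r hr hm
    rw [Real.norm_eq_abs, abs_le]
    have h1 := (h.low z hm.1 hm.2).2
    have h2 := fN_nonneg 0 (‖z - c‖ - r)
    have h3 : -Real.log |‖z - c‖ - r| ≤ fN 0 (‖z - c‖ - r) := by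
      rw [Real.log_abs]; unfold fN; simp
    have h4 := Real.log_le_self (norm_nonneg (z - x r))
    have h5 := norm_nonneg (z - c)
    have := hm.1
    have := hm.2
    constructor <;> linarith

theorem integral_Ioo_const (δ a : ℝ) (h : 0 ≤ δ) : ∫ _ in Ioo 0 δ, a = δ * a := by
  simp [h]

theorem Acc.le_of {V : Set ℂ} {c : ℂ} {d : ℝ} {x : ℝ → ℂ} (h : Acc V c d x) (z : ℂ) {a : ℝ}
    (ha : ∀ r, 0 < r → r < d → Real.log ‖z - x r‖ ≤ a) : Up x d z ≤ a := by
  unfold Up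
  have : ∫ r in Ioo 0 d, Real.log ‖z - x r‖ ≤ ∫ r in Ioo 0 d, a :=
    setIntegral_mono_on (h.integrable z) (integrableOn_const (by simp)) measurableSet_Ioo
      (fun r hr => ha r hr.1 hr.2)
  rw [integral_Ioo_const _ _ h.pos.le] at this
  rw [inv_mul_le_iff₀ h.pos]
  exact this

theorem Acc.ge_of {V : Set ℂ} {c : ℂ} {d : ℝ} {x : ℝ → ℂ} (h : Acc V c d x) (z : ℂ) {a : ℝ}
    (ha : ∀ r, 0 < r → r < d → a ≤ Real.log ‖z - x r‖) : a ≤ Up x d z := by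
  unfold Up
  have : ∫ r in Ioo 0 d, a ≤ ∫ r in Ioo 0 d, Real.log ‖z - x r‖ :=
    setIntegral_mono_on (integrableOn_const (by simp)) (h.integrable z) measurableSet_Ioo
      (fun r hr => ha r hr.1 hr.2)
  rw [integral_Ioo_const _ _ h.pos.le] at this
  rw [le_inv_mul_iff₀ h.pos]
  exact this

theorem Acc.up_center {V : Set ℂ} {c : ℂ} {d : ℝ} {x : ℝ → ℂ} (h : Acc V c d x) :
    Up x d c ≤ Real.log d := h.le_of c fun r h0 h1 => by
  rw [norm_sub_rev, h.dst r h0 h1]; exact Real.log_le_log h0 h1.le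

theorem Acc.up_le {V : Set ℂ} {c : ℂ} {d : ℝ} {x : ℝ → ℂ} (h : Acc V c d x) {z : ℂ} (hz : z ≠ c) :
    Up x d z ≤ Real.log (‖z - c‖ + d) := by
  have hs : 0 < ‖z - c‖ := norm_pos_iff.2 (sub_ne_zero.2 hz)
  by_cases hdd : ‖z - c‖ + d ≤ 0
  · have := h.pos; linarith
  unfold Up
  have : ∫ r in Ioo 0 d, Real.log ‖z - x r‖ ≤ ∫ r in Ioo 0 d, Real.log (‖z - c‖ + d) := by
    refine setIntegral_mono_ae_restrict (h.integrable z) (integrableOn_const (by simp)) ?_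
    filter_upwards [ae_ne_vol ‖z - c‖ _, ae_restrict_mem measurableSet_Ioo] with r hr hm
    have hp : 0 < |‖z - c‖ - r| := abs_pos.2 (sub_ne_zero.2 hr.symm)
    have hl := h.low z hm.1 hm.2
    have := hm.2
    exact Real.log_le_log (hp.trans_le hl.1) (by linarith)
  rw [integral_Ioo_const _ _ h.pos.le] at this
  rw [inv_mul_le_iff₀ h.pos]
  exact this

theorem Acc.up_ge_far {V : Set ℂ} {c : ℂ} {d : ℝ} {x : ℝ → ℂ} (h : Acc V c d x) {z : ℂ} {a : ℝ}
    (ha : 0 < a) (hz : a + d ≤ ‖z - c‖) : Real.log a ≤ Up x d z := by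
  refine h.ge_of z fun r h0 h1 => Real.log_le_log ha ?_
  have := (h.low z h0 h1).1
  have := (abs_le.1 this).2
  linarith

/-- the constant -/
noncomputable def C0 : ℝ := ∫ t, fN 0 t

theorem C0_nonneg : 0 ≤ C0 := integral_nonneg (fN_nonneg 0)

theorem Acc.up_ge {V : Set ℂ} {c : ℂ} {d : ℝ} {x : ℝ → ℂ} (h : Acc V c d x) (z : ℂ) :
    Real.log d - C0 ≤ Up x d z := by
  have hd := h.pos
  unfold Up
  rw [le_inv_mul_iff₀ h.pos]
  have hi : Integrable (fun r => fN 0 ((‖z - c‖ - r) / d)) :=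
    (fN_int0.comp_div hd.ne').comp_sub_left _
  have hI : ∫ r, fN 0 ((‖z - c‖ - r) / d) = d * C0 := by
    rw [integral_sub_left_eq_self (fun r => fN 0 (r / d)) volume ‖z - c‖,
      Measure.integral_comp_div (fN 0) d, abs_of_pos hd]; rfl
  have h1 : ∫ r in Ioo 0 d, fN 0 ((‖z - c‖ - r) / d) ≤ d * C0 := by
    rw [← hI]; exact setIntegral_le_integral hi (ae_of_all _ fun r => fN_nonneg _ _)
  have h2 : ∫ r in Ioo 0 d, (Real.log d - fN 0 ((‖z - c‖ - r) / d)) ≤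
      ∫ r in Ioo 0 d, Real.log ‖z - x r‖ := by
    refine setIntegral_mono_ae_restrict ((integrableOn_const (by simp)).sub hi.integrableOn)
      (h.integrable z) ?_
    filter_upwards [ae_ne_vol ‖z - c‖ _, h.nlog z] with r hr hm
    refine le_trans ?_ hm
    rw [Real.log_abs]
    have : Real.log ((‖z - c‖ - r) / d) = Real.log (‖z - c‖ - r) - Real.log d :=
      Real.log_div (sub_ne_zero.2 hr.symm) hd.ne'
    have h3 : -Real.log ((‖z - c‖ - r) / d) ≤ fN 0 ((‖z - c‖ - r) / d) := by unfold fN; simp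
    linarith
  rw [integral_sub (integrable_const _) hi.integrableOn,
    integral_Ioo_const _ _ h.pos.le] at h2
  linarith

theorem Acc.up_ge_log {V : Set ℂ} {c : ℂ} {d : ℝ} {x : ℝ → ℂ} (h : Acc V c d x) {z : ℂ}
    (hz : z ≠ c) : Real.log ‖z - c‖ - (Real.log 2 + C0) ≤ Up x d z := by
  have hs : 0 < ‖z - c‖ := norm_pos_iff.2 (sub_ne_zero.2 hz)
  have hC := C0_nonneg
  rcases le_or_gt (2 * d) ‖z - c‖ with h2 | h2
  · have := h.up_ge_far (a := ‖z - c‖ / 2) (z := z) (by positivity) (by linarith)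
    rw [Real.log_div hs.ne' (by norm_num)] at this
    linarith
  · have h1 := h.up_ge z
    have h3 := Real.log_le_log hs h2.le
    rw [Real.log_mul (by norm_num) h.pos.ne'] at h3
    linarith

theorem Acc.up_cont {V : Set ℂ} {c : ℂ} {d : ℝ} {x : ℝ → ℂ} (h : Acc V c d x) :
    Continuous (Up x d) := by
  have hd := h.pos
  have hx := h.meas
  let W : ℕ → ℂ → ℝ := fun n z => d⁻¹ * ∫ r in Ioo 0 d, Real.log (max ‖z - x r‖ (Real.exp (-n)))
  have hWi : ∀ (n : ℕ) z, IntegrableOn (fun r => Real.log (max ‖z - x r‖ (Real.exp (-n)))) (Ioo 0 d) := by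
    intro n z
    refine Integrable.mono' (g := fun r => ‖z - c‖ + d + n + 1) (integrableOn_const (by simp)) 
      (Measurable.aestronglyMeasurable (by fun_prop)) ?_
    filter_upwards [ae_restrict_mem measurableSet_Ioo] with r hm
    have hl := (h.low z hm.1 hm.2).2
    have hm2 := hm.2
    have hn : (0:ℝ) ≤ n := Nat.cast_nonneg n
    have he : Real.exp (-(n:ℝ)) ≤ 1 := Real.exp_le_one_iff.2 (by linarith)
    have hs := norm_nonneg (z - c)
    rw [Real.norm_eq_abs, abs_le]
    constructor
    · have : Real.log (Real.exp (-n)) ≤ Real.log (max ‖z - x r‖ (Real.exp (-n))) :=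
        Real.log_le_log (Real.exp_pos _) (le_max_right _ _)
      rw [Real.log_exp] at this
      linarith
    · refine (Real.log_le_self (le_max_of_le_left (norm_nonneg _))).trans ?_
      exact max_le (by linarith) (by linarith)
  have hWc : ∀ n, Continuous (W n) := by
    intro n
    refine continuous_const.mul ?_
    rw [continuous_iff_continuousAt]
    intro z0
    have hn : (0:ℝ) ≤ n := Nat.cast_nonneg n
    refine continuousAt_of_dominated (bound := fun r => ‖z0 - c‖ + 1 + d + n + 1)
      (Eventually.of_forall fun z => Measurable.aestronglyMeasurable (by fun_prop)) ?_
      (integrableOn_const (by simp)) (ae_of_all _ fun r => ?_)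
    · filter_upwards [ball_mem_nhds z0 one_pos] with z hz
      filter_upwards [ae_restrict_mem measurableSet_Ioo] with r hm
      have hl := (h.low z hm.1 hm.2).2
      have hm2 := hm.2
      have he : Real.exp (-(n:ℝ)) ≤ 1 := Real.exp_le_one_iff.2 (by linarith)
      have hs := norm_nonneg (z0 - c)
      have hz' : ‖z - c‖ ≤ ‖z0 - c‖ + 1 := by
        rw [mem_ball, dist_eq_norm] at hz
        have := norm_add_le (z - z0) (z0 - c)
        rw [sub_add_sub_cancel] at this
        linarith
      rw [Real.norm_eq_abs, abs_le]
      constructor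
      · have : Real.log (Real.exp (-n)) ≤ Real.log (max ‖z - x r‖ (Real.exp (-n))) :=
          Real.log_le_log (Real.exp_pos _) (le_max_right _ _)
        rw [Real.log_exp] at this
        linarith
      · refine (Real.log_le_self (le_max_of_le_left (norm_nonneg _))).trans ?_
        exact max_le (by linarith) (by linarith)
    · have : ∀ z, max ‖z - x r‖ (Real.exp (-n)) ≠ 0 := fun z =>
        ((Real.exp_pos _).trans_le (le_max_right _ _)).ne'
      exact (Continuous.log (by fun_prop) this).continuousAt
  have hu : TendstoUniformly W (Up x d) atTop := by
    rw [Metric.tendstoUniformly_iff]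
    intro ε hε
    have := (Metric.tendsto_atTop.1 fN_tendsto) (d * ε) (by positivity)
    obtain ⟨N, hN⟩ := this
    filter_upwards [eventually_ge_atTop N] with n hn z
    have h1 := hN n hn
    rw [Real.dist_0_eq_abs, abs_lt] at h1
    have hn0 : (0:ℝ) ≤ n := Nat.cast_nonneg n
    have hdiff : ∀ᵐ r ∂(volume.restrict (Ioo 0 d)),
        ‖Real.log ‖z - x r‖ - Real.log (max ‖z - x r‖ (Real.exp (-n)))‖ ≤ fN n (‖z - c‖ - r) := by
      filter_upwards [ae_ne_vol ‖z - c‖ _, ae_restrict_mem measurableSet_Ioo, h.nlog z] with r hr hm hl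
      have hp : 0 < |‖z - c‖ - r| := abs_pos.2 (sub_ne_zero.2 hr.symm)
      have hp' := hp.trans_le (h.low z hm.1 hm.2).1
      rcases le_total (Real.exp (-n)) ‖z - x r‖ with h2 | h2
      · rw [max_eq_left h2]; simpa using fN_nonneg _ _
      · rw [max_eq_right h2, Real.log_exp]
        have h3 := Real.log_le_log hp' h2
        rw [Real.log_exp] at h3
        rw [Real.norm_eq_abs, abs_of_nonpos (by linarith)]
        refine le_trans ?_ (le_max_left _ _)
        rw [Real.log_abs] at hl
        linarith
    have h2 : |Up x d z - W n z| ≤ d⁻¹ * ∫ t, fN n t := by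
      simp only [Up, W]
      rw [← mul_sub, abs_mul, abs_of_pos (inv_pos.2 hd), ← integral_sub (h.integrable z) (hWi n z)]
      refine mul_le_mul_of_nonneg_left ?_ (inv_pos.2 hd).le
      refine (norm_integral_le_of_norm_le (fN_int_shift hn0 ‖z - c‖).integrableOn hdiff).trans ?_
      refine (setIntegral_le_integral (fN_int_shift hn0 _) (ae_of_all _ fun r => fN_nonneg _ _)).trans ?_
      rw [integral_sub_left_eq_self (fN n) volume ‖z - c‖]
    rw [Real.dist_eq]
    refine h2.trans_lt ?_
    rw [inv_mul_lt_iff₀ hd]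
    exact h1.2
  exact hu.continuous (Eventually.of_forall hWc).frequently

/-- mean value property implies harmonicity -/
theorem harm_of_mean {D : Set ℂ} (hDo : IsOpen D) {u : ℂ → ℝ} (hc : ContinuousOn u D)
    (h1 : ∀ z ∈ D, ∃ ε > 0, ∀ r, 0 < r → r < ε → circleAverage u z r = u z) :
    HarmonicOnNhd u D := by
  intro z hz
  obtain ⟨ε, hε, hb⟩ := exists_rad hDo hz
  have hcb := hb (ε / 2) (by linarith)
  have hr : 0 < ε / 2 := by linarith
  obtain ⟨P, hP⟩ := sol_ball hr (hc.mono (sphere_subset_closedBall.trans hcb))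
  have hbD : ball z (ε / 2) ⊆ D := ball_subset_closedBall.trans hcb
  have hs1 : SubM u (ball z (ε / 2)) := fun w hw => by
    obtain ⟨e, he, h⟩ := h1 w (hbD hw)
    exact ⟨e, he, fun r a b => (h r a b).ge⟩
  have hs2 : SubM (-u) (ball z (ε / 2)) := fun w hw => by
    obtain ⟨e, he, h⟩ := h1 w (hbD hw)
    refine ⟨e, he, fun r a b => le_of_eq ?_⟩
    have := circleAverage_fun_smul (a := (-1:ℝ)) (f := u) (c := w) (R := r)
    simp only [smul_eq_mul, neg_one_mul] at this
    have h2 : circleAverage (-u) w r = - circleAverage u w r := this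
    rw [h2, h r a b]; rfl
  have hcl : closure (ball z (ε / 2)) = closedBall z (ε / 2) := closure_ball z hr.ne'
  have e1 : ∀ w ∈ closure (ball z (ε / 2)), u w ≤ P w :=
    CS.le_harm isBounded_ball isOpen_ball ⟨by rw [hcl]; exact hc.mono hcb, hs1⟩ hP.cont hP.harm
      (fun w hw => (hP.bd w hw).ge)
  have e2 : ∀ w ∈ closure (ball z (ε / 2)), (-u) w ≤ (-P) w :=
    CS.le_harm isBounded_ball isOpen_ball ⟨by rw [hcl]; exact (hc.mono hcb).neg, hs2⟩ hP.cont.neg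
      hP.harm.neg (fun w hw => by simp [hP.bd w hw])
  refine (harmonicAt_congr_nhds ?_).1 (hP.harm z (mem_ball_self hr))
  filter_upwards [ball_mem_nhds z hr] with w hw
  have a1 := e1 w (subset_closure hw)
  have a2 := e2 w (subset_closure hw)
  simp at a2
  linarith

theorem harm_log {D : Set ℂ} {a : ℂ} (ha : a ∉ D) : HarmonicOnNhd (fun z => Real.log ‖z - a‖) D :=
  fun z hz => AnalyticAt.harmonicAt_log_norm (f := fun z => z - a) (by fun_prop)
    (sub_ne_zero.2 (fun h => ha (h ▸ hz)))

theorem Acc.up_harm {V : Set ℂ} {c : ℂ} {d : ℝ} {x : ℝ → ℂ} (h : Acc V c d x) {D : Set ℂ}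
    (hDo : IsOpen D) (hDV : ∀ z ∈ V, z ∉ D) : HarmonicOnNhd (Up x d) D := by
  have hx := h.meas
  refine harm_of_mean hDo h.up_cont.continuousOn (fun z hz => ?_)
  obtain ⟨ε, hε, hb⟩ := Metric.isOpen_iff.1 hDo z hz
  refine ⟨ε / 2, by linarith, fun ρ h0 h1 => ?_⟩
  have hcb : closedBall z ρ ⊆ D := (closedBall_subset_ball (by linarith)).trans hb
  have hm : ∀ r, 0 < r → r < d → circleAverage (fun w => Real.log ‖w - x r‖) z ρ =
      Real.log ‖z - x r‖ := fun r a b => harm_mean (harm_log (hDV _ (h.mem r a b))) h0.le hcb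
  have hfar : ∀ r, 0 < r → r < d → ∀ θ, ε / 2 ≤ ‖circleMap z ρ θ - x r‖ := by
    intro r a b θ
    have h2 : ε ≤ dist (x r) z := by
      by_contra hh
      exact hDV _ (h.mem r a b) (hb (mem_ball.2 (not_le.1 hh)))
    have h3 : dist (circleMap z ρ θ) z = ρ := by simp [dist_eq_norm, abs_of_pos h0]
    have h4 := dist_triangle (x r) (circleMap z ρ θ) z
    rw [dist_comm (x r) (circleMap z ρ θ), dist_eq_norm (circleMap z ρ θ) (x r)] at h4
    linarith
  have hInt : Integrable (Function.uncurry fun (θ r : ℝ) => Real.log ‖circleMap z ρ θ - x r‖)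
      ((volume.restrict (Ioc 0 (2 * π))).prod (volume.restrict (Ioo 0 d))) := by
    refine Integrable.mono' (g := fun _ => |Real.log (ε / 2)| + (‖z - c‖ + ρ + d)) (integrable_const _)
      (Measurable.aestronglyMeasurable ?_) ?_
    · have := (continuous_circleMap z ρ).measurable
      unfold Function.uncurry
      fun_prop
    · have : ∀ᵐ p : ℝ × ℝ ∂((volume.restrict (Ioc 0 (2 * π))).prod (volume.restrict (Ioo 0 d))),
          p.2 ∈ Ioo 0 d :=
        (Measure.quasiMeasurePreserving_snd).ae (ae_restrict_mem measurableSet_Ioo)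
      filter_upwards [this] with p hp
      have e1 := hfar p.2 hp.1 hp.2 p.1
      have e2 := (h.low (circleMap z ρ p.1) hp.1 hp.2).2
      have e3 : ‖circleMap z ρ p.1 - c‖ ≤ ‖z - c‖ + ρ := by
        have h3 : ‖circleMap z ρ p.1 - z‖ = ρ := by simp [abs_of_pos h0]
        have := norm_add_le (circleMap z ρ p.1 - z) (z - c)
        rw [sub_add_sub_cancel] at this
        linarith
      simp only [Function.uncurry]
      rw [Real.norm_eq_abs, abs_le]
      have e4 := Real.log_le_self (norm_nonneg (circleMap z ρ p.1 - x p.2))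
      have e5 := Real.log_le_log (by linarith) e1
      have e6 := neg_abs_le (Real.log (ε / 2))
      have e7 := norm_nonneg (z - c)
      have e8 := hp.2
      have e9 := h.pos
      have e10 := abs_nonneg (Real.log (ε / 2))
      constructor <;> linarith
  have hsw := integral_integral_swap hInt
  have h2π : (0:ℝ) ≤ 2 * π := by positivity
  rw [circleAverage, intervalIntegral.integral_of_le h2π]
  simp only [Up, smul_eq_mul]
  rw [integral_const_mul, hsw, ← mul_assoc, mul_comm (2 * π)⁻¹, mul_assoc, ← integral_const_mul]
  congr 1
  refine setIntegral_congr_fun measurableSet_Ioo (fun r hr => ?_)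
  have := hm r hr.1 hr.2
  rw [circleAverage, intervalIntegral.integral_of_le h2π] at this
  simpa using this

theorem Acc.bar {V : Set ℂ} {c : ℂ} {d : ℝ} {x : ℝ → ℂ} (h : Acc V c d x) {D : Set ℂ}
    (hDo : IsOpen D) (hDV : ∀ z ∈ V, z ∉ D) : Bar D c := by
  intro ε hε η hη
  have hC := C0_nonneg
  have hlim : Tendsto (fun δ : ℝ => C0 / (Real.log (ε / 2) - Real.log δ + C0)) (𝓝[>] 0) (𝓝 0) := by
    refine Tendsto.div_atTop tendsto_const_nhds ?_
    refine tendsto_atTop_add_const_right _ _ ?_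
    simp only [sub_eq_add_neg]
    refine tendsto_atTop_add_const_left _ _ ?_
    exact tendsto_neg_atBot_atTop.comp Real.tendsto_log_nhdsGT_zero
  have e1 := hlim.eventually_lt_const hη
  have e2 : ∀ᶠ δ in 𝓝[>] (0:ℝ), δ ∈ Ioo 0 (min d (ε / 2)) :=
    Ioo_mem_nhdsGT (lt_min h.pos (by linarith))
  obtain ⟨δ, h1, h2⟩ := (e1.and e2).exists
  have hδ1 : δ < d := h2.2.trans_le (min_le_left _ _)
  have hδ2 : δ < ε / 2 := h2.2.trans_le (min_le_right _ _)
  have h' := h.mono h2.1 hδ1.le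
  have hden : 0 < Real.log (ε / 2) - Real.log δ + C0 := by
    have := Real.log_lt_log h2.1 hδ2
    linarith
  set A := Real.log (ε / 2) - Real.log δ + C0
  refine ⟨fun z => A⁻¹ * (Up x δ z + (C0 - Real.log δ)), ?_, ?_, ?_, ?_, ?_⟩
  · exact (continuous_const.mul (h'.up_cont.add continuous_const)).continuousOn
  · exact ((h'.up_harm hDo hDV).add (harmonicOnNhd_const _)).const_smul (c := A⁻¹)
  · intro z _
    have := h'.up_ge z
    exact mul_nonneg (inv_pos.2 hden).le (by linarith)
  · refine lt_of_le_of_lt ?_ h1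
    have := h'.up_center
    rw [div_eq_inv_mul]
    exact mul_le_mul_of_nonneg_left (by linarith) (inv_pos.2 hden).le
  · intro z _ hz
    rw [dist_eq_norm] at hz
    have := h'.up_ge_far (a := ε / 2) (z := z) (by linarith) (by linarith)
    rw [le_inv_mul_iff₀ hden]
    simp only [A]
    linarith

end HX

namespace HX
open Metric Filter Topology InnerProductSpace Real

/-- homotopy lifting for the exponential -/
theorem HL {A : Type} [TopologicalSpace A] (h : unitInterval × A → ℂ) (hc : Continuous h)
    (hn : ∀ p, h p ≠ 0) (h0 : ∀ a, h (0, a) = 1) :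
    ∃ l : A → ℂ, Continuous l ∧ ∀ a, Complex.exp (l a) = h (1, a) := by
  let H : C(unitInterval × A, {z : ℂ // z ≠ 0}) := ⟨fun p => ⟨h p, hn p⟩, by fun_prop⟩
  let f : C(A, ℂ) := ⟨fun _ => 0, continuous_const⟩
  have H0 : ∀ a, H (0, a) = (fun z : ℂ ↦ (⟨_, z.exp_ne_zero⟩ : {z : ℂ // z ≠ 0})) (f a) := by
    intro a; apply Subtype.ext; simp [H, f, h0]
  let G := Complex.isCoveringMap_exp.liftHomotopy H f H0
  refine ⟨fun a => G (1, a), by fun_prop, fun a => ?_⟩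
  have := congr_fun (Complex.isCoveringMap_exp.liftHomotopy_lifts H f H0) (1, a)
  exact congr_arg Subtype.val this

theorem log_star {E : Type} [NormedAddCommGroup E] [NormedSpace ℝ E] {f : E → ℂ}
    (hc : Continuous f) (hn : ∀ x, f x ≠ 0) :
    ∃ l : E → ℂ, Continuous l ∧ ∀ x, Complex.exp (l x) = f x := by
  obtain ⟨l, hl, he⟩ := HL (A := E) (fun p => f ((p.1 : ℝ) • p.2) / f 0)
    (by fun_prop) (fun p => div_ne_zero (hn _) (hn _)) (fun a => by simp [hn 0])
  refine ⟨fun x => l x + Complex.log (f 0), by fun_prop, fun x => ?_⟩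
  rw [Complex.exp_add, he, Complex.exp_log (hn 0)]
  simp [hn 0]

/-- path logarithm -/
theorem log_path {R : ℝ → ℂ} (hR : ContinuousOn R (Icc 0 1)) :
    ∃ l : ℂ → ℂ, ContinuousOn l (R '' Icc 0 1)ᶜ ∧
      ∀ x ∈ (R '' Icc 0 1)ᶜ, Complex.exp (l x) = (x - R 1) / (x - R 0) := by
  have hne : ∀ (a : ((R '' Icc 0 1)ᶜ : Set ℂ)) (t : unitInterval), (a : ℂ) - R t ≠ 0 := fun a t h =>
    a.2 ⟨t, t.2, (sub_eq_zero.1 h).symm⟩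
  have hRc : Continuous fun t : unitInterval => R t := hR.restrict
  obtain ⟨l, hl, he⟩ := HL (A := ((R '' Icc 0 1)ᶜ : Set ℂ))
    (fun p => ((p.2 : ℂ) - R p.1) / (p.2 - R 0)) (by
      refine Continuous.div ?_ ?_ (fun p => hne p.2 0)
      · exact (continuous_subtype_val.comp continuous_snd).sub (hRc.comp continuous_fst)
      · fun_prop)
    (fun p => div_ne_zero (hne p.2 p.1) (hne p.2 0)) (fun a => div_self (hne a 0))
  classical
  refine ⟨fun x => if h : x ∈ (R '' Icc 0 1)ᶜ then l ⟨x, h⟩ else 0, ?_, fun x hx => ?_⟩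
  · rw [continuousOn_iff_continuous_restrict]
    refine hl.congr fun x => ?_
    show l x = (if h : (x : ℂ) ∈ (R '' Icc 0 1)ᶜ then l ⟨x, h⟩ else 0)
    rw [dif_pos x.2]
  · have := he ⟨x, hx⟩
    rw [show (fun x => if h : x ∈ (R '' Icc 0 1)ᶜ then l ⟨x, h⟩ else 0) x = l ⟨x, hx⟩ from dif_pos hx]
    simpa using this

theorem log_unique {X : Type} [TopologicalSpace X] {s : Set X} (hs : IsPreconnected s)
    {l1 l2 : X → ℂ} (h1 : ContinuousOn l1 s) (h2 : ContinuousOn l2 s)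
    (he : ∀ x ∈ s, Complex.exp (l1 x) = Complex.exp (l2 x)) {x y : X} (hx : x ∈ s) (hy : y ∈ s) :
    l1 x - l2 x = l1 y - l2 y := by
  have hd : DiscreteTopology (AddSubgroup.zmultiples (2 * π * I : ℂ)) :=
    NormedSpace.discreteTopology_zmultiples _
  refine hs.constant_of_mapsTo (f := fun x => l1 x - l2 x)
    (T := (AddSubgroup.zmultiples (2 * π * I : ℂ) : Set ℂ)) ⟨hd⟩ (h1.sub h2) (fun w hw => ?_) hx hy
  obtain ⟨n, hn⟩ := Complex.exp_eq_exp_iff_exists_int.1 (he w hw)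
  refine AddSubgroup.mem_zmultiples_iff.2 ⟨n, ?_⟩
  simp [hn]

theorem no_log_circle {z : ℂ} {ρ : ℝ} (hρ : 0 < ρ) {l : ℂ → ℂ} (hl : ContinuousOn l (sphere z ρ))
    (he : ∀ y ∈ sphere z ρ, Complex.exp (l y) = y - z) : False := by
  have hm : ∀ θ, circleMap z ρ θ ∈ sphere z ρ := fun θ => circleMap_mem_sphere z hρ.le θ
  have h1 : Continuous fun θ : ℝ => l (circleMap z ρ θ) :=
    hl.comp_continuous (continuous_circleMap z ρ) hm
  have := log_unique (X := ℝ) isPreconnected_univ (l1 := fun θ : ℝ => l (circleMap z ρ θ))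
    (l2 := fun θ : ℝ => (Real.log ρ : ℂ) + θ * I) h1.continuousOn (by fun_prop) (fun θ _ => by
      rw [he _ (hm θ), Complex.exp_add, ← Complex.ofReal_exp, Real.exp_log hρ]
      simp [circleMap]) (mem_univ 0) (mem_univ (2 * π))
  simp only [circleMap] at this
  simp only [ofReal_zero, zero_mul, Complex.exp_zero, ofReal_mul, ofReal_ofNat, Complex.exp_two_pi_mul_I,
    add_zero] at this
  have h2 : (2 * π * I : ℂ) = 0 := by linear_combination this
  exact Complex.two_pi_I_ne_zero h2

theorem lemmaE {O : Set ℂ} (hOo : IsOpen O) (hOb : Bornology.IsBounded O) {z : ℂ} (hz : z ∈ O)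
    {f l : ℂ → ℂ} (hf : ContinuousOn f (closure O)) (hn : ∀ y ∈ closure O, f y ≠ 0)
    (hl : ContinuousOn l (frontier O))
    (he : ∀ y ∈ frontier O, f y = Complex.exp (l y) * (y - z)) : False := by
  classical
  obtain ⟨L, hL⟩ := ContinuousMap.exists_restrict_eq (isClosed_frontier (s := O))
    (⟨fun x => l x, hl.restrict⟩ : C(frontier O, ℂ))
  have hLl : ∀ y ∈ frontier O, L y = l y := fun y hy => by
    have := DFunLike.congr_fun hL ⟨y, hy⟩
    exact this
  let g : ℂ → ℂ := fun y => if y ∈ closure O then f y else Complex.exp (L y) * (y - z)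
  have hgo : ∀ y ∉ O, g y = Complex.exp (L y) * (y - z) := by
    intro y hy
    by_cases hyc : y ∈ closure O
    · have hyf : y ∈ frontier O := by rw [hOo.frontier_eq]; exact ⟨hyc, hy⟩
      simp only [g, hyc, if_true]
      rw [he y hyf, hLl y hyf]
    · simp only [g, hyc, if_false]
  have hgc : Continuous g := by
    have h1 : ContinuousOn g (closure O) := hf.congr fun y hy => by simp only [g, hy, if_true]
    have h2 : ContinuousOn g Oᶜ :=
      (show Continuous fun y => Complex.exp (L y) * (y - z) by fun_prop).continuousOn.congr
        fun y hy => hgo y hy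
    have h3 := h1.union_of_isClosed h2 isClosed_closure hOo.isClosed_compl
    rw [← continuousOn_univ]
    refine h3.mono fun y _ => ?_
    by_cases hy : y ∈ O
    · exact Or.inl (subset_closure hy)
    · exact Or.inr hy
  have hgn : ∀ y, g y ≠ 0 := by
    intro y
    by_cases hy : y ∈ closure O
    · simp only [g, hy, if_true]; exact hn y hy
    · simp only [g, hy, if_false]
      refine mul_ne_zero (Complex.exp_ne_zero _) (sub_ne_zero.2 fun h => hy (h ▸ subset_closure hz))
  obtain ⟨μ, hμ, hμe⟩ := log_star hgc hgn
  obtain ⟨ρ, hρ⟩ := hOb.subset_ball z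
  have hρ0 : 0 < ρ := pos_of_mem_ball (hρ hz)
  refine no_log_circle (z := z) hρ0 (l := fun y => μ y - L y)
    ((hμ.sub L.continuous).continuousOn) (fun y hy => ?_)
  have hyO : y ∉ O := fun h => by
    have := hρ h
    rw [mem_ball] at this
    rw [mem_sphere] at hy
    linarith
  rw [Complex.exp_sub, hμe, hgo y hyO]
  field_simp [Complex.exp_ne_zero]

/-- same component gives a logarithm -/
theorem log_comp {U : Set ℂ} (hUo : IsOpen U) (hUc : IsConnected U) {a b : ℂ} (ha : a ∈ U) (hb : b ∈ U) :
    ∃ l : ℂ → ℂ, ContinuousOn l Uᶜ ∧ ∀ y ∈ Uᶜ, Complex.exp (l y) = (y - a) / (y - b) := by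
  have hp : IsPathConnected U := (hUo.isConnected_iff_isPathConnected).1 hUc
  obtain ⟨R, hR⟩ := hp.joinedIn b hb a ha
  obtain ⟨l, hl, he⟩ := log_path (R := R.extend) R.continuous_extend.continuousOn
  have hsub : Uᶜ ⊆ (R.extend '' Icc 0 1)ᶜ := by
    rintro y hy ⟨t, ht, rfl⟩
    rw [Path.extend_apply R ht] at hy
    exact hy (hR ⟨t, ht⟩)
  exact ⟨l, hl.mono hsub, fun y hy => by rw [he y (hsub hy)]; simp⟩

end HX

namespace HX
open Metric Filter Topology InnerProductSpace Real

theorem scc_inj {γ : ℝ → ℂ} (h : IsSimpleClosedCurve γ) {s t : ℝ} (e : γ s = γ t) :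
    ∃ n : ℤ, s = t + n := by
  have hp : Function.Periodic γ 1 := h.2.1
  have hf : ∀ x, γ (Int.fract x) = γ x := fun x => by
    have := hp.sub_int_mul_eq ⌊x⌋ (x := x)
    rwa [mul_one] at this
  have := h.2.2 (x₁ := Int.fract s) ⟨Int.fract_nonneg s, Int.fract_lt_one s⟩
    (x₂ := Int.fract t) ⟨Int.fract_nonneg t, Int.fract_lt_one t⟩ (by rw [hf, hf, e])
  refine ⟨⌊s⌋ - ⌊t⌋, ?_⟩
  have h1 := Int.fract_add_floor s
  have h2 := Int.fract_add_floor t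
  push_cast; linarith

theorem scc_compact {γ : ℝ → ℂ} (h : IsSimpleClosedCurve γ) : IsCompact (range γ) := by
  have hp : Function.Periodic γ 1 := h.2.1
  rw [← hp.image_Icc (by norm_num) 0]
  exact isCompact_Icc.image h.1

theorem scc_conn {γ : ℝ → ℂ} (h : IsSimpleClosedCurve γ) : IsConnected (range γ) :=
  isConnected_range h.1

theorem scc_split {γ : ℝ → ℂ} (h : IsSimpleClosedCurve γ) (a : ℝ) : γ '' Icc a (a + 1) = range γ := by
  have hp : Function.Periodic γ 1 := h.2.1
  exact hp.image_Icc (by norm_num) a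

theorem scc_sep {γ : ℝ → ℂ} (h : IsSimpleClosedCurve γ) : ¬ IsPreconnected (range γ)ᶜ := by
  intro hc
  set p := γ 0 with hp
  set q := γ (1/2) with hq
  have hp1 : γ 1 = p := by have := h.2.1 0; simpa using this
  have hpq : p ≠ q := by
    intro e
    obtain ⟨n, hn⟩ := scc_inj h e
    have h2 : (n : ℝ) = -(1/2) := by linarith
    have h3 : ((2 * n : ℤ) : ℝ) = ((-1 : ℤ) : ℝ) := by push_cast; linarith
    have := Int.cast_injective h3; omega
  set A := γ '' Icc 0 (1/2) with hA
  set B := γ '' Icc (1/2) 1 with hB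
  have hAc : IsCompact A := isCompact_Icc.image h.1
  have hBc : IsCompact B := isCompact_Icc.image h.1
  have hAB : A ∪ B = range γ := by
    rw [hA, hB, ← image_union, Icc_union_Icc_eq_Icc (by norm_num) (by norm_num)]
    have := scc_split h 0; rwa [zero_add] at this
  have hI : ∀ x ∈ A, x ∈ B → x = p ∨ x = q := by
    rintro x ⟨s, hs, rfl⟩ ⟨t, ht, e⟩
    obtain ⟨n, hn⟩ := scc_inj h e
    have h1 : (n : ℝ) ≤ 1 := by linarith [hs.1, ht.2]
    have h0 : (0 : ℝ) ≤ n := by linarith [hs.2, ht.1]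
    have h1' : n ≤ 1 := by exact_mod_cast h1
    have h0' : 0 ≤ n := by exact_mod_cast h0
    have : n = 0 ∨ n = 1 := by omega
    rcases this with rfl | rfl
    · right
      have : s = 1/2 := by push_cast at hn; linarith [hs.2, ht.1]
      rw [this]
    · left
      have : s = 0 := by push_cast at hn; linarith [hs.1, ht.2]
      rw [this]
  obtain ⟨l1, hl1, e1⟩ := log_path (R := fun t => γ (t/2)) (by have := h.1; fun_prop)
  obtain ⟨l2, hl2, e2⟩ := log_path (R := fun t => γ (1 - t/2)) (by have := h.1; fun_prop)
  have i1 : (fun t => γ (t/2)) '' Icc 0 1 = A := by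
    ext x; constructor
    · rintro ⟨t, ht, rfl⟩; exact ⟨t/2, ⟨by linarith [ht.1], by linarith [ht.2]⟩, rfl⟩
    · rintro ⟨t, ht, rfl⟩; exact ⟨2*t, ⟨by linarith [ht.1], by linarith [ht.2]⟩, by simp⟩
  have i2 : (fun t => γ (1 - t/2)) '' Icc 0 1 = B := by
    ext x; constructor
    · rintro ⟨t, ht, rfl⟩; exact ⟨1 - t/2, ⟨by linarith [ht.2], by linarith [ht.1]⟩, rfl⟩
    · rintro ⟨t, ht, rfl⟩
      exact ⟨2*(1-t), ⟨by linarith [ht.2], by linarith [ht.1]⟩, by simp⟩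
  rw [i1] at hl1 e1; rw [i2] at hl2 e2
  simp only [zero_div, sub_zero, hp1, ← hp] at e1 e2
  rw [show (1 : ℝ) - 1/2 = 1/2 by norm_num] at e2
  rw [← hq] at e1 e2
  have hne : ∃ x0, x0 ∈ (range γ)ᶜ := by
    by_contra! hh
    have : range γ = univ := eq_univ_of_forall fun x => by simpa using hh x
    have h2 := scc_compact h
    rw [this] at h2
    exact noncompact_univ ℂ h2
  obtain ⟨x0, hx0⟩ := hne
  have hsA : (range γ)ᶜ ⊆ Aᶜ := compl_subset_compl.2 (image_subset_range _ _)
  have hsB : (range γ)ᶜ ⊆ Bᶜ := compl_subset_compl.2 (image_subset_range _ _)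
  set k := l1 x0 - l2 x0 with hk
  have hdiff : ∀ x ∈ (range γ)ᶜ, l1 x - l2 x = k := fun x hx =>
    log_unique hc (hl1.mono hsA) (hl2.mono hsB) (fun y hy => by rw [e1 y (hsA hy), e2 y (hsB hy)]) hx hx0
  have hk1 : Complex.exp k = 1 := by
    rw [hk, Complex.exp_sub, e1 _ (hsA hx0), e2 _ (hsB hx0), div_self]
    refine div_ne_zero (sub_ne_zero.2 ?_) (sub_ne_zero.2 ?_)
    · rintro rfl; exact hx0 ⟨_, rfl⟩
    · rintro rfl; exact hx0 ⟨_, rfl⟩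
  classical
  let l : ℂ → ℂ := fun x => if x ∈ A then l2 x + k else l1 x
  have hlA : EqOn l l1 Aᶜ := fun x hx => by simp only [l]; rw [if_neg hx]
  have hlB : EqOn l (fun x => l2 x + k) Bᶜ := fun x hx => by
    simp only [l]; split_ifs with hh
    · rfl
    · have := hdiff x (by rw [← hAB]; rintro (h | h); exacts [hh h, hx h])
      rw [← this]; ring
  have hlc : ContinuousOn l (Aᶜ ∪ Bᶜ) :=
    ContinuousOn.union_of_isOpen (hl1.congr hlA)
      ((hl2.add continuousOn_const).congr hlB) hAc.isClosed.isOpen_compl hBc.isClosed.isOpen_compl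
  have hle : ∀ x ∈ Aᶜ ∪ Bᶜ, Complex.exp (l x) = (x - q) / (x - p) := by
    rintro x (hx | hx)
    · rw [hlA hx, e1 x hx]
    · rw [hlB hx]; simp only; rw [Complex.exp_add, hk1, mul_one, e2 x hx]
  have hρ : 0 < ‖p - q‖ / 2 := by have := norm_pos_iff.2 (sub_ne_zero.2 hpq); linarith
  have hsub : ∀ x ∈ sphere p (‖p - q‖ / 2), x ∈ Aᶜ ∪ Bᶜ := by
    intro x hx
    rw [← compl_inter]; rintro ⟨ha, hb⟩
    rcases hI x ha hb with rfl | rfl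
    · simp at hx; rw [← hx] at hρ; exact lt_irrefl _ hρ
    · rw [mem_sphere, dist_comm, dist_eq_norm] at hx; linarith
  have hnear : ∀ x ∈ sphere p (‖p - q‖ / 2), ‖(x - p) / (p - q)‖ < 1 := by
    intro x hx
    rw [mem_sphere, dist_eq_norm] at hx
    rw [norm_div, hx, div_div, mul_comm, ← div_div, div_self (by linarith)]; norm_num
  refine no_log_circle (z := p) hρ
    (l := fun x => Complex.log (p - q) + Complex.log (1 + (x - p) / (p - q)) - l x) ?_ ?_
  · refine ContinuousOn.sub (ContinuousOn.add continuousOn_const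
      (ContinuousOn.clog (by fun_prop) fun x hx => ?_)) (hlc.mono hsub)
    exact Complex.mem_slitPlane_of_norm_lt_one (hnear x hx)
  · intro x hx
    have hx1 : 1 + (x - p) / (p - q) ≠ 0 := 
      Complex.slitPlane_ne_zero (Complex.mem_slitPlane_of_norm_lt_one (hnear x hx))
    have hpq' := sub_ne_zero.2 hpq
    rw [Complex.exp_sub, Complex.exp_add, Complex.exp_log hpq', Complex.exp_log hx1, hle x (hsub x hx)]
    have h3 : (p - q) * (1 + (x - p) / (p - q)) = x - q := by field_simp; ring
    rw [h3]
    have h4 : x - q ≠ 0 := by rw [← h3]; exact mul_ne_zero hpq' hx1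
    rw [div_div_eq_mul_div, mul_comm, mul_div_assoc, div_self h4, mul_one]

theorem comp_frontier {U : Set ℂ} (hU : IsOpen U) (v : ℂ) :
    frontier (connectedComponentIn U v) ⊆ Uᶜ := by
  intro x hx hxU
  have hVo : IsOpen (connectedComponentIn U v) := hU.connectedComponentIn
  by_cases hv : v ∈ U
  · have h1 : IsPreconnected (insert x (connectedComponentIn U v)) :=
      isPreconnected_connectedComponentIn.subset_closure (subset_insert _ _)
        (insert_subset hx.1 subset_closure)
    have h2 := h1.subset_connectedComponentIn (mem_insert_of_mem _ (mem_connectedComponentIn hv))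
      (insert_subset hxU (connectedComponentIn_subset U v))
    exact hx.2 (by rw [hVo.interior_eq]; exact h2 (mem_insert _ _))
  · rw [connectedComponentIn_eq_empty hv] at hx; simp at hx

theorem ext_ball_conn {R : ℝ} (hR : 0 < R) : IsPreconnected {z : ℂ | R < ‖z‖} := by
  have : {z : ℂ | R < ‖z‖} = Complex.exp '' {w | Real.log R < w.re} := by
    ext z; constructor
    · intro (hz : R < ‖z‖)
      have hz0 : z ≠ 0 := norm_pos_iff.1 (hR.trans hz)
      exact ⟨Complex.log z, by simpa [Complex.log_re] using Real.log_lt_log hR hz, Complex.exp_log hz0⟩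
    · rintro ⟨w, hw, rfl⟩
      simp only [mem_setOf_eq] at hw ⊢
      rw [Complex.norm_exp]
      exact (Real.log_lt_iff_lt_exp hR).1 hw
  rw [this]
  exact (convex_halfSpace_re_gt _).isPreconnected.image _ Complex.continuous_exp.continuousOn

theorem arc_log {γ : ℝ → ℂ} (h : IsSimpleClosedCurve γ) {a b : ℝ} (hab : a ≤ b) (hb : b < a + 1) {z : ℂ}
    (hz : z ∉ γ '' Icc a b) :
    ∃ l : ℂ → ℂ, Continuous l ∧ ∀ y ∈ γ '' Icc a b, Complex.exp (l y) = y - z := by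
  obtain ⟨L, hL, he⟩ := log_star (E := ℝ) (f := fun t => γ (projIcc a b hab t) - z)
    (by have := h.1; have := continuous_projIcc (a := a) (b := b) (h := hab); fun_prop)
    (fun t e => hz ⟨_, (projIcc a b hab t).2, sub_eq_zero.1 e⟩)
  have hemb : IsClosedEmbedding (fun t : Icc a b => γ t) := by
    refine Continuous.isClosedEmbedding (by have := h.1; fun_prop) ?_
    rintro ⟨s, hs⟩ ⟨t, ht⟩ e
    obtain ⟨n, hn⟩ := scc_inj h e
    have h1 : (n : ℝ) < 1 := by linarith [hs.2, ht.1]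
    have h2 : (-1 : ℝ) < n := by linarith [hs.1, ht.2]
    have h1' : n < 1 := by exact_mod_cast h1
    have h2' : -1 < n := by exact_mod_cast h2
    have : n = 0 := by omega
    subst this
    apply Subtype.ext; simpa using hn
  obtain ⟨l, hl⟩ := ContinuousMap.exists_extension hemb (⟨fun t : Icc a b => L t, by fun_prop⟩ : C(Icc a b, ℂ))
  refine ⟨l, l.continuous, ?_⟩
  rintro y ⟨t, ht, rfl⟩
  have := DFunLike.congr_fun hl ⟨t, ht⟩
  simp at this
  rw [this, he, projIcc_of_mem hab ht]

theorem scc_closure {γ : ℝ → ℂ} (h : IsSimpleClosedCurve γ) {v : ℂ} (hv : v ∉ range γ) :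
    range γ ⊆ closure (connectedComponentIn (range γ)ᶜ v) := by
  set V := connectedComponentIn (range γ)ᶜ v with hV
  have hΓ := scc_compact h
  have hUo : IsOpen (range γ)ᶜ := hΓ.isClosed.isOpen_compl
  have hVo : IsOpen V := hUo.connectedComponentIn
  have hvV : v ∈ V := mem_connectedComponentIn hv
  have hfr : frontier V ⊆ range γ := by
    have := comp_frontier hUo v; rwa [compl_compl] at this
  rintro c ⟨t0, rfl⟩
  by_contra hc
  have hev : ∀ᶠ t in 𝓝 t0, γ t ∈ (closure V)ᶜ :=
    h.1.continuousAt.eventually (isClosed_closure.isOpen_compl.mem_nhds hc)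
  obtain ⟨η0, hη0, hball⟩ := Metric.eventually_nhds_iff.1 hev
  obtain ⟨η, hη, hηl⟩ : ∃ η, 0 < η ∧ η < min η0 (1/2) := exists_between (by positivity)
  have hη1 : η < η0 := hηl.trans_le (min_le_left _ _)
  have hη2 : η < 1/2 := hηl.trans_le (min_le_right _ _)
  have hper : ∀ s, γ (s - 1) = γ s := fun s => by have := h.2.1 (s - 1); simpa using this.symm
  have hB : ∀ y ∈ range γ, y ∈ closure V → y ∈ γ '' Icc (t0 + η) (t0 + 1 - η) := by
    intro y hy hyV
    rw [← scc_split h t0] at hy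
    obtain ⟨s, hs, rfl⟩ := hy
    refine ⟨s, ⟨?_, ?_⟩, rfl⟩
    · by_contra! hlt
      exact hball (y := s) (by rw [Real.dist_eq, abs_lt]; constructor <;> linarith [hs.1]) hyV
    · by_contra! hlt
      refine hball (y := s - 1) (by rw [Real.dist_eq, abs_lt]; constructor <;> linarith [hs.2]) ?_
      rw [hper]; exact hyV
  have hab : t0 + η ≤ t0 + 1 - η := by linarith
  have hb : t0 + 1 - η < (t0 + η) + 1 := by linarith
  have key : ∀ (O : Set ℂ) (z : ℂ), IsOpen O → Bornology.IsBounded O → z ∈ O → 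
      z ∉ γ '' Icc (t0 + η) (t0 + 1 - η) → frontier O ⊆ frontier V → False := by
    intro O z hO hOb hz hzB hfO
    obtain ⟨l, hl, he⟩ := arc_log h hab hb hzB
    refine lemmaE hO hOb hz (f := fun _ => 1) (l := fun y => - l y) continuousOn_const
      (fun _ _ => one_ne_zero) (by fun_prop) (fun y hy => ?_)
    have hyV := hfO hy
    have hyB := hB y (hfr hyV) hyV.1
    rw [Complex.exp_neg, he y hyB, inv_mul_cancel₀]
    rw [← he y hyB]; exact Complex.exp_ne_zero _
  by_cases hVb : Bornology.IsBounded V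
  · exact key V v hVo hVb hvV (fun hh => hv (image_subset_range _ _ hh)) subset_rfl
  · obtain ⟨R, hR0, hR⟩ := hΓ.isBounded.exists_pos_norm_le
    have hex : ∃ w ∈ V, R < ‖w‖ := by
      by_contra! hh
      exact hVb (isBounded_iff_forall_norm_le.2 ⟨R, hh⟩)
    obtain ⟨w, hw, hwR⟩ := hex
    have hsub : {z : ℂ | R < ‖z‖} ⊆ V := by
      rw [hV, connectedComponentIn_eq hw]
      exact (ext_ball_conn hR0).subset_connectedComponentIn hwR
        (fun z hz hzΓ => absurd (hR z hzΓ) (not_le.2 hz))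
    refine key (closure V)ᶜ (γ t0) isClosed_closure.isOpen_compl ?_ hc ?_ ?_
    · refine isBounded_iff_forall_norm_le.2 ⟨R, fun x hx => ?_⟩
      by_contra! hh
      exact hx (subset_closure (hsub hh))
    · rintro ⟨s, hs, e⟩
      obtain ⟨n, hn⟩ := scc_inj h e
      have h1 : (n : ℝ) < 1 := by linarith [hs.2]
      have h2 : (0 : ℝ) < n := by linarith [hs.1]
      have h1' : n < 1 := by exact_mod_cast h1
      have h2' : 0 < n := by exact_mod_cast h2
      omega
    · rw [frontier_compl]; exact frontier_closure_subset

structure Geo (D : Set ℂ) (m : ℕ) (E : Fin m → Set ℂ) : Prop where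
  two : 2 ≤ m
  op : IsOpen D
  conn : IsConnected D
  bdd : Bornology.IsBounded D
  closed : ∀ j, IsClosed (E j)
  disj : ∀ i j, i ≠ j → Disjoint (E i) (E j)
  union : ⋃ j, E j = Dᶜ
  comp : ∀ j, ∀ x ∈ E j, x ∉ closure D → ∃ V, IsOpen V ∧ IsPreconnected V ∧ x ∈ V ∧ V ⊆ E j ∧
    Disjoint V (closure D) ∧ E j ∩ closure D ⊆ closure V
  inner : ∀ j, ∃ x ∈ E j, x ∉ closure D
  bd : ∀ j, (E j ∩ closure D).Nonempty

theorem geo_exists {m : ℕ} (hm : 2 ≤ m) {D : Set ℂ} (hDo : IsOpen D) (hDc : IsConnected D)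
    (hDb : Bornology.IsBounded D)
    {γ : Fin m → ℝ → ℂ} (hγ : ∀ j, IsSimpleClosedCurve (γ j))
    (hdisj : Pairwise (Function.onFun Disjoint fun j => Set.range (γ j)))
    (hfront : frontier D = ⋃ j, Set.range (γ j)) : ∃ E, Geo D m E := by
  classical
  obtain ⟨c, hc⟩ := hDc.nonempty
  have hΓc : ∀ j, IsClosed (range (γ j)) := fun j => (scc_compact (hγ j)).isClosed
  have hUo : ∀ j, IsOpen (range (γ j))ᶜ := fun j => (hΓc j).isOpen_compl
  set Ω : Fin m → Set ℂ := fun j => connectedComponentIn (range (γ j))ᶜ c with hΩ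
  have hΩo : ∀ j, IsOpen (Ω j) := fun j => (hUo j).connectedComponentIn
  have hfD : ∀ j, range (γ j) ⊆ frontier D := fun j => by rw [hfront]; exact subset_iUnion (fun j => range (γ j)) j
  have hDU : ∀ j, D ⊆ (range (γ j))ᶜ := fun j x hx hxj => by
    have := (hfD j hxj).2; rw [hDo.interior_eq] at this; exact this hx
  have hcΩ : ∀ j, c ∈ Ω j := fun j => mem_connectedComponentIn (hDU j hc)
  have hΩc : ∀ j, IsConnected (Ω j) := fun j => ⟨⟨c, hcΩ j⟩, isPreconnected_connectedComponentIn⟩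
  have hΩs : ∀ j, Ω j ⊆ (range (γ j))ᶜ := fun j => connectedComponentIn_subset _ _
  have hDΩ : ∀ j, D ⊆ Ω j := fun j => hDc.2.subset_connectedComponentIn hc (hDU j)
  have ha : ∀ j, ∀ x ∈ closure D, x ∉ range (γ j) → x ∈ Ω j := by
    intro j x hx hxj
    have h1 : IsPreconnected (insert x D) := hDc.2.subset_closure (subset_insert _ _)
        (insert_subset hx subset_closure)
    exact h1.subset_connectedComponentIn (mem_insert_of_mem _ hc)
      (insert_subset hxj (hDU j)) (mem_insert _ _)
  have hED : ∀ j, (Ω j)ᶜ ∩ closure D = range (γ j) := by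
    intro j; ext x; constructor
    · rintro ⟨h1, h2⟩; by_contra hh; exact h1 (ha j x h2 hh)
    · intro hx; exact ⟨fun h1 => hΩs j h1 hx, (hfD j hx).1⟩
  have hV : ∀ j, ∀ x ∈ (Ω j)ᶜ, x ∉ range (γ j) → connectedComponentIn (range (γ j))ᶜ x ⊆ (Ω j)ᶜ := by
    intro j x hx hxj y hy hyΩ
    have e1 := connectedComponentIn_eq hy
    have e2 := connectedComponentIn_eq hyΩ
    apply hx
    rw [hΩ]; simp only; rw [e2, ← e1]; exact mem_connectedComponentIn hxj
  have hdis : ∀ i j, i ≠ j → Disjoint (range (γ i)) (range (γ j)) := fun i j hij => hdisj hij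
  refine ⟨fun j => (Ω j)ᶜ, hm, hDo, hDc, hDb, fun j => (hΩo j).isClosed_compl, ?_, ?_, ?_, ?_, ?_⟩
  · intro i j hij
    rw [Set.disjoint_left]
    intro x hxi hxj
    have hxi' : x ∉ range (γ i) := by
      intro hh
      rw [← hED i] at hh
      have h2 : x ∈ range (γ j) := by rw [← hED j]; exact ⟨hxj, hh.2⟩
      rw [hED i] at hh
      exact Set.disjoint_left.1 (hdis i j hij) hh h2
    set V := connectedComponentIn (range (γ i))ᶜ x with hVd
    have hVp : IsPreconnected (V ∪ range (γ i)) :=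
      isPreconnected_connectedComponentIn.subset_closure subset_union_left
        (union_subset subset_closure (scc_closure (hγ i) hxi'))
    have hsub : V ∪ range (γ i) ⊆ (range (γ j))ᶜ := by
      rintro y (hy | hy) hyj
      · exact hV i x hxi hxi' hy (ha i y (hfD j hyj).1 (fun h => Set.disjoint_left.1 (hdis i j hij) h hyj))
      · exact Set.disjoint_left.1 (hdis i j hij) hy hyj
    have hg : γ i 0 ∈ Ω j := ha j _ (hfD i ⟨0, rfl⟩).1 (fun h => Set.disjoint_left.1 (hdis i j hij) ⟨0, rfl⟩ h)
    apply hxj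
    have e := connectedComponentIn_eq hg
    rw [hΩ]; simp only; rw [e]
    exact hVp.subset_connectedComponentIn (Or.inr ⟨0, rfl⟩) hsub (Or.inl (mem_connectedComponentIn hxi'))
  · rw [← compl_iInter]
    congr 1
    refine Subset.antisymm (fun x hx => ?_) (subset_iInter hDΩ)
    by_contra hxD
    rw [mem_iInter] at hx
    have hxc : x ∉ closure D := by
      intro hh
      have : x ∈ frontier D := ⟨hh, by rwa [hDo.interior_eq]⟩
      rw [hfront, mem_iUnion] at this
      obtain ⟨j, hj⟩ := this
      exact hΩs j (hx j) hj
    choose l hl he using fun j => log_comp (hΩo j) (hΩc j) (hx j) (hcΩ j)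
    have hsubj : ∀ j, range (γ j) ⊆ (Ω j)ᶜ := fun j y hy h => hΩs j h hy
    let L : ℂ → ℂ := fun y => if h : ∃ j, y ∈ range (γ j) then l h.choose y else 0
    have hLj : ∀ j, EqOn L (l j) (range (γ j)) := by
      intro j y hy
      have hex : ∃ j, y ∈ range (γ j) := ⟨j, hy⟩
      have : hex.choose = j := by
        by_contra hne
        exact Set.disjoint_left.1 (hdis _ _ hne) hex.choose_spec hy
      simp only [L]; rw [dif_pos hex, this]
    refine lemmaE hDo hDb hc (f := fun y => y - x) (l := L) (by fun_prop)
      (fun y hy h => hxc (by rw [← sub_eq_zero.1 h]; exact hy)) ?_ ?_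
    · rw [hfront]
      exact (locallyFinite_of_finite _).continuousOn_iUnion hΓc
        (fun j => ((hl j).mono (hsubj j)).congr (hLj j))
    · intro y hy
      have hyc : y - c ≠ 0 := by
        intro h0
        have h1 := hy.2
        rw [hDo.interior_eq, sub_eq_zero.1 h0] at h1
        exact h1 hc
      rw [hfront, mem_iUnion] at hy
      obtain ⟨j, hj⟩ := hy
      rw [hLj j hj, he j y (hsubj j hj), div_mul_cancel₀ _ hyc]
  · intro j x hx hxD
    have hxj : x ∉ range (γ j) := fun h => hxD (hfD j h).1
    refine ⟨connectedComponentIn (range (γ j))ᶜ x, (hUo j).connectedComponentIn,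
      isPreconnected_connectedComponentIn, mem_connectedComponentIn hxj, hV j x hx hxj, ?_, ?_⟩
    · rw [Set.disjoint_left]
      intro y hy hyD
      have h1 : y ∈ range (γ j) := by rw [← hED j]; exact ⟨hV j x hx hxj hy, hyD⟩
      exact connectedComponentIn_subset _ _ hy h1
    · rw [hED j]; exact scc_closure (hγ j) hxj
  · intro j
    by_contra! hh
    apply scc_sep (hγ j)
    have : (range (γ j))ᶜ = Ω j := by
      refine Subset.antisymm (fun x hx => ?_) (hΩs j)
      by_contra hxΩ
      have h1 := hh x hxΩ
      apply hx; rw [← hED j]; exact ⟨hxΩ, h1⟩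
    rw [this]; exact (hΩc j).2
  · intro j; rw [hED j]; exact ⟨γ j 0, 0, rfl⟩

end HX

namespace HX
open Metric Filter Topology InnerProductSpace Real MeasureTheory
open scoped CompactlySupported

theorem Geo.frontier_eq {D : Set ℂ} {m : ℕ} {E : Fin m → Set ℂ} (g : Geo D m E) :
    frontier D = closure D \ D := g.op.frontier_eq

theorem Geo.mem_front {D : Set ℂ} {m : ℕ} {E : Fin m → Set ℂ} (g : Geo D m E) {p : ℂ} :
    p ∈ frontier D ↔ ∃ j, p ∈ E j ∧ p ∈ closure D := by
  rw [g.frontier_eq]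
  have : p ∉ D ↔ ∃ j, p ∈ E j := by rw [← mem_compl_iff, ← g.union, mem_iUnion]
  simp only [Set.mem_sdiff, this]
  tauto

theorem Geo.notD {D : Set ℂ} {m : ℕ} {E : Fin m → Set ℂ} (g : Geo D m E) {p : ℂ} {j : Fin m}
    (h : p ∈ E j) : p ∉ D := by
  have : p ∈ Dᶜ := by rw [← g.union]; exact mem_iUnion.2 ⟨j, h⟩
  exact this

theorem Geo.fcpt {D : Set ℂ} {m : ℕ} {E : Fin m → Set ℂ} (g : Geo D m E) : IsCompact (frontier D) :=
    g.bdd.isCompact_closure.of_isClosed_subset isClosed_frontier frontier_subset_closure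

/-- accessibility from the component of an exterior point -/
theorem Geo.acc {D : Set ℂ} {m : ℕ} {E : Fin m → Set ℂ} (g : Geo D m E) {j : Fin m} {y : ℂ}
    (hy : y ∈ E j) (hyD : y ∉ closure D) :
    ∃ V, IsOpen V ∧ IsPreconnected V ∧ y ∈ V ∧ Disjoint V (closure D) ∧
      ∀ p ∈ E j, p ∈ closure D → ∃ d x, Acc V p d x := by
  obtain ⟨V, hVo, hVc, hyV, hVE, hVD, hV⟩ := g.comp j y hy hyD
  refine ⟨V, hVo, hVc, hyV, hVD, fun p hp hpD => acc_exists hVo hVc (hV ⟨hp, hpD⟩) ?_⟩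
  intro hpV
  exact Set.disjoint_left.1 hVD hpV hpD

theorem Geo.exists_acc {D : Set ℂ} {m : ℕ} {E : Fin m → Set ℂ} (g : Geo D m E) {p : ℂ}
    (hp : p ∈ frontier D) : ∃ V d x, Acc V p d x ∧ Disjoint V (closure D) := by
  obtain ⟨j, hj, hpD⟩ := g.mem_front.1 hp
  obtain ⟨y, hy, hyD⟩ := g.inner j
  obtain ⟨V, -, -, -, hVD, h⟩ := g.acc hy hyD
  obtain ⟨d, x, hx⟩ := h p hj hpD
  exact ⟨V, d, x, hx, hVD⟩

theorem Geo.dir {D : Set ℂ} {m : ℕ} {E : Fin m → Set ℂ} (g : Geo D m E) {φ : ℂ → ℝ}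
    (hφ : ContinuousOn φ (frontier D)) : ∃ u, Sol D φ u := by
  refine dirichlet g.bdd g.op (fun p hp => ?_) hφ
  obtain ⟨V, d, x, h, hV⟩ := g.exists_acc hp
  exact h.bar g.op (fun z hz hzD => Set.disjoint_left.1 hV hz (subset_closure hzD))

open Classical in
/-- the harmonic extension -/
noncomputable def Hs (D : Set ℂ) (φ : ℂ → ℝ) : ℂ → ℝ := if h : ∃ u, Sol D φ u then h.choose else 0

theorem Geo.sol {D : Set ℂ} {m : ℕ} {E : Fin m → Set ℂ} (g : Geo D m E) {φ : ℂ → ℝ}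
    (hφ : ContinuousOn φ (frontier D)) : Sol D φ (Hs D φ) := by
  have h := g.dir hφ
  rw [Hs, dif_pos h]; exact h.choose_spec

structure IsHM (D : Set ℂ) (z : ℂ) (μ : Measure ℂ) : Prop where
  prob : IsProbabilityMeasure μ
  supp : ∀ᵐ ζ ∂μ, ζ ∈ frontier D
  int : ∀ φ u, Sol D φ u → ∫ ζ, φ ζ ∂μ = u z

theorem Geo.hm {D : Set ℂ} {m : ℕ} {E : Fin m → Set ℂ} (g : Geo D m E) {z : ℂ} (hz : z ∈ D) :
    ∃ μ, IsHM D z μ := by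
  classical
  have : CompactSpace (frontier D) := isCompact_iff_compactSpace.1 g.fcpt
  let ex : (frontier D → ℝ) → ℂ → ℝ := fun f ζ => if h : ζ ∈ frontier D then f ⟨ζ, h⟩ else 0
  have exc : ∀ f : frontier D → ℝ, Continuous f → ContinuousOn (ex f) (frontier D) := by
    intro f hf
    rw [continuousOn_iff_continuous_restrict]
    convert hf using 1
    ext ⟨ζ, h⟩; simp [ex, h]
  have exv : ∀ f : frontier D → ℝ, ∀ ζ : frontier D, ex f ζ = f ζ := fun f ζ => by simp [ex]
  have hzc := subset_closure hz
  let Λ0 : C_c(frontier D, ℝ) →ₗ[ℝ] ℝ :=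
    { toFun := fun f => Hs D (ex f) z
      map_add' := fun f h => by
        refine Sol.unique g.bdd g.op (g.sol (exc _ (f + h).continuous)) (v := fun z => Hs D (ex f) z + Hs D (ex h) z) ?_ z hzc
        have := (g.sol (exc f (map_continuous f))).add (g.sol (exc h (map_continuous h)))
        refine ⟨this.cont, this.harm, fun w hw => ?_⟩
        exact (this.bd w hw).trans (by simp [ex, hw])
      map_smul' := fun a f => by
        refine Sol.unique g.bdd g.op (g.sol (exc _ (a • f).continuous)) (v := fun z => a * Hs D (ex f) z) ?_ z hzc
        have := (g.sol (exc f (map_continuous f))).smul a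
        refine ⟨this.cont, this.harm, fun w hw => ?_⟩
        exact (this.bd w hw).trans (by simp [ex, hw]) }
  let Λ : C_c(frontier D, ℝ) →ₚ[ℝ] ℝ := PositiveLinearMap.mk₀ Λ0 (fun f hf => by
    refine Sol.le g.bdd g.op (Sol.const 0) (g.sol (exc _ f.continuous)) (fun w hw => ?_) z hzc
    rw [← Subtype.coe_mk (p := (· ∈ frontier D)) w hw, exv]; exact hf _)
  set ν := RealRMK.rieszMeasure Λ with hν
  have hfin : IsFiniteMeasure ν := inferInstance
  have hInt : ∀ φ u, Sol D φ u → ∫ ζ : frontier D, φ ζ ∂ν = u z := by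
    intro φ u h
    have hc : Continuous fun ζ : frontier D => φ ζ := by
      have : ContinuousOn φ (frontier D) :=
        (h.cont.mono frontier_subset_closure).congr (fun w hw => (h.bd w hw).symm)
      exact this.restrict
    let f : C_c(frontier D, ℝ) := ⟨⟨fun ζ => φ ζ, hc⟩, HasCompactSupport.of_compactSpace _⟩
    have h1 := RealRMK.integral_rieszMeasure Λ f
    have h2 : Λ f = u z := by
      refine Sol.unique g.bdd g.op (g.sol (exc _ f.continuous)) ⟨h.cont, h.harm, fun w hw => ?_⟩ z hzc
      rw [h.bd w hw, ← Subtype.coe_mk (p := (· ∈ frontier D)) w hw, exv]; rfl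
    rw [← h2, ← h1]; rfl
  have hme : MeasurableEmbedding (Subtype.val : frontier D → ℂ) :=
    MeasurableEmbedding.subtype_coe isClosed_frontier.measurableSet
  refine ⟨ν.map Subtype.val, ⟨?_⟩, ?_, ?_⟩
  · rw [hme.map_apply, preimage_univ]
    have h1 := hInt _ _ (Sol.const 1)
    simp [Measure.real] at h1
    rw [← ENNReal.toReal_eq_one_iff]; exact h1
  · rw [hme.ae_map_iff]
    exact Eventually.of_forall fun x => x.2
  · intro φ u h
    rw [hme.integral_map]; exact hInt φ u h

theorem IsHM.integrable {D : Set ℂ} (hDb : Bornology.IsBounded D) {z : ℂ} {μ : Measure ℂ} (h : IsHM D z μ) {F : Type} [NormedAddCommGroup F] 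
    {f : ℂ → F} (hf : ContinuousOn f (frontier D)) : Integrable f μ := by
  have := h.prob
  have hr : μ.restrict (frontier D) = μ := Measure.restrict_eq_self_of_ae_mem h.supp
  have hc : IsCompact (frontier D) :=
    hDb.isCompact_closure.of_isClosed_subset isClosed_frontier frontier_subset_closure
  have := hf.integrableOn_compact (μ := μ) hc
  rwa [IntegrableOn, hr] at this

theorem IsHM.le {D : Set ℂ} {m : ℕ} {E : Fin m → Set ℂ} (g : Geo D m E) {z c : ℂ} (hz : z ∈ D) {C : ℝ}
    (hC : 0 < C) (hk : Hk D C c z) {μ ν : Measure ℂ} (hμ : IsHM D z μ) (hν : IsHM D c ν) :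
    μ ≤ ENNReal.ofReal C • ν := by
  have := hμ.prob
  have := hν.prob
  have hi : ∀ f : C_c(ℂ, ℝ), Integrable f μ := fun f => hμ.integrable g.bdd f.continuous.continuousOn
  have hi' : ∀ f : C_c(ℂ, ℝ), Integrable f ν := fun f => hν.integrable g.bdd f.continuous.continuousOn
  let Λ0 : C_c(ℂ, ℝ) →ₗ[ℝ] ℝ :=
    { toFun := fun f => C * ∫ ζ, f ζ ∂ν - ∫ ζ, f ζ ∂μ
      map_add' := fun f h => by
        simp only [CompactlySupportedContinuousMap.coe_add, Pi.add_apply]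
        rw [integral_add (hi f) (hi h), integral_add (hi' f) (hi' h)]; ring
      map_smul' := fun a f => by
        simp only [CompactlySupportedContinuousMap.coe_smul, Pi.smul_apply, smul_eq_mul, integral_const_mul]
        simp; ring }
  let Λ : C_c(ℂ, ℝ) →ₚ[ℝ] ℝ := PositiveLinearMap.mk₀ Λ0 (fun f hf => by
    have hs := g.sol (φ := f) f.continuous.continuousOn
    have h0 := Sol.le g.bdd g.op (Sol.const 0) hs (fun w hw => hf w)
    show 0 ≤ C * ∫ ζ, f ζ ∂ν - ∫ ζ, f ζ ∂μ
    rw [hμ.int _ _ hs, hν.int _ _ hs]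
    have := (hk _ hs.harm (fun w hw => h0 w (subset_closure hw))).1
    linarith)
  have hkey : RealRMK.rieszMeasure Λ + μ = ENNReal.ofReal C • ν := by
    have r0 : IsFiniteMeasureOnCompacts (RealRMK.rieszMeasure Λ + μ) := ⟨fun K hK => by
      rw [Measure.add_apply]
      exact ENNReal.add_lt_top.2 ⟨hK.measure_lt_top, hK.measure_lt_top⟩⟩
    have r1 : (RealRMK.rieszMeasure Λ + μ).Regular := inferInstance
    have hfC : IsFiniteMeasure (ENNReal.ofReal C • ν) := Measure.smul_finite _ ENNReal.ofReal_ne_top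
    have r2 : (ENNReal.ofReal C • ν).Regular := inferInstance
    refine Measure.ext_of_integral_eq_on_compactlySupported fun f => ?_
    rw [integral_add_measure (f.integrable) (hi f), RealRMK.integral_rieszMeasure, integral_smul_measure,
      ENNReal.toReal_ofReal hC.le]
    show C * ∫ ζ, f ζ ∂ν - ∫ ζ, f ζ ∂μ + _ = _
    simp
  rw [← hkey]
  exact Measure.le_add_left le_rfl

end HX

namespace HX
open Metric Filter Topology InnerProductSpace Real MeasureTheory

theorem seq_pos {d : ℝ} (hd : 0 < d) (n : ℕ) : 0 < d / (n + 1) := by positivity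
theorem seq_le {d : ℝ} (hd : 0 < d) (n : ℕ) : d / (n + 1) ≤ d := by
  rw [div_le_iff₀ (by positivity)]; nlinarith [(Nat.cast_nonneg n : (0 : ℝ) ≤ n)]
theorem seq_tendsto (d : ℝ) : Tendsto (fun n : ℕ => d / ((n : ℝ) + 1)) atTop (𝓝 0) :=
  Tendsto.div_atTop tendsto_const_nhds
    (tendsto_atTop_add_const_right _ _ tendsto_natCast_atTop_atTop)

theorem Acc.up_tendsto {V : Set ℂ} {c : ℂ} {d : ℝ} {x : ℝ → ℂ} (h : Acc V c d x) {z : ℂ} (hz : z ≠ c) :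
    Tendsto (fun n : ℕ => Up x (d / ((n : ℝ) + 1)) z) atTop (𝓝 (Real.log ‖z - c‖)) := by
  have hs : 0 < ‖z - c‖ := norm_pos_iff.2 (sub_ne_zero.2 hz)
  have ht := seq_tendsto d
  have hc : ContinuousAt Real.log ‖z - c‖ := Real.continuousAt_log hs.ne'
  refine tendsto_of_tendsto_of_tendsto_of_le_of_le'
    (g := fun n : ℕ => Real.log (‖z - c‖ - d / (n + 1))) (h := fun n : ℕ => Real.log (‖z - c‖ + d / (n + 1))) ?_ ?_ ?_ ?_
  · refine hc.tendsto.comp ?_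
    simpa using tendsto_const_nhds.sub ht
  · refine hc.tendsto.comp ?_
    simpa using tendsto_const_nhds.add ht
  · filter_upwards [ht.eventually_lt_const hs] with n hn
    exact (h.mono (seq_pos h.pos n) (seq_le h.pos n)).up_ge_far (by linarith) (by linarith)
  · exact Eventually.of_forall fun n => (h.mono (seq_pos h.pos n) (seq_le h.pos n)).up_le hz

theorem Acc.up_abs {V : Set ℂ} {c : ℂ} {d : ℝ} {x : ℝ → ℂ} (h : Acc V c d x) {z : ℂ} (hz : z ≠ c) (n : ℕ) :
    |Up x (d / ((n : ℝ) + 1)) z| ≤ |Real.log ‖z - c‖| + (Real.log 2 + C0 + ‖z - c‖ + d) := by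
  have h' := h.mono (seq_pos h.pos n) (seq_le h.pos n)
  have h1 := h'.up_ge_log hz
  have h2 := h'.up_le hz
  have hs : 0 < ‖z - c‖ := norm_pos_iff.2 (sub_ne_zero.2 hz)
  have h3 : Real.log (‖z - c‖ + d / (n + 1)) ≤ ‖z - c‖ + d := by
    have := seq_le h.pos n
    have := seq_pos h.pos n
    linarith [Real.log_le_sub_one_of_pos (show 0 < ‖z - c‖ + d / (n + 1) by positivity)]
  have hC := C0_nonneg
  have hl : 0 < Real.log 2 := Real.log_pos (by norm_num)
  have hd := h.pos
  rw [abs_le]; constructor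
  · linarith [neg_abs_le (Real.log ‖z - c‖)]
  · linarith [abs_nonneg (Real.log ‖z - c‖)]

theorem Acc.dct {V : Set ℂ} {c : ℂ} {d : ℝ} {x : ℝ → ℂ} (h : Acc V c d x) {μ : Measure ℂ}
    {R : ℝ} (hR : ∀ᵐ ζ ∂μ, ‖ζ - c‖ ≤ R) (hc : ∀ᵐ ζ ∂μ, ζ ≠ c) {n : ℂ → ℝ} (hn : Integrable n μ)
    (hnl : Integrable (fun ζ => n ζ * Real.log ‖ζ - c‖) μ) :
    Tendsto (fun k : ℕ => ∫ ζ, n ζ * Up x (d / ((k : ℝ) + 1)) ζ ∂μ) atTop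
      (𝓝 (∫ ζ, n ζ * Real.log ‖ζ - c‖ ∂μ)) := by
  refine tendsto_integral_of_dominated_convergence
    (fun ζ => ‖n ζ * Real.log ‖ζ - c‖‖ + ‖n ζ‖ * (Real.log 2 + C0 + R + d)) ?_ ?_ ?_ ?_
  · intro k
    exact hn.aestronglyMeasurable.mul (h.mono (seq_pos h.pos k) (seq_le h.pos k)).up_cont.aestronglyMeasurable
  · exact hnl.norm.add (hn.norm.mul_const _)
  · intro k
    filter_upwards [hR, hc] with ζ h1 h2
    rw [norm_mul, norm_mul, ← mul_add]
    refine mul_le_mul_of_nonneg_left ?_ (norm_nonneg _)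
    rw [Real.norm_eq_abs, Real.norm_eq_abs]
    linarith [h.up_abs h2 k]
  · filter_upwards [hc] with ζ h2
    exact (h.up_tendsto h2).const_mul _

theorem Acc.sol {V : Set ℂ} {c : ℂ} {d : ℝ} {x : ℝ → ℂ} (h : Acc V c d x) {D : Set ℂ} (hDo : IsOpen D)
    (hDV : ∀ z ∈ V, z ∉ D) : Sol D (Up x d) (Up x d) :=
  ⟨h.up_cont.continuousOn, h.up_harm hDo hDV, fun _ _ => rfl⟩

theorem Geo.radius {D : Set ℂ} {m : ℕ} {E : Fin m → Set ℂ} (g : Geo D m E) :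
    ∃ R, 1 ≤ R ∧ ∀ z ∈ closure D, ∀ w ∈ closure D, ‖z - w‖ ≤ R := by
  obtain ⟨R, hR0, hR⟩ := g.bdd.isCompact_closure.isBounded.exists_pos_norm_le
  refine ⟨2 * R + 1, by linarith, fun z hz w hw => ?_⟩
  linarith [norm_sub_le z w, hR z hz, hR w hw]

theorem HM_atom {D : Set ℂ} {m : ℕ} {E : Fin m → Set ℂ} (g : Geo D m E) {z : ℂ} (hz : z ∈ D) 
    {μ : Measure ℂ} (hμ : IsHM D z μ) {c : ℂ} (hc : c ∈ frontier D) : ∀ᵐ ζ ∂μ, ζ ≠ c := by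
  have := hμ.prob
  obtain ⟨R, hR1, hR⟩ := g.radius
  obtain ⟨V, d, x, h, hV⟩ := g.exists_acc hc
  have hDV : ∀ z ∈ V, z ∉ D := fun z hz hzD => Set.disjoint_left.1 hV hz (subset_closure hzD)
  have hzc : z ≠ c := by
    rintro rfl; rw [g.frontier_eq] at hc; exact hc.2 hz
  have h0 : μ {c} = 0 := by
    by_contra hne
    have ha : 0 < μ.real {c} := by
      rw [Measure.real, ENNReal.toReal_pos_iff]
      exact ⟨pos_iff_ne_zero.2 hne, measure_lt_top _ _⟩
    set a := μ.real {c} with ha'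
    have hbound : ∀ δ, 0 < δ → δ ≤ d → Real.log ‖z - c‖ - (Real.log 2 + C0) ≤ a * Real.log δ + (R + d) := by
      intro δ h1 h2
      have h' := h.mono h1 h2
      have hs := h'.sol g.op hDV
      have e := hμ.int _ _ hs
      refine (h'.up_ge_log hzc).trans ?_
      rw [← e]
      have hle : ∀ᵐ ζ ∂μ, Up x δ ζ ≤ indicator {c} (fun _ => Real.log δ) ζ + (R + d) := by
        filter_upwards [hμ.supp] with ζ hζ
        by_cases hh : ζ = c
        · subst hh; simp only [indicator_of_mem (mem_singleton _)]
          linarith [h'.up_center, h.pos]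
        · rw [indicator_of_notMem (by simpa using hh), zero_add]
          refine (h'.up_le hh).trans ?_
          have h4 := hR ζ (frontier_subset_closure hζ) c (frontier_subset_closure hc)
          have h5 : 0 < ‖ζ - c‖ + δ := by positivity
          linarith [Real.log_le_sub_one_of_pos h5]
      have hI : Integrable (fun ζ => indicator {c} (fun _ => Real.log δ) ζ + (R + d)) μ :=
        ((integrable_const _).indicator (measurableSet_singleton c)).add (integrable_const _)
      refine (integral_mono_ae (hμ.integrable g.bdd h'.up_cont.continuousOn) hI hle).trans ?_
      rw [integral_add ((integrable_const _).indicator (measurableSet_singleton c)) (integrable_const _),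
        integral_indicator (measurableSet_singleton c)]
      simp [ha', Measure.real]
    have ht : Tendsto (fun δ : ℝ => a * Real.log δ + (R + d)) (𝓝[>] 0) atBot :=
      tendsto_atBot_add_const_right _ _ ((Real.tendsto_log_nhdsGT_zero).const_mul_atBot ha)
    have hev := ht.eventually_lt_atBot (Real.log ‖z - c‖ - (Real.log 2 + C0))
    have hev2 : ∀ᶠ δ in 𝓝[>] (0:ℝ), δ ∈ Ioc 0 d := Ioc_mem_nhdsGT h.pos
    obtain ⟨δ, h1, h2⟩ := (hev.and hev2).exists
    exact absurd (hbound δ h2.1 h2.2) (not_le.2 h1)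
  rw [ae_iff]; simpa using h0

theorem HM_log {D : Set ℂ} {m : ℕ} {E : Fin m → Set ℂ} (g : Geo D m E) {z : ℂ} (hz : z ∈ D) 
    {μ : Measure ℂ} (hμ : IsHM D z μ) {c : ℂ} (hc : c ∈ frontier D) : 
    Integrable (fun ζ => Real.log ‖ζ - c‖) μ ∧ ∫ ζ, Real.log ‖ζ - c‖ ∂μ = Real.log ‖z - c‖ := by
  have := hμ.prob
  obtain ⟨R, hR1, hR⟩ := g.radius
  obtain ⟨V, d, x, h, hV⟩ := g.exists_acc hc
  have hDV : ∀ z ∈ V, z ∉ D := fun z hz hzD => Set.disjoint_left.1 hV hz (subset_closure hzD)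
  have hzc : z ≠ c := by
    rintro rfl; rw [g.frontier_eq] at hc; exact hc.2 hz
  have hat := HM_atom g hz hμ hc
  have hRa : ∀ᵐ ζ ∂μ, ‖ζ - c‖ ≤ R := by
    filter_upwards [hμ.supp] with ζ hζ
    exact hR _ (frontier_subset_closure hζ) _ (frontier_subset_closure hc)
  set M := R + d with hM
  have hsol : ∀ k : ℕ, Sol D (Up x (d / ((k : ℝ) + 1))) (Up x (d / ((k : ℝ) + 1))) := fun k =>
    (h.mono (seq_pos h.pos k) (seq_le h.pos k)).sol g.op hDV
  have hup : ∀ ζ, ζ ≠ c → ‖ζ - c‖ ≤ R → ∀ k : ℕ, Up x (d / ((k : ℝ) + 1)) ζ ≤ M := by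
    intro ζ h1 h2 k
    refine ((h.mono (seq_pos h.pos k) (seq_le h.pos k)).up_le h1).trans ?_
    have h3 := seq_pos h.pos k
    have h4 := seq_le h.pos k
    have h5 : 0 < ‖ζ - c‖ + d / ((k : ℝ) + 1) := by positivity
    linarith [Real.log_le_sub_one_of_pos h5]
  have hlogM : ∀ ζ, ζ ≠ c → ‖ζ - c‖ ≤ R → Real.log ‖ζ - c‖ ≤ M := by
    intro ζ h1 h2
    have h5 : 0 < ‖ζ - c‖ := norm_pos_iff.2 (sub_ne_zero.2 h1)
    linarith [Real.log_le_sub_one_of_pos h5, h.pos]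
  have hmeas : Measurable fun ζ : ℂ => Real.log ‖ζ - c‖ := by fun_prop
  have hInt : Integrable (fun ζ => M - Real.log ‖ζ - c‖) μ := by
    refine ⟨(measurable_const.sub hmeas).aestronglyMeasurable, ?_⟩
    rw [hasFiniteIntegral_iff_ofReal (by
      filter_upwards [hat, hRa] with ζ h1 h2
      have := hlogM ζ h1 h2
      simp only [Pi.zero_apply]; linarith)]
    have hlim : ∀ᵐ ζ ∂μ, ENNReal.ofReal (M - Real.log ‖ζ - c‖) =
        liminf (fun k : ℕ => ENNReal.ofReal (M - Up x (d / ((k : ℝ) + 1)) ζ)) atTop := by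
      filter_upwards [hat] with ζ h1
      refine (Tendsto.liminf_eq ?_).symm
      exact (ENNReal.continuous_ofReal.tendsto _).comp (tendsto_const_nhds.sub (h.up_tendsto h1))
    rw [lintegral_congr_ae hlim]
    have hcontk : ∀ k : ℕ, Continuous (Up x (d / ((k : ℝ) + 1))) := fun k =>
      (h.mono (seq_pos h.pos k) (seq_le h.pos k)).up_cont
    refine (lintegral_liminf_le (fun k => ?_)).trans_lt ?_
    · have := (hcontk k).measurable; fun_prop
    · refine (liminf_le_of_le (a := ENNReal.ofReal (M - (Real.log ‖z - c‖ - (Real.log 2 + C0)))) (by isBoundedDefault) ?_).trans_lt ENNReal.ofReal_lt_top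
      intro b hb
      obtain ⟨k, hk⟩ := hb.exists
      refine hk.trans ?_
      have hIk : Integrable (fun ζ => M - Up x (d / ((k : ℝ) + 1)) ζ) μ :=
        (integrable_const _).sub (hμ.integrable g.bdd (hcontk k).continuousOn)
      rw [← ofReal_integral_eq_lintegral_ofReal hIk (by
        filter_upwards [hat, hRa] with ζ h1 h2
        have := hup ζ h1 h2 k
        simp only [Pi.zero_apply]; linarith)]
      apply ENNReal.ofReal_le_ofReal
      rw [integral_sub (integrable_const _) (hμ.integrable g.bdd (hcontk k).continuousOn), hμ.int _ _ (hsol k)]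
      simp
      linarith [(h.mono (seq_pos h.pos k) (seq_le h.pos k)).up_ge_log hzc]
  have hInt' : Integrable (fun ζ => Real.log ‖ζ - c‖) μ := by
    have := (integrable_const (μ := μ) M).sub hInt
    refine this.congr (Eventually.of_forall fun ζ => ?_); simp
  refine ⟨hInt', ?_⟩
  have t1 := h.dct hRa hat (n := fun _ => 1) (integrable_const _) (by simpa using hInt')
  simp only [one_mul] at t1
  have t2 := h.up_tendsto hzc
  refine tendsto_nhds_unique t1 (t2.congr fun k => ?_)
  rw [hμ.int _ _ (hsol k)]

theorem HM_log_abs {D : Set ℂ} {m : ℕ} {E : Fin m → Set ℂ} (g : Geo D m E) {z : ℂ} (hz : z ∈ D) 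
    {μ : Measure ℂ} (hμ : IsHM D z μ) : ∃ C, ∀ c ∈ frontier D, ∫ ζ, |Real.log ‖ζ - c‖| ∂μ ≤ C := by
  have := hμ.prob
  obtain ⟨R, hR1, hR⟩ := g.radius
  obtain ⟨ε, hε, hb⟩ := Metric.isOpen_iff.1 g.op z hz
  refine ⟨2 * R - Real.log ε, fun c hc => ?_⟩
  obtain ⟨h1, h2⟩ := HM_log g hz hμ hc
  have hd : ε ≤ ‖z - c‖ := by
    by_contra! hlt
    rw [g.frontier_eq] at hc
    exact hc.2 (hb (by rw [mem_ball, dist_comm, dist_eq_norm]; exact hlt))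
  have hle : ∫ ζ, |Real.log ‖ζ - c‖| ∂μ ≤ ∫ ζ, (2 * R - Real.log ‖ζ - c‖) ∂μ := by
    refine integral_mono_ae h1.abs ((integrable_const _).sub h1) ?_
    filter_upwards [hμ.supp, HM_atom g hz hμ hc] with ζ h3 h4
    have h5 : 0 < ‖ζ - c‖ := norm_pos_iff.2 (sub_ne_zero.2 h4)
    have h6 := Real.log_le_sub_one_of_pos h5
    have h7 := hR _ (frontier_subset_closure h3) _ (frontier_subset_closure hc)
    rw [abs_le]; constructor <;> linarith
  rw [integral_sub (integrable_const _) h1, h2] at hle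
  simp at hle
  linarith [Real.log_le_log hε hd]

end HX

namespace HX
open Metric Filter Topology InnerProductSpace Real MeasureTheory

theorem cint {E : Type*} [NormedAddCommGroup E] [NormedSpace ℝ E] {h : ℂ → E} {U K : Set ℂ} (hU : IsOpen U) (hh : ContinuousOn h U)
    (hK : IsCompact K) (hKU : K ⊆ U) (h0 : ∀ x ∉ K, h x = 0) : Continuous h ∧ HasCompactSupport h ∧ Integrable h := by
  have hs : tsupport h ⊆ K := closure_minimal (fun x hx => by
    by_contra hn; exact hx (h0 x hn)) hK.isClosed
  have hc : Continuous h := hh.continuous_of_tsupport_subset hU (hs.trans hKU)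
  have hcs : HasCompactSupport h := hK.of_isClosed_subset (isClosed_tsupport _) hs
  exact ⟨hc, hcs, hc.integrable_of_hasCompactSupport hcs⟩

theorem ibp {𝕜 : Type*} [RCLike 𝕜] {U : Set ℂ} (hU : IsOpen U) {f g : ℂ → 𝕜} (hf : ContDiffOn ℝ 1 f U) (hg : ContDiff ℝ 1 g)
    (hgc : HasCompactSupport g) (hgU : tsupport g ⊆ U) (v : ℂ) :
    ∫ z, f z * fderiv ℝ g z v = - ∫ z, fderiv ℝ f z v * g z := by
  have hd : ContinuousOn (fun z => fderiv ℝ f z v) U :=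
    (hf.continuousOn_fderiv_of_isOpen hU le_rfl).clm_apply continuousOn_const
  have hd2 : Continuous (fun z => fderiv ℝ g z v) := (hg.continuous_fderiv one_ne_zero).clm_apply continuous_const
  have z1 : ∀ x ∉ tsupport g, g x = 0 := fun x hx => image_eq_zero_of_notMem_tsupport hx
  have z2 : ∀ x ∉ tsupport g, fderiv ℝ g x v = 0 := fun x hx => by
    rw [image_eq_zero_of_notMem_tsupport (f := fderiv ℝ g) (fun h => hx (tsupport_fderiv_subset ℝ h))]; rfl
  apply integral_mul_fderiv_eq_neg_fderiv_mul_of_integrable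
  · exact (cint hU (hd.mul hg.continuous.continuousOn) hgc hgU (fun x hx => by simp [z1 x hx])).2.2
  · exact (cint hU (hf.continuousOn.mul hd2.continuousOn) hgc hgU (fun x hx => by simp [z2 x hx])).2.2
  · exact (cint hU (hf.continuousOn.mul hg.continuous.continuousOn) hgc hgU (fun x hx => by simp [z1 x hx])).2.2
  · intro x hx
    exact (hf.differentiableOn one_ne_zero).differentiableAt (hU.mem_nhds (hgU hx))
  · intro x _; exact hg.differentiable one_ne_zero x

theorem inv_loc : LocallyIntegrable (fun z : ℂ => ‖z‖⁻¹) := by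
  refine locallyIntegrable_of_norm_le_rpow (C := 1) (α := 1) ?_ ?_ ?_ ?_
  · simp [Complex.finrank_real_complex]
  · simp [Complex.finrank_real_complex]
  · refine Eventually.of_forall fun x => ?_
    rw [Real.rpow_neg_one]; simp
  · exact (measurable_norm.inv).aestronglyMeasurable

/-- polar-coordinates computations -/
theorem polar_aux {E : Type*} [NormedAddCommGroup E] [NormedSpace ℝ E] [CompleteSpace E] {w : ℂ → E} (hw : ContDiff ℝ 1 w) (hwc : HasCompactSupport w) (a : ℂ) :
    ∫ z, (‖z‖^2)⁻¹ • fderiv ℝ w z (a * z) = ∫ r in Ioi (0:ℝ), ∫ θ in Ioo (-π) π, fderiv ℝ w (r * exp (θ * I)) (a * exp (θ * I))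
    ∧ ∫ z, (‖z‖^2)⁻¹ • fderiv ℝ w z (a * z) = ∫ θ in Ioo (-π) π, ∫ r in Ioi (0:ℝ), fderiv ℝ w (r * exp (θ * I)) (a * exp (θ * I)) := by
  have hd := hw.continuous_fderiv one_ne_zero
  set G : ℝ × ℝ → E := fun p => fderiv ℝ w (p.1 * exp (p.2 * I)) (a * exp (p.2 * I)) with hG
  have hGc : Continuous G := by
    apply Continuous.clm_apply
    · exact hd.comp (by fun_prop)
    · fun_prop
  obtain ⟨R, hR⟩ := (hwc.fderiv ℝ).isCompact.isBounded.subset_closedBall (0:ℂ)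
  have hGi : IntegrableOn G (Ioi 0 ×ˢ Ioo (-π) π) := by
    have h1 : IntegrableOn G (Icc 0 R ×ˢ Icc (-π) π) := hGc.continuousOn.integrableOn_compact (isCompact_Icc.prod isCompact_Icc)
    refine h1.of_forall_sdiff_eq_zero (measurableSet_Ioi.prod measurableSet_Ioo) ?_
    rintro ⟨r, θ⟩ ⟨⟨hr, hθ⟩, hn⟩
    have : R < r := by
      by_contra hc
      exact hn ⟨⟨le_of_lt hr, not_lt.1 hc⟩, ⟨hθ.1.le, hθ.2.le⟩⟩
    have hz : ((r:ℂ) * exp (θ * I)) ∉ tsupport (fderiv ℝ w) := by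
      intro h
      have := hR h
      rw [mem_closedBall_zero_iff, norm_mul, Complex.norm_exp_ofReal_mul_I, mul_one, Complex.norm_real, Real.norm_eq_abs, abs_of_pos hr] at this
      linarith
    simp only [hG]
    rw [image_eq_zero_of_notMem_tsupport hz]; rfl
  have e : ∫ z, (‖z‖^2)⁻¹ • fderiv ℝ w z (a * z) = ∫ p in Ioi (0:ℝ) ×ˢ Ioo (-π) π, G p := by
    rw [← Complex.integral_comp_polarCoord_symm]
    apply setIntegral_congr_fun (measurableSet_Ioi.prod measurableSet_Ioo)
    rintro ⟨r, θ⟩ ⟨hr, hθ⟩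
    have hr : 0 < r := hr
    have e1 : Complex.polarCoord.symm (r, θ) = r * exp (θ * I) := by
      rw [Complex.polarCoord_symm_apply, Complex.exp_mul_I]; push_cast; ring
    simp only [hG, e1]
    rw [norm_mul, Complex.norm_exp_ofReal_mul_I, mul_one, Complex.norm_real, Real.norm_eq_abs, abs_of_pos hr, smul_smul]
    have e2 : a * ((r:ℂ) * exp (θ * I)) = r • (a * exp (θ * I)) := by rw [Complex.real_smul]; ring
    rw [e2, map_smul, smul_smul]
    have : r * (r^2)⁻¹ * r = 1 := by field_simp
    rw [this, one_smul]
  have hGi2 : Integrable G ((volume.restrict (Ioi 0)).prod (volume.restrict (Ioo (-π) π))) := by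
    rw [Measure.prod_restrict]; exact hGi
  have e3 := setIntegral_prod G hGi
  refine ⟨e.trans e3, e.trans (e3.trans ?_)⟩
  exact integral_integral_swap hGi2

theorem polarA {E : Type*} [NormedAddCommGroup E] [NormedSpace ℝ E] [CompleteSpace E] {w : ℂ → E} (hw : ContDiff ℝ 1 w) (hwc : HasCompactSupport w) :
    ∫ z, (‖z‖^2)⁻¹ • fderiv ℝ w z z = -((2 * π) • w 0) := by
  have h := (polar_aux hw hwc 1).2
  simp only [one_mul] at h
  rw [h]
  have h2 : ∀ θ ∈ Ioo (-π) π, ∫ r in Ioi (0:ℝ), fderiv ℝ w (r * exp (θ * I)) (exp (θ * I)) = - w 0 := by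
    intro θ _
    set f : ℝ → E := fun r => w (r * exp (θ * I)) with hf
    have hfd : ∀ r : ℝ, HasDerivAt f (fderiv ℝ w (r * exp (θ * I)) (exp (θ * I))) r := by
      intro r
      have h1 : HasDerivAt (fun r : ℝ => (r:ℂ) * exp (θ * I)) (exp (θ * I)) r := by
        simpa using (Complex.ofRealCLM.hasDerivAt (x := r)).mul_const (exp (θ * I))
      exact (hw.differentiable one_ne_zero _).hasFDerivAt.comp_hasDerivAt r h1
    have hfC : ContDiff ℝ 1 f := by
      apply hw.comp
      exact (Complex.ofRealCLM.contDiff).mul contDiff_const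
    have hfc : HasCompactSupport f := by
      obtain ⟨R, hR⟩ := hwc.isCompact.isBounded.subset_closedBall (0:ℂ)
      apply HasCompactSupport.intro (isCompact_closedBall (0:ℝ) R)
      intro r hr
      refine image_eq_zero_of_notMem_tsupport (f := w) (x := (r:ℂ) * exp (θ * I)) ?_
      intro h
      have := hR (show ((r:ℂ) * exp (θ * I)) ∈ tsupport w from h)
      rw [mem_closedBall_zero_iff, norm_mul, Complex.norm_exp_ofReal_mul_I, mul_one, Complex.norm_real] at this
      exact hr (mem_closedBall_zero_iff.2 this)
    have h3 := hfc.integral_Ioi_deriv_eq hfC 0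
    rw [show f 0 = w 0 by simp [hf]] at h3
    rw [← h3]
    congr 1; funext r; rw [(hfd r).deriv]
  rw [setIntegral_congr_fun measurableSet_Ioo h2]
  simp only [integral_const, smul_neg]
  congr 2
  simp [Measure.real, ENNReal.toReal_ofReal, Real.pi_nonneg]
  ring

theorem polarB {E : Type*} [NormedAddCommGroup E] [NormedSpace ℝ E] [CompleteSpace E] {w : ℂ → E} (hw : ContDiff ℝ 1 w) (hwc : HasCompactSupport w) :
    ∫ z, (‖z‖^2)⁻¹ • fderiv ℝ w z (I * z) = 0 := by
  rw [(polar_aux hw hwc I).1]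
  have h2 : ∀ r ∈ Ioi (0:ℝ), ∫ θ in Ioo (-π) π, fderiv ℝ w (r * exp (θ * I)) (I * exp (θ * I)) = 0 := by
    intro r hr
    have hr : 0 < r := hr
    have hd := hw.continuous_fderiv one_ne_zero
    have hcont : Continuous fun θ : ℝ => fderiv ℝ w (r * exp (θ * I)) (I * exp (θ * I)) :=
      Continuous.clm_apply (hd.comp (by fun_prop)) (by fun_prop)
    have hfd : ∀ θ : ℝ, HasDerivAt (fun θ : ℝ => r⁻¹ • w (r * exp (θ * I))) (fderiv ℝ w (r * exp (θ * I)) (I * exp (θ * I))) θ := by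
      intro θ
      have h0 : HasDerivAt (fun θ : ℝ => (θ:ℂ) * I) I θ := by
        simpa using (Complex.ofRealCLM.hasDerivAt (x := θ)).mul_const I
      have h1 : HasDerivAt (fun θ : ℝ => (r:ℂ) * exp (θ * I)) (r • (I * exp (θ * I))) θ := by
        have := (h0.cexp).const_mul (r:ℂ)
        rw [Complex.real_smul, mul_comm I]; exact this
      have h3 := ((hw.differentiable one_ne_zero _).hasFDerivAt.comp_hasDerivAt θ h1).const_smul r⁻¹
      rw [map_smul, smul_smul, inv_mul_cancel₀ hr.ne', one_smul] at h3
      exact h3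
    rw [← integral_Ioc_eq_integral_Ioo, ← intervalIntegral.integral_of_le (by linarith [Real.pi_pos]),
      intervalIntegral.integral_eq_sub_of_hasDerivAt (fun θ _ => hfd θ) (hcont.intervalIntegrable _ _)]
    push_cast
    rw [sub_eq_zero, neg_mul, Complex.exp_neg, Complex.exp_pi_mul_I]
    norm_num
  rw [setIntegral_congr_fun measurableSet_Ioi h2]
  simp
end HX

namespace HX
open Metric Filter Topology InnerProductSpace Real MeasureTheory
open scoped Convolution ContDiff

noncomputable def dbar (f : ℂ → ℂ) (z : ℂ) : ℂ := fderiv ℝ f z 1 + I * fderiv ℝ f z I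
noncomputable def lap {E : Type*} [NormedAddCommGroup E] [NormedSpace ℝ E] (f : ℂ → E) (z : ℂ) : E :=
  fderiv ℝ (fun y => fderiv ℝ f y 1) z 1 + fderiv ℝ (fun y => fderiv ℝ f y I) z I

theorem clm_decomp {E : Type*} [NormedAddCommGroup E] [NormedSpace ℝ E] (L : ℂ →L[ℝ] E) (z : ℂ) :
    L z = z.re • L 1 + z.im • L I := by
  conv_lhs => rw [show z = z.re • (1:ℂ) + z.im • I by simp [Complex.re_add_im]]
  rw [map_add, map_smul, map_smul]

theorem inv_locC : LocallyIntegrable (fun z : ℂ => z⁻¹) :=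
  inv_loc.mono (measurable_id.inv).aestronglyMeasurable (Eventually.of_forall fun x => by simp)

theorem cs_int {E : Type*} [NormedAddCommGroup E] [NormedSpace ℝ E] {w : ℂ → E} (hw : ContDiff ℝ 1 w) (hwc : HasCompactSupport w) :
    Integrable (fun z : ℂ => ‖z‖⁻¹ * ‖fderiv ℝ w z‖) :=
  inv_loc.integrable_smul_right_of_hasCompactSupport (hw.continuous_fderiv one_ne_zero).norm (hwc.fderiv ℝ).norm

theorem cs_int2 {E : Type*} [NormedAddCommGroup E] [NormedSpace ℝ E] [SecondCountableTopologyEither ℂ E] {w : ℂ → E} (hw : ContDiff ℝ 1 w) (hwc : HasCompactSupport w) {a : ℂ} (ha : ‖a‖ = 1) :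
    Integrable (fun z : ℂ => (‖z‖^2)⁻¹ • fderiv ℝ w z (a * z)) := by
  refine (cs_int hw hwc).mono' ?_ ?_
  · refine AEStronglyMeasurable.smul ?_ ?_
    · exact ((measurable_norm.pow_const 2).inv).aestronglyMeasurable
    · exact ((hw.continuous_fderiv one_ne_zero).clm_apply (by fun_prop)).aestronglyMeasurable
  · refine Eventually.of_forall fun z => ?_
    rw [norm_smul]
    have h1 := (fderiv ℝ w z).le_opNorm (a * z)
    rw [norm_mul, ha, one_mul] at h1
    rcases eq_or_ne z 0 with rfl | hz
    · simp
    have hz' : 0 < ‖z‖ := norm_pos_iff.2 hz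
    rw [norm_inv, norm_pow, norm_norm]
    calc (‖z‖^2)⁻¹ * ‖fderiv ℝ w z (a * z)‖ ≤ (‖z‖^2)⁻¹ * (‖fderiv ℝ w z‖ * ‖z‖) := by gcongr
      _ = _ := by field_simp

theorem pompeiu {w : ℂ → ℂ} (hw : ContDiff ℝ 1 w) (hwc : HasCompactSupport w) :
    ∫ z : ℂ, z⁻¹ * dbar w z = -(2 * π * w 0) := by
  have hA := polarA hw hwc
  have hB := polarB hw hwc
  have iA : Integrable (fun z : ℂ => (‖z‖^2)⁻¹ • fderiv ℝ w z z) := by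
    simpa using cs_int2 hw hwc (a := 1) (by simp)
  have iB := cs_int2 hw hwc (a := I) (by simp)
  have e : ∀ z : ℂ, z⁻¹ * dbar w z = (‖z‖^2)⁻¹ • fderiv ℝ w z z + I * ((‖z‖^2)⁻¹ • fderiv ℝ w z (I * z)) := by
    intro z
    rw [Complex.inv_def, Complex.normSq_eq_norm_sq, clm_decomp (fderiv ℝ w z) z, clm_decomp (fderiv ℝ w z) (I * z), dbar]
    have : (starRingEnd ℂ) z = z.re - z.im * I := by
      apply Complex.ext <;> simp
    rw [this]
    simp only [Complex.real_smul, Complex.mul_re, Complex.mul_im, Complex.I_re, Complex.I_im]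
    push_cast
    ring_nf
    rw [Complex.I_sq]; ring
  simp_rw [e]
  rw [integral_add iA (iB.const_mul I), integral_const_mul, hA, hB]
  simp

noncomputable def TT (u : ℂ → ℂ) (z : ℂ) : ℂ := ∫ t : ℂ, (((2 * π)⁻¹ : ℝ) : ℂ) * (t⁻¹ * u (z - t))

theorem TT_fderiv {u : ℂ → ℂ} (hu : ContDiff ℝ 1 u) (huc : HasCompactSupport u) (z : ℂ) :
    DifferentiableAt ℝ (TT u) z ∧ ∀ v, fderiv ℝ (TT u) z v = ∫ t : ℂ, (((2 * π)⁻¹ : ℝ) : ℂ) * (t⁻¹ * fderiv ℝ u (z - t) v) := by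
  have hloc : LocallyIntegrable (fun t : ℂ => (((2 * π)⁻¹ : ℝ) : ℂ) * t⁻¹) := inv_locC.smul ((((2 * π)⁻¹ : ℝ) : ℂ))
  have h := huc.hasFDerivAt_convolution_right (ContinuousLinearMap.mul ℝ ℂ) hloc hu z
  have e : (fun t : ℂ => (((2 * π)⁻¹ : ℝ) : ℂ) * t⁻¹) ⋆[ContinuousLinearMap.mul ℝ ℂ, volume] u = TT u := by
    funext z
    simp only [convolution_def, TT, ContinuousLinearMap.mul_apply', mul_assoc]
  rw [e] at h
  refine ⟨h.differentiableAt, fun v => ?_⟩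
  rw [h.fderiv, convolution_precompR_apply _ hloc (huc.fderiv ℝ) (hu.continuous_fderiv one_ne_zero)]
  simp only [convolution_def, ContinuousLinearMap.mul_apply', mul_assoc]

theorem TT_dbar {u : ℂ → ℂ} (hu : ContDiff ℝ 1 u) (huc : HasCompactSupport u) (z : ℂ) : dbar (TT u) z = u z := by
  have h := (TT_fderiv hu huc z).2
  set w : ℂ → ℂ := fun t => u (z - t) with hw
  have hwC : ContDiff ℝ 1 w := hu.comp (contDiff_const.sub contDiff_id)
  have hwc : HasCompactSupport w := huc.comp_homeomorph (Homeomorph.subLeft z)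
  have hwd : ∀ t v, fderiv ℝ w t v = - fderiv ℝ u (z - t) v := by
    intro t v
    have h1 : HasFDerivAt w ((fderiv ℝ u (z - t)).comp (-ContinuousLinearMap.id ℝ ℂ)) t :=
      (hu.differentiable one_ne_zero (z - t)).hasFDerivAt.comp t ((hasFDerivAt_id t).const_sub z)
    rw [h1.fderiv]; simp
  have hi : ∀ v, Integrable (fun t : ℂ => (((2 * π)⁻¹ : ℝ) : ℂ) * (t⁻¹ * fderiv ℝ u (z - t) v)) := by
    intro v
    have : Integrable (fun t : ℂ => t⁻¹ • fderiv ℝ w t v) :=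
      inv_locC.integrable_smul_right_of_hasCompactSupport ((hwC.continuous_fderiv one_ne_zero).clm_apply continuous_const)
        ((hwc.fderiv ℝ).mono (fun t ht => by
          simp only [Function.mem_support] at ht ⊢
          intro h0; rw [h0] at ht; exact ht rfl))
    refine (this.neg.const_mul (((2 * π)⁻¹ : ℝ) : ℂ)).congr (Eventually.of_forall fun t => ?_)
    simp [hwd]
  have hp := pompeiu hwC hwc
  rw [dbar, h, h, ← integral_const_mul, ← integral_add (hi 1) ((hi I).const_mul I)]
  have : ∀ t : ℂ, (((2 * π)⁻¹ : ℝ) : ℂ) * (t⁻¹ * fderiv ℝ u (z - t) 1) + I * ((((2 * π)⁻¹ : ℝ) : ℂ) * (t⁻¹ * fderiv ℝ u (z - t) I))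
      = (-(((2 * π)⁻¹ : ℝ) : ℂ)) * (t⁻¹ * dbar w t) := by
    intro t; rw [dbar, hwd, hwd]; ring
  simp_rw [this]
  rw [integral_const_mul, hp]
  have hpi : (π:ℂ) ≠ 0 := by exact_mod_cast Real.pi_ne_zero
  simp only [hw, sub_zero]
  push_cast
  field_simp

theorem dbar_diff {f : ℂ → ℂ} {z : ℂ} (hf : DifferentiableAt ℝ f z) (h : dbar f z = 0) : DifferentiableAt ℂ f z := by
  rw [differentiableAt_complex_iff_differentiableAt_real]
  refine ⟨hf, ?_⟩
  rw [dbar] at h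
  rw [smul_eq_mul]
  linear_combination (-I) * h + (-fderiv ℝ f z I) * (by simp : 1 + I*I = (0:ℂ))*(-1)

theorem dbar_of_diff {f : ℂ → ℂ} {z : ℂ} (hf : DifferentiableAt ℂ f z) : dbar f z = 0 := by
  rw [differentiableAt_complex_iff_differentiableAt_real] at hf
  rw [dbar, hf.2, smul_eq_mul]
  linear_combination (fderiv ℝ f z 1) * (by simp : 1 + I*I = (0:ℂ))

theorem dbar_mul {f g : ℂ → ℂ} {z : ℂ} (hf : DifferentiableAt ℝ f z) (hg : DifferentiableAt ℝ g z) :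
    dbar (fun z => f z * g z) z = f z * dbar g z + dbar f z * g z := by
  simp only [dbar]
  rw [fderiv_fun_mul hf hg]
  simp; ring

theorem TT_bound {R : ℝ} : ∃ C, 0 ≤ C ∧ ∀ (u : ℂ → ℂ) (z : ℂ) (M : ℝ), (∀ y, ‖u y‖ ≤ M) → (∀ y, R < ‖z - y‖ → u y = 0) → ‖TT u z‖ ≤ C * M := by
  have hi : IntegrableOn (fun t : ℂ => ‖t‖⁻¹) (closedBall 0 R) := inv_loc.integrableOn_isCompact (isCompact_closedBall _ _)
  refine ⟨(2*π)⁻¹ * ∫ t in closedBall (0:ℂ) R, ‖t‖⁻¹, by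
    have : 0 ≤ ∫ t in closedBall (0:ℂ) R, ‖t‖⁻¹ := integral_nonneg fun t => by positivity
    have := Real.pi_pos; positivity, ?_⟩
  intro u z M hM h0
  have hM0 : 0 ≤ M := (norm_nonneg _).trans (hM 0)
  have e : (2*π)⁻¹ * (∫ t in closedBall (0:ℂ) R, ‖t‖⁻¹) * M = ∫ t, (closedBall (0:ℂ) R).indicator (fun t => (2*π)⁻¹ * ‖t‖⁻¹ * M) t := by
    rw [integral_indicator measurableSet_closedBall, integral_mul_const, integral_const_mul]
  rw [e]
  apply norm_integral_le_of_norm_le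
  · rw [integrable_indicator_iff measurableSet_closedBall]
    exact (hi.const_mul _).mul_const _
  · refine Eventually.of_forall fun t => ?_
    by_cases ht : t ∈ closedBall (0:ℂ) R
    · rw [indicator_of_mem ht, norm_mul, norm_mul, norm_inv, Complex.norm_real, Real.norm_eq_abs, abs_of_pos (by have := Real.pi_pos; positivity), mul_assoc]
      have := Real.pi_pos
      gcongr
      exact hM _
    · rw [indicator_of_notMem ht, h0]
      · simp
      · simpa using ht
end HX

namespace HX
open Metric Filter Topology InnerProductSpace Real MeasureTheory
open scoped Convolution ContDiff

theorem abs_log_le {t : ℝ} (ht : 0 ≤ t) : |Real.log t| ≤ t + t⁻¹ := by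
  rcases ht.eq_or_lt with rfl | ht
  · simp
  rw [abs_le]
  have h1 := Real.log_le_sub_one_of_pos ht
  have h2 := Real.log_le_sub_one_of_pos (inv_pos.2 ht)
  rw [Real.log_inv] at h2
  have := inv_pos.2 ht
  constructor <;> linarith

theorem bnd_loc : LocallyIntegrable (fun z : ℂ => ‖z‖ + ‖z‖⁻¹ + ‖z‖^2) := by
  refine (LocallyIntegrable.add (Continuous.locallyIntegrable continuous_norm) inv_loc).add ?_
  exact Continuous.locallyIntegrable (by fun_prop)

theorem log_loc : LocallyIntegrable (fun z : ℂ => Real.log ‖z‖) := by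
  refine bnd_loc.mono (Real.measurable_log.comp measurable_norm).aestronglyMeasurable (Eventually.of_forall fun x => ?_)
  rw [Real.norm_eq_abs, Real.norm_eq_abs]
  refine (abs_log_le (norm_nonneg x)).trans (le_trans ?_ (le_abs_self _))
  have := sq_nonneg ‖x‖; linarith

section
variable {E : Type*} [NormedAddCommGroup E] [NormedSpace ℝ E]

theorem dv_contDiff {w : ℂ → E} {n m : ℕ∞ω} (hw : ContDiff ℝ n w) (h : m + 1 ≤ n) (v : ℂ) :
    ContDiff ℝ m (fun z => fderiv ℝ w z v) :=
  (hw.fderiv_right h).clm_apply contDiff_const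

theorem dv_supp {w : ℂ → E} (v : ℂ) : tsupport (fun z => fderiv ℝ w z v) ⊆ tsupport w := by
  refine closure_minimal (fun x hx => ?_) (isClosed_tsupport _)
  by_contra hn
  apply hx
  show fderiv ℝ w x v = 0
  rw [image_eq_zero_of_notMem_tsupport (f := fderiv ℝ w) (fun h => hn (tsupport_fderiv_subset ℝ h))]; rfl

theorem dv_cs {w : ℂ → E} (hw : HasCompactSupport w) (v : ℂ) : HasCompactSupport (fun z => fderiv ℝ w z v) :=
  hw.of_isClosed_subset (isClosed_tsupport _) (dv_supp v)

theorem lap_supp {w : ℂ → E} : tsupport (lap w) ⊆ tsupport w := by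
  refine closure_minimal (fun x hx => ?_) (isClosed_tsupport _)
  by_contra hn
  apply hx
  have h1 : ∀ v, fderiv ℝ (fun y => fderiv ℝ w y v) x v = 0 := fun v =>
    image_eq_zero_of_notMem_tsupport (f := fun z => fderiv ℝ (fun y => fderiv ℝ w y v) z v) (fun h => hn (dv_supp v (dv_supp v h)))
  rw [lap, h1, h1, add_zero]

theorem lap_cs {w : ℂ → E} (hw : HasCompactSupport w) : HasCompactSupport (lap w) :=
  hw.of_isClosed_subset (isClosed_tsupport _) lap_supp

theorem lap_cont {w : ℂ → E} (hw : ContDiff ℝ 2 w) : Continuous (lap w) := by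
  have h : ∀ v, Continuous (fun z => fderiv ℝ (fun y => fderiv ℝ w y v) z v) := fun v =>
    (dv_contDiff (dv_contDiff (m := 1) hw (by norm_num) v) (m := 0) (by norm_num) v).continuous
  exact (h 1).add (h I)
end

theorem inner_decomp (L : ℂ →L[ℝ] ℝ) (z : ℂ) : inner ℝ z 1 * L 1 + inner ℝ z I * L I = L z := by
  rw [clm_decomp L z]
  simp [Complex.inner]

theorem log_green0 {w : ℂ → ℝ} (hw : ContDiff ℝ 2 w) (hwc : HasCompactSupport w) :
    ∫ z, Real.log ‖z‖ * lap w z = 2 * π * w 0 := by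
  have hw1 : ContDiff ℝ 1 w := hw.of_le (by norm_num)
  -- regularized identity
  have key : ∀ e : ℝ, 0 < e → ∫ z : ℂ, (Real.log (‖z‖^2 + e) / 2) * lap w z = - ∫ z : ℂ, (‖z‖^2 + e)⁻¹ * fderiv ℝ w z z := by
    intro e he
    set f : ℂ → ℝ := fun z => Real.log (‖z‖^2 + e) / 2 with hf
    have hpos : ∀ z : ℂ, 0 < ‖z‖^2 + e := fun z => by positivity
    have hfC : ContDiff ℝ 1 f :=
      (((contDiff_norm_sq ℝ).add contDiff_const).log (fun z => (hpos z).ne')).div_const 2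
    have hfd : ∀ z v, fderiv ℝ f z v = (‖z‖^2 + e)⁻¹ * inner ℝ z v := by
      intro z v
      have h1 : HasFDerivAt (fun z : ℂ => ‖z‖^2 + e) (2 • innerSL ℝ z) z :=
        (hasStrictFDerivAt_norm_sq z).hasFDerivAt.add_const e
      have h2 := (h1.log (hpos z).ne').mul_const (2⁻¹ : ℝ)
      have h3 : HasFDerivAt f _ z := h2
      rw [h3.fderiv]
      simp
      ring
    have I1 : ∀ v, ∫ z, f z * fderiv ℝ (fun y => fderiv ℝ w y v) z v = - ∫ z, (‖z‖^2 + e)⁻¹ * inner ℝ z v * fderiv ℝ w z v := by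
      intro v
      rw [ibp isOpen_univ hfC.contDiffOn (dv_contDiff hw (m := 1) (by norm_num) v) (dv_cs hwc v) (subset_univ _) v]
      simp_rw [hfd]
    have hcf : Continuous f := hfC.continuous
    have i1 : ∀ v, Integrable (fun z => f z * fderiv ℝ (fun y => fderiv ℝ w y v) z v) := fun v =>
      (hcf.mul (dv_contDiff (dv_contDiff (m := 1) hw (by norm_num) v) (m := 0) (by norm_num) v).continuous).integrable_of_hasCompactSupport
        ((dv_cs (dv_cs hwc v) v).mul_left)
    have hci : Continuous (fun z : ℂ => (‖z‖^2 + e)⁻¹) := by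
      apply Continuous.inv₀ (by fun_prop); intro z; exact (hpos z).ne'
    have i2 : ∀ v, Integrable (fun z : ℂ => (‖z‖^2 + e)⁻¹ * inner ℝ z v * fderiv ℝ w z v) := fun v =>
      ((hci.mul (by fun_prop)).mul (dv_contDiff hw1 (m := 0) (by norm_num) v).continuous).integrable_of_hasCompactSupport
        ((dv_cs hwc v).mul_left)
    have e1 : ∀ z, f z * lap w z = f z * fderiv ℝ (fun y => fderiv ℝ w y 1) z 1 + f z * fderiv ℝ (fun y => fderiv ℝ w y I) z I := fun z => by
      rw [lap, mul_add]
    change ∫ z, f z * lap w z = _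
    simp_rw [e1]
    rw [integral_add (i1 1) (i1 I), I1, I1, ← neg_add, ← integral_add (i2 1) (i2 I)]
    congr 2
    funext z
    rw [← inner_decomp (fderiv ℝ w z) z]; ring
  set ε : ℕ → ℝ := fun n => 1 / ((n:ℝ) + 1) with hε
  have hε0 : ∀ n, 0 < ε n := fun n => by simp only [hε]; positivity
  have hε1 : ∀ n, ε n ≤ 1 := fun n => by
    simp only [hε]; rw [div_le_one (by positivity)]; have : (0:ℝ) ≤ n := Nat.cast_nonneg n; linarith
  have hεt : Tendsto ε atTop (𝓝 0) := tendsto_one_div_add_atTop_nhds_zero_nat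
  have ne0 : ∀ᵐ z : ℂ, z ≠ 0 := by
    rw [ae_iff]; simp
  have l1 : Tendsto (fun n => ∫ z : ℂ, (Real.log (‖z‖^2 + ε n) / 2) * lap w z) atTop (𝓝 (∫ z : ℂ, Real.log ‖z‖ * lap w z)) := by
    have hb : Integrable (fun z : ℂ => (‖z‖ + ‖z‖⁻¹ + ‖z‖^2) * ‖lap w z‖) :=
      bnd_loc.integrable_smul_right_of_hasCompactSupport (lap_cont hw).norm (lap_cs hwc).norm
    refine tendsto_integral_of_dominated_convergence _ (fun n => ?_) hb (fun n => ?_) ?_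
    · refine AEStronglyMeasurable.mul ?_ (lap_cont hw).aestronglyMeasurable
      exact ((Real.measurable_log.comp ((measurable_norm.pow_const 2).add_const _)).div_const 2).aestronglyMeasurable
    · filter_upwards [ne0] with z hz
      have hz' : 0 < ‖z‖ := norm_pos_iff.2 hz
      rw [norm_mul]
      refine mul_le_mul_of_nonneg_right ?_ (norm_nonneg _)
      have b1 := abs_le.1 (abs_log_le (norm_nonneg z))
      have b2 : Real.log (‖z‖^2) ≤ Real.log (‖z‖^2 + ε n) := Real.log_le_log (by positivity) (by linarith [hε0 n])
      have b3 : Real.log (‖z‖^2 + ε n) ≤ ‖z‖^2 := by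
        have := Real.log_le_sub_one_of_pos (show 0 < ‖z‖^2 + ε n by have := hε0 n; positivity)
        linarith [hε1 n]
      rw [Real.log_pow] at b2
      push_cast at b2
      have := inv_pos.2 hz'
      have := sq_nonneg ‖z‖
      rw [Real.norm_eq_abs, abs_le]
      constructor <;> linarith
    · filter_upwards [ne0] with z hz
      have hz' : 0 < ‖z‖ := norm_pos_iff.2 hz
      have h1 : Tendsto (fun n => Real.log (‖z‖^2 + ε n) / 2) atTop (𝓝 (Real.log (‖z‖^2 + 0) / 2)) := by
        refine Tendsto.div_const ?_ 2
        exact ((Real.continuousAt_log (by positivity)).tendsto).comp (hεt.const_add (‖z‖^2))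
      have h2 : Real.log (‖z‖^2 + 0) / 2 = Real.log ‖z‖ := by
        rw [add_zero, Real.log_pow]; push_cast; ring
      rw [h2] at h1
      exact h1.mul_const _
  have l2 : Tendsto (fun n => - ∫ z : ℂ, (‖z‖^2 + ε n)⁻¹ * fderiv ℝ w z z) atTop (𝓝 (- ∫ z : ℂ, (‖z‖^2)⁻¹ • fderiv ℝ w z z)) := by
    refine Tendsto.neg ?_
    have hcd : Continuous fun z => fderiv ℝ w z z := (hw1.continuous_fderiv one_ne_zero).clm_apply continuous_id
    refine tendsto_integral_of_dominated_convergence _ (fun n => ?_) (cs_int hw1 hwc) (fun n => ?_) ?_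
    · refine AEStronglyMeasurable.mul ?_ hcd.aestronglyMeasurable
      exact ((measurable_norm.pow_const 2).add_const _).inv.aestronglyMeasurable
    · filter_upwards [ne0] with z hz
      have hz' : 0 < ‖z‖ := norm_pos_iff.2 hz
      have h1 := (fderiv ℝ w z).le_opNorm z
      have h2 := hε0 n
      rw [norm_mul, norm_inv, Real.norm_eq_abs, abs_of_pos (by positivity)]
      calc (‖z‖^2 + ε n)⁻¹ * ‖fderiv ℝ w z z‖ ≤ (‖z‖^2)⁻¹ * (‖fderiv ℝ w z‖ * ‖z‖) := by
            gcongr; linarith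
        _ = _ := by field_simp
    · filter_upwards [ne0] with z hz
      have hz' : 0 < ‖z‖ := norm_pos_iff.2 hz
      rw [smul_eq_mul]
      have : Tendsto (fun n => (‖z‖^2 + ε n)⁻¹) atTop (𝓝 ((‖z‖^2 + 0)⁻¹)) :=
        (hεt.const_add _).inv₀ (by positivity)
      rw [add_zero] at this
      exact this.mul_const _
  rw [polarA hw1 hwc] at l2
  have l3 := l1
  simp_rw [fun n => key (ε n) (hε0 n)] at l3
  have := tendsto_nhds_unique l3 l2
  rw [this]; simp

theorem lap_shift {E : Type*} [NormedAddCommGroup E] [NormedSpace ℝ E] (w : ℂ → E) (b z : ℂ) :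
    lap (fun z => w (z + b)) z = lap w (z + b) := by
  simp only [lap]
  have h : ∀ v, (fun y => fderiv ℝ (fun z => w (z + b)) y v) = fun y => (fun x => fderiv ℝ w x v) (y + b) := by
    intro v; funext y; rw [fderiv_comp_add_right]
  rw [h, h, fderiv_comp_add_right (f := fun x => fderiv ℝ w x 1), fderiv_comp_add_right (f := fun x => fderiv ℝ w x I)]

theorem log_green {w : ℂ → ℝ} (hw : ContDiff ℝ 2 w) (hwc : HasCompactSupport w) (b : ℂ) :
    ∫ z, Real.log ‖z - b‖ * lap w z = 2 * π * w b := by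
  have h := log_green0 (w := fun z => w (z + b)) (hw.comp (contDiff_id.add contDiff_const)) (hwc.comp_homeomorph (Homeomorph.addRight b))
  simp_rw [lap_shift] at h
  rw [zero_add] at h
  rw [← h, ← integral_add_right_eq_self _ b]
  simp
end HX

namespace HX
open Metric Filter Topology InnerProductSpace Real MeasureTheory
open scoped ContDiff Manifold

structure Cut (D : Set ℂ) {m : ℕ} (E : Fin m → Set ℂ) (j : Fin m) (X : ℂ → ℝ) : Prop where
  smooth : ContDiff ℝ ∞ X
  cs : HasCompactSupport X
  nonneg : ∀ z, 0 ≤ X z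
  le_one : ∀ z, X z ≤ 1
  one : ∀ x ∈ E j, ∀ᶠ y in 𝓝 x, X y = 1
  zero : ∀ i, i ≠ j → ∀ x ∈ E i, ∀ᶠ y in 𝓝 x, X y = 0

theorem Geo.exists_inf {D : Set ℂ} {m : ℕ} {E : Fin m → Set ℂ} (g : Geo D m E) :
    ∃ (j : Fin m) (R : ℝ), 0 < R ∧ {z : ℂ | R < ‖z‖} ⊆ E j ∧ ∀ i, i ≠ j → IsCompact (E i) := by
  obtain ⟨R, hR⟩ := g.bdd.subset_closedBall (0:ℂ)
  set R' := max R 1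
  have hR' : 0 < R' := lt_of_lt_of_le one_pos (le_max_right _ _)
  have hsub : {z : ℂ | R' < ‖z‖} ⊆ ⋃ j, E j := by
    rw [g.union]
    intro z hz hzD
    have := hR hzD
    rw [mem_closedBall_zero_iff] at this
    have h2 : R' < ‖z‖ := hz
    linarith [le_max_left R 1]
  have hne : ((R' + 1 : ℝ) : ℂ) ∈ {z : ℂ | R' < ‖z‖} := by
    show R' < ‖((R' + 1 : ℝ) : ℂ)‖
    rw [Complex.norm_real, Real.norm_eq_abs, abs_of_pos (by linarith)]; linarith
  obtain ⟨j, hj⟩ := mem_iUnion.1 (hsub hne)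
  have hall : {z : ℂ | R' < ‖z‖} ⊆ E j := by
    have hpre := ext_ball_conn hR'
    have hcl2 : IsClosed (⋃ i ∈ {i | i ≠ j}, E i) := Set.Finite.isClosed_biUnion (toFinite _) (fun i _ => g.closed i)
    rw [isPreconnected_closed_iff] at hpre
    intro z hz
    by_contra hn
    have h := hpre (E j) (⋃ i ∈ {i | i ≠ j}, E i) (g.closed j) hcl2 (fun y hy => by
      obtain ⟨i, hi⟩ := mem_iUnion.1 (hsub hy)
      by_cases hij : i = j
      · left; rw [← hij]; exact hi
      · right; exact mem_biUnion (show i ∈ {i | i ≠ j} from hij) hi) ⟨_, hne, hj⟩ (by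
      obtain ⟨i, hi⟩ := mem_iUnion.1 (hsub hz)
      refine ⟨z, hz, mem_biUnion (show i ∈ {i | i ≠ j} from ?_) hi⟩
      rintro rfl; exact hn hi)
    obtain ⟨y, _, hy1, hy2⟩ := h
    obtain ⟨i, hi, hy3⟩ := mem_iUnion₂.1 hy2
    exact (disjoint_left.1 (g.disj i j hi) hy3) hy1
  refine ⟨j, R', hR', hall, fun i hi => ?_⟩
  refine (isCompact_closedBall (0:ℂ) R').of_isClosed_subset (g.closed i) (fun z hz => ?_)
  rw [mem_closedBall_zero_iff]
  by_contra hn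
  exact (disjoint_left.1 (g.disj i j hi) hz) (hall (not_le.1 hn))

theorem Geo.exists_cut {D : Set ℂ} {m : ℕ} {E : Fin m → Set ℂ} (g : Geo D m E) {j : Fin m} (hj : IsCompact (E j)) :
    ∃ X, Cut D E j X := by
  obtain ⟨R, hR⟩ := hj.isBounded.subset_ball (0:ℂ)
  have hcl2 : IsClosed (⋃ i ∈ {i | i ≠ j}, E i) := Set.Finite.isClosed_biUnion (toFinite _) (fun i _ => g.closed i)
  have hcl3 : IsClosed ((⋃ i ∈ {i | i ≠ j}, E i) ∪ (ball (0:ℂ) R)ᶜ) := hcl2.union isOpen_ball.isClosed_compl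
  obtain ⟨f, h0, h1, hf⟩ := exists_contMDiffMap_zero_one_nhds_of_isClosed (n := ⊤) 𝓘(ℝ, ℂ) hcl3 hj.isClosed (by
    rw [disjoint_left]
    rintro x (hx | hx) hxj
    · obtain ⟨i, hi, hx⟩ := mem_iUnion₂.1 hx
      exact (disjoint_left.1 (g.disj i j hi) hx) hxj
    · exact hx (hR hxj))
  rw [eventually_nhdsSet_iff_forall] at h0 h1
  refine ⟨f, ⟨f.contMDiff.contDiff, ?_, fun z => (hf z).1, fun z => (hf z).2, h1, fun i hi x hx => h0 x (Or.inl (mem_biUnion (show i ∈ {i | i ≠ j} from hi) hx))⟩⟩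
  refine HasCompactSupport.intro (isCompact_closedBall (0:ℂ) R) (fun x hx => ?_)
  exact (h0 x (Or.inr (fun h => hx (ball_subset_closedBall h)))).self_of_nhds

theorem Cut.tsupp {D : Set ℂ} {m : ℕ} {E : Fin m → Set ℂ} (g : Geo D m E) {j : Fin m} {X : ℂ → ℝ} (h : Cut D E j X) :
    IsCompact (tsupport (fderiv ℝ X)) ∧ tsupport (fderiv ℝ X) ⊆ D := by
  refine ⟨h.cs.fderiv ℝ, fun x hx => ?_⟩
  by_contra hn
  have : x ∈ ⋃ j, E j := by rw [g.union]; exact hn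
  obtain ⟨i, hi⟩ := mem_iUnion.1 this
  have hc : ∃ c, ∀ᶠ y in 𝓝 x, X y = c := by
    by_cases hij : i = j
    · exact ⟨1, h.one x (hij ▸ hi)⟩
    · exact ⟨0, h.zero i hij x hi⟩
  obtain ⟨c, hc⟩ := hc
  revert hx
  rw [imp_false, notMem_tsupport_iff_eventuallyEq]
  filter_upwards [hc.eventually_nhds] with y hy
  have : X =ᶠ[𝓝 y] fun _ => c := hy
  rw [this.fderiv_eq]; simp only [fderiv_fun_const]

theorem dv_tsupp {E : Type*} [NormedAddCommGroup E] [NormedSpace ℝ E] {w : ℂ → E} (v : ℂ) : tsupport (fun z => fderiv ℝ w z v) ⊆ tsupport (fderiv ℝ w) := by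
  refine closure_mono (fun x hx => ?_)
  simp only [Function.mem_support] at hx ⊢
  intro h0; rw [h0] at hx; exact hx rfl

theorem lap_tsupp {E : Type*} [NormedAddCommGroup E] [NormedSpace ℝ E] {w : ℂ → E} : tsupport (lap w) ⊆ tsupport (fderiv ℝ w) := by
  refine closure_minimal (fun x hx => ?_) (isClosed_tsupport _)
  by_contra hn
  apply hx
  have h1 : ∀ v, fderiv ℝ (fun y => fderiv ℝ w y v) x v = 0 := fun v =>
    image_eq_zero_of_notMem_tsupport (f := fun z => fderiv ℝ (fun y => fderiv ℝ w y v) z v) (fun h => hn (dv_tsupp v (dv_supp v h)))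
  rw [lap, h1, h1, add_zero]

theorem fderiv_two {E : Type*} [NormedAddCommGroup E] [NormedSpace ℝ E] {w : ℂ → E} {z : ℂ} (hw : ContDiffAt ℝ 2 w z) (v u : ℂ) :
    fderiv ℝ (fun y => fderiv ℝ w y v) z u = fderiv ℝ (fderiv ℝ w) z u v := by
  have h : DifferentiableAt ℝ (fderiv ℝ w) z := (hw.fderiv_right (m := 1) (by norm_num)).differentiableAt (by norm_num)
  rw [fderiv_clm_apply h (by fun_prop)]
  simp

theorem flux_hol {D : Set ℂ} (hD : IsOpen D) {F : ℂ → ℂ} (hF : DifferentiableOn ℂ F D) {X : ℂ → ℝ} (hX : ContDiff ℝ ∞ X)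
    (hK : IsCompact (tsupport (fderiv ℝ X))) (hKD : tsupport (fderiv ℝ X) ⊆ D) :
    ∫ z, F z * ((lap X z : ℝ) : ℂ) = 0 := by
  set Y : ℂ → ℂ := fun z => ((fderiv ℝ X z 1 : ℝ) : ℂ) - I * ((fderiv ℝ X z I : ℝ) : ℂ) with hY
  have hXv : ∀ v, ContDiff ℝ 1 (fun z => fderiv ℝ X z v) := fun v => dv_contDiff hX (m := 1) (by norm_cast) v
  have hXc : ∀ v, ContDiff ℝ 1 (fun z => ((fderiv ℝ X z v : ℝ) : ℂ)) := fun v => Complex.ofRealCLM.contDiff.comp (hXv v)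
  have hYC : ContDiff ℝ 1 Y := (hXc 1).sub (contDiff_const.mul (hXc I))
  have hYs : tsupport Y ⊆ tsupport (fderiv ℝ X) := by
    refine closure_mono (fun x hx => ?_)
    simp only [Function.mem_support] at hx ⊢
    intro h0; apply hx; simp [hY, h0]
  have hYc : HasCompactSupport Y := hK.of_isClosed_subset (isClosed_tsupport _) hYs
  have hFC : ContDiffOn ℝ 1 F D := ((hF.contDiffOn hD (n := 1)).restrict_scalars ℝ)
  have hYd : ∀ z v, fderiv ℝ Y z v = ((fderiv ℝ (fun y => fderiv ℝ X y 1) z v : ℝ) : ℂ) - I * ((fderiv ℝ (fun y => fderiv ℝ X y I) z v : ℝ) : ℂ) := by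
    intro z v
    have h1 : ∀ u, HasFDerivAt (fun z => ((fderiv ℝ X z u : ℝ) : ℂ)) (Complex.ofRealCLM.comp (fderiv ℝ (fun y => fderiv ℝ X y u) z)) z := fun u =>
      Complex.ofRealCLM.hasFDerivAt.comp z ((hXv u).differentiable one_ne_zero z).hasFDerivAt
    have h2 := (h1 1).sub ((h1 I).const_mul I)
    have h3 : HasFDerivAt Y _ z := h2
    rw [h3.fderiv]; simp
  have hlap : ∀ z, ((lap X z : ℝ) : ℂ) = fderiv ℝ Y z 1 + I * fderiv ℝ Y z I := by
    intro z
    have h2 : ContDiffAt ℝ 2 X z := (hX.of_le (by norm_cast)).contDiffAt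
    rw [hYd, hYd, lap, fderiv_two h2, fderiv_two h2, fderiv_two h2, fderiv_two h2]
    have := (h2.isSymmSndFDerivAt (by simp)) 1 I
    rw [this]
    push_cast
    linear_combination ((fderiv ℝ (fderiv ℝ X) z I I : ℝ) : ℂ) * (Complex.I_mul_I)
  have i1 : ∀ v, Integrable (fun z => F z * fderiv ℝ Y z v) := fun v =>
    (cint hD (hF.continuousOn.mul (dv_contDiff hYC (m := 0) (by norm_num) v).continuous.continuousOn) hYc (hYs.trans hKD) (fun x hx => by
      have : fderiv ℝ Y x v = 0 := image_eq_zero_of_notMem_tsupport (f := fun z => fderiv ℝ Y z v) (fun h => hx (dv_supp v h))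
      simp [this])).2.2
  have i2 : ∀ v, Integrable (fun z => fderiv ℝ F z v * Y z) := fun v =>
    (cint hD (((hFC.continuousOn_fderiv_of_isOpen hD le_rfl).clm_apply continuousOn_const).mul hYC.continuous.continuousOn) hYc (hYs.trans hKD) (fun x hx => by
      simp [image_eq_zero_of_notMem_tsupport hx])).2.2
  have e : ∀ z, F z * ((lap X z : ℝ) : ℂ) = F z * fderiv ℝ Y z 1 + I * (F z * fderiv ℝ Y z I) := fun z => by rw [hlap]; ring
  simp_rw [e]
  rw [integral_add (i1 1) ((i1 I).const_mul I), integral_const_mul, ibp hD hFC hYC hYc (hYs.trans hKD), ibp hD hFC hYC hYc (hYs.trans hKD),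
    mul_neg, ← neg_add, ← integral_const_mul, ← integral_add (i2 1) ((i2 I).const_mul I), neg_eq_zero]
  rw [← integral_zero ℂ ℂ]
  congr 1; funext z
  by_cases hz : z ∈ D
  · have := dbar_of_diff (hF.differentiableAt (hD.mem_nhds hz))
    rw [dbar] at this
    linear_combination (Y z) * this
  · rw [image_eq_zero_of_notMem_tsupport (fun h => hz (hKD (hYs h)))]; simp

theorem harm_lap {D : Set ℂ} {w : ℂ → ℝ} (hw : HarmonicOnNhd w D) {z : ℂ} (hz : z ∈ D) : lap w z = 0 := by
  have h1 := (hw z hz).1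
  have h2 := (hw z hz).2.self_of_nhds
  rw [laplacian_eq_iteratedFDeriv_complexPlane] at h2
  simp only [iteratedFDeriv_two_apply, Pi.zero_apply] at h2
  rw [lap, fderiv_two h1, fderiv_two h1]
  simpa using h2

theorem flux_pos {D : Set ℂ} (hDb : Bornology.IsBounded D) (hDo : IsOpen D) {Y w : ℂ → ℝ} (hY : ContDiff ℝ ∞ Y) (hYn : ∀ z, 0 ≤ Y z)
    (hK : IsCompact (tsupport (fderiv ℝ Y))) (hKD : tsupport (fderiv ℝ Y) ⊆ D)
    (hw : ContinuousOn w (closure D)) (hwh : HarmonicOnNhd w D) (hpos : ∀ z ∈ tsupport (fderiv ℝ Y), 0 < w z)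
    (hbd : ∀ p ∈ frontier D, w p = 0 ∨ ∀ᶠ y in 𝓝 p, Y y = 0) :
    0 ≤ ∫ z, w z * lap Y z := by
  obtain ⟨ε, hε, hεK⟩ : ∃ ε > 0, ∀ z ∈ tsupport (fderiv ℝ Y), 2 * ε ≤ w z := by
    rcases (tsupport (fderiv ℝ Y)).eq_empty_or_nonempty with h | h
    · exact ⟨1, one_pos, by simp [h]⟩
    · obtain ⟨x, hx, hm⟩ := hK.exists_isMinOn h (hw.mono (hKD.trans subset_closure))
      exact ⟨w x / 2, half_pos (hpos x hx), fun z hz => by have := hm hz; simp only [mem_setOf_eq] at this; linarith⟩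
  set h : ℝ → ℝ := fun t => Real.smoothTransition (t - 1) with hh
  have hhs : ContDiff ℝ 1 h := Real.smoothTransition.contDiff.comp (contDiff_id.sub contDiff_const)
  have hhm : Monotone h := fun a b hab => Real.smoothTransition.monotone (by linarith)
  have hh0 : ∀ t, t ≤ 1 → h t = 0 := fun t ht => Real.smoothTransition.zero_of_nonpos (by linarith)
  have hh1 : ∀ t, 2 ≤ t → h t = 1 := fun t ht => Real.smoothTransition.one_of_one_le (by linarith)
  set χ : ℂ → ℝ := D.indicator (fun z => Y z * h (w z / ε)) with hχ
  set K' : Set ℂ := (closure D ∩ w ⁻¹' Ici ε) ∩ tsupport Y with hK'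
  have hcl : IsClosed K' := (hw.preimage_isClosed_of_isClosed isClosed_closure isClosed_Ici).inter (isClosed_tsupport _)
  have hcp : IsCompact K' := hDb.isCompact_closure.of_isClosed_subset hcl (fun z hz => hz.1.1)
  have hK'D : K' ⊆ D := by
    intro z hz
    by_contra hn
    have hf : z ∈ frontier D := by rw [hDo.frontier_eq]; exact ⟨hz.1.1, hn⟩
    rcases hbd z hf with h0 | h0
    · have : ε ≤ w z := hz.1.2
      linarith
    · exact (notMem_tsupport_iff_eventuallyEq.2 h0) hz.2
  have hχ0 : ∀ z, z ∉ K' → χ z = 0 := by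
    intro z hz
    by_cases hzD : z ∈ D
    · rw [hχ, indicator_of_mem hzD]
      by_cases hzY : z ∈ tsupport Y
      · have : w z < ε := by
          by_contra hn
          exact hz ⟨⟨subset_closure hzD, not_lt.1 hn⟩, hzY⟩
        rw [hh0 _ (by rw [div_le_one hε]; exact this.le), mul_zero]
      · rw [image_eq_zero_of_notMem_tsupport hzY, zero_mul]
    · rw [hχ, indicator_of_notMem hzD]
  have hχs : tsupport χ ⊆ K' := closure_minimal (fun z hz => by by_contra hn; exact hz (hχ0 z hn)) hcl
  have hχc : HasCompactSupport χ := hcp.of_isClosed_subset (isClosed_tsupport _) hχs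
  have hwc : ∀ z ∈ D, ContDiffAt ℝ 2 w z := fun z hz => (hwh z hz).1
  have hχe : ∀ z ∈ D, χ =ᶠ[𝓝 z] fun y => Y y * h (w y / ε) := fun z hz => by
    filter_upwards [hDo.mem_nhds hz] with y hy
    rw [hχ, indicator_of_mem hy]
  have hχC : ContDiff ℝ 1 χ := by
    rw [contDiff_iff_contDiffAt]
    intro z
    by_cases hz : z ∈ D
    · refine ContDiffAt.congr_of_eventuallyEq ?_ (hχe z hz)
      exact (hY.contDiffAt.of_le (by norm_cast)).mul (hhs.contDiffAt.comp z (((hwc z hz).of_le (by norm_num)).div_const ε))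
    · refine contDiffAt_const (c := (0:ℝ)).congr_of_eventuallyEq ?_
      filter_upwards [hcl.isOpen_compl.mem_nhds (fun h => hz (hK'D h))] with y hy
      exact hχ0 y hy
  have hwC : ContDiffOn ℝ 2 w D := fun z hz => (hwc z hz).contDiffWithinAt
  have hwv : ∀ v, ContDiffOn ℝ 1 (fun z => fderiv ℝ w z v) D := fun v =>
    (hwC.fderiv_of_isOpen hDo (m := 1) (by norm_num)).clm_apply contDiffOn_const
  have hYv : ∀ v, ContDiff ℝ 1 (fun z => fderiv ℝ Y z v) := fun v => dv_contDiff hY (m := 1) (by norm_cast) v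
  have hYvc : ∀ v, HasCompactSupport (fun z => fderiv ℝ Y z v) := fun v => hK.of_isClosed_subset (isClosed_tsupport _) (dv_tsupp v)
  have i1 : ∀ v, Integrable (fun z => w z * fderiv ℝ (fun y => fderiv ℝ Y y v) z v) := fun v =>
    (cint hDo ((hw.mono subset_closure).mul (dv_contDiff (hYv v) (m := 0) (by norm_num) v).continuous.continuousOn) hK hKD (fun x hx => by
      have : fderiv ℝ (fun y => fderiv ℝ Y y v) x v = 0 := image_eq_zero_of_notMem_tsupport (f := fun z => fderiv ℝ (fun y => fderiv ℝ Y y v) z v) (fun h => hx (dv_tsupp v (dv_supp v h)))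
      simp [this])).2.2
  have i2 : ∀ v, Integrable (fun z => fderiv ℝ w z v * fderiv ℝ Y z v) := fun v =>
    (cint hDo ((hwv v).continuousOn.mul (hYv v).continuous.continuousOn) hK hKD (fun x hx => by
      have : fderiv ℝ Y x = 0 := image_eq_zero_of_notMem_tsupport hx
      simp [this])).2.2
  have i3 : ∀ v, Integrable (fun z => fderiv ℝ w z v * fderiv ℝ χ z v) := fun v =>
    (cint hDo ((hwv v).continuousOn.mul (dv_contDiff hχC (m := 0) (by norm_num) v).continuous.continuousOn) hcp hK'D (fun x hx => by
      have : fderiv ℝ χ x v = 0 := image_eq_zero_of_notMem_tsupport (f := fun z => fderiv ℝ χ z v) (fun h => hx (hχs (dv_supp v h)))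
      simp [this])).2.2
  have i4 : ∀ v, Integrable (fun z => fderiv ℝ (fun y => fderiv ℝ w y v) z v * χ z) := fun v =>
    (cint hDo ((((hwv v).continuousOn_fderiv_of_isOpen hDo le_rfl).clm_apply continuousOn_const).mul hχC.continuous.continuousOn) hcp hK'D (fun x hx => by
      simp [hχ0 x hx])).2.2
  have e1 : ∫ z, w z * lap Y z = -∫ z, (fderiv ℝ w z 1 * fderiv ℝ Y z 1 + fderiv ℝ w z I * fderiv ℝ Y z I) := by
    rw [integral_add (i2 1) (i2 I)]
    simp only [lap, mul_add]
    rw [integral_add (i1 1) (i1 I), ibp hDo (hwC.of_le (by norm_num)) (hYv 1) (hYvc 1) ((dv_tsupp 1).trans hKD),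
      ibp hDo (hwC.of_le (by norm_num)) (hYv I) (hYvc I) ((dv_tsupp I).trans hKD)]
    ring
  have e2 : ∫ z, (fderiv ℝ w z 1 * fderiv ℝ χ z 1 + fderiv ℝ w z I * fderiv ℝ χ z I) = 0 := by
    rw [integral_add (i3 1) (i3 I), ibp hDo (hwv 1) hχC hχc (hχs.trans hK'D), ibp hDo (hwv I) hχC hχc (hχs.trans hK'D), ← neg_add,
      ← integral_add (i4 1) (i4 I), neg_eq_zero, ← integral_zero ℂ ℝ]
    congr 1; funext z
    by_cases hz : z ∈ D
    · have := harm_lap hwh hz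
      rw [lap] at this
      rw [← add_mul, this, zero_mul]
    · rw [hχ0 z (fun h => hz (hK'D h))]; simp
  rw [e1, neg_nonneg, ← e2]
  refine integral_mono ((i2 1).add (i2 I)) ((i3 1).add (i3 I)) (fun z => ?_)
  show fderiv ℝ w z 1 * fderiv ℝ Y z 1 + fderiv ℝ w z I * fderiv ℝ Y z I ≤ fderiv ℝ w z 1 * fderiv ℝ χ z 1 + fderiv ℝ w z I * fderiv ℝ χ z I
  by_cases hz : z ∈ D
  · have hd : ∀ v, fderiv ℝ χ z v = Y z * (deriv h (w z / ε) * (fderiv ℝ w z v / ε)) + h (w z / ε) * fderiv ℝ Y z v := by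
      intro v
      have hw1 : HasFDerivAt w (fderiv ℝ w z) z := ((hwc z hz).differentiableAt (by norm_num)).hasFDerivAt
      have hY1 : HasFDerivAt Y (fderiv ℝ Y z) z := (hY.differentiable (by simp) z).hasFDerivAt
      have h1 := hw1.const_mul ε⁻¹
      have hd1 : HasDerivAt h (deriv h (ε⁻¹ * w z)) (ε⁻¹ * w z) := (hhs.differentiable one_ne_zero _).hasDerivAt
      have h2 := hd1.comp_hasFDerivAt z h1
      have h3 := hY1.mul h2
      rw [(hχe z hz).fderiv_eq]
      have e : (fun y => Y y * h (w y / ε)) = Y * (h ∘ fun y => ε⁻¹ * w y) := by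
        funext y; simp [div_eq_inv_mul]
      rw [e, h3.fderiv]
      simp [div_eq_inv_mul]
      try ring
    have hdp : 0 ≤ deriv h (w z / ε) := hhm.deriv_nonneg
    have hq : 0 ≤ Y z * (deriv h (w z / ε) * ((fderiv ℝ w z 1 ^ 2 + fderiv ℝ w z I ^ 2) / ε)) := by
      have := hYn z
      positivity
    rw [hd, hd]
    by_cases hzK : z ∈ tsupport (fderiv ℝ Y)
    · have : h (w z / ε) = 1 := hh1 _ (by rw [le_div_iff₀ hε]; exact hεK z hzK)
      rw [this]
      have e : Y z * (deriv h (w z / ε) * ((fderiv ℝ w z 1 ^ 2 + fderiv ℝ w z I ^ 2) / ε)) = fderiv ℝ w z 1 * (Y z * (deriv h (w z / ε) * (fderiv ℝ w z 1 / ε)))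
        + fderiv ℝ w z I * (Y z * (deriv h (w z / ε) * (fderiv ℝ w z I / ε))) := by ring
      linarith
    · have h0 : fderiv ℝ Y z = 0 := image_eq_zero_of_notMem_tsupport hzK
      rw [h0]
      have e : Y z * (deriv h (w z / ε) * ((fderiv ℝ w z 1 ^ 2 + fderiv ℝ w z I ^ 2) / ε)) = fderiv ℝ w z 1 * (Y z * (deriv h (w z / ε) * (fderiv ℝ w z 1 / ε)))
        + fderiv ℝ w z I * (Y z * (deriv h (w z / ε) * (fderiv ℝ w z I / ε))) := by ring
      simp only [ContinuousLinearMap.zero_apply, mul_zero, add_zero]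
      linarith
  · have h0 : fderiv ℝ Y z = 0 := image_eq_zero_of_notMem_tsupport (fun h => hz (hKD h))
    have h1 : ∀ v, fderiv ℝ χ z v = 0 := fun v => image_eq_zero_of_notMem_tsupport (f := fun z => fderiv ℝ χ z v) (fun h => hz (hK'D (hχs (dv_supp v h))))
    rw [h0, h1, h1]; simp

end HX

namespace HX
open Metric Filter Topology InnerProductSpace Real MeasureTheory
open scoped ContDiff

structure Al (D : Set ℂ) (F : ℂ → ℂ) : Prop where
  cont : ContinuousOn F (closure D)
  hol : DifferentiableOn ℂ F D

/-- logarithmic potential of `n dμ` -/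
noncomputable def Lp0 (μ : Measure ℂ) (n : ℂ → ℝ) (y : ℂ) : ℝ := ∫ ζ, n ζ * Real.log ‖ζ - y‖ ∂μ

theorem log_al {D : Set ℂ} {y y' : ℂ} {r : ℝ} (hr : ∀ z ∈ closure D, r ≤ ‖z - y‖) (hy : ‖y' - y‖ < r) :
    ∃ a, Al D a ∧ ∀ z ∈ closure D, Real.log ‖z - y'‖ - Real.log ‖z - y‖ = (a z).re := by
  have h0 : 0 < r := lt_of_le_of_lt (norm_nonneg _) hy
  have hne : ∀ z ∈ closure D, z - y ≠ 0 := fun z hz h => by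
    have := hr z hz; rw [h, norm_zero] at this; linarith
  have hsl : ∀ z ∈ closure D, (1 - (y' - y) / (z - y)) ∈ slitPlane := fun z hz => by
    refine Or.inl ?_
    have h1 : ‖(y' - y) / (z - y)‖ < 1 := by
      rw [norm_div, div_lt_one (norm_pos_iff.2 (hne z hz))]
      exact hy.trans_le (hr z hz)
    have h2 := Complex.re_le_norm ((y' - y) / (z - y))
    simp only [Complex.sub_re, Complex.one_re]; linarith
  have hd : DifferentiableOn ℂ (fun z => (y' - y) / (z - y)) D := fun z hz =>
    ((differentiableAt_const _).div ((differentiableAt_id).sub_const y) (hne z (subset_closure hz))).differentiableWithinAt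
  have hc : ContinuousOn (fun z => (y' - y) / (z - y)) (closure D) :=
    continuousOn_const.div (continuousOn_id.sub continuousOn_const) hne
  refine ⟨fun z => Complex.log (1 - (y' - y) / (z - y)), ⟨(continuousOn_const.sub hc).clog hsl,
    ((differentiableOn_const 1).sub hd).clog (fun z hz => hsl z (subset_closure hz))⟩, fun z hz => ?_⟩
  rw [Complex.log_re]
  have e : 1 - (y' - y) / (z - y) = (z - y') / (z - y) := by
    rw [eq_div_iff (hne z hz), sub_mul, div_mul_cancel₀ _ (hne z hz)]; ring
  have hz' : z - y' ≠ 0 := by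
    intro h
    have h1 : z = y' := sub_eq_zero.1 h
    have := hr z hz; rw [h1] at this; linarith
  rw [e, norm_div, Real.log_div (norm_ne_zero_iff.2 hz') (norm_ne_zero_iff.2 (hne z hz))]

theorem ext_dist {D : Set ℂ} {y : ℂ} (hy : y ∉ closure D) : ∃ r > 0, ∀ z ∈ closure D, r ≤ ‖z - y‖ := by
  obtain ⟨r, hr, h⟩ := Metric.isOpen_iff.1 (isClosed_closure (s := D)).isOpen_compl y hy
  refine ⟨r, hr, fun z hz => ?_⟩
  by_contra hn
  exact h (by rw [mem_ball, dist_eq_norm]; exact not_le.1 hn) hz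

theorem log_cont {y : ℂ} {s : Set ℂ} (hy : y ∉ s) : ContinuousOn (fun ζ => Real.log ‖ζ - y‖) s :=
  ContinuousOn.log (by fun_prop) (fun z hz => norm_ne_zero_iff.2 (sub_ne_zero.2 (fun h => hy (h ▸ hz))))

theorem IsHM.bmul {D : Set ℂ} {m : ℕ} {E : Fin m → Set ℂ} (g : Geo D m E) {c : ℂ} {μ : Measure ℂ} (hμ : IsHM D c μ) {n : ℂ → ℝ} (hn : Integrable n μ)
    {f : ℂ → ℝ} (hf : ContinuousOn f (frontier D)) : Integrable (fun ζ => n ζ * f ζ) μ := by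
  obtain ⟨C, hC⟩ := g.fcpt.exists_bound_of_continuousOn hf
  refine hn.mul_bdd (hμ.integrable g.bdd hf).aestronglyMeasurable (c := C) ?_
  filter_upwards [hμ.supp] with ζ hζ using hC ζ hζ

theorem Lp0_const {D : Set ℂ} {m : ℕ} {E : Fin m → Set ℂ} (g : Geo D m E) {c : ℂ} {μ : Measure ℂ} (hμ : IsHM D c μ) {n : ℂ → ℝ} (hn : Integrable n μ)
    (hA : ∀ a, Al D a → ∫ ζ, n ζ * (a ζ).re ∂μ = 0) {V : Set ℂ} (hVc : IsPreconnected V) (hV : Disjoint V (closure D))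
    {y y' : ℂ} (hy : y ∈ V) (hy' : y' ∈ V) : Lp0 μ n y' = Lp0 μ n y := by
  have hloc : ∀ x ∉ closure D, ∃ r > 0, ∀ x' ∈ ball x r, x' ∉ closure D ∧ Lp0 μ n x' = Lp0 μ n x := by
    intro x hx
    obtain ⟨r, hr, h⟩ := ext_dist hx
    refine ⟨r, hr, fun x' hx' => ?_⟩
    rw [mem_ball, dist_eq_norm] at hx'
    have hx'D : x' ∉ closure D := fun h' => by linarith [h x' h']
    refine ⟨hx'D, ?_⟩
    obtain ⟨a, ha, hae⟩ := log_al h hx'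
    have h1 := hA a ha
    rw [← sub_eq_zero, Lp0, Lp0, ← integral_sub (hμ.bmul g hn (log_cont (fun h => hx'D (frontier_subset_closure h))))
      (hμ.bmul g hn (log_cont (fun h => hx (frontier_subset_closure h)))), ← h1]
    refine integral_congr_ae ?_
    filter_upwards [hμ.supp] with ζ hζ
    rw [← mul_sub, hae ζ (frontier_subset_closure hζ)]
  have hsub : V ⊆ {x | x ∉ closure D ∧ Lp0 μ n x = Lp0 μ n y} := by
    refine hVc.subset_left_of_subset_union (u := {x | x ∉ closure D ∧ Lp0 μ n x = Lp0 μ n y}) (v := {x | x ∉ closure D ∧ Lp0 μ n x ≠ Lp0 μ n y}) ?_ ?_ ?_ ?_ ?_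
    · rw [Metric.isOpen_iff]
      rintro x ⟨hx, hxe⟩
      obtain ⟨r, hr, h⟩ := hloc x hx
      exact ⟨r, hr, fun x' hx' => ⟨(h x' hx').1, (h x' hx').2.trans hxe⟩⟩
    · rw [Metric.isOpen_iff]
      rintro x ⟨hx, hxe⟩
      obtain ⟨r, hr, h⟩ := hloc x hx
      exact ⟨r, hr, fun x' hx' => ⟨(h x' hx').1, fun hh => hxe ((h x' hx').2.symm.trans hh)⟩⟩
    · rw [disjoint_left]; rintro x ⟨_, h1⟩ ⟨_, h2⟩; exact h2 h1
    · intro x hx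
      have hxD := disjoint_left.1 hV hx
      by_cases h : Lp0 μ n x = Lp0 μ n y
      · exact Or.inl ⟨hxD, h⟩
      · exact Or.inr ⟨hxD, h⟩
    · exact ⟨y, hy, disjoint_left.1 hV hy, rfl⟩
  exact (hsub hy').2

theorem Acc.fub {V : Set ℂ} {c : ℂ} {d : ℝ} {x : ℝ → ℂ} (h : Acc V c d x) {μ : Measure ℂ} [SFinite μ]
    {R : ℝ} (hR : ∀ᵐ ζ ∂μ, ‖ζ - c‖ ≤ R) {n : ℂ → ℝ} (hn : Integrable n μ) {k : ℝ}
    (hk : ∀ y ∈ V, Lp0 μ n y = k) : ∫ ζ, n ζ * Up x d ζ ∂μ = k := by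
  have hm : AEStronglyMeasurable (Function.uncurry fun (ζ : ℂ) (r : ℝ) => n ζ * Real.log ‖ζ - x r‖) (μ.prod (volume.restrict (Ioo 0 d))) := by
    refine hn.aestronglyMeasurable.comp_fst.mul ?_
    have : Measurable (fun p : ℂ × ℝ => Real.log ‖p.1 - x p.2‖) :=
      Real.measurable_log.comp (measurable_norm.comp (measurable_fst.sub (h.meas.comp measurable_snd)))
    exact this.aestronglyMeasurable
  have hInt : Integrable (Function.uncurry fun (ζ : ℂ) (r : ℝ) => n ζ * Real.log ‖ζ - x r‖) (μ.prod (volume.restrict (Ioo 0 d))) := by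
    rw [integrable_prod_iff hm]
    constructor
    · exact Eventually.of_forall (fun ζ => (h.integrable ζ).const_mul (n ζ))
    · refine Integrable.mono' (hn.norm.mul_const (2 * (R + d) * d - d * (Real.log d - C0))) hm.norm.integral_prod_right' ?_
      filter_upwards [hR] with ζ hζ
      rw [Real.norm_eq_abs, abs_of_nonneg (integral_nonneg (fun _ => norm_nonneg _))]
      simp only [Function.uncurry, norm_mul]
      rw [integral_const_mul]
      refine mul_le_mul_of_nonneg_left ?_ (norm_nonneg _)
      have h1 : ∫ r in Ioo 0 d, ‖Real.log ‖ζ - x r‖‖ ≤ ∫ r in Ioo 0 d, (2 * (R + d) - Real.log ‖ζ - x r‖) := by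
        refine setIntegral_mono_on (h.integrable ζ).norm ((integrableOn_const (by simp)).sub (h.integrable ζ)) measurableSet_Ioo (fun r hr => ?_)
        have h2 := (h.low ζ hr.1 hr.2).2
        have h3 : Real.log ‖ζ - x r‖ ≤ ‖ζ - x r‖ := Real.log_le_self (norm_nonneg _)
        have h4 := norm_nonneg (ζ - x r)
        rw [Real.norm_eq_abs]
        rw [abs_le]
        constructor <;> [linarith [hr.2]; linarith [hr.2]]
      refine h1.trans ?_
      rw [integral_sub (integrable_const _) (h.integrable ζ)]
      have h5 := h.up_ge ζ
      rw [Up, le_inv_mul_iff₀ h.pos] at h5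
      have h6 : ∫ r in Ioo 0 d, 2 * (R + d) = 2 * (R + d) * d := by
        rw [setIntegral_const]; simp [h.pos.le]; ring
      rw [h6]; linarith
  have h1 := integral_integral_swap hInt
  have h2 : ∀ ζ, n ζ * Up x d ζ = d⁻¹ * ∫ r in Ioo 0 d, n ζ * Real.log ‖ζ - x r‖ := by
    intro ζ; rw [Up, integral_const_mul]; ring
  simp_rw [h2]
  rw [integral_const_mul, h1]
  have h3 : ∫ r in Ioo 0 d, ∫ ζ, n ζ * Real.log ‖ζ - x r‖ ∂μ = ∫ r in Ioo 0 d, k :=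
    setIntegral_congr_fun measurableSet_Ioo (fun r hr => hk _ (h.mem r hr.1 hr.2))
  rw [h3, setIntegral_const]
  simp [h.pos.le, h.pos.ne']

theorem Lp0_bd {D : Set ℂ} {m : ℕ} {E : Fin m → Set ℂ} (g : Geo D m E) {c : ℂ} (hc : c ∈ D) {μ : Measure ℂ} (hμ : IsHM D c μ) {n : ℂ → ℝ} (hn : Integrable n μ)
    {p : ℂ} (hp : p ∈ frontier D) (hnl : Integrable (fun ζ => n ζ * Real.log ‖ζ - p‖) μ) {V : Set ℂ} {d : ℝ} {x : ℝ → ℂ} (h : Acc V p d x)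
    {k : ℝ} (hk : ∀ y ∈ V, Lp0 μ n y = k) : Lp0 μ n p = k := by
  have := hμ.prob
  obtain ⟨R, hR1, hR⟩ := g.radius
  have hR' : ∀ᵐ ζ ∂μ, ‖ζ - p‖ ≤ R := by
    filter_upwards [hμ.supp] with ζ hζ using hR _ (frontier_subset_closure hζ) _ (frontier_subset_closure hp)
  have h1 := h.dct hR' (HM_atom g hc hμ hp) hn hnl
  have h2 : ∀ j : ℕ, ∫ ζ, n ζ * Up x (d / ((j : ℝ) + 1)) ζ ∂μ = k := fun j =>
    (h.mono (seq_pos h.pos j) (seq_le h.pos j)).fub hR' hn hk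
  simp_rw [h2] at h1
  exact tendsto_nhds_unique h1 tendsto_const_nhds

end HX

namespace HX
open Metric Filter Topology InnerProductSpace Real MeasureTheory
open scoped ContDiff

theorem log_unif {κ : ℂ → ℝ} (hκ : Continuous κ) (hκc : HasCompactSupport κ) (R : ℝ) :
    ∃ C, ∀ b : ℂ, ‖b‖ ≤ R → Integrable (fun z => Real.log ‖b - z‖ * κ z) ∧ ∫ z, ‖Real.log ‖b - z‖ * κ z‖ ≤ C := by
  obtain ⟨M, hM⟩ := hκ.bounded_above_of_compact_support hκc
  obtain ⟨R1, hR1⟩ := hκc.isBounded.subset_closedBall (0:ℂ)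
  set G : ℂ → ℝ := (closedBall (0:ℂ) (R + R1)).indicator (fun t => |Real.log ‖t‖| * M) with hG
  have hGi : Integrable G := by
    rw [hG, integrable_indicator_iff measurableSet_closedBall]
    exact ((log_loc.integrableOn_isCompact (isCompact_closedBall _ _)).norm).mul_const M
  have hle : ∀ b : ℂ, ‖b‖ ≤ R → ∀ z, ‖Real.log ‖b - z‖ * κ z‖ ≤ G (z - b) := by
    intro b hb z
    by_cases hz : z ∈ tsupport κ
    · have h1 := hR1 hz
      rw [mem_closedBall_zero_iff] at h1
      have h2 : z - b ∈ closedBall (0:ℂ) (R + R1) := by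
        rw [mem_closedBall_zero_iff]; linarith [norm_sub_le z b]
      rw [hG, indicator_of_mem h2, norm_mul, norm_sub_rev z b, Real.norm_eq_abs]
      exact mul_le_mul_of_nonneg_left (hM z) (abs_nonneg _)
    · rw [image_eq_zero_of_notMem_tsupport hz, mul_zero, norm_zero, hG]
      refine indicator_nonneg (fun t _ => mul_nonneg (abs_nonneg _) ((norm_nonneg _).trans (hM 0))) _
  refine ⟨∫ t, G t, fun b hb => ?_⟩
  have hGs : Integrable (fun z => G (z - b)) := hGi.comp_sub_right b
  have hInt : Integrable (fun z => Real.log ‖b - z‖ * κ z) := by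
    refine hGs.mono' ?_ (Eventually.of_forall (hle b hb))
    exact (Real.measurable_log.comp (measurable_norm.comp (measurable_const.sub measurable_id))).aestronglyMeasurable.mul hκ.aestronglyMeasurable
  refine ⟨hInt, ?_⟩
  rw [← integral_sub_right_eq_self G b]
  exact integral_mono hInt.norm hGs (hle b hb)

theorem Geo.pos_meas {D : Set ℂ} {m : ℕ} {E : Fin m → Set ℂ} (g : Geo D m E) {c : ℂ} (hc : c ∈ D) {μ : Measure ℂ} (hμ : IsHM D c μ) (l : Fin m) :
    μ (E l) ≠ 0 := by
  intro h0
  have hcl2 : IsClosed (⋃ i ∈ {i | i ≠ l}, E i) := Set.Finite.isClosed_biUnion (toFinite _) (fun i _ => g.closed i)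
  obtain ⟨f, hf0, hf1, hf⟩ := exists_continuous_zero_one_of_isClosed hcl2 (g.closed l) (by
    rw [disjoint_left]
    intro x hx hxj
    obtain ⟨i, hi, hx⟩ := mem_iUnion₂.1 hx
    exact (disjoint_left.1 (g.disj i l hi) hx) hxj)
  obtain ⟨u, hu⟩ := g.dir (φ := f) f.continuous.continuousOn
  have h1 := hμ.int _ _ hu
  have h2 : ∫ ζ, f ζ ∂μ = 0 := by
    rw [← integral_zero ℂ ℝ (μ := μ)]
    refine integral_congr_ae ?_
    filter_upwards [hμ.supp, measure_eq_zero_iff_ae_notMem.1 h0] with ζ hζ hn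
    obtain ⟨i, hi, -⟩ := g.mem_front.1 hζ
    refine hf0 (mem_biUnion (show i ∈ {i | i ≠ l} from ?_) hi)
    rintro rfl; exact hn hi
  have hpos : ∀ z ∈ D, 0 ≤ u z := fun z hz =>
    Sol.le g.bdd g.op (Sol.const 0) hu (fun p _ => (hf p).1) z (subset_closure hz)
  have hz : ∀ z ∈ D, u z = 0 := by
    intro z hz
    obtain ⟨C, hC, h⟩ := harnack g.op g.conn.isPreconnected hc (isCompact_singleton (x := z)) (singleton_subset_iff.2 hz)
    have := (h z rfl u hu.harm hpos).1
    rw [← h1, h2, mul_zero] at this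
    exact le_antisymm this (hpos z hz)
  obtain ⟨p, hp, hpD⟩ := g.bd l
  have hpf : p ∈ frontier D := g.mem_front.2 ⟨l, hp, hpD⟩
  have h3 : EqOn u (fun _ => 0) (closure D) :=
    EqOn.of_subset_closure (fun z hz' => hz z hz') hu.cont continuousOn_const subset_closure subset_rfl
  have h4 := h3 hpD
  rw [hu.bd p hpf, hf1 hp] at h4
  simp at h4

theorem prod_int {D : Set ℂ} {m : ℕ} {E : Fin m → Set ℂ} (g : Geo D m E) {c z : ℂ} (hz : z ∈ D) {μ ν : Measure ℂ} (hμ : IsHM D c μ) (hν : IsHM D z ν)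
    {n : ℂ → ℝ} (hn : Integrable n μ) : Integrable (Function.uncurry fun ζ p : ℂ => n ζ * Real.log ‖ζ - p‖) (μ.prod ν) := by
  have := hμ.prob
  have := hν.prob
  have hm : AEStronglyMeasurable (Function.uncurry fun ζ p : ℂ => n ζ * Real.log ‖ζ - p‖) (μ.prod ν) := by
    refine hn.aestronglyMeasurable.comp_fst.mul ?_
    have : Measurable (fun p : ℂ × ℂ => Real.log ‖p.1 - p.2‖) :=
      Real.measurable_log.comp (measurable_norm.comp (measurable_fst.sub measurable_snd))
    exact this.aestronglyMeasurable
  obtain ⟨C, hC⟩ := HM_log_abs g hz hν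
  rw [integrable_prod_iff hm]
  constructor
  · filter_upwards [hμ.supp] with ζ hζ
    have := (HM_log g hz hν hζ).1
    simp_rw [norm_sub_rev _ ζ] at this
    exact this.const_mul (n ζ)
  · refine Integrable.mono' (hn.norm.mul_const C) hm.norm.integral_prod_right' ?_
    filter_upwards [hμ.supp] with ζ hζ
    rw [Real.norm_eq_abs, abs_of_nonneg (integral_nonneg (fun _ => norm_nonneg _))]
    simp only [Function.uncurry, norm_mul]
    rw [integral_const_mul]
    refine mul_le_mul_of_nonneg_left ?_ (norm_nonneg _)
    have := hC ζ hζ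
    simp_rw [norm_sub_rev _ ζ] at this
    exact this

theorem WL1 {D : Set ℂ} {m : ℕ} {E : Fin m → Set ℂ} (g : Geo D m E) {c : ℂ} (hc : c ∈ D) {μ : Measure ℂ} (hμ : IsHM D c μ) {n : ℂ → ℝ} (hn : Integrable n μ)
    (hA : ∀ a, Al D a → ∫ ζ, n ζ * (a ζ).re ∂μ = 0) {b : Fin m → ℂ} (hb : ∀ l, b l ∈ E l) (hbD : ∀ l, b l ∉ closure D)
    (hL : ∀ l, ∫ ζ, n ζ * Real.log ‖ζ - b l‖ ∂μ = 0) : ∀ᵐ ζ ∂μ, n ζ = 0 := by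
  have := hμ.prob
  have hae : ∀ {z : ℂ} {ν : Measure ℂ}, z ∈ D → IsHM D z ν → ∀ᵐ p ∂ν, Integrable (fun ζ => n ζ * Real.log ‖ζ - p‖) μ := by
    intro z ν hz hν
    have := hν.prob
    exact (prod_int g hz hμ hν hn).prod_left_ae
  have hi : ∀ y ∉ closure D, Lp0 μ n y = 0 := by
    intro y hy
    have hyu : y ∈ ⋃ l, E l := by rw [g.union]; exact fun h => hy (subset_closure h)
    obtain ⟨l, hl⟩ := mem_iUnion.1 hyu
    obtain ⟨p, hpE, hpf, hpi⟩ : ∃ p ∈ E l, p ∈ frontier D ∧ Integrable (fun ζ => n ζ * Real.log ‖ζ - p‖) μ := by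
      by_contra hcon
      push Not at hcon
      apply g.pos_meas hc hμ l
      rw [measure_eq_zero_iff_ae_notMem]
      filter_upwards [hμ.supp, hae hc hμ] with p hp1 hp2 hp3
      exact hcon p hp3 hp1 hp2
    have hpD := frontier_subset_closure hpf
    obtain ⟨V, -, hVc, hyV, hVD, hV⟩ := g.acc hl hy
    obtain ⟨d, x, hacc⟩ := hV p hpE hpD
    obtain ⟨V', -, hVc', hyV', hVD', hV'⟩ := g.acc (hb l) (hbD l)
    obtain ⟨d', x', hacc'⟩ := hV' p hpE hpD
    have h1 := Lp0_bd g hc hμ hn hpf hpi hacc (fun y' hy' => Lp0_const g hμ hn hA hVc hVD hyV hy')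
    have h2 := Lp0_bd g hc hμ hn hpf hpi hacc' (fun y' hy' => Lp0_const g hμ hn hA hVc' hVD' hyV' hy')
    rw [← h1, h2]; exact hL l
  have hii : ∀ p ∈ frontier D, Integrable (fun ζ => n ζ * Real.log ‖ζ - p‖) μ → Lp0 μ n p = 0 := by
    intro p hp hpi
    obtain ⟨V, d, x, h, hV⟩ := g.exists_acc hp
    exact Lp0_bd g hc hμ hn hp hpi h (fun y hy => hi y (disjoint_left.1 hV hy))
  have hiii : ∀ z ∈ D, Lp0 μ n z = 0 := by
    intro z hz
    obtain ⟨ν, hν⟩ := g.hm hz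
    have := hν.prob
    have h1 : Lp0 μ n z = ∫ ζ, ∫ p, n ζ * Real.log ‖ζ - p‖ ∂ν ∂μ := by
      refine integral_congr_ae ?_
      filter_upwards [hμ.supp] with ζ hζ
      have := (HM_log g hz hν hζ).2
      simp_rw [norm_sub_rev _ ζ] at this
      rw [integral_const_mul, this]
    rw [h1, integral_integral_swap (prod_int g hz hμ hν hn), ← integral_zero ℂ ℝ (μ := ν)]
    refine integral_congr_ae ?_
    filter_upwards [hν.supp, hae hz hν] with p hp1 hp2
    exact hii p hp1 hp2
  refine ae_eq_zero_of_integral_contDiff_smul_eq_zero hn.locallyIntegrable (fun w hw hwc => ?_)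
  have hw2 : ContDiff ℝ 2 w := hw.of_le (by norm_cast)
  obtain ⟨R, hR⟩ := g.fcpt.isBounded.exists_norm_le
  obtain ⟨C, hC⟩ := log_unif (lap_cont hw2) (lap_cs hwc) R
  have hm : AEStronglyMeasurable (Function.uncurry fun ζ z : ℂ => n ζ * (Real.log ‖ζ - z‖ * lap w z)) (μ.prod volume) := by
    refine hn.aestronglyMeasurable.comp_fst.mul ?_
    have : Measurable (fun p : ℂ × ℂ => Real.log ‖p.1 - p.2‖ * lap w p.2) :=
      (Real.measurable_log.comp (measurable_norm.comp (measurable_fst.sub measurable_snd))).mul ((lap_cont hw2).measurable.comp measurable_snd)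
    exact this.aestronglyMeasurable
  have hInt : Integrable (Function.uncurry fun ζ z : ℂ => n ζ * (Real.log ‖ζ - z‖ * lap w z)) (μ.prod volume) := by
    rw [integrable_prod_iff hm]
    constructor
    · filter_upwards [hμ.supp] with ζ hζ
      exact (hC ζ (hR ζ hζ)).1.const_mul (n ζ)
    · refine Integrable.mono' (hn.norm.mul_const C) hm.norm.integral_prod_right' ?_
      filter_upwards [hμ.supp] with ζ hζ
      rw [Real.norm_eq_abs, abs_of_nonneg (integral_nonneg (fun _ => norm_nonneg _))]
      simp only [Function.uncurry]
      simp_rw [norm_mul (n ζ)]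
      rw [integral_const_mul]
      exact mul_le_mul_of_nonneg_left (hC ζ (hR ζ hζ)).2 (norm_nonneg _)
  have h1 : ∀ ζ, w ζ • n ζ = (2 * π)⁻¹ * ∫ z, n ζ * (Real.log ‖ζ - z‖ * lap w z) := by
    intro ζ
    have := log_green hw2 hwc ζ
    simp_rw [norm_sub_rev _ ζ] at this
    rw [integral_const_mul, this, smul_eq_mul]
    have := Real.pi_pos
    field_simp
  simp_rw [h1]
  rw [integral_const_mul, integral_integral_swap hInt]
  refine mul_eq_zero_of_right _ ?_
  rw [← integral_zero ℂ ℝ]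
  refine integral_congr_ae ?_
  filter_upwards [hInt.prod_left_ae] with z hz
  have e : ∫ ζ, n ζ * (Real.log ‖ζ - z‖ * lap w z) ∂μ = Lp0 μ n z * lap w z := by
    rw [Lp0, ← integral_mul_const]; simp_rw [mul_assoc]
  rw [e]
  by_cases h0 : lap w z = 0
  · rw [h0, mul_zero]
  · by_cases hzD : z ∈ closure D
    · by_cases hzD' : z ∈ D
      · rw [hiii z hzD', zero_mul]
      · have hzf : z ∈ frontier D := by rw [g.op.frontier_eq]; exact ⟨hzD, hzD'⟩
        rw [hii z hzf ?_, zero_mul]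
        have h3 := hz.mul_const (lap w z)⁻¹
        refine h3.congr (Eventually.of_forall fun ζ => ?_)
        simp only [Function.uncurry]
        field_simp
    · rw [hi z hzD, zero_mul]

end HX

namespace HX
open Metric Filter Topology InnerProductSpace Real MeasureTheory
open scoped ContDiff

theorem l2_dense {μ : Measure ℂ} [IsProbabilityMeasure μ] (Q : Submodule ℝ (ℂ → ℝ)) (hQ : ∀ q ∈ Q, MemLp q 2 μ)
    (hperp : ∀ n : ℂ → ℝ, MemLp n 2 μ → (∀ q ∈ Q, ∫ ζ, n ζ * q ζ ∂μ = 0) → ∀ᵐ ζ ∂μ, n ζ = 0)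
    {φ : ℂ → ℝ} (hφ : MemLp φ 2 μ) {ε : ℝ} (hε : 0 < ε) : ∃ q ∈ Q, ∫ ζ, (φ ζ - q ζ) ^ 2 ∂μ < ε := by
  let W : Submodule ℝ (Lp ℝ 2 μ) :=
    { carrier := {f | ∃ q ∈ Q, f =ᵐ[μ] q}
      add_mem' := by
        rintro f f' ⟨q, hq, h⟩ ⟨q', hq', h'⟩
        exact ⟨q + q', Q.add_mem hq hq', (Lp.coeFn_add f f').trans (h.add h')⟩
      zero_mem' := ⟨0, Q.zero_mem, Lp.coeFn_zero _ _ _⟩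
      smul_mem' := by
        rintro k f ⟨q, hq, h⟩
        refine ⟨k • q, Q.smul_mem k hq, (Lp.coeFn_smul k f).trans ?_⟩
        exact h.fun_comp (fun t => k • t) }
  have hW : W.topologicalClosure = ⊤ := by
    rw [Submodule.topologicalClosure_eq_top_iff, Submodule.eq_bot_iff]
    intro n hn
    rw [Submodule.mem_orthogonal] at hn
    have h1 := hperp n (Lp.memLp n) (fun q hq => by
      have h2 := hn ((hQ q hq).toLp q) ⟨q, hq, (hQ q hq).coeFn_toLp⟩
      rw [L2.inner_def] at h2
      rw [← h2]
      refine integral_congr_ae ?_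
      filter_upwards [(hQ q hq).coeFn_toLp] with ζ hζ
      rw [hζ]; simp)
    exact (Lp.eq_zero_iff_ae_eq_zero).2 h1
  have hmem : hφ.toLp φ ∈ closure (W : Set (Lp ℝ 2 μ)) := by
    have : hφ.toLp φ ∈ W.topologicalClosure := by rw [hW]; trivial
    exact this
  obtain ⟨f, ⟨q, hq, hfq⟩, hd⟩ := Metric.mem_closure_iff.1 hmem (Real.sqrt ε) (Real.sqrt_pos.2 hε)
  refine ⟨q, hq, ?_⟩
  rw [dist_eq_norm] at hd
  have h2 : ‖hφ.toLp φ - f‖ ^ 2 < ε := by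
    have := pow_lt_pow_left₀ hd (norm_nonneg _) two_ne_zero
    rwa [Real.sq_sqrt hε.le] at this
  rw [← real_inner_self_eq_norm_sq, L2.inner_def] at h2
  refine lt_of_eq_of_lt ?_ h2
  refine integral_congr_ae ?_
  filter_upwards [Lp.coeFn_sub (hφ.toLp φ) f, hφ.coeFn_toLp, hfq] with ζ h1 h3 h4
  rw [h1, Pi.sub_apply, h3, h4]; simp [sq]

theorem IsHM.memLp {D : Set ℂ} {m : ℕ} {E : Fin m → Set ℂ} (g : Geo D m E) {c : ℂ} {μ : Measure ℂ} (hμ : IsHM D c μ)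
    {F : Type} [NormedAddCommGroup F] {f : ℂ → F} (hf : ContinuousOn f (frontier D)) : MemLp f 2 μ := by
  have := hμ.prob
  obtain ⟨C, hC⟩ := g.fcpt.exists_bound_of_continuousOn hf
  refine MemLp.of_bound (hμ.integrable g.bdd hf).aestronglyMeasurable C ?_
  filter_upwards [hμ.supp] with ζ hζ using hC ζ hζ

theorem Al.re_sol {D : Set ℂ} (hD : IsOpen D) {a : ℂ → ℂ} (h : Al D a) : Sol D (fun z => (a z).re) (fun z => (a z).re) :=
  ⟨Complex.continuous_re.comp_continuousOn h.cont, harm_re hD h.hol, fun _ _ => rfl⟩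

theorem log_sol {D : Set ℂ} {b : ℂ} (hb : b ∉ closure D) : Sol D (fun z => Real.log ‖z - b‖) (fun z => Real.log ‖z - b‖) :=
  ⟨log_cont hb, harm_log (fun h => hb (subset_closure h)), fun _ _ => rfl⟩

theorem Sol.sum {D : Set ℂ} {ι : Type} (s : Finset ι) {φ u : ι → ℂ → ℝ} (h : ∀ i, Sol D (φ i) (u i)) :
    Sol D (fun z => ∑ i ∈ s, φ i z) (fun z => ∑ i ∈ s, u i z) := by
  classical
  induction s using Finset.induction_on with
  | empty => simpa using Sol.const 0
  | insert a s ha ih =>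
    have := (h a).add ih
    simp_rw [Finset.sum_insert ha]
    exact this

theorem WL2 {D : Set ℂ} {m : ℕ} {E : Fin m → Set ℂ} (g : Geo D m E) {c : ℂ} (hc : c ∈ D) {μ : Measure ℂ} (hμ : IsHM D c μ)
    {b : Fin m → ℂ} (hb : ∀ l, b l ∈ E l) (hbD : ∀ l, b l ∉ closure D) {φ : ℂ → ℝ} (hφ : ContinuousOn φ (frontier D)) {ε : ℝ} (hε : 0 < ε) :
    ∃ a, Al D a ∧ ∃ t : Fin m → ℝ, ∫ ζ, (φ ζ - ((a ζ).re + ∑ l, t l * Real.log ‖ζ - b l‖)) ^ 2 ∂μ < ε := by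
  have := hμ.prob
  let Q : Submodule ℝ (ℂ → ℝ) :=
    { carrier := {q | ∃ a, Al D a ∧ ∃ t : Fin m → ℝ, q = fun ζ => (a ζ).re + ∑ l, t l * Real.log ‖ζ - b l‖}
      add_mem' := by
        rintro _ _ ⟨a, ha, t, rfl⟩ ⟨a', ha', t', rfl⟩
        refine ⟨fun z => a z + a' z, ⟨ha.cont.add ha'.cont, ha.hol.add ha'.hol⟩, t + t', ?_⟩
        funext ζ
        simp [add_mul, Finset.sum_add_distrib]; ring
      zero_mem' := ⟨fun _ => 0, ⟨continuousOn_const, differentiableOn_const _⟩, 0, by funext; simp⟩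
      smul_mem' := by
        rintro k _ ⟨a, ha, t, rfl⟩
        refine ⟨fun z => (k:ℂ) * a z, ⟨continuousOn_const.mul ha.cont, ha.hol.const_mul _⟩, k • t, ?_⟩
        funext ζ
        simp [mul_add, Finset.mul_sum, mul_assoc] }
  have hcont : ∀ (a : ℂ → ℂ) (t : Fin m → ℝ), Al D a → ContinuousOn (fun ζ => (a ζ).re + ∑ l, t l * Real.log ‖ζ - b l‖) (frontier D) := fun a t ha =>
    ((Complex.continuous_re.comp_continuousOn ha.cont).mono frontier_subset_closure).add
      (continuousOn_finset_sum _ (fun l _ => continuousOn_const.mul (log_cont (fun h => hbD l (frontier_subset_closure h)))))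
  obtain ⟨q, ⟨a, ha, t, rfl⟩, h⟩ := l2_dense Q (μ := μ) (by
    rintro _ ⟨a, ha, t, rfl⟩
    exact hμ.memLp g (hcont a t ha)) (by
    intro n hn h
    refine WL1 g hc hμ (hn.integrable (by norm_num)) (fun a ha => ?_) hb hbD (fun l => ?_)
    · have := h _ ⟨a, ha, 0, rfl⟩
      simpa using this
    · have := h _ ⟨0, ⟨continuousOn_const, differentiableOn_const _⟩, Pi.single l 1, rfl⟩
      simpa [Pi.single_apply] using this) (hμ.memLp g hφ) hε
  exact ⟨a, ha, t, h⟩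

theorem lap_tcs {X : ℂ → ℝ} (hK : IsCompact (tsupport (fderiv ℝ X))) : HasCompactSupport (lap X) :=
  hK.of_isClosed_subset (isClosed_tsupport _) lap_tsupp

/-- integrability of `u * lap X` -/
theorem flux_int {D : Set ℂ} (hDo : IsOpen D) {X : ℂ → ℝ} (hX : ContDiff ℝ ∞ X)
    (hK : IsCompact (tsupport (fderiv ℝ X))) (hKD : tsupport (fderiv ℝ X) ⊆ D) {u : ℂ → ℝ} (hu : ContinuousOn u D) :
    Integrable (fun z => u z * lap X z) :=
  (cint hDo (hu.mul (lap_cont (hX.of_le (by norm_cast))).continuousOn) hK hKD (fun x hx => by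
    have : lap X x = 0 := image_eq_zero_of_notMem_tsupport (fun h => hx (lap_tsupp h))
    simp [this])).2.2

theorem flux_re {D : Set ℂ} (hD : IsOpen D) {F : ℂ → ℂ} (hF : DifferentiableOn ℂ F D) {X : ℂ → ℝ} (hX : ContDiff ℝ ∞ X)
    (hK : IsCompact (tsupport (fderiv ℝ X))) (hKD : tsupport (fderiv ℝ X) ⊆ D) {u : ℂ → ℝ} (hu : ∀ z ∈ D, u z = (F z).re) :
    ∫ z, u z * lap X z = 0 := by
  have h := flux_hol hD hF hX hK hKD
  have hi : Integrable (fun z => F z * ((lap X z : ℝ) : ℂ)) :=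
    (cint hD (hF.continuousOn.mul (Complex.continuous_ofReal.comp (lap_cont (hX.of_le (by norm_cast)))).continuousOn) hK hKD (fun x hx => by
    have : lap X x = 0 := image_eq_zero_of_notMem_tsupport (fun h => hx (lap_tsupp h))
    simp [this])).2.2
  have h2 := congrArg Complex.re h
  rw [← RCLike.re_eq_complex_re, ← integral_re hi] at h2
  simp only [RCLike.re_eq_complex_re, Complex.re_mul_ofReal, Complex.zero_re] at h2
  rw [← h2]
  congr 1; funext z
  by_cases hz : z ∈ D
  · rw [hu z hz]
  · have : lap X z = 0 := image_eq_zero_of_notMem_tsupport (fun h => hz (hKD (lap_tsupp h)))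
    simp [this]

theorem flux_bound {D : Set ℂ} {m : ℕ} {E : Fin m → Set ℂ} (g : Geo D m E) {c : ℂ} (hc : c ∈ D) {μ : Measure ℂ} (hμ : IsHM D c μ)
    {X : ℂ → ℝ} (hX : ContDiff ℝ ∞ X) (hK : IsCompact (tsupport (fderiv ℝ X))) (hKD : tsupport (fderiv ℝ X) ⊆ D) :
    ∃ C, 0 ≤ C ∧ ∀ φ u, ContinuousOn φ (frontier D) → Sol D φ u → |∫ z, u z * lap X z| ≤ C * ∫ ζ, |φ ζ| ∂μ := by
  obtain ⟨C, hC, hk⟩ := harnack g.op g.conn.isPreconnected hc hK hKD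
  have hlc := lap_cont (hX.of_le (show (2 : WithTop ℕ∞) ≤ ∞ by norm_cast))
  have hli : Integrable (lap X) := hlc.integrable_of_hasCompactSupport (lap_tcs hK)
  refine ⟨C * ∫ z, |lap X z|, mul_nonneg hC.le (integral_nonneg (fun _ => abs_nonneg _)), fun φ u hφ hu => ?_⟩
  have hv := g.sol (φ := fun z => |φ z|) hφ.abs
  have hvp : ∀ z ∈ D, 0 ≤ Hs D (fun z => |φ z|) z := fun z hz => Sol.le g.bdd g.op (Sol.const 0) hv (fun p _ => abs_nonneg _) z (subset_closure hz)
  have h1 : ∀ z ∈ tsupport (fderiv ℝ X), |u z| ≤ C * ∫ ζ, |φ ζ| ∂μ := by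
    intro z hz
    rw [hμ.int _ _ hv]
    refine le_trans ?_ ((hk z hz) _ hv.harm hvp).1
    rw [abs_le]
    constructor
    · have := Sol.le g.bdd g.op (hv.smul (-1)) hu (fun p _ => by show -1 * |φ p| ≤ φ p; linarith [neg_abs_le (φ p)]) z (subset_closure (hKD hz))
      simpa using this
    · exact Sol.le g.bdd g.op hu hv (fun p _ => le_abs_self _) z (subset_closure (hKD hz))
  have h2 : |∫ z, u z * lap X z| ≤ ∫ z, |u z * lap X z| := abs_integral_le_integral_abs
  refine h2.trans ?_
  rw [mul_right_comm, ← integral_const_mul]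
  refine integral_mono (flux_int g.op hX hK hKD (hu.cont.mono subset_closure)).abs (hli.abs.const_mul _) (fun z => ?_)
  simp only [abs_mul]
  by_cases hz : z ∈ tsupport (fderiv ℝ X)
  · exact mul_le_mul_of_nonneg_right (h1 z hz) (abs_nonneg _)
  · have : lap X z = 0 := image_eq_zero_of_notMem_tsupport (fun h => hz (lap_tsupp h))
    simp [this]

theorem l1_le {μ : Measure ℂ} [IsProbabilityMeasure μ] {r : ℂ → ℝ} (hr : MemLp r 2 μ) {η : ℝ} (hη : 0 < η) (h : ∫ ζ, r ζ ^ 2 ∂μ ≤ η ^ 2) :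
    ∫ ζ, |r ζ| ∂μ ≤ η := by
  have h2 : Integrable (fun ζ => r ζ ^ 2) μ := hr.integrable_sq
  have h1 : ∫ ζ, |r ζ| ∂μ ≤ ∫ ζ, ((2 * η)⁻¹ * r ζ ^ 2 + η / 2) ∂μ := by
    refine integral_mono (hr.integrable (by norm_num)).abs ((h2.const_mul _).add (integrable_const _)) (fun ζ => ?_)
    have h3 : 0 ≤ (2 * η)⁻¹ * (|r ζ| - η) ^ 2 := by positivity
    have h4 : (2 * η)⁻¹ * (|r ζ| - η) ^ 2 = (2 * η)⁻¹ * r ζ ^ 2 + η / 2 - |r ζ| := by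
      rw [← sq_abs (r ζ)]; field_simp; ring
    show |r ζ| ≤ (2 * η)⁻¹ * r ζ ^ 2 + η / 2
    linarith
  rw [integral_add (h2.const_mul _) (integrable_const _), integral_const_mul, integral_const] at h1
  have h5 : (2 * η)⁻¹ * ∫ ζ, r ζ ^ 2 ∂μ ≤ (2 * η)⁻¹ * η ^ 2 := mul_le_mul_of_nonneg_left h (by positivity)
  have h6 : (2 * η)⁻¹ * η ^ 2 = η / 2 := by field_simp
  simp only [probReal_univ, one_smul] at h1
  linarith

theorem far_log {D : Set ℂ} {y : ℂ} (hy : ∀ z ∈ closure D, ‖z‖ < ‖y‖) : ∃ a, Al D a ∧ ∀ z ∈ closure D, Real.log ‖z - y‖ = (a z).re := by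
  rcases D.eq_empty_or_nonempty with rfl | ⟨z0, hz0⟩
  · exact ⟨0, ⟨by simp, by simp⟩, by simp⟩
  have hy0 : 0 < ‖y‖ := (norm_nonneg z0).trans_lt (hy z0 (subset_closure hz0))
  have hy1 : y ≠ 0 := norm_pos_iff.1 hy0
  have hsl : ∀ z ∈ closure D, (1 - z / y) ∈ slitPlane := fun z hz => by
    refine Or.inl ?_
    have h1 : ‖z / y‖ < 1 := by
      rw [norm_div, div_lt_one hy0]; exact hy z hz
    have h2 := Complex.re_le_norm (z / y)
    simp only [Complex.sub_re, Complex.one_re]; linarith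
  refine ⟨fun z => Complex.log (1 - z / y) + (Real.log ‖y‖ : ℂ), ⟨?_, ?_⟩, fun z hz => ?_⟩
  · exact (ContinuousOn.clog (by fun_prop) hsl).add continuousOn_const
  · exact (DifferentiableOn.clog (by fun_prop) (fun z hz => hsl z (subset_closure hz))).add_const _
  · have hne : 1 - z / y ≠ 0 := slitPlane_ne_zero (hsl z hz)
    rw [Complex.add_re, Complex.log_re, Complex.ofReal_re, ← Real.log_mul (norm_ne_zero_iff.2 hne) hy0.ne', ← norm_mul, sub_mul, one_mul,
      div_mul_cancel₀ _ hy1, norm_sub_rev]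

theorem WL3 {D : Set ℂ} {m : ℕ} {E : Fin m → Set ℂ} (g : Geo D m E) {c : ℂ} (hc : c ∈ D) {μ : Measure ℂ} (hμ : IsHM D c μ)
    {φ : ℂ → ℝ} (hφ : ContinuousOn φ (frontier D)) {u : ℂ → ℝ} (hu : Sol D φ u) {F : ℂ → ℂ} (hF : DifferentiableOn ℂ F D)
    (huF : ∀ z ∈ D, u z = (F z).re) {ε : ℝ} (hε : 0 < ε) :
    ∃ a, Al D a ∧ ∫ ζ, (φ ζ - (a ζ).re) ^ 2 ∂μ < ε := by
  classical
  have := hμ.prob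
  obtain ⟨j, R, hR0, hRj, hcpt⟩ := g.exists_inf
  obtain ⟨R1, hR1⟩ := g.bdd.isCompact_closure.isBounded.exists_norm_le
  set y : ℂ := ((max R R1 + 1 : ℝ) : ℂ) with hy
  have hyn : ‖y‖ = max R R1 + 1 := by
    rw [hy, Complex.norm_real, Real.norm_eq_abs, abs_of_pos]
    linarith [le_max_left R R1]
  have hyj : y ∈ E j := hRj (show R < ‖y‖ by rw [hyn]; linarith [le_max_left R R1])
  have hyf : ∀ z ∈ closure D, ‖z‖ < ‖y‖ := fun z hz => by rw [hyn]; linarith [le_max_right R R1, hR1 z hz]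
  have hyD : y ∉ closure D := fun h => lt_irrefl _ (hyf y h)
  obtain ⟨a0, ha0, ha0e⟩ := far_log hyf
  choose b' hb' hbD' using g.inner
  set b : Fin m → ℂ := fun l => if l = j then y else b' l with hbdef
  have hb : ∀ l, b l ∈ E l := fun l => by
    by_cases h : l = j
    · simp only [hbdef, h, if_true]; exact hyj
    · simp only [hbdef, h, if_false]; exact hb' l
  have hbD : ∀ l, b l ∉ closure D := fun l => by
    by_cases h : l = j
    · simp only [hbdef, h, if_true]; exact hyD
    · simp only [hbdef, h, if_false]; exact hbD' l
  have hbj : b j = y := by simp [hbdef]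
  have hqs : ∀ (a : ℂ → ℂ) (t : Fin m → ℝ), Al D a → Sol D (fun ζ => (a ζ).re + ∑ l, t l * Real.log ‖ζ - b l‖) (fun ζ => (a ζ).re + ∑ l, t l * Real.log ‖ζ - b l‖) :=
    fun a t ha => (ha.re_sol g.op).add (Sol.sum _ (fun l => (log_sol (hbD l)).smul (t l)))
  have hcoef : ∀ l, ∃ C, 0 ≤ C ∧ (l ≠ j → ∀ (a : ℂ → ℂ) (t : Fin m → ℝ), Al D a →
      |t l| ≤ C * ∫ ζ, |φ ζ - ((a ζ).re + ∑ l, t l * Real.log ‖ζ - b l‖)| ∂μ) := by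
    intro l
    by_cases hl : l = j
    · exact ⟨0, le_rfl, fun h => absurd hl h⟩
    obtain ⟨X, hX⟩ := g.exists_cut (hcpt l hl)
    obtain ⟨hK, hKD⟩ := hX.tsupp g
    obtain ⟨C, hC0, hC⟩ := flux_bound g hc hμ hX.smooth hK hKD
    refine ⟨C, hC0, fun _ a t ha => ?_⟩
    have hs := hu.sub (hqs a t ha)
    have h1 := hC _ _ (hφ.sub ((hqs a t ha).cont.mono frontier_subset_closure)) hs
    have hli : ∀ i, Integrable (fun z => Real.log ‖z - b i‖ * lap X z) := fun i =>
      flux_int g.op hX.smooth hK hKD ((log_sol (hbD i)).cont.mono subset_closure)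
    have h2 : ∫ z, (u z - ((a z).re + ∑ l, t l * Real.log ‖z - b l‖)) * lap X z = -(t l * (2 * π)) := by
      have e : ∀ z, (u z - ((a z).re + ∑ l, t l * Real.log ‖z - b l‖)) * lap X z
          = u z * lap X z - ((a z).re * lap X z + ∑ i, t i * (Real.log ‖z - b i‖ * lap X z)) := by
        intro z
        have : ∑ i, t i * (Real.log ‖z - b i‖ * lap X z) = (∑ l, t l * Real.log ‖z - b l‖) * lap X z := by
          rw [Finset.sum_mul]; simp_rw [mul_assoc]
        rw [this]; ring
      simp_rw [e]
      have i1 := flux_int g.op hX.smooth hK hKD (hu.cont.mono subset_closure)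
      have i2 := flux_int g.op hX.smooth hK hKD ((ha.re_sol g.op).cont.mono subset_closure)
      have i3 : Integrable (fun z => ∑ i, t i * (Real.log ‖z - b i‖ * lap X z)) := integrable_finsetSum _ (fun i _ => (hli i).const_mul _)
      have i23 : Integrable (fun z => (a z).re * lap X z + ∑ i, t i * (Real.log ‖z - b i‖ * lap X z)) := i2.add i3
      rw [integral_sub i1 i23, integral_add i2 i3, flux_re g.op hF hX.smooth hK hKD huF,
        flux_re g.op ha.hol hX.smooth hK hKD (fun _ _ => rfl), integral_finsetSum _ (fun i _ => (hli i).const_mul _)]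
      simp_rw [integral_const_mul, log_green (hX.smooth.of_le (show (2 : WithTop ℕ∞) ≤ ∞ by norm_cast)) hX.cs]
      rw [Finset.sum_eq_single l]
      · rw [(hX.one _ (hb l)).self_of_nhds]; ring
      · intro i _ hi
        rw [(hX.zero i hi _ (hb i)).self_of_nhds]; ring
      · simp
    rw [h2, abs_neg, abs_mul, abs_of_pos (by positivity : (0:ℝ) < 2 * π)] at h1
    refine le_trans ?_ h1
    nlinarith [abs_nonneg (t l), Real.pi_gt_three]
  choose C hC0 hC using hcoef
  have hlogb : ∀ l, ∃ B, ∀ ζ ∈ frontier D, ‖Real.log ‖ζ - b l‖‖ ≤ B := fun l =>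
    g.fcpt.exists_bound_of_continuousOn (log_cont (fun h => hbD l (frontier_subset_closure h)))
  choose B hB using hlogb
  set M := ∑ l, C l * |B l| with hM
  have hM0 : 0 ≤ M := Finset.sum_nonneg (fun l _ => mul_nonneg (hC0 l) (abs_nonneg _))
  set δ := ε / (2 * (1 + M ^ 2)) with hδ
  have hδ0 : 0 < δ := by positivity
  set η := Real.sqrt δ with hη
  have hη0 : 0 < η := Real.sqrt_pos.2 hδ0
  have hη2 : η ^ 2 = δ := Real.sq_sqrt hδ0.le
  obtain ⟨a, ha, t, hat⟩ := WL2 g hc hμ hb hbD hφ hδ0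
  have hrc : ContinuousOn (fun ζ => φ ζ - ((a ζ).re + ∑ l, t l * Real.log ‖ζ - b l‖)) (frontier D) := hφ.sub ((hqs a t ha).cont.mono frontier_subset_closure)
  have hrm := hμ.memLp g hrc
  have hI := l1_le hrm hη0 (by rw [hη2]; exact hat.le)
  refine ⟨fun z => a z + (t j : ℂ) * a0 z, ⟨ha.cont.add (continuousOn_const.mul ha0.cont), ha.hol.add (ha0.hol.const_mul _)⟩, ?_⟩
  have hle : ∀ ζ ∈ frontier D, (φ ζ - (a ζ + (t j : ℂ) * a0 ζ).re) ^ 2 ≤ 2 * (φ ζ - ((a ζ).re + ∑ l, t l * Real.log ‖ζ - b l‖)) ^ 2 + 2 * (M * η) ^ 2 := by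
    intro ζ hζ
    have h1 : (a0 ζ).re = Real.log ‖ζ - b j‖ := by rw [hbj, ha0e ζ (frontier_subset_closure hζ)]
    have h2 := Finset.add_sum_erase Finset.univ (fun l => t l * Real.log ‖ζ - b l‖) (Finset.mem_univ j)
    set s := ∑ l ∈ Finset.univ.erase j, t l * Real.log ‖ζ - b l‖ with hs
    have hs1 : |s| ≤ M * η := by
      refine (Finset.abs_sum_le_sum_abs _ _).trans ?_
      rw [hM, Finset.sum_mul]
      refine (Finset.sum_le_sum (fun l hl => ?_)).trans (Finset.sum_le_sum_of_subset_of_nonneg (Finset.erase_subset j _) (fun l _ _ => mul_nonneg (mul_nonneg (hC0 l) (abs_nonneg _)) hη0.le))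
      rw [abs_mul]
      have h3 := hC l (Finset.ne_of_mem_erase hl) a t ha
      have h4 : |t l| ≤ C l * η := h3.trans (mul_le_mul_of_nonneg_left hI (hC0 l))
      have h5 : |Real.log ‖ζ - b l‖| ≤ |B l| := (hB l ζ hζ).trans (le_abs_self _)
      calc |t l| * |Real.log ‖ζ - b l‖| ≤ (C l * η) * |B l| := mul_le_mul h4 h5 (abs_nonneg _) (mul_nonneg (hC0 l) hη0.le)
        _ = C l * |B l| * η := by ring
    have h6 : s ^ 2 ≤ (M * η) ^ 2 := by rw [← sq_abs s]; exact pow_le_pow_left₀ (abs_nonneg _) hs1 2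
    simp only [Complex.add_re, Complex.re_ofReal_mul, h1]
    rw [← h2]
    nlinarith [sq_nonneg (φ ζ - (a ζ).re - t j * Real.log ‖ζ - b j‖ - s - s)]
  have hac : ContinuousOn (fun ζ => φ ζ - (a ζ + (t j : ℂ) * a0 ζ).re) (frontier D) :=
    hφ.sub ((Complex.continuous_re.comp_continuousOn (ha.cont.add (continuousOn_const.mul ha0.cont))).mono frontier_subset_closure)
  have hbig : ∫ ζ, (φ ζ - (a ζ + (t j : ℂ) * a0 ζ).re) ^ 2 ∂μ ≤ ∫ ζ, (2 * (φ ζ - ((a ζ).re + ∑ l, t l * Real.log ‖ζ - b l‖)) ^ 2 + 2 * (M * η) ^ 2) ∂μ := by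
    refine integral_mono_ae (hμ.memLp g hac).integrable_sq ((hrm.integrable_sq.const_mul 2).add (integrable_const _)) ?_
    filter_upwards [hμ.supp] with ζ hζ using hle ζ hζ
  refine hbig.trans_lt ?_
  rw [integral_add (hrm.integrable_sq.const_mul 2) (integrable_const _), integral_const_mul, integral_const]
  simp only [probReal_univ, one_smul]
  have : 2 * δ + 2 * (M * η) ^ 2 = ε := by
    rw [mul_pow, hη2, hδ]; field_simp
  linarith

structure SS (D : Set ℂ) (Φ : ℂ → ℂ) : Prop where
  cont : ContinuousOn Φ (frontier D)
  sv : ∀ a, Al D a → ∀ u, Sol D (fun z => (a z * Φ z).re) u → ∃ F : ℂ → ℂ, DifferentiableOn ℂ F D ∧ ∀ z ∈ D, u z = (F z).re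

theorem Al.const {D : Set ℂ} (k : ℂ) : Al D (fun _ => k) := ⟨continuousOn_const, differentiableOn_const _⟩
theorem Al.add {D : Set ℂ} {a b : ℂ → ℂ} (ha : Al D a) (hb : Al D b) : Al D (fun z => a z + b z) := ⟨ha.cont.add hb.cont, ha.hol.add hb.hol⟩
theorem Al.mul {D : Set ℂ} {a b : ℂ → ℂ} (ha : Al D a) (hb : Al D b) : Al D (fun z => a z * b z) := ⟨ha.cont.mul hb.cont, ha.hol.mul hb.hol⟩
theorem Al.sub {D : Set ℂ} {a b : ℂ → ℂ} (ha : Al D a) (hb : Al D b) : Al D (fun z => a z - b z) := ⟨ha.cont.sub hb.cont, ha.hol.sub hb.hol⟩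
theorem Al.id {D : Set ℂ} : Al D (fun z => z) := ⟨continuousOn_id, differentiableOn_id⟩
theorem Al.pow {D : Set ℂ} {a : ℂ → ℂ} (ha : Al D a) (n : ℕ) : Al D (fun z => a z ^ n) := ⟨ha.cont.pow n, ha.hol.pow n⟩

theorem AP {D : Set ℂ} {m : ℕ} {E : Fin m → Set ℂ} (g : Geo D m E) {c : ℂ} (hc : c ∈ D) {μ : Measure ℂ} (hμ : IsHM D c μ)
    {Φ : ℂ → ℂ} (hΦ : SS D Φ) {ε : ℝ} (hε : 0 < ε) :
    ∃ α β, Al D α ∧ Al D β ∧ β c = 0 ∧ ∫ ζ, ‖Φ ζ - α ζ - (starRingEnd ℂ) (β ζ)‖ ^ 2 ∂μ < ε := by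
  have := hμ.prob
  have h1 : ContinuousOn (fun z => ((1:ℂ) * Φ z).re) (frontier D) := Complex.continuous_re.comp_continuousOn (continuousOn_const.mul hΦ.cont)
  have h2 : ContinuousOn (fun z => (-I * Φ z).re) (frontier D) := Complex.continuous_re.comp_continuousOn (continuousOn_const.mul hΦ.cont)
  obtain ⟨F1, hF1, hu1⟩ := hΦ.sv _ (Al.const 1) _ (g.sol h1)
  obtain ⟨F2, hF2, hu2⟩ := hΦ.sv _ (Al.const (-I)) _ (g.sol h2)
  obtain ⟨a1, ha1, he1⟩ := WL3 g hc hμ h1 (g.sol h1) hF1 hu1 (half_pos hε)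
  obtain ⟨a2, ha2, he2⟩ := WL3 g hc hμ h2 (g.sol h2) hF2 hu2 (half_pos hε)
  set k : ℂ := (a1 c - I * a2 c) / 2 with hk
  refine ⟨fun z => (1/2) * (a1 z + I * a2 z) + (starRingEnd ℂ) k, fun z => (1/2) * (a1 z - I * a2 z) - k,
    ((Al.const _).mul (ha1.add ((Al.const _).mul ha2))).add (Al.const _), ((Al.const _).mul (ha1.sub ((Al.const _).mul ha2))).sub (Al.const _), by simp only [hk]; ring, ?_⟩
  have hac : ∀ a, Al D a → ContinuousOn (fun z => (a z).re) (frontier D) := fun a ha => (Complex.continuous_re.comp_continuousOn ha.cont).mono frontier_subset_closure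
  have e : ∀ ζ, ‖Φ ζ - ((1/2) * (a1 ζ + I * a2 ζ) + (starRingEnd ℂ) k) - (starRingEnd ℂ) ((1/2) * (a1 ζ - I * a2 ζ) - k)‖ ^ 2
      = (((1:ℂ) * Φ ζ).re - (a1 ζ).re) ^ 2 + ((-I * Φ ζ).re - (a2 ζ).re) ^ 2 := by
    intro ζ
    rw [← Complex.normSq_eq_norm_sq, Complex.normSq_apply]
    simp
    ring
  simp_rw [e]
  have i1 : Integrable (fun ζ => (((1:ℂ) * Φ ζ).re - (a1 ζ).re) ^ 2) μ := (hμ.memLp g (h1.sub (hac _ ha1))).integrable_sq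
  have i2 : Integrable (fun ζ => ((-I * Φ ζ).re - (a2 ζ).re) ^ 2) μ := (hμ.memLp g (h2.sub (hac _ ha2))).integrable_sq
  rw [integral_add i1 i2]
  linarith

end HX

namespace HX
open Metric Filter Topology InnerProductSpace Real MeasureTheory
open scoped ContDiff

theorem flux_congr {D : Set ℂ} {X : ℂ → ℝ} (hKD : tsupport (fderiv ℝ X) ⊆ D) {u v : ℂ → ℝ} (h : ∀ z ∈ D, u z = v z) :
    ∫ z, u z * lap X z = ∫ z, v z * lap X z := by
  congr 1; funext z
  by_cases hz : z ∈ D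
  · rw [h z hz]
  · have : lap X z = 0 := image_eq_zero_of_notMem_tsupport (fun h => hz (hKD (lap_tsupp h)))
    simp [this]

theorem flux_A {D : Set ℂ} {m : ℕ} {E : Fin m → Set ℂ} (g : Geo D m E) {c : ℂ} (hc : c ∈ D)
    {Y : ℂ → ℝ} (hY : ContDiff ℝ ∞ Y) (hYn : ∀ z, 0 ≤ Y z) (hY1 : ∀ z, Y z ≤ 1)
    (hK : IsCompact (tsupport (fderiv ℝ Y))) (hKD : tsupport (fderiv ℝ Y) ⊆ D) 
    (hYb : ∀ p ∈ frontier D, Y p = 1 ∨ ∀ᶠ y in 𝓝 p, Y y = 0) {V : ℂ → ℝ} (hV : Sol D (fun z => 1 - Y z) V) :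
    0 ≤ ∫ z, V z * lap Y z ∧ ∃ s > 0, ∀ φ u, (∀ p ∈ frontier D, 0 ≤ φ p) → 
      (∀ p ∈ frontier D, φ p = 0 ∨ ∀ᶠ y in 𝓝 p, Y y = 0) → Sol D φ u → s * u c * ∫ z, V z * lap Y z ≤ ∫ z, u z * lap Y z := by
  have hDo := g.op
  obtain ⟨C', hC', hH'⟩ := harnack hDo g.conn.isPreconnected hc hK hKD
  set C := max C' 1
  have hC1 : 1 ≤ C := le_max_right _ _
  have hC : 0 < C := by linarith
  have hVle : ∀ z ∈ closure D, V z ≤ 1 := fun z hz => Sol.le g.bdd hDo hV (Sol.const 1) (fun z _ => by linarith [hYn z]) z hz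
  have key : ∀ φ u, (∀ p ∈ frontier D, 0 ≤ φ p) → 
      (∀ p ∈ frontier D, φ p = 0 ∨ ∀ᶠ y in 𝓝 p, Y y = 0) → Sol D φ u → (1/(2*C)) * u c * ∫ z, V z * lap Y z ≤ ∫ z, u z * lap Y z := by
    intro φ u hφ hφb hu
    have hu0 : ∀ z ∈ D, 0 ≤ u z := fun z hz => Sol.le g.bdd hDo (Sol.const 0) hu (fun z hz => hφ z hz) z (subset_closure hz)
    rcases (hu0 c hc).eq_or_lt with h0 | hpos
    · have : ∀ z ∈ D, u z = (fun _ => (0:ℝ)) z := by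
        intro z hz
        obtain ⟨C2, _, h2⟩ := harnack hDo g.conn.isPreconnected hc (isCompact_singleton (x := z)) (by simpa using hz)
        have := (h2 z rfl u hu.harm hu0).1
        rw [← h0, mul_zero] at this
        exact le_antisymm this (hu0 z hz)
      rw [flux_congr hKD this, ← h0]; simp
    · set t := (1/(2*C)) * u c with ht
      have hts : t > 0 := by positivity
      have hw := hu.sub (hV.smul t)
      have := flux_pos g.bdd hDo hY hYn hK hKD hw.cont hw.harm (fun z hz => by
        have h1 := (hH' z hz u hu.harm hu0).2
        have h2 : u c ≤ C * u z := h1.trans (mul_le_mul_of_nonneg_right (le_max_left _ _) (hu0 z (hKD hz)))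
        have h3 := hVle z (subset_closure (hKD hz))
        have h4 : t * V z ≤ t := by nlinarith
        have h5 : 2 * C * t = u c := by rw [ht]; field_simp
        have h6 : 2 * t ≤ u z := by
          by_contra h; push Not at h
          nlinarith
        show 0 < u z - t * V z
        linarith) (fun p hp => by
          rcases hφb p hp with h | h
          · rcases hYb p hp with h' | h'
            · left; rw [hw.bd p hp, h, h']; ring
            · right; exact h'
          · right; exact h)
      have i1 := flux_int hDo hY hK hKD (hu.cont.mono subset_closure)
      have i2 := (flux_int hDo hY hK hKD (hV.cont.mono subset_closure)).const_mul t
      have e : (fun z => (u z - t * V z) * lap Y z) = fun z => u z * lap Y z - t * (V z * lap Y z) := by funext z; ring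
      rw [e, integral_sub i1 i2, integral_const_mul] at this
      linarith
  refine ⟨?_, 1/(2*C), by positivity, key⟩
  have h := key _ V (fun p _ => by linarith [hY1 p]) (fun p hp => by
    rcases hYb p hp with h | h
    · left; linarith
    · right; exact h) hV
  have h1 : 1 / (2*C) * V c ≤ 1/2 := by
    have := hVle c (subset_closure hc)
    have h2 : 1/(2*C) ≤ 1/2 := by apply one_div_le_one_div_of_le <;> linarith
    have h3 : 0 < 1/(2*C) := by positivity
    nlinarith
  by_contra hneg; push Not at hneg
  nlinarith

theorem flux_coer {D : Set ℂ} {m : ℕ} {E : Fin m → Set ℂ} (g : Geo D m E) {c : ℂ} (hc : c ∈ D) {μ : Measure ℂ} (hμ : IsHM D c μ)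
    {j : Fin m} {X : ℂ → ℝ} (hX : Cut D E j X) :
    ∃ c0 > 0, ∀ φ u, ContinuousOn φ (frontier D) → (∀ p ∈ frontier D, 0 ≤ φ p) → Sol D (fun z => (1 - 2 * X z) * φ z) u → 
      c0 * ∫ ζ, φ ζ ∂μ ≤ ∫ z, u z * lap X z := by
  have hDo := g.op
  obtain ⟨hK, hKD⟩ := hX.tsupp g
  have hXs := hX.smooth
  have hYs : ContDiff ℝ ∞ (fun z => 1 - X z) := contDiff_const.sub hXs
  have hfd : ∀ v : ℂ, (fun z => fderiv ℝ (fun z => 1 - X z) z v) = fun z => - fderiv ℝ X z v := by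
    intro v; funext z; rw [fderiv_const_sub]; rfl
  have hlapY : lap (fun z => 1 - X z) = fun z => - lap X z := by
    funext z
    unfold lap
    simp only [hfd, fderiv_fun_neg]
    simp; ring
  have hts : tsupport (fderiv ℝ (fun z => 1 - X z)) = tsupport (fderiv ℝ X) := by
    have : fderiv ℝ (fun z => 1 - X z) = - fderiv ℝ X := by
      funext z; rw [fderiv_const_sub]; rfl
    rw [this]
    unfold tsupport
    rw [Function.support_neg]
  have hXb : ∀ p ∈ frontier D, (X p = 1 ∧ ∀ᶠ y in 𝓝 p, 1 - X y = 0) ∨ (X p = 0 ∧ ∀ᶠ y in 𝓝 p, X y = 0) := by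
    intro p hp
    obtain ⟨i, hi, _⟩ := g.mem_front.1 hp
    by_cases hij : i = j
    · subst hij
      have := hX.one p hi
      exact Or.inl ⟨this.self_of_nhds, this.mono (fun y hy => by rw [hy]; ring)⟩
    · have := hX.zero i hij p hi
      exact Or.inr ⟨this.self_of_nhds, this⟩
  have hXc := hXs.continuous
  have s1 := g.sol (φ := fun z => 1 - X z) (by fun_prop)
  have s0 := g.sol (φ := fun z => 1 - (1 - X z)) (by fun_prop)
  set V1 := Hs D (fun z => 1 - X z)
  set V0 := Hs D (fun z => 1 - (1 - X z))
  obtain ⟨p1, t1, ht1, k1⟩ := flux_A g hc hXs hX.nonneg hX.le_one hK hKD (fun p hp => by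
    rcases hXb p hp with h | h
    · exact Or.inl h.1
    · exact Or.inr h.2) s1
  obtain ⟨p0, t0, ht0, k0⟩ := flux_A g hc hYs (fun z => by linarith [hX.le_one z]) (fun z => by linarith [hX.nonneg z]) (by rw [hts]; exact hK) (by rw [hts]; exact hKD) (fun p hp => by
    rcases hXb p hp with h | h
    · exact Or.inr h.2
    · exact Or.inl (by rw [h.1]; ring)) s0
  have hn : ∀ u : ℂ → ℝ, ∫ z, u z * lap (fun z => 1 - X z) z = - ∫ z, u z * lap X z := by
    intro u; rw [hlapY, ← integral_neg]; congr 1; funext z; ring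
  simp only [hn] at p0 k0
  have hadd : ∀ φ ψ u v, Sol D φ u → Sol D ψ v → ∀ w, Sol D (fun z => φ z + ψ z) w → ∫ z, w z * lap X z = (∫ z, u z * lap X z) + ∫ z, v z * lap X z := by
    intro φ ψ u v hu hv w hw
    rw [flux_congr hKD (fun z hz => Sol.unique g.bdd hDo hw (hu.add hv) z (subset_closure hz))]
    rw [← integral_add (flux_int hDo hXs hK hKD (hu.cont.mono subset_closure)) (flux_int hDo hXs hK hKD (hv.cont.mono subset_closure))]
    congr 1; funext z; ring
  have hconst : ∀ a : ℝ, ∫ z, (fun _ => a) z * lap X z = 0 := by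
    intro a
    exact flux_re hDo (F := fun _ => (a : ℂ)) (differentiableOn_const _) hXs hK hKD (fun z _ => by simp)
  set τ := ∫ z, V1 z * lap X z with hτ
  have hτ0 : - ∫ z, V0 z * lap X z = τ := by
    have := hadd _ _ _ _ s1 s0 (fun _ => 1) ⟨continuousOn_const, harmonicOnNhd_const 1, fun z _ => by ring⟩
    rw [hconst] at this; linarith
  rw [hτ0] at k0
  -- decomposition
  have dec : ∀ φ, ContinuousOn φ (frontier D) → (∀ p ∈ frontier D, 0 ≤ φ p) → 
      ∃ u1 u0, Sol D (fun z => (1 - X z) * φ z) u1 ∧ Sol D (fun z => X z * φ z) u0 ∧ t1 * u1 c * τ ≤ ∫ z, u1 z * lap X z ∧ t0 * u0 c * τ ≤ - ∫ z, u0 z * lap X z := by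
    intro φ hφ hp
    have a1 := g.sol (φ := fun z => (1 - X z) * φ z) ((by fun_prop : Continuous fun z => 1 - X z).continuousOn.mul hφ)
    have a0 := g.sol (φ := fun z => X z * φ z) (hXc.continuousOn.mul hφ)
    refine ⟨_, _, a1, a0, k1 _ _ (fun p hq => mul_nonneg (by linarith [hX.le_one p]) (hp p hq)) (fun p hq => ?_) a1,
      k0 _ _ (fun p hq => mul_nonneg (hX.nonneg p) (hp p hq)) (fun p hq => ?_) a0⟩
    · rcases hXb p hq with h | h
      · left; rw [h.1]; ring
      · exact Or.inr h.2
    · rcases hXb p hq with h | h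
      · exact Or.inr h.2
      · left; rw [h.1]; ring
  have nonn : ∀ φ u, (∀ p ∈ frontier D, 0 ≤ φ p) → Sol D φ u → 0 ≤ u c := fun φ u hφ hu => 
    Sol.le g.bdd hDo (Sol.const 0) hu (fun z hz => hφ z hz) c (subset_closure hc)
  have hτpos : 0 < τ := by
    refine lt_of_le_of_ne p1 (fun h0 => ?_)
    obtain ⟨b, hbE, hb⟩ := g.inner j
    have hL := log_sol hb
    have hgr := log_green (hXs.of_le (by norm_cast)) hX.cs b
    rw [(hX.one b hbE).self_of_nhds] at hgr
    obtain ⟨M, hM⟩ := g.fcpt.exists_bound_of_continuousOn (hL.cont.mono frontier_subset_closure)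
    have hM' : ∀ p ∈ frontier D, |Real.log ‖p - b‖| ≤ M := fun p hp => by simpa using hM p hp
    have hψ := hL.add (Sol.const M)
    have hψc : ContinuousOn (fun z => Real.log ‖z - b‖ + M) (frontier D) := hψ.cont.mono frontier_subset_closure
    obtain ⟨u1, u0, h1, h0', q1, q0⟩ := dec _ hψc (fun p hp => by linarith [(abs_le.1 (hM' p hp)).1])
    have hψc2 : ContinuousOn (fun z => M - Real.log ‖z - b‖) (frontier D) := continuousOn_const.sub (hL.cont.mono frontier_subset_closure)
    obtain ⟨v1, v0, h2, h2', r1, r0⟩ := dec _ hψc2 (fun p hp => by linarith [(abs_le.1 (hM' p hp)).2])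
    rw [← h0] at q1 q0 r1 r0
    simp only [mul_zero] at q1 q0 r1 r0
    have e1 := hadd _ _ _ _ h1 h0' (fun z => Real.log ‖z - b‖ + M) ⟨hψ.cont, hψ.harm, fun z _ => by ring⟩
    have e2 := hadd _ _ _ _ hL (Sol.const M) _ hψ
    have e3 := hadd _ _ _ _ h1 h2 _ (⟨(s1.smul (2*M)).cont, (s1.smul (2*M)).harm, fun z hz => by rw [(s1.smul (2*M)).bd z hz]; ring⟩ : Sol D _ (fun z => 2*M*V1 z))
    have e4 : ∫ z, 2 * M * V1 z * lap X z = 0 := by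
      have : (fun z => 2 * M * V1 z * lap X z) = fun z => (2 * M) * (V1 z * lap X z) := by funext z; ring
      rw [this, integral_const_mul, ← hτ, ← h0, mul_zero]
    rw [hconst, hgr] at e2
    have := Real.pi_pos
    linarith
  refine ⟨min t1 t0 * τ, by positivity, ?_⟩
  intro φ u hφ hp hu
  obtain ⟨u1, u0, h1, h0', q1, q0⟩ := dec φ hφ hp
  have e1 := hadd _ _ _ _ hu h0' u1 ⟨h1.cont, h1.harm, fun z hz => by rw [h1.bd z hz]; ring⟩
  have hi := hμ.int _ _ (⟨(h1.add h0').cont, (h1.add h0').harm, fun z hz => by rw [(h1.add h0').bd z hz]; ring⟩ : Sol D φ _)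
  have n1 := nonn _ _ (fun p hq => mul_nonneg (by linarith [hX.le_one p]) (hp p hq)) h1
  have n0 := nonn _ _ (fun p hq => mul_nonneg (hX.nonneg p) (hp p hq)) h0'
  rw [hi]
  have m1 : min t1 t0 * u1 c * τ ≤ t1 * u1 c * τ := by gcongr; exact min_le_left _ _
  have m0 : min t1 t0 * u0 c * τ ≤ t0 * u0 c * τ := by gcongr; exact min_le_right _ _
  linarith

end HX

namespace HX
open Metric Filter Topology InnerProductSpace Real MeasureTheory
open scoped ContDiff

theorem G_fun {D : Set ℂ} {m : ℕ} {E : Fin m → Set ℂ} (g : Geo D m E) {j : Fin m} {X : ℂ → ℝ} (hX : Cut D E j X) :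
    ∃ C1, 0 ≤ C1 ∧ ∀ β, Al D β → ∀ s, 0 ≤ s → (∀ z ∈ tsupport (fderiv ℝ X), ‖β z‖ ≤ s) → 
      ∃ T : ℂ → ℂ, ContinuousOn T (closure D) ∧ Al D (fun z => (1 - 2 * ((X z : ℝ) : ℂ)) * β z + 2 * T z) ∧ ∀ z ∈ closure D, ‖T z‖ ≤ C1 * s := by
  have hDo := g.op
  obtain ⟨hK, hKD⟩ := hX.tsupp g
  have hXs := hX.smooth
  obtain ⟨R, hR1, hR⟩ := g.radius
  obtain ⟨C, hC0, hC⟩ := TT_bound (R := R)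
  set Xc : ℂ → ℂ := fun z => ((X z : ℝ) : ℂ) with hXc
  have hXcs : ContDiff ℝ ∞ Xc := Complex.ofRealCLM.contDiff.comp hXs
  have hXd : ∀ z, DifferentiableAt ℝ Xc z := fun z => (hXcs.differentiable (by simp)) z
  have hfd : ∀ z v, fderiv ℝ Xc z v = ((fderiv ℝ X z v : ℝ) : ℂ) := by
    intro z v
    have h1 : HasFDerivAt X (fderiv ℝ X z) z := (hXs.differentiable (by simp) z).hasFDerivAt
    have h2 := Complex.ofRealCLM.hasFDerivAt.comp z h1
    have h3 : fderiv ℝ Xc z = Complex.ofRealCLM.comp (fderiv ℝ X z) := h2.fderiv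
    rw [h3]; rfl
  set κ : ℂ → ℂ := dbar Xc with hκ
  have hκs : ContDiff ℝ 1 κ := by
    have h1 : ∀ v : ℂ, ContDiff ℝ 1 (fun z => fderiv ℝ Xc z v) := fun v => 
      (hXcs.fderiv_right (m := 1) (by norm_cast)).clm_apply contDiff_const
    exact (h1 1).add (contDiff_const.mul (h1 I))
  have hκ0 : ∀ z, z ∉ tsupport (fderiv ℝ X) → κ z = 0 := by
    intro z hz
    have : fderiv ℝ X z = 0 := image_eq_zero_of_notMem_tsupport hz
    simp [hκ, dbar, hfd, this]
  have hκc : HasCompactSupport κ := HasCompactSupport.intro hK hκ0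
  obtain ⟨M, hM⟩ := hκs.continuous.bounded_above_of_compact_support hκc
  have hM0 : 0 ≤ M := (norm_nonneg _).trans (hM 0)
  refine ⟨C * M, by positivity, ?_⟩
  intro β hβ s hs0 hs
  set u : ℂ → ℂ := fun z => β z * κ z with hu
  have hβd : ∀ z ∈ D, DifferentiableAt ℂ β z := fun z hz => hβ.hol.differentiableAt (hDo.mem_nhds hz)
  have hus : ContDiff ℝ 1 u := by
    rw [contDiff_iff_contDiffAt]
    intro z
    by_cases hz : z ∈ D
    · have h1 : ContDiffAt ℂ 1 β z := (hβ.hol.analyticAt (hDo.mem_nhds hz)).contDiffAt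
      exact (h1.restrict_scalars ℝ).mul hκs.contDiffAt
    · have hz' : z ∉ tsupport (fderiv ℝ X) := fun h => hz (hKD h)
      have : u =ᶠ[𝓝 z] fun _ => 0 := by
        filter_upwards [(isClosed_tsupport (fderiv ℝ X)).isOpen_compl.mem_nhds hz'] with y hy
        simp [hu, hκ0 y hy]
      exact contDiffAt_const.congr_of_eventuallyEq this
  have huc : HasCompactSupport u := hκc.mul_left
  have hTd : ∀ z, DifferentiableAt ℝ (TT u) z := fun z => (TT_fderiv hus huc z).1
  refine ⟨TT u, fun z _ => (hTd z).continuousAt.continuousWithinAt, ⟨?_, ?_⟩, ?_⟩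
  · have hTc : ContinuousOn (TT u) (closure D) := fun z _ => (hTd z).continuousAt.continuousWithinAt
    have h1 : ContinuousOn (fun z => 1 - 2 * Xc z) (closure D) := (continuous_const.sub (continuous_const.mul hXcs.continuous)).continuousOn
    exact (h1.mul hβ.cont).add (continuousOn_const.mul hTc)
  · intro z hz
    apply DifferentiableAt.differentiableWithinAt
    have hβr : DifferentiableAt ℝ β z := (hβd z hz).restrictScalars ℝ
    have hA : DifferentiableAt ℝ (fun z => 1 - 2 * Xc z) z := ((hXd z).const_mul 2).const_sub 1
    apply dbar_diff
    · exact (hA.mul hβr).add ((hTd z).const_mul 2)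
    · have e1 := dbar_mul hA hβr
      rw [dbar_of_diff (hβd z hz)] at e1
      have e2 : dbar (fun z => 1 - 2 * Xc z) z = - 2 * κ z := by
        simp only [dbar, hκ]
        rw [fderiv_const_sub, fderiv_const_mul (hXd z)]
        simp; ring
      have e3 := TT_dbar hus huc z
      have e4 : dbar (fun z => (1 - 2 * Xc z) * β z + 2 * TT u z) z = dbar (fun z => (1 - 2 * Xc z) * β z) z + 2 * dbar (TT u) z := by
        simp only [dbar]
        have hm : DifferentiableAt ℝ (fun z => (1 - 2 * Xc z) * β z) z := hA.mul hβr
        rw [fderiv_fun_add hm ((hTd z).const_mul 2), fderiv_const_mul (hTd z)]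
        simp; ring
      rw [e4, e1, e2, e3]; simp only [hu]; ring
  · intro z hz
    have := hC u z (M * s) (fun y => by
      by_cases hy : y ∈ tsupport (fderiv ℝ X)
      · rw [hu]; simp only [norm_mul]; rw [mul_comm]
        exact mul_le_mul (hM y) (hs y hy) (norm_nonneg _) hM0
      · simp only [hu, hκ0 y hy, mul_zero, norm_zero]; positivity) (fun y hy => by
      by_cases hy' : y ∈ tsupport (fderiv ℝ X)
      · exact absurd (hR z hz y (subset_closure (hKD hy'))) (not_le.2 hy)
      · simp [hu, hκ0 y hy'])
    linarith

theorem SS.al_mul {D : Set ℂ} {a Φ : ℂ → ℂ} (ha : Al D a) (h : SS D Φ) : SS D (fun z => a z * Φ z) :=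
  ⟨(ha.cont.mono frontier_subset_closure).mul h.cont, fun b hb u hu => h.sv _ (hb.mul ha) u ⟨hu.cont, hu.harm, fun z hz => by
    rw [hu.bd z hz]; ring_nf⟩⟩

theorem SS.al {D : Set ℂ} (hDb : Bornology.IsBounded D) (hDo : IsOpen D) {a : ℂ → ℂ} (ha : Al D a) : SS D a :=
  ⟨ha.cont.mono frontier_subset_closure, fun b hb u hu => ⟨fun z => b z * a z, (hb.mul ha).hol, fun z hz => 
    Sol.unique hDb hDo hu ((hb.mul ha).re_sol hDo) z (subset_closure hz)⟩⟩

theorem SS.congr {D : Set ℂ} {Φ Ψ : ℂ → ℂ} (h : SS D Φ) (e : EqOn Φ Ψ (frontier D)) : SS D Ψ :=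
  ⟨h.cont.congr e.symm, fun b hb u hu => h.sv b hb u ⟨hu.cont, hu.harm, fun z hz => by rw [hu.bd z hz, e hz]⟩⟩

theorem SS.add {D : Set ℂ} {m : ℕ} {E : Fin m → Set ℂ} (g : Geo D m E) {Φ Ψ : ℂ → ℂ} (h : SS D Φ) (h' : SS D Ψ) : SS D (fun z => Φ z + Ψ z) :=
  ⟨h.cont.add h'.cont, fun b hb u hu => by
    have hbc := hb.cont.mono frontier_subset_closure
    have s1 := g.sol (φ := fun z => (b z * Φ z).re) (Complex.continuous_re.comp_continuousOn (hbc.mul h.cont))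
    have s2 := g.sol (φ := fun z => (b z * Ψ z).re) (Complex.continuous_re.comp_continuousOn (hbc.mul h'.cont))
    obtain ⟨F1, d1, e1⟩ := h.sv b hb _ s1
    obtain ⟨F2, d2, e2⟩ := h'.sv b hb _ s2
    refine ⟨fun z => F1 z + F2 z, d1.add d2, fun z hz => ?_⟩
    have s3 := s1.add s2
    rw [Sol.unique g.bdd g.op hu ⟨s3.cont, s3.harm, fun z hz => by rw [s3.bd z hz]; simp; ring⟩ z (subset_closure hz), e1 z hz, e2 z hz]
    simp⟩

theorem E1 {D : Set ℂ} {m : ℕ} {E : Fin m → Set ℂ} (g : Geo D m E) {c : ℂ} (hc : c ∈ D) {μ : Measure ℂ} (hμ : IsHM D c μ)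
    {j : Fin m} {X : ℂ → ℝ} (hX : Cut D E j X) : 
    ∃ C, 0 ≤ C ∧ ∀ Ψ, SS D Ψ → ∀ α β, Al D α → Al D β → ∀ s, 0 ≤ s → (∀ z ∈ tsupport (fderiv ℝ X), ‖β z‖ ≤ s) → 
      ∫ ζ, ‖β ζ‖ ^ 2 ∂μ ≤ C * (∫ ζ, ‖Ψ ζ - α ζ - (starRingEnd ℂ) (β ζ)‖ ^ 2 ∂μ + s ^ 2) := by
  have hDo := g.op
  have := hμ.prob
  obtain ⟨hK, hKD⟩ := hX.tsupp g
  have hXs := hX.smooth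
  obtain ⟨c0, hc0, hco⟩ := flux_coer g hc hμ hX
  obtain ⟨C, hC0, hC⟩ := flux_bound g hc hμ hXs hK hKD
  obtain ⟨C1, hC10, hC1⟩ := G_fun g hX
  set A := 4 * C ^ 2 / c0 + C with hA
  have hA0 : 0 ≤ A := by positivity
  refine ⟨(2 / c0) * (A * (1 + C1 ^ 2)), by positivity, ?_⟩
  intro Ψ hΨ α β hα hβ s hs0 hs
  obtain ⟨T, hTc, hG, hT⟩ := hC1 β hβ s hs0 hs
  set G : ℂ → ℂ := fun z => (1 - 2 * ((X z : ℝ) : ℂ)) * β z + 2 * T z with hGdef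
  have fs : frontier D ⊆ closure D := frontier_subset_closure
  have hβc := hβ.cont.mono fs
  have hαc := hα.cont.mono fs
  have hGc := hG.cont.mono fs
  have hTc' := hTc.mono fs
  set r : ℂ → ℂ := fun ζ => Ψ ζ - α ζ - (starRingEnd ℂ) (β ζ) with hr
  have hrc : ContinuousOn r (frontier D) := (hΨ.cont.sub hαc).sub (Complex.continuous_conj.comp_continuousOn hβc)
  have hre : ∀ f : ℂ → ℂ, ContinuousOn f (frontier D) → ContinuousOn (fun z => (f z).re) (frontier D) := fun f hf => Complex.continuous_re.comp_continuousOn hf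
  have hXc : Continuous X := hXs.continuous
  -- solutions
  have s1 := g.sol (φ := fun z => (G z * Ψ z).re) (hre _ (hGc.mul hΨ.cont))
  have s2 := (hG.mul hα).re_sol hDo
  have s3 := g.sol (φ := fun z => (G z * r z).re) (hre _ (hGc.mul hrc))
  have s4 := g.sol (φ := fun z => 2 * (T z * (starRingEnd ℂ) (β z)).re) (continuousOn_const.mul (hre _ (hTc'.mul (Complex.continuous_conj.comp_continuousOn hβc))))
  obtain ⟨F, hF, hFe⟩ := hΨ.sv G hG _ s1
  have z1 := flux_re hDo hF hXs hK hKD hFe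
  have z2 := flux_re hDo (hG.mul hα).hol hXs hK hKD (fun z _ => rfl)
  have s5 := ((s1.sub s2).sub s3).sub s4
  have hnn : ContinuousOn (fun z => ‖β z‖ ^ 2) (frontier D) := hβc.norm.pow 2
  have k := hco (fun z => ‖β z‖ ^ 2) _ hnn (fun p _ => by positivity) ⟨s5.cont, s5.harm, fun z hz => by
    rw [s5.bd z hz]
    simp only [hGdef, hr, ← Complex.normSq_eq_norm_sq, Complex.normSq_apply]
    simp; ring⟩
  have cd : ∀ {φ u : ℂ → ℝ}, Sol D φ u → ContinuousOn u D := fun h => h.cont.mono subset_closure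
  have i1 := flux_int hDo hXs hK hKD (cd s1)
  have i2 := flux_int hDo hXs hK hKD (cd s2)
  have i3 := flux_int hDo hXs hK hKD (cd s3)
  have i4 := flux_int hDo hXs hK hKD (cd s4)
  have e : ∀ u1 u2 u3 u4 : ℂ → ℝ, Integrable (fun z => u1 z * lap X z) → Integrable (fun z => u2 z * lap X z) → Integrable (fun z => u3 z * lap X z) → Integrable (fun z => u4 z * lap X z) → 
    ∫ z, (u1 z - u2 z - u3 z - u4 z) * lap X z = (∫ z, u1 z * lap X z) - (∫ z, u2 z * lap X z) - (∫ z, u3 z * lap X z) - (∫ z, u4 z * lap X z) := by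
    intro u1 u2 u3 u4 i1 i2 i3 i4
    have i12 : Integrable (fun z => u1 z * lap X z - u2 z * lap X z) := i1.sub i2
    have i123 : Integrable (fun z => u1 z * lap X z - u2 z * lap X z - u3 z * lap X z) := i12.sub i3
    rw [← integral_sub i1 i2, ← integral_sub i12 i3, ← integral_sub i123 i4]
    congr 1; funext z; ring
  rw [e _ _ _ _ i1 i2 i3 i4, z1, z2] at k
  have b3 := (abs_le.1 (hC (fun z => (G z * r z).re) _ (hre _ (hGc.mul hrc)) s3)).1
  have b4 := (abs_le.1 (hC (fun z => 2 * (T z * (starRingEnd ℂ) (β z)).re) _ (continuousOn_const.mul (hre _ (hTc'.mul (Complex.continuous_conj.comp_continuousOn hβc)))) s4)).1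
  have j3 : Integrable (fun z => |(G z * r z).re|) μ := hμ.integrable g.bdd (hre _ (hGc.mul hrc)).abs
  have j4 : Integrable (fun z => |2 * (T z * (starRingEnd ℂ) (β z)).re|) μ := hμ.integrable g.bdd (continuousOn_const.mul (hre _ (hTc'.mul (Complex.continuous_conj.comp_continuousOn hβc)))).abs
  have jβ : Integrable (fun z => ‖β z‖ ^ 2) μ := hμ.integrable g.bdd hnn
  have jr : Integrable (fun z => ‖r z‖ ^ 2) μ := hμ.integrable g.bdd (hrc.norm.pow 2)
  have main : (C * ∫ z, |(G z * r z).re| ∂μ) + (C * ∫ z, |2 * (T z * (starRingEnd ℂ) (β z)).re| ∂μ) ≤ c0 / 2 * (∫ z, ‖β z‖ ^ 2 ∂μ) + A * (∫ z, ‖r z‖ ^ 2 ∂μ) + A * (C1 * s) ^ 2 := by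
    have q1 : Integrable (fun z => C * |(G z * r z).re| + C * |2 * (T z * (starRingEnd ℂ) (β z)).re|) μ := (j3.const_mul C).add (j4.const_mul C)
    have q2 : Integrable (fun z => c0 / 2 * ‖β z‖ ^ 2 + A * ‖r z‖ ^ 2) μ := (jβ.const_mul _).add (jr.const_mul _)
    have q3 : Integrable (fun z => (c0 / 2 * ‖β z‖ ^ 2 + A * ‖r z‖ ^ 2) + A * (C1 * s) ^ 2) μ := q2.add (integrable_const _)
    have := integral_mono_ae q1 q3 (by
      filter_upwards [hμ.supp] with z hz
      have hTz := hT z (fs hz)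
      have x0 : 0 ≤ X z := hX.nonneg z
      have x1 : X z ≤ 1 := hX.le_one z
      have hG1 : ‖G z‖ ≤ ‖β z‖ + 2 * ‖T z‖ := by
        have h1 : ‖(1 - 2 * ((X z : ℝ) : ℂ))‖ ≤ 1 := by
          have : (1 - 2 * ((X z : ℝ) : ℂ)) = ((1 - 2 * X z : ℝ) : ℂ) := by push_cast; ring
          rw [this, Complex.norm_real, Real.norm_eq_abs, abs_le]; constructor <;> linarith
        calc ‖G z‖ ≤ ‖(1 - 2 * ((X z : ℝ) : ℂ)) * β z‖ + ‖2 * T z‖ := norm_add_le _ _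
          _ ≤ _ := by
            rw [norm_mul, norm_mul]; simp only [Complex.norm_ofNat]
            nlinarith [norm_nonneg (β z)]
      have y1 : |(G z * r z).re| ≤ (‖β z‖ + 2 * ‖T z‖) * ‖r z‖ := (Complex.abs_re_le_norm _).trans (by rw [norm_mul]; gcongr)
      have y2 : |2 * (T z * (starRingEnd ℂ) (β z)).re| ≤ 2 * (‖T z‖ * ‖β z‖) := by
        rw [abs_mul, abs_two]; gcongr
        exact (Complex.abs_re_le_norm _).trans (by rw [norm_mul, Complex.norm_conj])
      have y3 : ‖T z‖ ^ 2 ≤ (C1 * s) ^ 2 := by gcongr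
      set b := ‖β z‖
      set t := ‖T z‖
      set ρ := ‖r z‖
      have w1 : C * (b * ρ) ≤ c0 / 4 * b ^ 2 + C ^ 2 / c0 * ρ ^ 2 := by
        have : c0 / 4 * b ^ 2 + C ^ 2 / c0 * ρ ^ 2 - C * (b * ρ) = (c0 * b - 2 * C * ρ) ^ 2 / (4 * c0) := by field_simp; ring
        have : 0 ≤ (c0 * b - 2 * C * ρ) ^ 2 / (4 * c0) := by positivity
        linarith
      have w2 : C * (2 * (t * b)) ≤ c0 / 4 * b ^ 2 + 4 * C ^ 2 / c0 * t ^ 2 := by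
        have : c0 / 4 * b ^ 2 + 4 * C ^ 2 / c0 * t ^ 2 - C * (2 * (t * b)) = (c0 * b - 4 * C * t) ^ 2 / (4 * c0) := by field_simp; ring
        have : 0 ≤ (c0 * b - 4 * C * t) ^ 2 / (4 * c0) := by positivity
        linarith
      have w3 : C * (2 * t * ρ) ≤ C * t ^ 2 + C * ρ ^ 2 := by nlinarith [sq_nonneg (t - ρ)]
      have w4 : C * |(G z * r z).re| ≤ C * ((b + 2 * t) * ρ) := by gcongr
      have w5 : C * |2 * (T z * (starRingEnd ℂ) (β z)).re| ≤ C * (2 * (t * b)) := by gcongr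
      have w6 : A * t ^ 2 ≤ A * (C1 * s) ^ 2 := by gcongr
      have w7 : 0 ≤ 3 * (C ^ 2 / c0) * ρ ^ 2 := by positivity
      have w8 : A * ρ ^ 2 = 4 * (C ^ 2 / c0) * ρ ^ 2 + C * ρ ^ 2 := by rw [hA]; ring
      have w9 : A * t ^ 2 = 4 * C ^ 2 / c0 * t ^ 2 + C * t ^ 2 := by rw [hA]; ring
      show C * |(G z * r z).re| + C * |2 * (T z * (starRingEnd ℂ) (β z)).re| ≤ (c0 / 2 * b ^ 2 + A * ρ ^ 2) + A * (C1 * s) ^ 2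
      nlinarith)
    rw [integral_add (j3.const_mul C) (j4.const_mul C), integral_add q2 (integrable_const _), integral_add (jβ.const_mul _) (jr.const_mul _)] at this
    simp only [integral_const_mul] at this
    simpa using this
  have fin : c0 / 2 * (∫ z, ‖β z‖ ^ 2 ∂μ) ≤ A * (∫ z, ‖r z‖ ^ 2 ∂μ) + A * (C1 * s) ^ 2 := by
    linarith
  have jr0 : 0 ≤ ∫ z, ‖r z‖ ^ 2 ∂μ := integral_nonneg (fun z => by positivity)
  have : A * (∫ z, ‖r z‖ ^ 2 ∂μ) + A * (C1 * s) ^ 2 ≤ A * (1 + C1 ^ 2) * (∫ z, ‖r z‖ ^ 2 ∂μ + s ^ 2) := by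
    have h1 : 0 ≤ A * C1 ^ 2 * (∫ z, ‖r z‖ ^ 2 ∂μ) := by positivity
    have h2 : 0 ≤ A * s ^ 2 := by positivity
    nlinarith
  have h3 := fin.trans this
  calc ∫ z, ‖β z‖ ^ 2 ∂μ = (2 / c0) * (c0 / 2 * (∫ z, ‖β z‖ ^ 2 ∂μ)) := by field_simp
    _ ≤ (2 / c0) * (A * (1 + C1 ^ 2) * (∫ z, ‖r z‖ ^ 2 ∂μ + s ^ 2)) := by gcongr
    _ = _ := by ring

end HX

namespace HX
open Metric Filter Topology InnerProductSpace Real MeasureTheory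
open scoped ContDiff

structure PQ (D : Set ℂ) (Ψ p q : ℂ → ℂ) : Prop where
  hp : DifferentiableOn ℂ p D
  hq : DifferentiableOn ℂ q D
  re : ∀ z ∈ D, Hs D (fun z => (Ψ z).re) z = (p z).re + (q z).re
  im : ∀ z ∈ D, Hs D (fun z => (Ψ z).im) z = (p z).im - (q z).im

theorem re_sol {D : Set ℂ} {m : ℕ} {E : Fin m → Set ℂ} (g : Geo D m E) {f : ℂ → ℂ} (hf : ContinuousOn f (frontier D)) :
    Sol D (fun z => (f z).re) (Hs D (fun z => (f z).re)) := g.sol (Complex.continuous_re.comp_continuousOn hf)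

theorem im_sol {D : Set ℂ} {m : ℕ} {E : Fin m → Set ℂ} (g : Geo D m E) {f : ℂ → ℂ} (hf : ContinuousOn f (frontier D)) :
    Sol D (fun z => (f z).im) (Hs D (fun z => (f z).im)) := g.sol (Complex.continuous_im.comp_continuousOn hf)

theorem PQ.exists {D : Set ℂ} {m : ℕ} {E : Fin m → Set ℂ} (g : Geo D m E) (c : ℂ) {Ψ : ℂ → ℂ} (h : SS D Ψ) :
    ∃ p q, PQ D Ψ p q ∧ q c = 0 := by
  obtain ⟨F1, d1, e1⟩ := h.sv (fun _ => 1) (Al.const 1) (Hs D (fun z => (Ψ z).re)) (by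
    have := re_sol g h.cont
    exact ⟨this.cont, this.harm, fun z hz => by rw [this.bd z hz, one_mul]⟩)
  obtain ⟨F2, d2, e2⟩ := h.sv (fun _ => -I) (Al.const (-I)) (Hs D (fun z => (Ψ z).im)) (by
    have := im_sol g h.cont
    exact ⟨this.cont, this.harm, fun z hz => by rw [this.bd z hz]; simp⟩)
  set k := (F1 c - I * F2 c) / 2
  refine ⟨fun z => (F1 z + I * F2 z) / 2 + (starRingEnd ℂ) k, fun z => (F1 z - I * F2 z) / 2 - k, ⟨?_, ?_, ?_, ?_⟩, ?_⟩
  · exact ((d1.add (d2.const_mul I)).div_const 2).add_const _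
  · exact ((d1.sub (d2.const_mul I)).div_const 2).sub_const _
  · intro z hz
    rw [e1 z hz]; simp; ring
  · intro z hz
    rw [e2 z hz]; simp; ring
  · simp [k]

theorem jensen {D : Set ℂ} (hDb : Bornology.IsBounded D) (hDo : IsOpen D) {r1 r2 w1 w2 h : ℂ → ℝ} (h1 : Sol D r1 w1) (h2 : Sol D r2 w2)
    (hh : Sol D (fun z => r1 z ^ 2 + r2 z ^ 2) h) {z : ℂ} (hz : z ∈ closure D) : w1 z ^ 2 + w2 z ^ 2 ≤ h z := by
  have s := ((h1.smul (2 * w1 z)).add (h2.smul (2 * w2 z))).sub (Sol.const (w1 z ^ 2 + w2 z ^ 2))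
  have := Sol.le hDb hDo s hh (fun y _ => by nlinarith [sq_nonneg (r1 y - w1 z), sq_nonneg (r2 y - w2 z)]) z hz
  nlinarith

theorem B2 {D : Set ℂ} {m : ℕ} {E : Fin m → Set ℂ} (g : Geo D m E) {c : ℂ} {μ : Measure ℂ} (hμ : IsHM D c μ)
    {C : ℝ} {z : ℂ} (hz : z ∈ D) (hk : Hk D C c z) {β : ℂ → ℂ} (hβ : Al D β) : ‖β z‖ ^ 2 ≤ C * ∫ ζ, ‖β ζ‖ ^ 2 ∂μ := by
  have hs := g.sol (φ := fun z => ‖β z‖ ^ 2) ((hβ.cont.mono frontier_subset_closure).norm.pow 2)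
  have i1 : Sol D (fun z => (β z).im) (fun z => (β z).im) := ⟨Complex.continuous_im.comp_continuousOn hβ.cont, harm_im g.op hβ.hol, fun _ _ => rfl⟩
  have e : ∀ w : ℂ, ‖w‖ ^ 2 = w.re ^ 2 + w.im ^ 2 := fun w => by rw [← Complex.normSq_eq_norm_sq, Complex.normSq_apply]; ring
  have j := jensen g.bdd g.op (hβ.re_sol g.op) i1 (h := Hs D (fun z => ‖β z‖ ^ 2)) (by simpa only [e] using hs) (subset_closure hz)
  rw [hμ.int _ _ hs, e]
  exact j.trans (hk _ hs.harm (fun w hw => Sol.le g.bdd g.op (Sol.const 0) hs (fun y _ => by positivity) w (subset_closure hw))).1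

theorem B1 {D : Set ℂ} {m : ℕ} {E : Fin m → Set ℂ} (g : Geo D m E) {c : ℂ} (hc : c ∈ D) {μ : Measure ℂ} (hμ : IsHM D c μ)
    {C : ℝ} {z : ℂ} (hz : z ∈ D) (hk : Hk D C c z) {Ψ p q α β : ℂ → ℂ} (hΨ : ContinuousOn Ψ (frontier D)) (hpq : PQ D Ψ p q) (hqc : q c = 0)
    (hα : Al D α) (hβ : Al D β) (hβc : β c = 0) :
    ‖q z - β z‖ ^ 2 ≤ C * ∫ ζ, ‖Ψ ζ - α ζ - (starRingEnd ℂ) (β ζ)‖ ^ 2 ∂μ := by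
  have fs : frontier D ⊆ closure D := frontier_subset_closure
  set r : ℂ → ℂ := fun ζ => Ψ ζ - α ζ - (starRingEnd ℂ) (β ζ) with hr
  have hrc : ContinuousOn r (frontier D) := (hΨ.sub (hα.cont.mono fs)).sub (Complex.continuous_conj.comp_continuousOn (hβ.cont.mono fs))
  have hs := g.sol (φ := fun z => ‖r z‖ ^ 2) (hrc.norm.pow 2)
  have im_s : ∀ a, Al D a → Sol D (fun z => (a z).im) (fun z => (a z).im) := fun a ha => ⟨Complex.continuous_im.comp_continuousOn ha.cont, harm_im g.op ha.hol, fun _ _ => rfl⟩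
  have e : ∀ w : ℂ, ‖w‖ ^ 2 = w.re ^ 2 + w.im ^ 2 := fun w => by rw [← Complex.normSq_eq_norm_sq, Complex.normSq_apply]; ring
  have w1 := ((re_sol g hΨ).sub (hα.re_sol g.op)).sub (hβ.re_sol g.op)
  have w2 := ((im_sol g hΨ).sub (im_s α hα)).add (im_s β hβ)
  have hs' : Sol D (fun z => ((Ψ z).re - (α z).re - (β z).re) ^ 2 + ((Ψ z).im - (α z).im + (β z).im) ^ 2) (Hs D (fun z => ‖r z‖ ^ 2)) :=
    ⟨hs.cont, hs.harm, fun z hz => by rw [hs.bd z hz, e]; simp [hr]⟩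
  set h : ℂ → ℝ := fun z => Hs D (fun z => ‖r z‖ ^ 2) z - 2 * ((p z - α z) * (q z - β z)).re with hh
  have hharm : HarmonicOnNhd h D := by
    have d : DifferentiableOn ℂ (fun z => (p z - α z) * (q z - β z)) D := (hpq.hp.sub hα.hol).mul (hpq.hq.sub hβ.hol)
    exact hs.harm.sub ((harm_re g.op d).const_smul (c := (2:ℝ)))
  have key : ∀ y ∈ D, ‖q y - β y‖ ^ 2 ≤ h y := by
    intro y hy
    have j := jensen g.bdd g.op w1 w2 hs' (subset_closure hy)
    rw [hpq.re y hy, hpq.im y hy] at j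
    simp only [hh]
    rw [e]
    simp only [Complex.mul_re, Complex.sub_re, Complex.sub_im]
    nlinarith [sq_nonneg ((p y).re - (α y).re), sq_nonneg ((p y).im - (α y).im)]
  have hcv : h c = ∫ ζ, ‖r ζ‖ ^ 2 ∂μ := by
    rw [hμ.int _ _ hs, hh]; simp [hqc, hβc]
  rw [← hcv]
  exact (key z hz).trans (hk h hharm (fun w hw => le_trans (by positivity) (key w hw))).1

theorem E2 {D : Set ℂ} {m : ℕ} {E : Fin m → Set ℂ} (g : Geo D m E) {c : ℂ} (hc : c ∈ D)
    {j : Fin m} {X : ℂ → ℝ} (hX : Cut D E j X) {K : Set ℂ} (hK : IsCompact K) (hKD : K ⊆ D) : 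
    ∃ C, 0 ≤ C ∧ ∀ Ψ p q, SS D Ψ → PQ D Ψ p q → q c = 0 → ∀ s, 0 ≤ s → (∀ z ∈ tsupport (fderiv ℝ X), ‖q z‖ ≤ s) → 
      ∀ z ∈ K, ‖q z‖ ≤ C * s := by
  obtain ⟨hK0, hK0D⟩ := hX.tsupp g
  obtain ⟨μ, hμ⟩ := g.hm hc
  obtain ⟨C4, hC4, h4⟩ := E1 g hc hμ hX
  obtain ⟨H, hH, hk⟩ := harnack g.op g.conn.isPreconnected hc (hK.union hK0) (union_subset hKD hK0D)
  refine ⟨√(4 * H * C4), by positivity, ?_⟩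
  intro Ψ p q hΨ hpq hqc s hs0 hs z hz
  have main : ∀ ε > 0, ‖q z‖ ^ 2 ≤ 4 * H * C4 * s ^ 2 + ε * (2 * H + 2 * H * C4 * (1 + 2 * H)) := by
    intro ε hε
    obtain ⟨α, β, hα, hβ, hβc, hap⟩ := AP g hc hμ hΨ hε
    have hb : ∀ y ∈ K ∪ tsupport (fderiv ℝ X), ‖q y - β y‖ ^ 2 ≤ H * ε := fun y hy => 
      (B1 g hc hμ (union_subset hKD hK0D hy) (hk y hy) hΨ.cont hpq hqc hα hβ hβc).trans (by gcongr)
    set s' := s + √(H * ε) with hs'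
    have hbs : ∀ y ∈ tsupport (fderiv ℝ X), ‖β y‖ ≤ s' := by
      intro y hy
      have h1 := hb y (Or.inr hy)
      have h2 : ‖q y - β y‖ ≤ √(H * ε) := Real.le_sqrt_of_sq_le h1
      have h3 := hs y hy
      have h4 : ‖β y‖ ≤ ‖q y‖ + ‖q y - β y‖ := by
        calc ‖β y‖ = ‖q y - (q y - β y)‖ := by congr 1; ring
          _ ≤ _ := norm_sub_le _ _
      linarith
    have h5 := h4 Ψ hΨ α β hα hβ s' (by positivity) hbs
    have h6 := B2 g hμ (hKD hz) (hk z (Or.inl hz)) hβ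
    have h7 := hb z (Or.inl hz)
    have h8 : s' ^ 2 ≤ 2 * s ^ 2 + 2 * (H * ε) := by
      have : √(H * ε) ^ 2 = H * ε := Real.sq_sqrt (by positivity)
      nlinarith [sq_nonneg (s - √(H * ε))]
    have h9 : ‖q z‖ ^ 2 ≤ 2 * ‖q z - β z‖ ^ 2 + 2 * ‖β z‖ ^ 2 := by
      have : ‖q z‖ ≤ ‖q z - β z‖ + ‖β z‖ := by
        calc ‖q z‖ = ‖(q z - β z) + β z‖ := by congr 1; ring
          _ ≤ _ := norm_add_le _ _
      nlinarith [sq_nonneg (‖q z - β z‖ - ‖β z‖), norm_nonneg (q z)]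
    have h10 : H * (∫ ζ, ‖β ζ‖ ^ 2 ∂μ) ≤ H * (C4 * (ε + (2 * s ^ 2 + 2 * (H * ε)))) := by
      gcongr
      exact h5.trans (by gcongr)
    nlinarith
  have : ‖q z‖ ^ 2 ≤ 4 * H * C4 * s ^ 2 := by
    set B := 2 * H + 2 * H * C4 * (1 + 2 * H)
    have hB : 0 < B := by positivity
    refine le_of_forall_pos_le_add (fun ε hε => ?_)
    have := main (ε / B) (by positivity)
    rwa [div_mul_cancel₀ _ hB.ne'] at this
  calc ‖q z‖ ≤ √(4 * H * C4 * s ^ 2) := Real.le_sqrt_of_sq_le this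
    _ = _ := by rw [Real.sqrt_mul (by positivity), Real.sqrt_sq hs0]

end HX

namespace HX
open Metric Filter Topology InnerProductSpace Real MeasureTheory
open scoped ContDiff

theorem E4 {D : Set ℂ} {m : ℕ} {E : Fin m → Set ℂ} (g : Geo D m E) {c : ℂ} (hc : c ∈ D)
    {j : Fin m} {X : ℂ → ℝ} (hX : Cut D E j X) :
    ∃ t : Finset ℂ, ∀ Ψ p q, SS D Ψ → PQ D Ψ p q → q c = 0 → (∀ ζ ∈ t, q ζ = 0) → ∀ z ∈ D, q z = 0 := by
  obtain ⟨hK0, hK0D⟩ := hX.tsupp g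
  set K0 := tsupport (fderiv ℝ X) with hK0def
  obtain ⟨δ, hδ, hδD⟩ := hK0.exists_cthickening_subset_open g.op hK0D
  obtain ⟨C, hC0, hC⟩ := E2 g hc hX hK0.cthickening hδD
  obtain ⟨t, htK, htf, htc⟩ := hK0.finite_cover_balls (e := δ / (2 * (C + 1))) (by positivity)
  refine ⟨htf.toFinset, ?_⟩
  intro Ψ p q hΨ hpq hqc hqt
  have hqt' : ∀ ζ ∈ t, q ζ = 0 := fun ζ hζ => hqt ζ (by simpa using hζ)
  have hq0 : ∀ z ∈ K0, ‖q z‖ ≤ 0 := by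
    rcases K0.eq_empty_or_nonempty with he | hne
    · intro z hz; rw [he] at hz; exact absurd hz (notMem_empty z)
    · obtain ⟨z0, hz0, hmax⟩ := hK0.exists_isMaxOn hne ((hpq.hq.continuousOn.mono hK0D).norm)
      set s := ‖q z0‖ with hs
      have hs0 : 0 ≤ s := norm_nonneg _
      have hb := hC Ψ p q hΨ hpq hqc s hs0 (fun z hz => hmax hz)
      obtain ⟨ζ, hζ, hzζ⟩ := mem_iUnion₂.1 (htc hz0)
      have hsub : ball ζ δ ⊆ cthickening δ K0 := fun y hy => 
        mem_cthickening_of_dist_le y ζ δ K0 (htK hζ) (mem_ball.1 hy).le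
      have he : δ / (2 * (C + 1)) ≤ δ := by
        apply div_le_self hδ.le; linarith
      have h1 := Complex.dist_le_div_mul_dist_of_mapsTo_ball (R₁ := δ) (R₂ := C * s) (f := q) (c := ζ) (z := z0) (hpq.hq.mono (hsub.trans hδD)) (fun y hy => by
        rw [hqt' ζ hζ, mem_closedBall_zero_iff]; exact hb y (hsub hy)) (ball_subset_ball he hzζ)
      rw [hqt' ζ hζ, dist_zero_right] at h1
      have h2 : C * s / δ * dist z0 ζ ≤ C * s / δ * (δ / (2 * (C + 1))) := by
        have := (mem_ball.1 hzζ).le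
        gcongr
      have h3 : C * s / δ * (δ / (2 * (C + 1))) ≤ s / 2 := by
        have : C * s / δ * (δ / (2 * (C + 1))) = (C / (C + 1)) * (s / 2) := by field_simp
        rw [this]
        have : C / (C + 1) ≤ 1 := by rw [div_le_one (by positivity)]; linarith
        nlinarith
      have hs' : s ≤ 0 := by linarith
      intro z hz
      exact (show ‖q z‖ ≤ s from hmax hz).trans hs'
  intro z hz
  obtain ⟨C2, _, h2⟩ := E2 g hc hX (isCompact_singleton (x := z)) (by simpa using hz)
  have := h2 Ψ p q hΨ hpq hqc 0 le_rfl hq0 z rfl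
  simpa using this

def Ex (D : Set ℂ) (Φ : ℂ → ℂ) : Prop := ∃ F, Al D F ∧ EqOn F Φ (frontier D)

theorem Ex.of_q {D : Set ℂ} {m : ℕ} {E : Fin m → Set ℂ} (g : Geo D m E) {Ψ p q : ℂ → ℂ} (hΨ : ContinuousOn Ψ (frontier D)) (h : PQ D Ψ p q)
    (hq : ∀ z ∈ D, q z = 0) : Ex D Ψ := by
  have s1 := re_sol g hΨ
  have s2 := im_sol g hΨ
  refine ⟨fun z => ((Hs D (fun z => (Ψ z).re) z : ℝ) : ℂ) + ((Hs D (fun z => (Ψ z).im) z : ℝ) : ℂ) * I, ⟨?_, ?_⟩, ?_⟩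
  · exact (Complex.continuous_ofReal.comp_continuousOn s1.cont).add ((Complex.continuous_ofReal.comp_continuousOn s2.cont).mul continuousOn_const)
  · refine h.hp.congr (fun z hz => ?_)
    rw [h.re z hz, h.im z hz, hq z hz]
    apply Complex.ext <;> simp
  · intro z hz
    simp only [s1.bd z hz, s2.bd z hz, Complex.re_add_im]

theorem PQ.add {D : Set ℂ} {m : ℕ} {E : Fin m → Set ℂ} (g : Geo D m E) {Ψ p q Ψ' p' q' : ℂ → ℂ} (hΨ : ContinuousOn Ψ (frontier D)) (h : PQ D Ψ p q)
    (hΨ' : ContinuousOn Ψ' (frontier D)) (h' : PQ D Ψ' p' q') : PQ D (fun z => Ψ z + Ψ' z) (fun z => p z + p' z) (fun z => q z + q' z) := by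
  refine ⟨h.hp.add h'.hp, h.hq.add h'.hq, fun z hz => ?_, fun z hz => ?_⟩
  · rw [Sol.unique g.bdd g.op (re_sol g (f := fun z => Ψ z + Ψ' z) (hΨ.add hΨ')) ((re_sol g hΨ).add (re_sol g hΨ')) z (subset_closure hz)]
    rw [h.re z hz, h'.re z hz]; simp; ring
  · rw [Sol.unique g.bdd g.op (im_sol g (f := fun z => Ψ z + Ψ' z) (hΨ.add hΨ')) ((im_sol g hΨ).add (im_sol g hΨ')) z (subset_closure hz)]
    rw [h.im z hz, h'.im z hz]; simp; ring

theorem PQ.smul {D : Set ℂ} {m : ℕ} {E : Fin m → Set ℂ} (g : Geo D m E) {Ψ p q : ℂ → ℂ} (hΨ : ContinuousOn Ψ (frontier D)) (h : PQ D Ψ p q) (k : ℂ) :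
    PQ D (fun z => (starRingEnd ℂ) k * Ψ z) (fun z => (starRingEnd ℂ) k * p z) (fun z => k * q z) := by
  have hc : ContinuousOn (fun z => (starRingEnd ℂ) k * Ψ z) (frontier D) := continuousOn_const.mul hΨ
  have s1 := ((re_sol g hΨ).smul k.re).add ((im_sol g hΨ).smul k.im)
  have s2 := ((im_sol g hΨ).smul k.re).sub ((re_sol g hΨ).smul k.im)
  refine ⟨h.hp.const_mul _, h.hq.const_mul _, fun z hz => ?_, fun z hz => ?_⟩
  · rw [Sol.unique g.bdd g.op (re_sol g hc) ⟨s1.cont, s1.harm, fun z hz => by rw [s1.bd z hz]; simp⟩ z (subset_closure hz)]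
    rw [h.re z hz, h.im z hz]; simp; ring
  · rw [Sol.unique g.bdd g.op (im_sol g hc) ⟨s2.cont, s2.harm, fun z hz => by rw [s2.bd z hz]; simp; ring⟩ z (subset_closure hz)]
    rw [h.re z hz, h.im z hz]; simp; ring

theorem PQ.sum {D : Set ℂ} {m : ℕ} {E : Fin m → Set ℂ} (g : Geo D m E) {ι : Type} (s : Finset ι) {Ψ p q : ι → ℂ → ℂ} (hΨ : ∀ i, ContinuousOn (Ψ i) (frontier D)) (h : ∀ i, PQ D (Ψ i) (p i) (q i)) :
    PQ D (fun z => ∑ i ∈ s, Ψ i z) (fun z => ∑ i ∈ s, p i z) (fun z => ∑ i ∈ s, q i z) := by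
  classical
  induction s using Finset.induction_on with
  | empty =>
    simp only [Finset.sum_empty]
    refine ⟨differentiableOn_const _, differentiableOn_const _, fun z hz => ?_, fun z hz => ?_⟩
    · simpa using Sol.unique g.bdd g.op (re_sol g (f := fun _ => 0) continuousOn_const) (Sol.const (0:ℂ).re) z (subset_closure hz)
    · simpa using Sol.unique g.bdd g.op (im_sol g (f := fun _ => 0) continuousOn_const) (Sol.const (0:ℂ).im) z (subset_closure hz)
  | insert a s ha ih =>
    simp only [Finset.sum_insert ha]
    exact (h a).add g (hΨ a) (continuousOn_finsetSum s (fun i _ => hΨ i)) ih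

theorem E6 {D : Set ℂ} {m : ℕ} {E : Fin m → Set ℂ} (g : Geo D m E) {Φ : ℂ → ℂ} (hΦ : SS D Φ) :
    ∃ P : Polynomial ℂ, P ≠ 0 ∧ Ex D (fun z => P.eval z * Φ z) := by
  obtain ⟨c, hc⟩ := g.conn.nonempty
  obtain ⟨ji, R, hR, hRE, hcpt⟩ := g.exists_inf
  have : ∃ j, j ≠ ji := by
    have := g.two
    have : Nontrivial (Fin m) := Fin.nontrivial_iff_two_le.2 this
    exact exists_ne ji
  obtain ⟨j, hj⟩ := this
  obtain ⟨X, hX⟩ := g.exists_cut (hcpt j hj)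
  obtain ⟨t, ht⟩ := E4 g hc hX
  set N := t.card
  have hSk : ∀ k : Fin (N + 1), SS D (fun z => z ^ (k:ℕ) * Φ z) := fun k => hΦ.al_mul (Al.id.pow k)
  choose p q hpq hqc using fun k => PQ.exists g c (hSk k)
  have hLI : ¬ LinearIndependent ℂ (fun k : Fin (N + 1) => (fun ζ : t => q k ζ)) := by
    intro h
    have := h.fintype_card_le_finrank
    simp [N] at this
  obtain ⟨a, ha, k0, hk0⟩ := Fintype.not_linearIndependent_iff.1 hLI
  set P : Polynomial ℂ := ∑ k : Fin (N + 1), Polynomial.monomial (k:ℕ) ((starRingEnd ℂ) (a k)) with hP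
  have hPe : ∀ z, P.eval z = ∑ k : Fin (N + 1), (starRingEnd ℂ) (a k) * z ^ (k:ℕ) := fun z => by
    simp [hP, Polynomial.eval_finset_sum]
  have hsum := PQ.sum g Finset.univ (Ψ := fun (k : Fin (N + 1)) z => (starRingEnd ℂ) (a k) * (z ^ (k:ℕ) * Φ z)) (fun k => continuousOn_const.mul (hSk k).cont) (fun k => (hpq k).smul g (hSk k).cont (a k))
  have hPS : SS D (fun z => P.eval z * Φ z) := hΦ.al_mul ⟨P.continuous.continuousOn, P.differentiable.differentiableOn⟩
  have heq : (fun z => ∑ k : Fin (N + 1), (starRingEnd ℂ) (a k) * (z ^ (k:ℕ) * Φ z)) = fun z => P.eval z * Φ z := by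
    funext z; rw [hPe, Finset.sum_mul]; congr 1; funext k; ring
  rw [heq] at hsum
  refine ⟨P, ?_, Ex.of_q g hPS.cont hsum (ht _ _ _ hPS hsum ?_ ?_)⟩
  · intro h0
    have : P.coeff k0 = 0 := by rw [h0]; simp
    rw [hP, Polynomial.finset_sum_coeff] at this
    simp only [Polynomial.coeff_monomial, Fin.val_inj, Finset.sum_ite_eq', Finset.mem_univ, if_true] at this
    exact hk0 (by simpa using this)
  · simp [hqc]
  · intro ζ hζ
    have := congrFun ha ⟨ζ, hζ⟩
    simpa using this

theorem poly_red {D : Set ℂ} (hend : ∀ o Φ, SS D Φ → Ex D (fun z => (z - o) * Φ z) → Ex D Φ) : 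
    ∀ n : ℕ, ∀ P : Polynomial ℂ, P ≠ 0 → P.natDegree = n → ∀ Φ, SS D Φ → Ex D (fun z => P.eval z * Φ z) → Ex D Φ := by
  intro n
  induction n with
  | zero =>
    intro P hP hd Φ hΦ ⟨F, hF, hFe⟩
    rw [Polynomial.eq_C_of_natDegree_eq_zero hd] at hFe hP
    have h0 : P.coeff 0 ≠ 0 := fun h => hP (by rw [h]; simp)
    refine ⟨fun z => (P.coeff 0)⁻¹ * F z, (Al.const _).mul hF, fun z hz => ?_⟩
    have := hFe hz
    simp only [Polynomial.eval_C] at this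
    simp only [this]; field_simp
  | succ n ih =>
    intro P hP hd Φ hΦ hex
    obtain ⟨o, ho⟩ := IsAlgClosed.exists_root P (by rw [Polynomial.degree_eq_natDegree hP, hd]; norm_cast)
    obtain ⟨Q, hQ⟩ := Polynomial.dvd_iff_isRoot.2 ho
    have hQ0 : Q ≠ 0 := fun h => hP (by rw [hQ, h, mul_zero])
    have hdQ : Q.natDegree = n := by
      have := Polynomial.natDegree_mul (Polynomial.X_sub_C_ne_zero o) hQ0
      rw [← hQ, hd, Polynomial.natDegree_X_sub_C] at this; omega
    refine ih Q hQ0 hdQ Φ hΦ (hend o _ (hΦ.al_mul ⟨Q.continuous.continuousOn, Q.differentiable.differentiableOn⟩) ?_)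
    have e : (fun z => (z - o) * (Q.eval z * Φ z)) = fun z => P.eval z * Φ z := by
      funext z; rw [hQ]; simp; ring
    rw [e]; exact hex

theorem main_red {D : Set ℂ} {m : ℕ} {E : Fin m → Set ℂ} (g : Geo D m E) (hend : ∀ o Φ, SS D Φ → Ex D (fun z => (z - o) * Φ z) → Ex D Φ) {Φ : ℂ → ℂ} (hΦ : SS D Φ) : Ex D Φ := by
  obtain ⟨P, hP, h⟩ := E6 g hΦ
  exact poly_red hend _ P hP rfl Φ hΦ h

end HX

namespace HX
open Metric Filter Topology InnerProductSpace Real MeasureTheory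
open scoped ContDiff

theorem PLle {D : Set ℂ} (hDb : Bornology.IsBounded D) (hDo : IsOpen D) {o : ℂ} (ho : o ∉ D) {w : ℂ → ℝ} {B R : ℝ} (hR : 0 < R)
    (hRR : ∀ z ∈ D, ‖z - o‖ ≤ R)
    (hw : HarmonicOnNhd w D) (hc : ContinuousOn w (closure D \ {o})) (h0 : ∀ z ∈ frontier D, z ≠ o → w z = 0) (hB : ∀ z ∈ D, w z ≤ B) :
    ∀ z ∈ D, w z ≤ 0 := by
  have key : ∀ ε > 0, ∀ z ∈ D, w z ≤ ε * (Real.log R - Real.log ‖z - o‖) := by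
    intro ε hε
    have hl : HarmonicOnNhd (fun z => Real.log ‖z - o‖) D := harm_log ho
    have hv : HarmonicOnNhd (w + ε • ((fun z => Real.log ‖z - o‖) - fun _ => Real.log R)) D :=
      hw.add ((hl.sub (Sol.const (D := D) (Real.log R)).harm).const_smul)
    have h := maxB (M := 0) hDo hv.continuousOn (SubM.of_harm hDo hv) (fun e he => by
      set ρ := R * Real.exp (-(|B| / ε))
      have hρ : 0 < ρ := by positivity
      refine ⟨(closure D ∩ {z | ρ ≤ ‖z - o‖}) ∩ w ⁻¹' Ici e, ?_, ?_, ?_⟩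
      · have c1 : IsClosed (closure D ∩ {z | ρ ≤ ‖z - o‖}) := isClosed_closure.inter (isClosed_le continuous_const (by fun_prop))
        refine hDb.isCompact_closure.of_isClosed_subset ((hc.mono ?_).preimage_isClosed_of_isClosed c1 isClosed_Ici) (fun z hz => hz.1.1)
        rintro z ⟨h1, h2⟩
        refine ⟨h1, fun h => ?_⟩
        rw [mem_singleton_iff.1 h] at h2
        simp at h2; linarith
      · rintro z ⟨⟨h1, h2⟩, h3⟩
        by_contra hz
        have : z ∈ frontier D := by rw [hDo.frontier_eq]; exact ⟨h1, hz⟩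
        have := h0 z this (by rintro rfl; simp at h2; linarith)
        simp only [mem_preimage, mem_Ici] at h3; linarith
      · rintro z ⟨hz, hk⟩
        have hzo : 0 < ‖z - o‖ := norm_pos_iff.2 (sub_ne_zero.2 (fun h => ho (h ▸ hz)))
        simp only [Pi.add_apply, Pi.smul_apply, Pi.sub_apply, smul_eq_mul]
        by_cases h2 : ρ ≤ ‖z - o‖
        · have : w z < e := by
            by_contra! h; exact hk ⟨⟨subset_closure hz, h2⟩, h⟩
          have := Real.log_le_log hzo (hRR z hz)
          nlinarith
        · push Not at h2
          have := Real.log_le_log hzo h2.le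
          rw [Real.log_mul hR.ne' (Real.exp_ne_zero _), Real.log_exp] at this
          have h3 : ε * (Real.log ‖z - o‖ - Real.log R) ≤ ε * (-(|B| / ε)) := by gcongr; linarith
          have h4 : ε * (-(|B| / ε)) = -|B| := by field_simp
          have := hB z hz
          have := le_abs_self B
          linarith)
    intro z hz
    have := h z hz
    simp only [Pi.add_apply, Pi.smul_apply, Pi.sub_apply, smul_eq_mul] at this
    linarith
  intro z hz
  have hzo : 0 < ‖z - o‖ := norm_pos_iff.2 (sub_ne_zero.2 (fun h => ho (h ▸ hz)))
  have hL : 0 ≤ Real.log R - Real.log ‖z - o‖ := sub_nonneg.2 (Real.log_le_log hzo (hRR z hz))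
  refine le_of_forall_pos_le_add (fun e he => ?_)
  have := key (e / (Real.log R - Real.log ‖z - o‖ + 1)) (by positivity) z hz
  refine this.trans ?_
  rw [zero_add, div_mul_eq_mul_div, div_le_iff₀ (by positivity)]
  nlinarith

theorem PL {D : Set ℂ} (hDb : Bornology.IsBounded D) (hDo : IsOpen D) {o : ℂ} (ho : o ∉ D) {w : ℂ → ℝ} {B R : ℝ} (hR : 0 < R)
    (hRR : ∀ z ∈ D, ‖z - o‖ ≤ R)
    (hw : HarmonicOnNhd w D) (hc : ContinuousOn w (closure D \ {o})) (h0 : ∀ z ∈ frontier D, z ≠ o → w z = 0) (hB : ∀ z ∈ D, |w z| ≤ B) :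
    ∀ z ∈ D, w z = 0 := by
  intro z hz
  have h1 := PLle hDb hDo ho hR hRR hw hc h0 (fun z hz => (abs_le.1 (hB z hz)).2) z hz
  have h2 := PLle hDb hDo ho hR hRR (w := -w) hw.neg hc.neg (fun z hz h => by simp [h0 z hz h])
    (fun z hz => by have := (abs_le.1 (hB z hz)).1; simp only [Pi.neg_apply]; linarith) z hz
  simp only [Pi.neg_apply] at h2
  linarith

theorem SubM.locally {D : Set ℂ} {v : ℂ → ℝ} (h : ∀ z ∈ D, ∃ ε > 0, ∃ w : ℂ → ℝ, SubM w (ball z ε) ∧ EqOn v w (ball z ε)) : SubM v D := by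
  intro z hz
  obtain ⟨ε, hε, w, hw, e⟩ := h z hz
  obtain ⟨ε', hε', h'⟩ := hw z (mem_ball_self hε)
  refine ⟨min ε ε', lt_min hε hε', fun r h0 hr => ?_⟩
  have := h' r h0 (hr.trans_le (min_le_right _ _))
  rw [e (mem_ball_self hε)]
  refine this.trans (le_of_eq ?_)
  refine circleAverage_congr_sphere (fun y hy => (e ?_).symm)
  rw [abs_of_pos h0] at hy
  rw [mem_ball, mem_sphere.1 hy]
  exact hr.trans_le (min_le_left _ _)

theorem bd_quot {D : Set ℂ} {m : ℕ} {E : Fin m → Set ℂ} (g : Geo D m E) {o : ℂ} (ho : o ∈ frontier D) {k : ℂ → ℂ} (hk : Al D k) {M : ℝ}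
    (hM : 0 ≤ M) (hkM : ∀ z ∈ frontier D, ‖k z‖ ≤ M * ‖z - o‖) :
    ∃ M', 0 ≤ M' ∧ ∀ z ∈ D, ‖k z‖ ≤ M' * ‖z - o‖ := by
  obtain ⟨V, d, x, hx, hV⟩ := g.exists_acc ho
  have hVD : ∀ z ∈ V, z ∉ D := fun z hz h => Set.disjoint_left.1 hV hz (subset_closure h)
  have hoD : o ∉ D := by rw [g.op.frontier_eq] at ho; exact ho.2
  set M' := M * Real.exp (Real.log 2 + C0)
  have hM' : 0 ≤ M' := by positivity
  refine ⟨M', hM', fun z hz => ?_⟩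
  have hzo : z ≠ o := fun h => hoD (h ▸ hz)
  have key : ∀ δ, 0 < δ → δ ≤ d → ‖k z‖ ≤ M' * (‖z - o‖ + δ) := by
    intro δ h0 h1
    have hx := hx.mono h0 h1
    have hs : SubM (fun z => ‖k z‖ * Real.exp (-Up x δ z)) D := by
      refine SubM.locally (fun y hy => ?_)
      obtain ⟨ε, hε, f, hf, e⟩ := harm_iff.2 (hx.up_harm g.op hVD) y hy
      obtain ⟨ε', hε', hb⟩ := Metric.isOpen_iff.1 g.op y hy
      refine ⟨min ε ε', lt_min hε hε', _, SubM.norm isOpen_ball (F := fun z => k z * Complex.exp (-f z)) ?_, ?_⟩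
      · exact (hk.hol.mono ((ball_subset_ball (min_le_right _ _)).trans hb)).mul ((hf.mono (ball_subset_ball (min_le_left _ _))).neg.cexp)
      · intro w hw
        simp only [norm_mul, Complex.norm_exp, neg_re]
        rw [e w (ball_subset_ball (min_le_left _ _) hw)]
    have := maxA g.bdd g.op (M := M') (hk.cont.norm.mul (Real.continuous_exp.comp_continuousOn hx.up_cont.continuousOn.neg)) hs (fun y hy => by
      have hky := hkM y hy
      by_cases hyo : y = o
      · subst hyo; simp at hky; simp [hky, hM']
      have h2 := hx.up_ge_log hyo
      have h3 : 0 < ‖y - o‖ := norm_pos_iff.2 (sub_ne_zero.2 hyo)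
      calc ‖k y‖ * Real.exp (-Up x δ y) ≤ (M * ‖y - o‖) * Real.exp (-(Real.log ‖y - o‖ - (Real.log 2 + C0))) := by gcongr
        _ = M' := by
          rw [neg_sub, Real.exp_sub, Real.exp_log h3]; field_simp; rfl) z (subset_closure hz)
    have h2 := hx.up_le hzo
    have h3 : Real.exp (Up x δ z) ≤ ‖z - o‖ + δ := by
      rw [← Real.exp_log (show 0 < ‖z - o‖ + δ by positivity)]; gcongr
    change ‖k z‖ * Real.exp (-Up x δ z) ≤ M' at this
    rw [Real.exp_neg, ← div_eq_mul_inv, div_le_iff₀ (Real.exp_pos _)] at this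
    exact this.trans (by gcongr)
  refine le_of_forall_pos_le_add (fun e he => ?_)
  have := key (min d (e / (M' + 1))) (lt_min hx.pos (by positivity)) (min_le_left _ _)
  refine this.trans ?_
  have h4 : M' * min d (e / (M' + 1)) ≤ M' * (e / (M' + 1)) := by gcongr; exact min_le_right _ _
  have h5 : M' * (e / (M' + 1)) ≤ e := by rw [mul_div_assoc', div_le_iff₀ (by positivity)]; nlinarith
  rw [mul_add]; linarith

theorem end_out {D : Set ℂ} {o : ℂ} (ho : o ∉ closure D) {Φ : ℂ → ℂ} (h : Ex D (fun z => (z - o) * Φ z)) : Ex D Φ := by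
  obtain ⟨k, hk, e⟩ := h
  have hne : ∀ z ∈ closure D, z - o ≠ 0 := fun z hz h => ho (sub_eq_zero.1 h ▸ hz)
  refine ⟨fun z => k z / (z - o), ⟨hk.cont.div (by fun_prop) hne, hk.hol.div (by fun_prop) (fun z hz => hne z (subset_closure hz))⟩, fun z hz => ?_⟩
  have := hne z (frontier_subset_closure hz)
  simp only [e hz]; field_simp

theorem end_bd {D : Set ℂ} {m : ℕ} {E : Fin m → Set ℂ} (g : Geo D m E) {o : ℂ} (ho : o ∈ frontier D) {Φ : ℂ → ℂ} (hΦ : ContinuousOn Φ (frontier D))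
    (h : Ex D (fun z => (z - o) * Φ z)) : Ex D Φ := by
  obtain ⟨k, hk, e⟩ := h
  obtain ⟨M0, hM0⟩ := g.fcpt.exists_bound_of_continuousOn hΦ
  have hoD : o ∉ D := by rw [g.op.frontier_eq] at ho; exact ho.2
  obtain ⟨M', hM', hb⟩ := bd_quot g ho hk (abs_nonneg M0) (fun z hz => by
    rw [e hz, norm_mul, mul_comm]; gcongr; exact (hM0 z hz).trans (le_abs_self _))
  obtain ⟨R, hR, hRR⟩ := g.radius
  have hne : ∀ z ∈ D, z - o ≠ 0 := fun z hz h => hoD (sub_eq_zero.1 h ▸ hz)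
  set F : ℂ → ℂ := fun z => k z / (z - o) with hF
  have hFd : DifferentiableOn ℂ F D := hk.hol.div (by fun_prop) hne
  have hFc : ContinuousOn F (closure D \ {o}) := (hk.cont.mono sdiff_subset).div (by fun_prop) (fun z hz => sub_ne_zero.2 hz.2)
  have hFM : ∀ z ∈ D, ‖F z‖ ≤ M' := fun z hz => by
    rw [hF, norm_div, div_le_iff₀ (norm_pos_iff.2 (hne z hz))]; exact hb z hz
  have hFe : ∀ z ∈ frontier D, z ≠ o → F z = Φ z := fun z hz h => by
    have := sub_ne_zero.2 h
    simp only [hF, e hz]; field_simp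
  have hRo : ∀ z ∈ D, ‖z - o‖ ≤ R := fun z hz => hRR z (subset_closure hz) o (frontier_subset_closure ho)
  have r := re_sol g hΦ
  have i := im_sol g hΦ
  obtain ⟨B1, hB1⟩ := g.bdd.isCompact_closure.exists_bound_of_continuousOn r.cont
  obtain ⟨B2, hB2⟩ := g.bdd.isCompact_closure.exists_bound_of_continuousOn i.cont
  refine Ex.of_q g (p := F) (q := fun _ => 0) hΦ ⟨hFd, differentiableOn_const _, fun z hz => ?_, fun z hz => ?_⟩ (fun _ _ => rfl)
  · have := PL g.bdd g.op hoD (B := B1 + M') (by linarith) hRo (r.harm.sub (harm_re g.op hFd)) ((r.cont.mono sdiff_subset).sub (Complex.continuous_re.comp_continuousOn hFc))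
      (fun z hz h => by simp only [Pi.sub_apply, r.bd z hz, hFe z hz h, sub_self]; ) (fun z hz => by
        have h1 := hB1 z (subset_closure hz)
        rw [Real.norm_eq_abs] at h1
        exact (abs_sub _ _).trans (add_le_add h1 ((Complex.abs_re_le_norm _).trans (hFM z hz)))) z hz
    simp only [Pi.sub_apply] at this
    simp only [zero_re]; linarith
  · have := PL g.bdd g.op hoD (B := B2 + M') (by linarith) hRo (i.harm.sub (harm_im g.op hFd)) ((i.cont.mono sdiff_subset).sub (Complex.continuous_im.comp_continuousOn hFc))
      (fun z hz h => by simp only [Pi.sub_apply, i.bd z hz, hFe z hz h, sub_self]; ) (fun z hz => by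
        have h1 := hB2 z (subset_closure hz)
        rw [Real.norm_eq_abs] at h1
        exact (abs_sub _ _).trans (add_le_add h1 ((Complex.abs_im_le_norm _).trans (hFM z hz)))) z hz
    simp only [Pi.sub_apply] at this
    simp only [zero_im]; linarith

end HX

namespace HX
open Metric Filter Topology InnerProductSpace Real MeasureTheory
open scoped ContDiff

structure BP (D : Set ℂ) (o : ℂ) (B p : ℂ → ℂ) (κ : ℂ) : Prop where
  ne : κ ≠ 0
  hB : DifferentiableOn ℂ B D
  hp : DifferentiableOn ℂ p D
  zero : B o = 0
  rel : ∀ z ∈ D, B z * (1 - (z - o) * p z) = κ * (z - o)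
  lim : ∀ ε > 0, ∃ K, IsCompact K ∧ K ⊆ D ∧ ∀ z ∈ D \ K, |‖B z‖ - 1| ≤ ε

theorem near_bd {D : Set ℂ} {m : ℕ} {E : Fin m → Set ℂ} (g : Geo D m E) {o : ℂ} (ho : o ∈ D) {p q : ℂ → ℂ}
    (hc : ContinuousOn (fun z : ℂ => (z - o)⁻¹) (frontier D)) (h : PQ D (fun z => (z - o)⁻¹) p q) :
    ∀ ε > 0, ∃ K, IsCompact K ∧ K ⊆ D ∧ ∀ z ∈ D \ K, z ≠ o ∧ ‖(z - o)⁻¹ - p z - (starRingEnd ℂ) (q z)‖ ≤ ε := by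
  intro ε hε
  have r := re_sol g hc
  have i := im_sol g hc
  obtain ⟨ρ, hρ, hb⟩ := Metric.nhds_basis_closedBall.mem_iff.1 (g.op.mem_nhds ho)
  set T : ℂ → ℂ := fun z => (Hs D (fun z : ℂ => ((z - o)⁻¹).re) z : ℂ) + (Hs D (fun z : ℂ => ((z - o)⁻¹).im) z : ℂ) * I with hT
  have hTc : ContinuousOn T (closure D) :=
    (Complex.continuous_ofReal.comp_continuousOn r.cont).add ((Complex.continuous_ofReal.comp_continuousOn i.cont).mul continuousOn_const)
  have hTf : ∀ z ∈ frontier D, T z = (z - o)⁻¹ := fun z hz => by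
    simp only [hT, r.bd z hz, i.bd z hz]; exact Complex.re_add_im _
  have hTD : ∀ z ∈ D, T z = p z + (starRingEnd ℂ) (q z) := fun z hz => by
    simp only [hT, h.re z hz, h.im z hz]
    apply Complex.ext <;> simp; ring
  obtain ⟨k1, k2⟩ := compact_of_frontier g.bdd g.op (v := fun z => ‖1 - (z - o) * T z‖) (a := ε * ρ)
    (by fun_prop) (fun z hz => by
      have : z - o ≠ 0 := fun h => by
        rw [g.op.frontier_eq] at hz; exact hz.2 (sub_eq_zero.1 h ▸ ho)
      rw [hTf z hz, mul_inv_cancel₀ this]; simp; positivity)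
  refine ⟨closedBall o ρ ∪ (closure D ∩ {z | ε * ρ ≤ ‖1 - (z - o) * T z‖}), (isCompact_closedBall _ _).union k1, union_subset hb k2, ?_⟩
  rintro z ⟨hz, hzK⟩
  rw [mem_union, not_or] at hzK
  have h1 : ρ < ‖z - o‖ := by
    by_contra! h; exact hzK.1 (by rwa [mem_closedBall, dist_eq_norm])
  have hne : z - o ≠ 0 := norm_pos_iff.1 (hρ.trans h1)
  have h2 : ‖1 - (z - o) * T z‖ < ε * ρ := by
    by_contra! h; exact hzK.2 ⟨subset_closure hz, h⟩
  refine ⟨sub_ne_zero.1 hne, ?_⟩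
  have e : (z - o)⁻¹ - p z - (starRingEnd ℂ) (q z) = (1 - (z - o) * T z) / (z - o) := by
    rw [hTD z hz]; field_simp; ring
  rw [e, norm_div, div_le_iff₀ (hρ.trans h1)]
  exact h2.le.trans (by gcongr)

theorem const_of_im {D : Set ℂ} (hDo : IsOpen D) (hDc : IsPreconnected D) {J : ℂ → ℂ} (hJ : DifferentiableOn ℂ J D) (hi : ∀ z ∈ D, (J z).im = 0)
    {o : ℂ} (ho : o ∈ D) : ∀ z ∈ D, J z = J o := by
  rcases (hJ.analyticOnNhd hDo).is_constant_or_isOpen hDc with ⟨w, hw⟩ | h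
  · intro z hz; rw [hw z hz, hw o ho]
  · exfalso
    obtain ⟨ε, hε, hb⟩ := Metric.isOpen_iff.1 (h D subset_rfl hDo) (J o) (mem_image_of_mem _ ho)
    obtain ⟨z, hz, e⟩ := hb (show J o + ((ε / 2 : ℝ) : ℂ) * I ∈ ball (J o) ε by
      rw [mem_ball, dist_eq_norm]; simp only [add_sub_cancel_left, norm_mul, Complex.norm_I, mul_one, Complex.norm_real, Real.norm_eq_abs]
      rw [abs_of_pos (by positivity)]; linarith)
    have := congrArg Complex.im e
    simp [hi z hz, hi o ho] at this
    linarith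

theorem getB {D : Set ℂ} {m : ℕ} {E : Fin m → Set ℂ} (g : Geo D m E) {o : ℂ} (ho : o ∈ D) (hs : SS D (fun z => (z - o)⁻¹)) :
    ∃ B p κ, BP D o B p κ := by
  obtain ⟨p, q, h, hq0⟩ := PQ.exists g o hs
  have hd := near_bd g ho hs.cont h
  set J : ℂ → ℂ := fun z => dslope q o z - q z * p z with hJ
  have hJd : DifferentiableOn ℂ J D := ((Complex.differentiableOn_dslope (g.op.mem_nhds ho)).2 h.hq).sub (h.hq.mul h.hp)
  have hJe : ∀ z, z ≠ o → J z = ((‖q z‖ ^ 2 : ℝ) : ℂ) + q z * ((z - o)⁻¹ - p z - (starRingEnd ℂ) (q z)) := fun z hz => by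
    have : q z * (starRingEnd ℂ) (q z) = ((‖q z‖ ^ 2 : ℝ) : ℂ) := by rw [Complex.mul_conj, Complex.normSq_eq_norm_sq]
    rw [← this, hJ]
    simp only [dslope_of_ne _ hz, slope_def_field, hq0, sub_zero]
    ring
  have hJre : ∀ z, z ≠ o → ∀ ε, ‖(z - o)⁻¹ - p z - (starRingEnd ℂ) (q z)‖ ≤ ε → |(J z).re - ‖q z‖ ^ 2| ≤ ‖q z‖ * ε ∧ |(J z).im| ≤ ‖q z‖ * ε := by
    intro z hz ε hε
    rw [hJe z hz]
    set d := (z - o)⁻¹ - p z - (starRingEnd ℂ) (q z)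
    have h1 : ‖q z * d‖ ≤ ‖q z‖ * ε := by rw [norm_mul]; gcongr
    constructor
    · rw [add_re, ofReal_re, add_sub_cancel_left]; exact (Complex.abs_re_le_norm _).trans h1
    · rw [add_im, ofReal_im, zero_add]; exact (Complex.abs_im_le_norm _).trans h1
  have hre := harm_re g.op hJd
  have him := harm_im g.op hJd
  have hpos : ∀ z ∈ D, 0 ≤ (J z).re := by
    have := maxB (M := 0) g.op (v := -fun z => (J z).re) hre.neg.continuousOn (SubM.of_harm g.op hre.neg) (fun e he => by
      obtain ⟨K, k1, k2, k3⟩ := hd (min 1 e) (by positivity)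
      refine ⟨K, k1, k2, fun z hz => ?_⟩
      obtain ⟨hzo, hze⟩ := k3 z hz
      have h1 := (abs_le.1 (hJre z hzo _ hze).1).1
      have := min_le_left 1 e
      have := min_le_right 1 e
      have : 0 < min 1 e := by positivity
      simp only [Pi.neg_apply]
      nlinarith [sq_nonneg (‖q z‖ - min 1 e / 2)])
    intro z hz
    have := this z hz
    simp only [Pi.neg_apply] at this; linarith
  have hq2 : ∀ z ∈ D, z ≠ o → ∀ ε, 0 < ε → ε ≤ 1 → ‖(z - o)⁻¹ - p z - (starRingEnd ℂ) (q z)‖ ≤ ε → ‖q z‖ * ε ≤ ε * (1 + (J z).re) := by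
    intro z hz hzo ε h0 h1 hε
    have := (abs_le.1 (hJre z hzo ε hε).1).1
    have : ‖q z‖ * ε ≤ ‖q z‖ := mul_le_of_le_one_right (norm_nonneg _) h1
    rw [mul_comm]
    gcongr
    nlinarith [sq_nonneg (‖q z‖ - 1)]
  have him0 : ∀ z ∈ D, (J z).im = 0 := by
    have key : ∀ s : ℝ, |s| ≤ 1 → ∀ ε, 0 < ε → ε ≤ 1 → ∀ z ∈ D, s * (J z).im - ε * (J z).re ≤ ε := by
      intro s hs ε h0 h1
      have hh : HarmonicOnNhd ((s • fun z => (J z).im) - ε • fun z => (J z).re) D := him.const_smul.sub hre.const_smul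
      have := maxB (M := ε) g.op hh.continuousOn (SubM.of_harm g.op hh) (fun e he => by
        obtain ⟨K, k1, k2, k3⟩ := hd ε h0
        refine ⟨K, k1, k2, fun z hz => ?_⟩
        obtain ⟨hzo, hze⟩ := k3 z hz
        have h2 := (hJre z hzo _ hze).2.trans (hq2 z hz.1 hzo ε h0 h1 hze)
        have h3 : s * (J z).im ≤ |(J z).im| := by
          refine (le_abs_self _).trans ?_
          rw [abs_mul]; exact mul_le_of_le_one_left (abs_nonneg _) hs
        simp only [Pi.sub_apply, Pi.smul_apply, smul_eq_mul]
        linarith)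
      intro z hz
      simpa only [Pi.sub_apply, Pi.smul_apply, smul_eq_mul] using this z hz
    have key2 : ∀ s : ℝ, |s| ≤ 1 → ∀ z ∈ D, s * (J z).im ≤ 0 := by
      intro s hs z hz
      refine le_of_forall_pos_le_add (fun e he => ?_)
      have hp := hpos z hz
      have := key s hs (min 1 (e / (1 + (J z).re))) (by positivity) (min_le_left _ _) z hz
      have h2 : min 1 (e / (1 + (J z).re)) * (1 + (J z).re) ≤ e := by
        rw [← le_div_iff₀ (by positivity)]; exact min_le_right _ _
      linarith
    intro z hz
    have h1 := key2 1 (by simp) z hz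
    have h2 := key2 (-1) (by simp) z hz
    linarith
  have hJc := const_of_im g.op g.conn.isPreconnected hJd him0 ho
  set r0 := (J o).re with hr0
  have hr0p : 0 ≤ r0 := hpos o ho
  have hJr : ∀ z ∈ D, J z = (r0 : ℂ) := fun z hz => by
    rw [hJc z hz]; apply Complex.ext <;> simp [hr0, him0 o ho]
  have hlim : ∀ ε > 0, ∃ K, IsCompact K ∧ K ⊆ D ∧ ∀ z ∈ D \ K, |‖q z‖ ^ 2 - r0| ≤ ε := by
    intro e he
    obtain ⟨K, k1, k2, k3⟩ := hd (min 1 (e / (1 + r0))) (by positivity)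
    refine ⟨K, k1, k2, fun z hz => ?_⟩
    obtain ⟨hzo, hze⟩ := k3 z hz
    have h1 := (hJre z hzo _ hze).1.trans (hq2 z hz.1 hzo _ (by positivity) (min_le_left _ _) hze)
    rw [hJr z hz.1, ofReal_re] at h1
    rw [abs_sub_comm]
    refine h1.trans ?_
    rw [← le_div_iff₀ (by positivity)]; exact min_le_right _ _
  rcases hr0p.eq_or_lt with hz0 | hrp
  · exfalso
    have hq : ∀ z ∈ D, q z = 0 := by
      have := maxB (M := 0) g.op h.hq.continuousOn.norm (SubM.norm g.op h.hq) (fun e he => by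
        obtain ⟨K, k1, k2, k3⟩ := hlim (e ^ 2) (by positivity)
        refine ⟨K, k1, k2, fun z hz => ?_⟩
        have := k3 z hz
        rw [← hz0, sub_zero, abs_of_nonneg (by positivity)] at this
        rw [zero_add]
        exact (sq_le_sq₀ (norm_nonneg _) he.le).1 this)
      exact fun z hz => norm_le_zero_iff.1 (this z hz)
    obtain ⟨F, hF, e⟩ := Ex.of_q g hs.cont h hq
    have hA : Al D (fun z => (z - o) * F z - 1) := ⟨((continuous_id.sub continuous_const).continuousOn.mul hF.cont).sub continuousOn_const,
      ((differentiable_id.sub (differentiable_const o)).differentiableOn.mul hF.hol).sub (differentiableOn_const _)⟩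
    have := maxA g.bdd g.op (M := 0) hA.cont.norm (SubM.norm g.op hA.hol) (fun z hz => by
      have hne : z - o ≠ 0 := fun h => by
        rw [g.op.frontier_eq] at hz; exact hz.2 (sub_eq_zero.1 h ▸ ho)
      rw [e hz, mul_inv_cancel₀ hne]; simp) o (subset_closure ho)
    simp at this
    linarith
  · set t := √r0 with ht
    have htp : 0 < t := Real.sqrt_pos.2 hrp
    have htt : t * t = r0 := Real.mul_self_sqrt hr0p
    have htc : (t : ℂ) ≠ 0 := by exact_mod_cast htp.ne'
    refine ⟨fun z => q z / t, p, t, htc, h.hq.div_const _, h.hp, by simp [hq0], fun z hz => ?_, fun e he => ?_⟩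
    · by_cases hzo : z = o
      · simp [hzo, hq0]
      have hne := sub_ne_zero.2 hzo
      have h1 := hJr z hz
      simp only [hJ, dslope_of_ne _ hzo, slope_def_field, hq0, sub_zero] at h1
      rw [← htt] at h1
      push_cast at h1
      field_simp at h1 ⊢
      linear_combination h1
    · obtain ⟨K, k1, k2, k3⟩ := hlim (e * r0) (by positivity)
      refine ⟨K, k1, k2, fun z hz => ?_⟩
      have h1 := k3 z hz
      have h2 : ‖q z / t‖ = ‖q z‖ / t := by rw [norm_div, Complex.norm_real, Real.norm_of_nonneg htp.le]
      rw [h2]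
      set b := ‖q z‖ / t with hb
      have hb0 : 0 ≤ b := by positivity
      have h3 : ‖q z‖ ^ 2 - r0 = r0 * ((b - 1) * (b + 1)) := by
        rw [hb, ← htt]; field_simp; ring
      rw [h3, abs_mul, abs_of_pos hrp, mul_comm, mul_le_mul_iff_left₀ hrp, abs_mul, abs_of_pos (show 0 < b + 1 by positivity)] at h1
      nlinarith [abs_nonneg (b - 1)]

end HX

namespace HX
open Metric Filter Topology InnerProductSpace Real MeasureTheory
open scoped ContDiff

theorem BP.le_one {D : Set ℂ} (hDo : IsOpen D) {o : ℂ} {B p : ℂ → ℂ} {κ : ℂ} (h : BP D o B p κ) : ∀ z ∈ D, ‖B z‖ ≤ 1 := by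
  refine maxB hDo h.hB.continuousOn.norm (SubM.norm hDo h.hB) (fun e he => ?_)
  obtain ⟨K, k1, k2, k3⟩ := h.lim e he
  exact ⟨K, k1, k2, fun z hz => by have := (abs_le.1 (k3 z hz)).2; linarith⟩

theorem BP.lt_one {D : Set ℂ} (hDo : IsOpen D) (hDc : IsPreconnected D) {o : ℂ} (ho : o ∈ D) {B p : ℂ → ℂ} {κ : ℂ} (h : BP D o B p κ) :
    ∀ z ∈ D, ‖B z‖ < 1 := by
  intro z hz
  refine lt_of_le_of_ne (h.le_one hDo z hz) (fun he => ?_)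
  have := Complex.norm_eqOn_of_isPreconnected_of_isMaxOn hDc hDo h.hB hz (fun w hw => by
    simp only [Function.comp_apply, he, mem_setOf_eq]; exact h.le_one hDo w hw) ho
  simp [h.zero, he] at this

/-- division by `B` -/
noncomputable def Lq (o : ℂ) (p : ℂ → ℂ) (κ : ℂ) (f : ℂ → ℂ) : ℂ → ℂ := fun z => dslope f o z * (1 - (z - o) * p z) / κ

theorem BP.L_hol {D : Set ℂ} (hDo : IsOpen D) {o : ℂ} (ho : o ∈ D) {B p : ℂ → ℂ} {κ : ℂ} (h : BP D o B p κ) {f : ℂ → ℂ}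
    (hf : DifferentiableOn ℂ f D) : DifferentiableOn ℂ (Lq o p κ f) D :=
  (((Complex.differentiableOn_dslope (hDo.mem_nhds ho)).2 hf).mul
    ((differentiableOn_const _).sub ((differentiable_id.sub (differentiable_const o)).differentiableOn.mul h.hp))).div_const _

theorem BP.L_mul {D : Set ℂ} {o : ℂ} {B p : ℂ → ℂ} {κ : ℂ} (h : BP D o B p κ) {f : ℂ → ℂ}
    (hf : f o = 0) : ∀ z ∈ D, B z * Lq o p κ f z = f z := by
  intro z hz
  by_cases hzo : z = o
  · rw [hzo, h.zero, hf, zero_mul]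
  have := h.ne
  have hne := sub_ne_zero.2 hzo
  have hr := h.rel z hz
  simp only [Lq, dslope_of_ne _ hzo, slope_def_field, hf, sub_zero]
  field_simp
  linear_combination (f z) * hr

noncomputable def gs (o : ℂ) (p : ℂ → ℂ) (κ : ℂ) (f : ℂ → ℂ) : ℕ → ℂ → ℂ
  | 0 => f
  | n + 1 => Lq o p κ (fun z => gs o p κ f n z - gs o p κ f n o)

theorem gs_hol {D : Set ℂ} (hDo : IsOpen D) {o : ℂ} (ho : o ∈ D) {B p : ℂ → ℂ} {κ : ℂ} (h : BP D o B p κ) {f : ℂ → ℂ}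
    (hf : DifferentiableOn ℂ f D) (n : ℕ) : DifferentiableOn ℂ (gs o p κ f n) D := by
  induction n with
  | zero => exact hf
  | succ n ih => exact h.L_hol hDo ho (ih.sub_const _)

theorem gs_eq {D : Set ℂ} {o : ℂ} {B p : ℂ → ℂ} {κ : ℂ} (h : BP D o B p κ) (f : ℂ → ℂ)
    (n : ℕ) : ∀ z ∈ D, f z = (∑ k ∈ Finset.range n, gs o p κ f k o * B z ^ k) + B z ^ n * gs o p κ f n z := by
  intro z hz
  induction n with
  | zero => simp [gs]
  | succ n ih =>
    have := h.L_mul (f := fun z => gs o p κ f n z - gs o p κ f n o) (by simp) z hz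
    rw [Finset.sum_range_succ]
    simp only [gs]
    rw [pow_succ, mul_assoc, this, ih]
    ring

theorem gs_h {D : Set ℂ} (hDo : IsOpen D) {o : ℂ} (ho : o ∈ D) {B p : ℂ → ℂ} {κ : ℂ} (h : BP D o B p κ) {f : ℂ → ℂ}
    (hf : DifferentiableOn ℂ f D) {M : ℝ} (hM : ∀ z ∈ D, ‖f z‖ ≤ M) (n : ℕ) :
    ∀ z ∈ D, ‖gs o p κ f n z + ∑ k ∈ Finset.range n, gs o p κ f k o * (starRingEnd ℂ) (B z ^ (n - k))‖ ≤ M := by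
  set c : ℕ → ℂ := fun k => gs o p κ f k o with hc
  set H : ℂ → ℂ := fun z => gs o p κ f n z + ∑ k ∈ Finset.range n, c k * (starRingEnd ℂ) (B z ^ (n - k)) with hH
  have hM0 : 0 ≤ M := (norm_nonneg _).trans (hM o ho)
  -- the boundary estimate
  have hbd : ∀ e > 0, ∃ K, IsCompact K ∧ K ⊆ D ∧ ∀ z ∈ D \ K, ‖H z‖ ≤ M + e := by
    intro e he
    set Q : ℝ → ℝ := fun b => M * (b⁻¹) ^ n + ∑ k ∈ Finset.range n, ‖c k‖ * ((b⁻¹) ^ (n - k) * |b ^ (2 * (n - k)) - 1|) with hQ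
    have hQc : ContinuousAt Q 1 := by
      have : ContinuousAt (fun b : ℝ => b⁻¹) 1 := continuousAt_inv₀ one_ne_zero
      refine (continuousAt_const.mul (this.pow n)).add ?_
      refine tendsto_finsetSum _ (fun k _ => ?_)
      exact (continuousAt_const (y := ‖c k‖)).mul ((this.pow (n - k)).mul ((continuousAt_id.pow _).sub continuousAt_const).abs)
    have hQ1 : Q 1 = M := by simp [hQ]
    obtain ⟨η, hη, hQη⟩ := Metric.continuousAt_iff.1 hQc e he
    obtain ⟨K, k1, k2, k3⟩ := h.lim (min (η / 2) (1 / 2)) (by positivity)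
    refine ⟨K, k1, k2, fun z hz => ?_⟩
    have hb := k3 z hz
    set b := ‖B z‖ with hbdef
    have hb1 : 0 < b := by
      have := (abs_le.1 (hb.trans (min_le_right _ _))).1; linarith
    have hB0 : B z ≠ 0 := norm_pos_iff.1 hb1
    have h1 : Q b < M + e := by
      have := hQη (x := b) (by rw [Real.dist_eq]; have := hb.trans (min_le_left _ _); linarith)
      rw [Real.dist_eq, hQ1] at this
      linarith [(abs_lt.1 this).2]
    refine le_trans ?_ h1.le
    have e1 : H z = f z * ((B z)⁻¹) ^ n + ∑ k ∈ Finset.range n, c k * (((B z)⁻¹) ^ (n - k) * (((b ^ (2 * (n - k)) : ℝ) : ℂ) - 1)) := by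
      have h2 := gs_eq h f n z hz.1
      have h3 : gs o p κ f n z = f z * ((B z)⁻¹) ^ n - ∑ k ∈ Finset.range n, c k * ((B z)⁻¹) ^ (n - k) := by
        have h4 : ∑ k ∈ Finset.range n, c k * ((B z)⁻¹) ^ (n - k) = (∑ k ∈ Finset.range n, c k * B z ^ k) * ((B z)⁻¹) ^ n := by
          rw [Finset.sum_mul]
          refine Finset.sum_congr rfl (fun k hk => ?_)
          have hk' : k ≤ n := (Finset.mem_range.1 hk).le
          obtain ⟨j, rfl⟩ := Nat.exists_eq_add_of_le hk'
          rw [Nat.add_sub_cancel_left]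
          rw [pow_add, mul_assoc, ← mul_assoc (B z ^ k), ← mul_pow, mul_inv_cancel₀ hB0, one_pow, one_mul]
        rw [h4, ← sub_mul, h2]
        rw [add_sub_cancel_left, mul_comm (B z ^ n), mul_assoc, ← mul_pow, mul_inv_cancel₀ hB0, one_pow, mul_one]
      simp only [hH]
      rw [h3, sub_add, ← Finset.sum_sub_distrib, sub_eq_add_neg, ← Finset.sum_neg_distrib]
      congr 1
      refine Finset.sum_congr rfl (fun k hk => ?_)
      have h5 : ((b ^ (2 * (n - k)) : ℝ) : ℂ) = B z ^ (n - k) * (starRingEnd ℂ) (B z ^ (n - k)) := by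
        rw [Complex.mul_conj, Complex.normSq_eq_norm_sq, norm_pow, ← pow_mul, mul_comm (n - k)]
      have h6 : ((B z)⁻¹) ^ (n - k) * B z ^ (n - k) = 1 := by rw [← mul_pow, inv_mul_cancel₀ hB0, one_pow]
      rw [h5, mul_sub, ← mul_assoc _ (B z ^ (n - k)), h6]
      ring
    rw [e1]
    refine (norm_add_le _ _).trans (add_le_add ?_ ((norm_sum_le _ _).trans (Finset.sum_le_sum fun k _ => ?_)))
    · rw [norm_mul, norm_pow, norm_inv]
      gcongr
      exact hM z hz.1
    · rw [norm_mul, norm_mul, norm_pow, norm_inv]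
      gcongr
      rw [← ofReal_one, ← ofReal_sub, Complex.norm_real, Real.norm_eq_abs]
  -- each real projection is harmonic
  have hre : ∀ s : ℂ, ‖s‖ ≤ 1 → ∀ z ∈ D, (s * H z).re ≤ M := by
    intro s hs
    set W : ℂ → ℂ := fun z => s * gs o p κ f n z + ∑ k ∈ Finset.range n, (starRingEnd ℂ) (s * c k) * B z ^ (n - k) with hW
    have hWd : DifferentiableOn ℂ W D := ((gs_hol hDo ho h hf n).const_mul s).add
      (DifferentiableOn.fun_sum fun k _ => (h.hB.pow _).const_mul _)
    have hWe : ∀ z, (s * H z).re = (W z).re := by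
      intro z
      simp only [hH, hW, mul_add, Finset.mul_sum, add_re, re_sum]
      congr 1
      refine Finset.sum_congr rfl (fun k _ => ?_)
      rw [← mul_assoc, ← Complex.conj_re, map_mul, Complex.conj_conj]
    have hh := harm_re hDo hWd
    have := maxB (M := M) hDo hh.continuousOn (SubM.of_harm hDo hh) (fun e he => by
      obtain ⟨K, k1, k2, k3⟩ := hbd e he
      refine ⟨K, k1, k2, fun z hz => ?_⟩
      rw [← hWe]
      refine (Complex.re_le_norm _).trans ?_
      rw [norm_mul]
      exact (mul_le_of_le_one_left (norm_nonneg _) hs).trans (k3 z hz))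
    intro z hz
    rw [hWe]; exact this z hz
  intro z hz
  change ‖H z‖ ≤ M
  by_cases h0 : H z = 0
  · rw [h0, norm_zero]; exact hM0
  have hn : ‖H z‖ ≠ 0 := norm_ne_zero_iff.2 h0
  have := hre ((starRingEnd ℂ) (H z) / ((‖H z‖ : ℝ) : ℂ)) (by
    rw [norm_div, Complex.norm_conj, Complex.norm_real, norm_norm, div_self hn]) z hz
  rw [div_mul_eq_mul_div, mul_comm, Complex.mul_conj, Complex.normSq_eq_norm_sq, ← ofReal_div, ofReal_re, sq, mul_div_assoc, div_self hn, mul_one] at this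
  exact this

theorem BP.factor {D : Set ℂ} (hDo : IsOpen D) (hDc : IsPreconnected D) {o : ℂ} (ho : o ∈ D) {B p : ℂ → ℂ} {κ : ℂ} (h : BP D o B p κ) {f : ℂ → ℂ}
    (hf : DifferentiableOn ℂ f D) {M : ℝ} (hM : ∀ z ∈ D, ‖f z‖ ≤ M) :
    ∃ G : ℂ → ℂ, DifferentiableOn ℂ G (ball 0 1) ∧ ∀ z ∈ D, G (B z) = f z := by
  set c : ℕ → ℂ := fun k => gs o p κ f k o with hc
  have hM0 : 0 ≤ M := (norm_nonneg _).trans (hM o ho)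
  have hcM : ∀ n, ‖c n‖ ≤ M := by
    intro n
    have := gs_h hDo ho h hf hM n o ho
    rw [Finset.sum_eq_zero (fun k hk => by
      rw [h.zero, zero_pow (by have := Finset.mem_range.1 hk; omega)]; simp), add_zero] at this
    exact this
  have hgM : ∀ n, ∀ z ∈ D, ‖gs o p κ f n z‖ ≤ M + n * M := by
    intro n z hz
    have h1 := gs_h hDo ho h hf hM n z hz
    have h2 : ‖∑ k ∈ Finset.range n, gs o p κ f k o * (starRingEnd ℂ) (B z ^ (n - k))‖ ≤ n * M := by
      refine (norm_sum_le _ _).trans ((Finset.sum_le_card_nsmul _ _ M (fun k _ => ?_)).trans (by simp))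
      rw [norm_mul, Complex.norm_conj, norm_pow]
      exact (mul_le_of_le_one_right (norm_nonneg _) (pow_le_one₀ (norm_nonneg _) (h.le_one hDo z hz))).trans (hcM k)
    have h3 := norm_sub_le (gs o p κ f n z + ∑ k ∈ Finset.range n, gs o p κ f k o * (starRingEnd ℂ) (B z ^ (n - k)))
      (∑ k ∈ Finset.range n, gs o p κ f k o * (starRingEnd ℂ) (B z ^ (n - k)))
    rw [add_sub_cancel_right] at h3
    linarith
  refine ⟨fun w => ∑' n, c n * w ^ n, ?_, ?_⟩
  · intro w hw
    rw [mem_ball_zero_iff] at hw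
    obtain ⟨r, h1, h2⟩ := exists_between hw
    have hr0 : 0 ≤ r := (norm_nonneg _).trans h1.le
    have := differentiableOn_tsum_of_summable_norm (U := ball (0:ℂ) r) (F := fun n w => c n * w ^ n) (u := fun n => M * r ^ n)
      ((summable_geometric_of_lt_one hr0 h2).mul_left M) (fun n => by fun_prop) isOpen_ball (fun n w hw => by
        rw [norm_mul, norm_pow]
        rw [mem_ball_zero_iff] at hw
        gcongr
        exact hcM n)
    exact (this.differentiableAt (isOpen_ball.mem_nhds (mem_ball_zero_iff.2 h1))).differentiableWithinAt
  · intro z hz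
    have hb := h.lt_one hDo hDc ho z hz
    have hsum : Summable (fun n => c n * B z ^ n) := by
      refine Summable.of_norm_bounded ((summable_geometric_of_lt_one (norm_nonneg _) hb).mul_left M) (fun n => ?_)
      rw [norm_mul, norm_pow]
      gcongr
      exact hcM n
    have t1 := hsum.hasSum.tendsto_sum_nat
    have t2 : Tendsto (fun n => ∑ k ∈ Finset.range n, c k * B z ^ k) atTop (𝓝 (f z)) := by
      rw [tendsto_iff_norm_sub_tendsto_zero]
      have t3 : Tendsto (fun n : ℕ => M * ‖B z‖ ^ n + M * (n * ‖B z‖ ^ n)) atTop (𝓝 0) := by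
        have a1 := (tendsto_pow_atTop_nhds_zero_of_lt_one (norm_nonneg _) hb).const_mul M
        have a2 := (tendsto_self_mul_const_pow_of_lt_one (norm_nonneg _) hb).const_mul M
        simpa using a1.add a2
      refine squeeze_zero (fun _ => norm_nonneg _) (fun n => ?_) t3
      have h2 := gs_eq h f n z hz
      have h3 : (∑ k ∈ Finset.range n, c k * B z ^ k) - f z = -(B z ^ n * gs o p κ f n z) := by rw [h2]; ring
      rw [h3, norm_neg, norm_mul, norm_pow]
      have := mul_le_mul_of_nonneg_left (hgM n z hz) (pow_nonneg (norm_nonneg (B z)) n)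
      linarith
    exact tendsto_nhds_unique t1 t2

theorem ball_log {f : ℂ → ℂ} (hf : DifferentiableOn ℂ f (ball 0 1)) (h0 : ∀ z ∈ ball (0:ℂ) 1, f z ≠ 0) :
    ∃ l : ℂ → ℂ, DifferentiableOn ℂ l (ball 0 1) ∧ ∀ z ∈ ball (0:ℂ) 1, f z = Complex.exp (l z) := by
  have hd : DifferentiableOn ℂ (fun z => deriv f z / f z) (ball 0 1) := (hf.deriv isOpen_ball).div hf h0
  obtain ⟨l, hl⟩ := hd.isExactOn_ball
  have hm : (0:ℂ) ∈ ball (0:ℂ) 1 := by simp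
  have hl' : ∀ z ∈ ball (0:ℂ) 1, HasDerivAt l (deriv f z / f z) z := hl
  have hq : ∀ z ∈ ball (0:ℂ) 1, HasDerivAt (fun z => f z * Complex.exp (-l z)) 0 z := by
    intro z hz
    have h1 := (hf.differentiableAt (isOpen_ball.mem_nhds hz)).hasDerivAt.mul (hl' z hz).neg.cexp
    have e : deriv f z * Complex.exp (-l z) + f z * (Complex.exp (-l z) * -(deriv f z / f z)) = 0 := by
      have := h0 z hz
      field_simp; ring
    exact e ▸ h1
  have hc : ∀ z ∈ ball (0:ℂ) 1, f z * Complex.exp (-l z) = f 0 * Complex.exp (-l 0) := by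
    intro z hz
    exact (isOpen_ball.is_const_of_deriv_eq_zero (convex_ball _ _).isPreconnected
      (fun z hz => (hq z hz).differentiableAt.differentiableWithinAt) (fun z hz => (hq z hz).deriv) hz hm)
  have hne : f 0 * Complex.exp (-l 0) ≠ 0 := mul_ne_zero (h0 0 hm) (Complex.exp_ne_zero _)
  refine ⟨fun z => l z + Complex.log (f 0 * Complex.exp (-l 0)), fun z hz => ((hl' z hz).differentiableAt.add_const _).differentiableWithinAt, fun z hz => ?_⟩
  rw [Complex.exp_add, Complex.exp_log hne, ← hc z hz, Complex.exp_neg]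
  field_simp

theorem no_BP {D : Set ℂ} {m : ℕ} {E : Fin m → Set ℂ} (g : Geo D m E) {o : ℂ} (ho : o ∈ D) {B p : ℂ → ℂ} {κ : ℂ} (h : BP D o B p κ) : False := by
  obtain ⟨j0, R, hR, hRj, hcpt⟩ := g.exists_inf
  obtain ⟨j, hj⟩ : ∃ j : Fin m, j ≠ j0 := by
    have : Nontrivial (Fin m) := Fin.nontrivial_iff_two_le.2 g.two
    exact exists_ne j0
  obtain ⟨b, hbE, hb⟩ := g.inner j
  obtain ⟨X, hX⟩ := g.exists_cut (hcpt j hj)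
  obtain ⟨hK, hKD⟩ := hX.tsupp g
  have hDc := g.conn.isPreconnected
  have hne : ∀ z ∈ closure D, z - b ≠ 0 := fun z hz e => hb (sub_eq_zero.1 e ▸ hz)
  obtain ⟨M1, hM1⟩ := g.bdd.isCompact_closure.exists_bound_of_continuousOn (f := fun z : ℂ => z - b) (by fun_prop)
  obtain ⟨M2, hM2⟩ := g.bdd.isCompact_closure.exists_bound_of_continuousOn (f := fun z : ℂ => (z - b)⁻¹) (ContinuousOn.inv₀ (by fun_prop) hne)
  obtain ⟨G1, d1, e1⟩ := h.factor g.op hDc ho (f := fun z => z - b) (by fun_prop) (fun z hz => hM1 z (subset_closure hz))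
  obtain ⟨G2, d2, e2⟩ := h.factor g.op hDc ho (f := fun z => (z - b)⁻¹)
    (DifferentiableOn.inv (by fun_prop) (fun z hz => hne z (subset_closure hz))) (fun z hz => hM2 z (subset_closure hz))
  have hBb : ∀ z ∈ D, B z ∈ ball (0:ℂ) 1 := fun z hz => mem_ball_zero_iff.2 (h.lt_one g.op hDc ho z hz)
  have hopen : IsOpen (B '' D) := by
    rcases (h.hB.analyticOnNhd g.op).is_constant_or_isOpen hDc with ⟨w, hw⟩ | h'
    · exfalso
      obtain ⟨ρ, hρ, hbb⟩ := Metric.isOpen_iff.1 g.op o ho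
      have hz : o + ((ρ / 2 : ℝ) : ℂ) ∈ D := hbb (by
        rw [mem_ball, dist_eq_norm, add_sub_cancel_left, Complex.norm_real, Real.norm_of_nonneg (by positivity)]; linarith)
      have h2 := e1 _ hz
      rw [hw _ hz, ← hw o ho, e1 o ho] at h2
      have : ((ρ / 2 : ℝ) : ℂ) = 0 := by linear_combination -h2
      have := ofReal_eq_zero.1 this
      linarith
    · exact h' D subset_rfl g.op
  have hm : (0:ℂ) ∈ ball (0:ℂ) 1 := by simp
  have hone : EqOn (fun w => G1 w * G2 w) (fun _ => 1) (ball 0 1) := by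
    refine ((d1.mul d2).analyticOnNhd isOpen_ball).eqOn_of_preconnected_of_eventuallyEq analyticOnNhd_const (convex_ball _ _).isPreconnected hm ?_
    filter_upwards [hopen.mem_nhds ⟨o, ho, h.zero⟩] with w hw
    obtain ⟨z, hz, rfl⟩ := hw
    change G1 (B z) * G2 (B z) = 1
    rw [e1 z hz, e2 z hz, mul_inv_cancel₀ (hne z (subset_closure hz))]
  obtain ⟨l, hl, hle⟩ := ball_log d1 (fun z hz h0 => by
    have := hone hz
    simp [h0] at this)
  have hflux := flux_re g.op (F := fun z => l (B z)) (u := fun z => Real.log ‖z - b‖) (hl.comp h.hB hBb) hX.smooth hK hKD (fun z hz => by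
    change Real.log ‖z - b‖ = (l (B z)).re
    rw [← Real.log_exp (l (B z)).re, ← Complex.norm_exp, ← hle _ (hBb z hz), e1 z hz])
  have hgr := log_green (hX.smooth.of_le (by norm_cast)) hX.cs b
  rw [(hX.one b hbE).self_of_nhds] at hgr
  rw [hgr] at hflux
  have := Real.pi_pos
  linarith

theorem end_in {D : Set ℂ} {m : ℕ} {E : Fin m → Set ℂ} (g : Geo D m E) {o : ℂ} (ho : o ∈ D) {Φ : ℂ → ℂ} (hΦ : SS D Φ)
    (h : Ex D (fun z => (z - o) * Φ z)) : Ex D Φ := by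
  obtain ⟨k, hk, e⟩ := h
  have hne : ∀ z ∈ frontier D, z ≠ o := fun z hz h => by
    rw [g.op.frontier_eq] at hz; exact hz.2 (h ▸ ho)
  have hsl : Al D (dslope k o) := by
    refine ⟨?_, (Complex.differentiableOn_dslope (g.op.mem_nhds ho)).2 hk.hol⟩
    refine (continuousOn_dslope (mem_of_superset (g.op.mem_nhds ho) subset_closure)).2 ⟨hk.cont, hk.hol.differentiableAt (g.op.mem_nhds ho)⟩
  have hse : ∀ z ∈ frontier D, dslope k o z = Φ z - k o * (z - o)⁻¹ := fun z hz => by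
    have := sub_ne_zero.2 (hne z hz)
    rw [dslope_of_ne _ (hne z hz), slope_def_field, e hz]
    field_simp
  by_cases h0 : k o = 0
  · exact ⟨dslope k o, hsl, fun z hz => by rw [hse z hz, h0]; simp⟩
  exfalso
  have hΨ : SS D (fun z => (z - o)⁻¹) := by
    have s1 := (SS.add g hΦ (SS.al g.bdd g.op ((Al.const (D := D) (-1)).mul hsl))).al_mul (Al.const (k o)⁻¹)
    refine s1.congr (fun z hz => ?_)
    simp only [hse z hz]
    field_simp
    ring
  obtain ⟨B, p, κ, hB⟩ := getB g ho hΨ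
  exact no_BP g ho hB

theorem hend {D : Set ℂ} {m : ℕ} {E : Fin m → Set ℂ} (g : Geo D m E) (o : ℂ) (Φ : ℂ → ℂ) (hΦ : SS D Φ)
    (h : Ex D (fun z => (z - o) * Φ z)) : Ex D Φ := by
  by_cases h1 : o ∈ D
  · exact end_in g h1 hΦ h
  by_cases h2 : o ∈ closure D
  · exact end_bd g (by rw [g.op.frontier_eq]; exact ⟨h2, h1⟩) hΦ.cont h
  · exact end_out h2 h

end HX

theorem stmt_1 (m : ℕ) (hm : 2 ≤ m) (D : Set ℂ) (hDo : IsOpen D) (hDc : IsConnected D)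
    (hDb : Bornology.IsBounded D)
    (γ : Fin m → ℝ → ℂ) (hγ : ∀ j, IsSimpleClosedCurve (γ j))
    (hdisj : Pairwise (Function.onFun Disjoint fun j => Set.range (γ j)))
    (hfront : frontier D = ⋃ j, Set.range (γ j))
    (Φ : ℂ → ℂ) (hΦc : ContinuousOn Φ (frontier D)) :
    ExtendsHolo D Φ ↔
      ∀ g : ℂ → ℂ, ContinuousOn g (frontier D) → ExtendsHolo D g →
        ∀ u : ℂ → ℝ, ContinuousOn u (closure D) → HarmonicOnD u D →
          (∀ z ∈ frontier D, u z = (g z * Φ z).re) →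
          HasSingleValuedConjugate u D := by
  obtain ⟨E, hE⟩ := HX.geo_exists hm hDo hDc hDb hγ hdisj hfront
  have fs : frontier D ⊆ closure D := frontier_subset_closure
  constructor
  · rintro ⟨F, hFc, hFd, hFe⟩ g _ ⟨G, hGc, hGd, hGe⟩ u huc hu hub
    have hA : HX.Al D (fun z => G z * F z) := HX.Al.mul ⟨hGc, hGd⟩ ⟨hFc, hFd⟩
    refine ⟨fun z => G z * F z, hA.hol, fun z hz => ?_⟩
    refine HX.Sol.unique hDb hDo (φ := fun z => (G z * F z).re) ⟨huc, HX.harm_iff.1 hu, fun w hw => ?_⟩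
      (hA.re_sol hDo) z (subset_closure hz)
    rw [hub w hw, hGe hw, hFe hw]
  · intro h
    have hs : HX.SS D Φ := ⟨hΦc, fun a ha u hu =>
      h a (ha.cont.mono fs) ⟨a, ha.cont, ha.hol, fun _ _ => rfl⟩ u hu.cont (HX.harm_iff.2 hu.harm) hu.bd⟩
    obtain ⟨F, hF, e⟩ := HX.main_red hE (HX.hend hE) hs
    exact ⟨F, hF.cont, hF.hol, e⟩
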